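/- Let f be a real strongly additive function with B_x² := ∑_{p ≤ x} f(p)²/p → ∞, B_y ~ B_x for y := x^{1/log₂ x}, ∑_{y < p ≤ x} f(p)/p = o(B_x), and satisfying the Lindeberg condition: for every ε > 0, ∑_{p ≤ x, |f(p)| > ε B_x} f(p)²/p = o(B_x²). Then uniformly for 1 ≤ k ≪ log₂ x and t ∈ ℝ, (1/π_k(x)) · #{1 < n ≤ x : ω(n−1) = k, f(n) ≤ A_x + t B_x} = Φ(t) + o(1) as x → ∞, where A_x := ∑_{p ≤ x} f(p)/p and Φ is the standard normal distribution function. -/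

import Mathlib

open Finset Real Filter Asymptotics

/-- `π_k(x) := #{n ≤ x : ω(n) = k}`. -/
noncomputable def pik (k : ℕ) (x : ℝ) : ℕ :=
  ((Finset.Icc 1 ⌊x⌋₊).filter (fun n => n.primeFactors.card = k)).card

/-- The primes `p ≤ x`. -/
noncomputable def primesUpTo (x : ℝ) : Finset ℕ :=
  (Finset.Icc 1 ⌊x⌋₊).filter Nat.Prime

/-- `A_x := ∑_{p ≤ x} f(p)/p`. -/
noncomputable def Afn (f : ℕ → ℝ) (x : ℝ) : ℝ := ∑ p ∈ primesUpTo x, f p / p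

/-- `B_x² := ∑_{p ≤ x} f(p)²/p`. -/
noncomputable def Bsq (f : ℕ → ℝ) (x : ℝ) : ℝ := ∑ p ∈ primesUpTo x, f p ^ 2 / p

/-- `B_x := (∑_{p ≤ x} f(p)²/p)^{1/2}`. -/
noncomputable def Bfn (f : ℕ → ℝ) (x : ℝ) : ℝ := Real.sqrt (Bsq f x)

/-- The standard normal distribution function. -/
noncomputable def Phi (t : ℝ) : ℝ :=
  (Real.sqrt (2 * Real.pi))⁻¹ * ∫ u in Set.Iic t, Real.exp (-u ^ 2 / 2)

open Nat (ModEq dvd_of_mem_primeFactors dvd_one factorial_succ floor_le le_floor le_floor_iff le_of_dvd lt_floor_add_one mem_primeFactors mem_primesLE mod_eq_of_lt mul_div_cancel' prime_of_mem_primeFactors primesLE)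
open Complex (I norm_I norm_exp_ofReal_mul_I norm_real ofReal_neg ofReal_re ofReal_sum re_le_norm re_sum)
open ArithmeticFunction (log_apply vonMangoldt vonMangoldt_nonneg)
open MeasureTheory (Measure ProbabilityMeasure measureReal_def)
open ProbabilityTheory (cdf cdf_eq_real cdf_le_one cdf_nonneg gaussianReal)

/-- Upper half of Mertens' first theorem for the von Mangoldt function. -/
lemma sum_vonMangoldt_div_le (n : ℕ) (hn : 1 ≤ n) :
    ∑ d ∈ Ioc 0 n, vonMangoldt d / (d : ℝ) ≤ log n + 6 := by
  have hn' : (0 : ℝ) < n := by exact_mod_cast hn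
  have h1 := ArithmeticFunction.sum_Ioc_mul_zeta_eq_sum vonMangoldt n
  rw [ArithmeticFunction.vonMangoldt_mul_zeta] at h1
  have h2 : ∑ d ∈ Ioc 0 n, ArithmeticFunction.log d ≤ (n : ℝ) * log n := by
    have : ∀ d ∈ Ioc 0 n, ArithmeticFunction.log d ≤ log n := by
      intro d hd; rw [mem_Ioc] at hd; rw [log_apply]; apply log_le_log
      · exact_mod_cast hd.1
      · exact_mod_cast hd.2
    refine (sum_le_card_nsmul _ _ _ this).trans ?_; simp
  have h3 : (n : ℝ) * ∑ d ∈ Ioc 0 n, vonMangoldt d / (d : ℝ)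
      ≤ ∑ d ∈ Ioc 0 n, vonMangoldt d * ((n / d : ℕ) : ℝ)
        + ∑ d ∈ Ioc 0 n, vonMangoldt d := by
    rw [mul_sum, ← sum_add_distrib]; apply sum_le_sum; intro d hd; rw [mem_Ioc] at hd
    have hd0 : (0 : ℝ) < d := by exact_mod_cast hd.1
    have hf : (n : ℝ) / d ≤ ((n / d : ℕ) : ℝ) + 1 := by
      rw [div_le_iff₀ hd0]
      have h := Nat.lt_div_mul_add (a := n) hd.1
      have : n ≤ (n / d + 1) * d := by nlinarith
      exact_mod_cast this
    calc (n : ℝ) * (vonMangoldt d / d)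
        = vonMangoldt d * ((n : ℝ) / d) := by ring
      _ ≤ vonMangoldt d * (((n / d : ℕ) : ℝ) + 1) := by gcongr
      _ = _ := by ring
  have h4 : ∑ d ∈ Ioc 0 n, vonMangoldt d ≤ 6 * (n : ℝ) := by
    have := Chebyshev.psi_le_const_mul_self (x := (n : ℝ)) hn'.le; rw [Chebyshev.psi] at this
    rw [Nat.floor_natCast] at this
    have hl : log 4 ≤ 2 := by
      rw [show (4 : ℝ) = 2 ^ 2 by norm_num, log_pow]
      have := log_two_lt_d9; push_cast; linarith
    nlinarith
  rw [← h1] at h3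
  have h5 : (n : ℝ) * ∑ d ∈ Ioc 0 n, vonMangoldt d / (d : ℝ)
      ≤ n * (log n + 6) := by linarith
  exact le_of_mul_le_mul_left h5 hn'

lemma sum_log_div_prime_le (n : ℕ) (hn : 1 ≤ n) :
    ∑ p ∈ primesLE n, log p / (p : ℝ) ≤ log n + 6 := by
  refine le_trans ?_ (sum_vonMangoldt_div_le n hn)
  rw [Nat.primesLE_eq_filter_Ioc_zero, sum_filter]
  apply sum_le_sum
  intro d hd
  split_ifs with h
  · rw [ArithmeticFunction.vonMangoldt_apply_prime h]
  · have : 0 ≤ vonMangoldt d := vonMangoldt_nonneg; positivity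

lemma sum_inv_prime_le_aux (n : ℕ) (hn : 2 ≤ n) :
    ∑ p ∈ primesLE n, (1 : ℝ) / p ≤ (∑ p ∈ primesLE n, log p / (p : ℝ)) / log n
      + log (log n) - 6 / log n + (6 / log 2 - log (log 2)) := by
  induction n, hn using Nat.le_induction with
  | base =>
    have : primesLE 2 = {2} := by decide
    have h2 : log 2 ≠ 0 := (log_pos (by norm_num)).ne'; rw [this]; simp; field_simp; linarith
  | succ n hn ih =>
    have hl : 0 < log n := log_pos (by exact_mod_cast (by omega : 1 < n))
    have hl1 : 0 < log ((n : ℝ) + 1) := log_pos (by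
      have : (0 : ℝ) < n := by exact_mod_cast (by omega : 0 < n)
      linarith)
    have hle : log n ≤ log ((n : ℝ) + 1) := log_le_log
      (by exact_mod_cast (by omega : 0 < n)) (by linarith)
    set S := ∑ p ∈ primesLE n, log p / (p : ℝ)
    have hSle : S ≤ log n + 6 := sum_log_div_prime_le n (by omega)
    have key : S / log n - S / log ((n : ℝ) + 1) ≤
        log (log ((n : ℝ) + 1)) - log (log n)
        + 6 / log n - 6 / log ((n : ℝ) + 1) := by
      have h1 : 1 - log n / log ((n : ℝ) + 1) ≤
          log (log ((n : ℝ) + 1)) - log (log n) := by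
        rw [← log_div hl1.ne' hl.ne']
        have := one_sub_inv_le_log_of_pos (x := log ((n : ℝ) + 1) / log n)
          (by positivity)
        rwa [inv_div] at this
      have h2 : S / log n - S / log ((n : ℝ) + 1)
          = S * (1 / log n - 1 / log ((n : ℝ) + 1)) := by ring
      have h3 : 0 ≤ 1 / log n - 1 / log ((n : ℝ) + 1) := by rw [sub_nonneg]; gcongr
      have h4 : (log n + 6) * (1 / log n - 1 / log ((n : ℝ) + 1))
         = 1 - log n / log ((n : ℝ) + 1) + 6 / log n - 6 / log ((n : ℝ) + 1) := by
        field_simp; ring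
      rw [h2]; nlinarith [mul_le_mul_of_nonneg_right hSle h3]
    rw [Nat.primesLE_succ]; push_cast
    split_ifs with hp
    · rw [sum_insert (Nat.notMem_primesLE n), sum_insert (Nat.notMem_primesLE n), add_div]; push_cast
      have : log ((n : ℝ) + 1) / ((n : ℝ) + 1) / log ((n : ℝ) + 1) = 1 / ((n : ℝ) + 1) := by field_simp
      rw [this]; linarith
    · linarith

/-- Upper half of Mertens' second theorem. -/
lemma sum_inv_prime_le : ∃ C : ℝ, 0 < C ∧ ∀ n : ℕ, 2 ≤ n →
    ∑ p ∈ primesLE n, (1 : ℝ) / p ≤ log (log n) + C := by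
  refine ⟨1 + 6 / log 2 + |log (log 2)|, ?_, ?_⟩
  · have : 0 < log 2 := log_pos (by norm_num); positivity
  intro n hn
  have hl : 0 < log n := log_pos (by exact_mod_cast (by omega : 1 < n))
  have h1 := sum_inv_prime_le_aux n hn
  have h2 := sum_log_div_prime_le n (by omega)
  have h3 : (∑ p ∈ primesLE n, log p / (p : ℝ)) / log n ≤ 1 + 6 / log n := by
    rw [div_le_iff₀ hl]
    have : (1 + 6 / log n) * log n = log n + 6 := by field_simp
    linarith
  have := neg_abs_le (log (log 2))
  linarith

lemma sum_inv_le_of_primeFactors_subset (T e : Finset ℕ) (he : ∀ p ∈ e, p.Prime)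
    (hT : ∀ n ∈ T, n ≠ 0 ∧ n.primeFactors ⊆ e) :
    ∑ n ∈ T, (1 : ℝ) / n ≤ ∏ p ∈ e, (1 + 1 / ((p : ℝ) - 1)) := by
  let φ : ℕ →* ℝ :=
    { toFun := fun n => (n : ℝ)⁻¹
      map_one' := by simp
      map_mul' := by intro a b; push_cast; rw [mul_inv] }
  have h := EulerProduct.summable_and_hasSum_factoredNumbers_prod_filter_prime_geometric
    (f := φ) (fun {p} hp => by
      change ‖((p : ℝ))⁻¹‖ < 1
      rw [norm_inv, Real.norm_natCast]; exact inv_lt_one_of_one_lt₀ (by exact_mod_cast hp.one_lt)) e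
  have hprod : ∏ p ∈ e with p.Prime, (1 - φ p)⁻¹ = ∏ p ∈ e, (1 + 1 / ((p : ℝ) - 1)) := by
    rw [filter_true_of_mem he]; apply prod_congr rfl; intro p hp
    have h1 : (1 : ℝ) < p := by exact_mod_cast (he p hp).one_lt
    change (1 - (p : ℝ)⁻¹)⁻¹ = _
    have : (p : ℝ) - 1 ≠ 0 := by linarith
    have h3 : (1 : ℝ) - (p : ℝ)⁻¹ = (p - 1) / p := by field_simp
    rw [h3, inv_div]; field_simp; ring
  rw [hprod] at h
  have hmem : ∀ n ∈ T, n ∈ Nat.factoredNumbers e := by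
    intro n hn; rw [Nat.mem_factoredNumbers]; refine ⟨(hT n hn).1, fun p hp => (hT n hn).2 ?_⟩
    rw [Nat.mem_primeFactors_iff_mem_primeFactorsList]; exact hp
  have hs : ∑ n ∈ T, (1 : ℝ) / n = ∑ m ∈ T.attach.map ⟨fun n => (⟨n.1, hmem n.1 n.2⟩ : Nat.factoredNumbers e),
      fun a b hab => by
        simp only [Subtype.mk.injEq] at hab; exact Subtype.ext hab⟩, φ m := by
    rw [sum_map, ← sum_attach]; apply sum_congr rfl; intro n _
    change (1 : ℝ) / n = ((n : ℕ) : ℝ)⁻¹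
    rw [one_div]
  rw [hs]
  apply sum_le_hasSum _ _ h.2
  intro i _
  change (0 : ℝ) ≤ ((i : ℕ) : ℝ)⁻¹
  positivity

lemma sum_inv_le_of_primeFactors_eq (T e : Finset ℕ) (he : ∀ p ∈ e, p.Prime)
    (hT : ∀ n ∈ T, n ≠ 0 ∧ n.primeFactors = e) :
    ∑ n ∈ T, (1 : ℝ) / n ≤ ∏ p ∈ e, 1 / ((p : ℝ) - 1) := by
  set r := ∏ p ∈ e, p with hr
  have hr0 : 0 < r := prod_pos fun p hp => (he p hp).pos
  have hdvd : ∀ n ∈ T, n = r * (n / r) := by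
    intro n hn
    have : r ∣ n := by
      rw [hr, ← (hT n hn).2]; exact Nat.prod_primeFactors_dvd n
    exact (mul_div_cancel' this).symm
  have hinj : Set.InjOn (fun n => n / r) (T : Set ℕ) := by
    intro a ha b hb hab; rw [hdvd a ha, hdvd b hb]; simp only at hab; rw [hab]
  have h1 : ∑ n ∈ T, (1 : ℝ) / n = 1 / r * ∑ m ∈ T.image (fun n => n / r), (1 : ℝ) / m := by
    rw [sum_image hinj, mul_sum]; apply sum_congr rfl; intro n hn
    conv_lhs => rw [hdvd n hn]
    push_cast; rw [one_div_mul_one_div]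
  have h2 := sum_inv_le_of_primeFactors_subset (T.image (fun n => n / r)) e he (by
    intro m hm; rw [mem_image] at hm
    obtain ⟨n, hn, rfl⟩ := hm
    have h := hdvd n hn
    have hne : n / r ≠ 0 := by
      intro h0; rw [h0] at h; exact (hT n hn).1 (by simpa using h)
    refine ⟨hne, ?_⟩; rw [← (hT n hn).2]
    exact Nat.primeFactors_mono (Nat.div_dvd_of_dvd ⟨n / r, h⟩) (hT n hn).1)
  rw [h1]
  calc 1 / (r : ℝ) * ∑ m ∈ T.image (fun n => n / r), (1 : ℝ) / m
      ≤ 1 / (r : ℝ) * ∏ p ∈ e, (1 + 1 / ((p : ℝ) - 1)) := by gcongr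
    _ = ∏ p ∈ e, 1 / ((p : ℝ) - 1) := by
      rw [hr]; push_cast; rw [one_div, ← prod_inv_distrib, ← prod_mul_distrib]; apply prod_congr rfl; intro p hp
      have h1 : (1 : ℝ) < p := by exact_mod_cast (he p hp).one_lt
      have : (p : ℝ) - 1 ≠ 0 := by linarith
      field_simp; ring

lemma log_le_prod_primes (n : ℕ) :
    log (n + 1) ≤ ∏ p ∈ primesLE n, (1 + 1 / ((p : ℝ) - 1)) := by
  have h1 := log_add_one_le_harmonic n
  have h2 := sum_inv_le_of_primeFactors_subset (Ioc 0 n) (primesLE n)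
    (fun p hp => Nat.prime_of_mem_primesLE hp) (by
      intro m hm; rw [mem_Ioc] at hm; refine ⟨by omega, fun p hp => ?_⟩; rw [mem_primesLE]
      exact ⟨(Nat.le_of_mem_primeFactors hp).trans hm.2, prime_of_mem_primeFactors hp⟩)
  refine le_trans ?_ h2
  push_cast at h1
  refine h1.trans (le_of_eq ?_)
  rw [harmonic_eq_sum_Icc]
  push_cast
  apply sum_congr
  · ext; simp [Nat.lt_iff_add_one_le]
  · intros; rw [one_div]

lemma sum_inv_mul_pred_le (T : Finset ℕ) (W : ℕ) (hW : 1 ≤ W) (hT : ∀ q ∈ T, W < q) :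
    ∑ q ∈ T, 1 / ((q : ℝ) * ((q : ℝ) - 1)) ≤ 1 / W := by
  have hsub : T ⊆ Ioc W (T.sup id) := fun q hq => by rw [mem_Ioc]; exact ⟨hT q hq, Finset.le_sup (f := id) hq⟩
  have key : ∀ n, W ≤ n → ∑ q ∈ Ioc W n, 1 / ((q : ℝ) * ((q : ℝ) - 1)) = 1 / W - 1 / n := by
    intro n hn
    induction n, hn using Nat.le_induction with
    | base => simp
    | succ n hn ih =>
      have hn0 : (n : ℝ) ≠ 0 := by
        have : 0 < n := by omega
        positivity
      have hn1 : (n : ℝ) + 1 ≠ 0 := by positivity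
      rw [← Finset.insert_Ioc_right_eq_Ioc_add_one (by omega), sum_insert (by simp), ih]; push_cast
      rw [add_sub_cancel_right]; field_simp; ring
  have hnn : ∀ q ∈ Ioc W (T.sup id), 0 ≤ 1 / ((q : ℝ) * ((q : ℝ) - 1)) := by
    intro q hq; rw [mem_Ioc] at hq
    have : (1 : ℝ) ≤ q := by exact_mod_cast (by omega : 1 ≤ q)
    have : 0 ≤ (q : ℝ) - 1 := by linarith
    positivity
  refine (sum_le_sum_of_subset_of_nonneg hsub fun q hq _ => hnn q hq).trans ?_
  rcases le_total W (T.sup id) with h | h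
  · rw [key _ h]
    have : (0 : ℝ) ≤ 1 / ((T.sup id : ℕ) : ℝ) := by positivity
    linarith
  · rw [Finset.Ioc_eq_empty (by omega)]; simp

lemma sum_inv_pred_le : ∃ C : ℝ, 0 < C ∧ ∀ n : ℕ, 2 ≤ n →
    ∑ p ∈ primesLE n, 1 / ((p : ℝ) - 1) ≤ log (log n) + C := by
  obtain ⟨C, hC, h⟩ := sum_inv_prime_le
  refine ⟨C + 1, by linarith, fun n hn => ?_⟩
  have h1 := sum_inv_mul_pred_le (primesLE n) 1 le_rfl
    (fun q hq => Nat.one_lt_of_mem_primesLE hq)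
  have h2 : ∑ p ∈ primesLE n, 1 / ((p : ℝ) - 1) =
      ∑ p ∈ primesLE n, (1 : ℝ) / p + ∑ q ∈ primesLE n, 1 / ((q : ℝ) * ((q : ℝ) - 1)) := by
    rw [← sum_add_distrib]; apply sum_congr rfl; intro p hp
    have h1 : (1 : ℝ) < p := by exact_mod_cast Nat.one_lt_of_mem_primesLE hp
    have : (p : ℝ) - 1 ≠ 0 := by linarith
    field_simp; ring
  have := h n hn
  simp at h1
  rw [h2]
  simp
  simp at this
  linarith

lemma prod_primes_le : ∃ C : ℝ, 0 < C ∧ ∀ n : ℕ, 2 ≤ n →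
    ∏ p ∈ primesLE n, (1 + 1 / ((p : ℝ) - 1)) ≤ C * log n := by
  obtain ⟨C, hC, h⟩ := sum_inv_pred_le
  refine ⟨exp C, exp_pos C, fun n hn => ?_⟩
  have hl : 0 < log n := log_pos (by exact_mod_cast (by omega : 1 < n))
  calc ∏ p ∈ primesLE n, (1 + 1 / ((p : ℝ) - 1))
      ≤ ∏ p ∈ primesLE n, exp (1 / ((p : ℝ) - 1)) := by
        apply Finset.prod_le_prod
        · intro p hp
          have h1 : (1 : ℝ) < p := by exact_mod_cast Nat.one_lt_of_mem_primesLE hp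
          have : (0 : ℝ) < (p : ℝ) - 1 := by linarith
          positivity
        · intro p _; linarith [add_one_le_exp (1 / ((p : ℝ) - 1))]
    _ = exp (∑ p ∈ primesLE n, 1 / ((p : ℝ) - 1)) := by rw [exp_sum]
    _ ≤ exp (log (log n) + C) := exp_le_exp.mpr (h n hn)
    _ = exp C * log n := by rw [exp_add, exp_log hl]; ring

/-- Lower half of Mertens' second theorem. -/
lemma sum_inv_prime_ge (n : ℕ) (hn : 2 ≤ n) :
    log (log n) - 1 ≤ ∑ p ∈ primesLE n, (1 : ℝ) / p := by
  have hl : 0 < log n := log_pos (by exact_mod_cast (by omega : 1 < n))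
  have h0 := log_le_prod_primes n
  have h1 := sum_inv_mul_pred_le (primesLE n) 1 le_rfl
    (fun q hq => Nat.one_lt_of_mem_primesLE hq)
  have h2 : ∏ p ∈ primesLE n, (1 + 1 / ((p : ℝ) - 1)) ≤
      exp (∑ p ∈ primesLE n, (1 : ℝ) / p + 1) := by
    calc ∏ p ∈ primesLE n, (1 + 1 / ((p : ℝ) - 1))
        ≤ ∏ p ∈ primesLE n, exp (1 / (p : ℝ) + 1 / ((p : ℝ) * ((p : ℝ) - 1))) := by
          apply Finset.prod_le_prod
          · intro p hp
            have h1 : (1 : ℝ) < p := by exact_mod_cast Nat.one_lt_of_mem_primesLE hp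
            have : (0 : ℝ) < (p : ℝ) - 1 := by linarith
            positivity
          · intro p hp
            have h1 : (1 : ℝ) < p := by exact_mod_cast Nat.one_lt_of_mem_primesLE hp
            have : (p : ℝ) - 1 ≠ 0 := by linarith
            have h3 : 1 / (p : ℝ) + 1 / ((p : ℝ) * ((p : ℝ) - 1)) = 1 / ((p : ℝ) - 1) := by
              field_simp; ring
            rw [h3]; linarith [add_one_le_exp (1 / ((p : ℝ) - 1))]
      _ = exp (∑ p ∈ primesLE n, (1 / (p : ℝ) + 1 / ((p : ℝ) * ((p : ℝ) - 1)))) := by rw [exp_sum]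
      _ ≤ _ := by
          rw [exp_le_exp, sum_add_distrib]; simp only [Nat.cast_one, div_one] at h1; linarith
  have h3 : log n ≤ log ((n : ℝ) + 1) := log_le_log
      (by exact_mod_cast (by omega : 0 < n)) (by linarith)
  have h4 := log_le_log hl (h3.trans (h0.trans h2))
  rw [log_exp] at h4
  linarith

/-- Mean value of `φ` over a complete residue system modulo `p`. -/
noncomputable def avg (p : ℕ) (φ : ℕ → ℂ) : ℂ := (∑ b ∈ range p, φ b) / p

/-- The `ℓ¹` norm of `φ` over a complete residue system modulo `p`. -/
noncomputable def lone (p : ℕ) (φ : ℕ → ℂ) : ℝ := ∑ b ∈ range p, ‖φ b‖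

lemma lone_nonneg (p : ℕ) (φ : ℕ → ℂ) : 0 ≤ lone p φ := sum_nonneg fun _ _ => norm_nonneg _

lemma count_modEq_bound (N1 N2 m r : ℕ) (h : N1 ≤ N2) (hm : 0 < m) :
    |(((Ioc N1 N2).filter (fun n => n ≡ r [MOD m])).card : ℝ) - ((N2 : ℝ) - N1) / m| ≤ 1 := by
  have h1 := Nat.Ioc_filter_modEq_card N1 N2 hm r
  have h2 : ⌊((N1 : ℚ) - r) / m⌋ ≤ ⌊((N2 : ℚ) - r) / m⌋ := by
    apply Int.floor_le_floor
    have : (N1 : ℚ) ≤ N2 := by exact_mod_cast h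
    gcongr
  rw [max_eq_left (by omega)] at h1
  have e1 := Int.floor_le (((N1 : ℚ) - r) / m)
  have e2 := Int.lt_floor_add_one (((N1 : ℚ) - r) / m)
  have e3 := Int.floor_le (((N2 : ℚ) - r) / m)
  have e4 := Int.lt_floor_add_one (((N2 : ℚ) - r) / m)
  have key : |(((Ioc N1 N2).filter (fun n => n ≡ r [MOD m])).card : ℚ) - ((N2 : ℚ) - N1) / m| ≤ 1 := by
    have h3 : (((Ioc N1 N2).filter (fun n => n ≡ r [MOD m])).card : ℚ)
      = ⌊((N2 : ℚ) - r) / m⌋ - ⌊((N1 : ℚ) - r) / m⌋ := by exact_mod_cast h1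
    have h4 : ((N2 : ℚ) - N1) / m = ((N2 : ℚ) - r) / m - ((N1 : ℚ) - r) / m := by ring
    rw [h3, h4, abs_le]
    constructor <;> linarith
  have h5 : ((|(((Ioc N1 N2).filter (fun n => n ≡ r [MOD m])).card : ℚ) - ((N2 : ℚ) - N1) / m| : ℚ) : ℝ)
      ≤ 1 := by
    rw [← Rat.cast_one]; exact Rat.cast_le.mpr key
  simpa using h5

lemma crt_sum_bound (N1 N2 : ℕ) (h12 : N1 ≤ N2) (ψ : ℕ → ℕ → ℂ) (S : Finset ℕ) :
    (∀ p ∈ S, p.Prime) → (∀ p ∈ S, ∀ n, ψ p (n % p) = ψ p n) →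
    ∀ m r : ℕ, 0 < m → (∀ p ∈ S, Nat.Coprime m p) →
    ‖∑ n ∈ (Ioc N1 N2).filter (fun n => n ≡ r [MOD m]), ∏ p ∈ S, ψ p n
      - (((N2 : ℂ) - N1) / m) * ∏ p ∈ S, avg p (ψ p)‖ ≤ ∏ p ∈ S, lone p (ψ p) := by
  classical
  induction S using Finset.induction_on with
  | empty =>
    intro _ _ m r hm _
    have := count_modEq_bound N1 N2 m r h12 hm; simp only [prod_empty, sum_const, nsmul_eq_mul, mul_one]
    rw [← norm_eq_abs, ← norm_real] at this
    push_cast at this; exact this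
  | insert q S hq ih =>
    intro hp hper m r hm hco
    have hqp : q.Prime := hp q (mem_insert_self _ _)
    have hmq : Nat.Coprime m q := hco q (mem_insert_self _ _)
    have ih' := fun c => ih (fun p hp' => hp p (mem_insert_of_mem hp'))
      (fun p hp' => hper p (mem_insert_of_mem hp')) (m * q) c (Nat.mul_pos hm hqp.pos)
      (fun p hp' => by
        apply Nat.Coprime.mul_left (hco p (mem_insert_of_mem hp'))
        rw [Nat.coprime_primes hqp (hp p (mem_insert_of_mem hp'))]
        rintro rfl; exact hq hp')
    have hsplit : ∑ n ∈ (Ioc N1 N2).filter (fun n => n ≡ r [MOD m]), ∏ p ∈ insert q S, ψ p n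
        = ∑ b ∈ range q, ψ q b * ∑ n ∈ (Ioc N1 N2).filter
            (fun n => n ≡ (Nat.chineseRemainder hmq r b : ℕ) [MOD (m * q)]), ∏ p ∈ S, ψ p n := by
      rw [← sum_fiberwise_of_maps_to (s := (Ioc N1 N2).filter (fun n => n ≡ r [MOD m]))
        (t := range q) (g := fun n => n % q) (fun n _ => mem_range.mpr (Nat.mod_lt _ hqp.pos))]
      apply sum_congr rfl; intro b hb; rw [mem_range] at hb; rw [mul_sum, filter_filter]; apply sum_congr
      · ext n
        simp only [mem_filter, and_congr_right_iff]; intro _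
        have hc := (Nat.chineseRemainder hmq r b).2; constructor
        · rintro ⟨h1, h2⟩; rw [← Nat.modEq_and_modEq_iff_modEq_mul hmq]; refine ⟨h1.trans hc.1.symm, ?_⟩
          have : n ≡ b [MOD q] := by rw [ModEq, h2, mod_eq_of_lt hb]
          exact this.trans hc.2.symm
        · intro h; rw [← Nat.modEq_and_modEq_iff_modEq_mul hmq] at h; refine ⟨h.1.trans hc.1, ?_⟩
          have := h.2.trans hc.2; rw [ModEq, mod_eq_of_lt hb] at this; exact this
      · intro n hn; rw [mem_filter] at hn; rw [prod_insert hq]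
        congr 1
        have hc := (Nat.chineseRemainder hmq r b).2; rw [← Nat.modEq_and_modEq_iff_modEq_mul hmq] at hn
        have := hn.2.2.trans hc.2; rw [ModEq, mod_eq_of_lt hb] at this; rw [← this, hper q (mem_insert_self _ _)]
    have hq0 : (q : ℂ) ≠ 0 := by exact_mod_cast hqp.ne_zero
    have hm0 : (m : ℂ) ≠ 0 := by exact_mod_cast hm.ne'
    have hmain : (((N2 : ℂ) - N1) / m) * ∏ p ∈ insert q S, avg p (ψ p)
        = ∑ b ∈ range q, ψ q b * ((((N2 : ℂ) - N1) / ((m * q : ℕ) : ℂ)) * ∏ p ∈ S, avg p (ψ p)) := by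
      rw [prod_insert hq, ← sum_mul, avg]; push_cast; field_simp
    rw [hsplit, hmain, ← sum_sub_distrib, prod_insert hq, lone, sum_mul]
    refine (norm_sum_le _ _).trans (sum_le_sum fun b _ => ?_); rw [← mul_sub, norm_mul]
    exact mul_le_mul_of_nonneg_left (ih' _) (norm_nonneg _)

lemma crt_sum_bound' (N1 N2 : ℕ) (h12 : N1 ≤ N2) (ψ : ℕ → ℕ → ℂ) (S : Finset ℕ)
    (hp : ∀ p ∈ S, p.Prime) (hper : ∀ p ∈ S, ∀ n, ψ p (n % p) = ψ p n) :
    ‖∑ n ∈ Ioc N1 N2, ∏ p ∈ S, ψ p n - ((N2 : ℂ) - N1) * ∏ p ∈ S, avg p (ψ p)‖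
      ≤ ∏ p ∈ S, lone p (ψ p) := by
  have := crt_sum_bound N1 N2 h12 ψ S hp hper 1 0 one_pos (fun p _ => Nat.coprime_one_left p)
  simpa [Nat.modEq_one] using this

/-- Ramanujan-type local factor of Selberg's weights. -/
noncomputable def rr (p n : ℕ) : ℝ := if p ∣ n then -1 else 1 / ((p : ℝ) - 1)

noncomputable def Lam (P : Finset ℕ) (g : Finset ℕ → ℝ) (n : ℕ) : ℝ :=
  ∑ e ∈ P.powerset, g e * ∏ p ∈ e, rr p n

/-- The product of `1/(p-1)` over `e`. -/
noncomputable def vv (e : Finset ℕ) : ℝ := ∏ p ∈ e, 1 / ((p : ℝ) - 1)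

noncomputable def HH (P : Finset ℕ) (g : Finset ℕ → ℝ) : ℝ := ∑ e ∈ P.powerset, vv e * g e ^ 2

lemma rr_mod (p n : ℕ) : rr p (n % p) = rr p n := by
  unfold rr
  simp only [Nat.dvd_mod_iff dvd_rfl]

lemma sum_range_dvd (p : ℕ) (hp : p.Prime) (a b : ℂ) :
    ∑ n ∈ range p, (if p ∣ n then a else b) = a + (p - 1) * b := by
  obtain ⟨k, rfl⟩ : ∃ k, p = k + 1 := ⟨p - 1, by have := hp.pos; omega⟩
  rw [sum_range_succ']
  have : ∀ i ∈ range k, (if (k + 1) ∣ (i + 1) then a else b) = b := by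
    intro i hi; rw [mem_range] at hi; rw [if_neg]; intro h
    have := le_of_dvd (by omega) h; omega
  rw [sum_congr rfl this]
  simp
  ring

lemma avg_rr (p : ℕ) (hp : p.Prime) : avg p (fun n => (rr p n : ℂ)) = 0 := by
  have : ∀ n, ((rr p n : ℝ) : ℂ) = if p ∣ n then -1 else 1 / ((p : ℂ) - 1) := by intro n; unfold rr; split_ifs <;> push_cast <;> rfl
  simp only [avg, this]
  have h1 : (p : ℂ) - 1 ≠ 0 := by rw [sub_ne_zero]; exact_mod_cast hp.one_lt.ne'
  rw [sum_range_dvd p hp]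
  field_simp
  ring

lemma avg_rr_sq (p : ℕ) (hp : p.Prime) :
    avg p (fun n => (rr p n : ℂ) * (rr p n : ℂ)) = 1 / ((p : ℂ) - 1) := by
  have : ∀ n, ((rr p n : ℝ) : ℂ) * (rr p n : ℂ)
      = if p ∣ n then 1 else 1 / ((p : ℂ) - 1) ^ 2 := by
    intro n; unfold rr; split_ifs
    · push_cast; ring
    · push_cast; rw [sq, div_mul_div_comm, one_mul]
  simp only [avg, this]
  have h1 : (p : ℂ) - 1 ≠ 0 := by rw [sub_ne_zero]; exact_mod_cast hp.one_lt.ne'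
  have h0 : (p : ℂ) ≠ 0 := by exact_mod_cast hp.ne_zero
  rw [sum_range_dvd p hp]
  field_simp
  ring

lemma abs_rr_le (p n : ℕ) (hp : p.Prime) : |rr p n| ≤ 1 := by
  unfold rr
  have h2 : (2 : ℝ) ≤ p := by exact_mod_cast hp.two_le
  split_ifs
  · simp
  · rw [abs_of_nonneg (by apply div_nonneg <;> linarith), div_le_one (by linarith)]; linarith

lemma lone_rr (p : ℕ) (hp : p.Prime) : ∑ b ∈ range p, |rr p b| = 2 := by
  have : ∀ n, ((|rr p n| : ℝ) : ℂ) = if p ∣ n then 1 else 1 / ((p : ℂ) - 1) := by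
    intro n; unfold rr
    have h2 : (2 : ℝ) ≤ p := by exact_mod_cast hp.two_le
    split_ifs
    · simp
    · rw [abs_of_nonneg (by apply div_nonneg <;> linarith)]
      push_cast; rfl
  have h1 : (p : ℂ) - 1 ≠ 0 := by rw [sub_ne_zero]; exact_mod_cast hp.one_lt.ne'
  have h : ((∑ b ∈ range p, |rr p b| : ℝ) : ℂ) = 2 := by
    push_cast; simp only [this]; rw [sum_range_dvd p hp]; field_simp; ring
  exact_mod_cast h

lemma prod_ite_union (e e' : Finset ℕ) (F : ℕ → ℂ) :
    ∏ p ∈ e ∪ e', ((if p ∈ e then F p else 1) * (if p ∈ e' then F p else 1))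
      = (∏ p ∈ e, F p) * ∏ p ∈ e', F p := by
  rw [prod_mul_distrib, prod_ite_mem, prod_ite_mem]
  rw [inter_eq_right.mpr subset_union_left, inter_eq_right.mpr subset_union_right]

lemma lam_pair_bound (N1 N2 : ℕ) (h12 : N1 ≤ N2) (ψ : ℕ → ℕ → ℂ) (P S : Finset ℕ)
    (hP : ∀ p ∈ P, p.Prime) (hS : ∀ p ∈ S, p.Prime) (hPS : Disjoint P S)
    (hper : ∀ p ∈ S, ∀ n, ψ p (n % p) = ψ p n) (e e' : Finset ℕ) (he : e ⊆ P) (he' : e' ⊆ P) :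
    ‖∑ n ∈ Ioc N1 N2, (∏ p ∈ e, (rr p n : ℂ)) * (∏ p ∈ e', (rr p n : ℂ)) * ∏ p ∈ S, ψ p n
      - ((N2 : ℂ) - N1) * (if e = e' then (vv e : ℂ) else 0) * ∏ p ∈ S, avg p (ψ p)‖
      ≤ 2 ^ e.card * 2 ^ e'.card * ∏ p ∈ S, lone p (ψ p) := by
  classical
  let χ : ℕ → ℕ → ℂ := fun p n => if p ∈ S then ψ p n else
    (if p ∈ e then (rr p n : ℂ) else 1) * (if p ∈ e' then (rr p n : ℂ) else 1)
  have hU : e ∪ e' ⊆ P := union_subset he he'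
  have hdis : Disjoint (e ∪ e') S := disjoint_of_subset_left hU hPS
  have hnS : ∀ p ∈ e ∪ e', p ∉ S := fun p hp hpS => disjoint_left.mp hdis hp hpS
  have h := crt_sum_bound' N1 N2 h12 χ ((e ∪ e') ∪ S) (by
    intro p hp
    rcases mem_union.mp hp with hp | hp
    · exact hP p (hU hp)
    · exact hS p hp) (by
    intro p hp n; simp only [χ]
    split_ifs with h1
    all_goals first | exact hper p h1 n | simp [rr_mod])
  have hprod : ∀ n, ∏ p ∈ (e ∪ e') ∪ S, χ p n
      = (∏ p ∈ e, (rr p n : ℂ)) * (∏ p ∈ e', (rr p n : ℂ)) * ∏ p ∈ S, ψ p n := by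
    intro n; rw [prod_union hdis, ← prod_ite_union e e' (fun p => (rr p n : ℂ))]
    congr 1
    · apply prod_congr rfl; intro p hp; simp only [χ, if_neg (hnS p hp)]
    · apply prod_congr rfl; intro p hp; simp only [χ, if_pos hp]
  have havgS : ∏ p ∈ S, avg p (χ p) = ∏ p ∈ S, avg p (ψ p) := by
    apply prod_congr rfl; intro p hp; simp only [χ, if_pos hp]
  have hloneS : ∏ p ∈ S, lone p (χ p) = ∏ p ∈ S, lone p (ψ p) := by
    apply prod_congr rfl; intro p hp; simp only [χ, if_pos hp]
  have havg : ∏ p ∈ e ∪ e', avg p (χ p) = if e = e' then (vv e : ℂ) else 0 := by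
    split_ifs with h
    · subst h; rw [union_self, vv]; push_cast; apply prod_congr rfl; intro p hp
      simp only [χ, if_neg (hnS p (by simpa using hp)), if_pos hp]; exact avg_rr_sq p (hP p (he hp))
    · have : ∃ p, (p ∈ e ∧ p ∉ e') ∨ (p ∉ e ∧ p ∈ e') := by
        by_contra hc
        push Not at hc
        apply h
        ext p
        have := hc p
        tauto
      obtain ⟨p, hp⟩ := this; apply prod_eq_zero (i := p)
      · rw [mem_union]; tauto
      · have hpU : p ∈ e ∪ e' := by rw [mem_union]; tauto
        rcases hp with hp | hp
        · simp only [χ, if_neg (hnS p hpU), if_pos hp.1, if_neg hp.2, mul_one]; exact avg_rr p (hP p (hU hpU))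
        · simp only [χ, if_neg (hnS p hpU), if_pos hp.2, if_neg hp.1, one_mul]; exact avg_rr p (hP p (hU hpU))
  have hlone : ∏ p ∈ e ∪ e', lone p (χ p) ≤ 2 ^ e.card * 2 ^ e'.card := by
    calc ∏ p ∈ e ∪ e', lone p (χ p) ≤ ∏ p ∈ e ∪ e', (2 : ℝ) := by
          apply Finset.prod_le_prod (fun p _ => lone_nonneg _ _); intro p hp; rw [← lone_rr p (hP p (hU hp)), lone]
          apply sum_le_sum; intro b _; simp only [χ, if_neg (hnS p hp)]
          have h1 := abs_rr_le p b (hP p (hU hp))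
          have h0 := abs_nonneg (rr p b); rw [mem_union] at hp
          split_ifs
          · rw [norm_mul, norm_real, norm_eq_abs]; nlinarith
          · rw [mul_one, norm_real, norm_eq_abs]
          · rw [one_mul, norm_real, norm_eq_abs]
          · tauto
      _ = 2 ^ (e ∪ e').card := by rw [prod_const]
      _ ≤ 2 ^ (e.card + e'.card) := by apply pow_le_pow_right₀ (by norm_num) (card_union_le _ _)
      _ = _ := by rw [pow_add]
  simp only [hprod] at h
  rw [prod_union hdis, prod_union hdis, havgS, hloneS, havg] at h
  rw [mul_assoc]
  refine h.trans ?_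
  apply mul_le_mul_of_nonneg_right hlone
  exact prod_nonneg fun p _ => lone_nonneg _ _

lemma two_pow_card_le_prod (e : Finset ℕ) (he : ∀ p ∈ e, p.Prime) : 2 ^ e.card ≤ ∏ p ∈ e, p := by
  rw [← prod_const]
  exact Finset.prod_le_prod' fun p hp => (he p hp).two_le

lemma prod_primes_inj (e e' : Finset ℕ) (he : ∀ p ∈ e, p.Prime) (he' : ∀ p ∈ e', p.Prime)
    (h : ∏ p ∈ e, p = ∏ p ∈ e', p) : e = e' := by
  rw [← Nat.primeFactors_prod he, ← Nat.primeFactors_prod he', h]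

lemma card_support_le (P : Finset ℕ) (hP : ∀ p ∈ P, p.Prime) (D : ℝ) (hD : 0 ≤ D) :
    (((P.powerset).filter (fun e => ((∏ p ∈ e, p : ℕ) : ℝ) ≤ D)).card : ℝ) ≤ D := by
  have hsub : ∀ e ∈ (P.powerset).filter (fun e => ((∏ p ∈ e, p : ℕ) : ℝ) ≤ D),
      (∏ p ∈ e, p) ∈ Ioc 0 ⌊D⌋₊ := by
    intro e he; rw [mem_filter, mem_powerset] at he; rw [mem_Ioc]
    exact ⟨prod_pos fun p hp => (hP p (he.1 hp)).pos, le_floor he.2⟩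
  have := card_le_card_of_injOn (fun e => ∏ p ∈ e, p) hsub (by
    intro e he e' he' h; simp only [coe_filter, mem_powerset, Set.mem_ofPred_eq] at he he'
    exact prod_primes_inj e e' (fun p hp => hP p (he.1 hp)) (fun p hp => hP p (he'.1 hp)) h)
  rw [Nat.card_Ioc, Nat.sub_zero] at this
  exact (Nat.cast_le.mpr this).trans (floor_le hD)

lemma sum_abs_g_two_pow_le (P : Finset ℕ) (hP : ∀ p ∈ P, p.Prime) (g : Finset ℕ → ℝ) (Bd D : ℝ)
    (hD : 0 ≤ D) (hB : 0 ≤ Bd) (hg : ∀ e, |g e| ≤ Bd)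
    (hgD : ∀ e, D < ((∏ p ∈ e, p : ℕ) : ℝ) → g e = 0) :
    ∑ e ∈ P.powerset, |g e| * 2 ^ e.card ≤ Bd * D ^ 2 := by
  calc ∑ e ∈ P.powerset, |g e| * 2 ^ e.card
      = ∑ e ∈ (P.powerset).filter (fun e => ((∏ p ∈ e, p : ℕ) : ℝ) ≤ D), |g e| * 2 ^ e.card := by
        symm
        apply sum_filter_of_ne; intro e _ hne
        by_contra h
        push Not at h
        exact hne (by rw [hgD e h]; simp)
    _ ≤ ∑ e ∈ (P.powerset).filter (fun e => ((∏ p ∈ e, p : ℕ) : ℝ) ≤ D), Bd * D := by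
        apply sum_le_sum; intro e he; rw [mem_filter, mem_powerset] at he
        have h2 : (2 : ℝ) ^ e.card ≤ D := by
          refine le_trans ?_ he.2; exact_mod_cast two_pow_card_le_prod e fun p hp => hP p (he.1 hp)
        exact mul_le_mul (hg e) h2 (by positivity) hB
    _ ≤ D * (Bd * D) := by
        rw [sum_const, nsmul_eq_mul]
        exact mul_le_mul_of_nonneg_right (card_support_le P hP D hD) (by positivity)
    _ = _ := by ring

lemma lam_sq_sum (N1 N2 : ℕ) (h12 : N1 ≤ N2) (ψ : ℕ → ℕ → ℂ) (P S : Finset ℕ)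
    (hP : ∀ p ∈ P, p.Prime) (hS : ∀ p ∈ S, p.Prime) (hPS : Disjoint P S)
    (hper : ∀ p ∈ S, ∀ n, ψ p (n % p) = ψ p n) (g : Finset ℕ → ℝ) (Bd D : ℝ)
    (hD : 0 ≤ D) (hB : 0 ≤ Bd) (hg : ∀ e, |g e| ≤ Bd)
    (hgD : ∀ e, D < ((∏ p ∈ e, p : ℕ) : ℝ) → g e = 0) :
    ‖∑ n ∈ Ioc N1 N2, (Lam P g n : ℂ) ^ 2 * ∏ p ∈ S, ψ p n
      - ((N2 : ℂ) - N1) * (HH P g : ℂ) * ∏ p ∈ S, avg p (ψ p)‖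
      ≤ Bd ^ 2 * D ^ 4 * ∏ p ∈ S, lone p (ψ p) := by
  classical
  have h1 : ∑ n ∈ Ioc N1 N2, (Lam P g n : ℂ) ^ 2 * ∏ p ∈ S, ψ p n
      = ∑ e ∈ P.powerset, ∑ e' ∈ P.powerset, ((g e * g e' : ℝ) : ℂ) *
        ∑ n ∈ Ioc N1 N2, (∏ p ∈ e, (rr p n : ℂ)) * (∏ p ∈ e', (rr p n : ℂ)) * ∏ p ∈ S, ψ p n := by
    simp only [mul_sum]
    have hc : ∀ e ∈ P.powerset, ∑ e' ∈ P.powerset, ∑ n ∈ Ioc N1 N2, ((g e * g e' : ℝ) : ℂ) *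
          ((∏ p ∈ e, (rr p n : ℂ)) * (∏ p ∈ e', (rr p n : ℂ)) * ∏ p ∈ S, ψ p n)
        = ∑ n ∈ Ioc N1 N2, ∑ e' ∈ P.powerset, ((g e * g e' : ℝ) : ℂ) *
          ((∏ p ∈ e, (rr p n : ℂ)) * (∏ p ∈ e', (rr p n : ℂ)) * ∏ p ∈ S, ψ p n) :=
      fun e _ => sum_comm
    rw [sum_congr rfl hc, sum_comm]; apply sum_congr rfl; intro n _; unfold Lam; push_cast; rw [sq, sum_mul_sum, sum_mul]
    apply sum_congr rfl; intro e _; rw [sum_mul]; apply sum_congr rfl; intro e' _; ring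
  have h2 : ((N2 : ℂ) - N1) * (HH P g : ℂ) * ∏ p ∈ S, avg p (ψ p)
      = ∑ e ∈ P.powerset, ∑ e' ∈ P.powerset, ((g e * g e' : ℝ) : ℂ) *
        (((N2 : ℂ) - N1) * (if e = e' then (vv e : ℂ) else 0) * ∏ p ∈ S, avg p (ψ p)) := by
    unfold HH; push_cast; rw [mul_sum, sum_mul]; apply sum_congr rfl; intro e he; rw [sum_eq_single e]
    · rw [if_pos rfl]; ring
    · intro e' _ hne
      rw [if_neg (Ne.symm hne)]; ring
    · intro h; exact absurd he h
  rw [h1, h2, ← sum_sub_distrib]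
  simp only [← sum_sub_distrib, ← mul_sub]
  have h0 : 0 ≤ ∏ p ∈ S, lone p (ψ p) := prod_nonneg fun p _ => lone_nonneg _ _
  calc _ ≤ ∑ e ∈ P.powerset, ∑ e' ∈ P.powerset, |g e| * |g e'| *
        (2 ^ e.card * 2 ^ e'.card * ∏ p ∈ S, lone p (ψ p)) := by
        refine (norm_sum_le _ _).trans (sum_le_sum fun e he => ?_)
        refine (norm_sum_le _ _).trans (sum_le_sum fun e' he' => ?_); rw [norm_mul, norm_real, norm_eq_abs, abs_mul]
        apply mul_le_mul_of_nonneg_left _ (by positivity)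
        exact lam_pair_bound N1 N2 h12 ψ P S hP hS hPS hper e e' (mem_powerset.mp he)
          (mem_powerset.mp he')
    _ = (∑ e ∈ P.powerset, |g e| * 2 ^ e.card) ^ 2 * ∏ p ∈ S, lone p (ψ p) := by
        rw [sq, sum_mul_sum, sum_mul]; apply sum_congr rfl; intro e _; rw [sum_mul]; apply sum_congr rfl; intro e' _
        ring
    _ ≤ (Bd * D ^ 2) ^ 2 * ∏ p ∈ S, lone p (ψ p) := by
        apply mul_le_mul_of_nonneg_right _ h0
        apply pow_le_pow_left₀ (sum_nonneg fun e _ => by positivity); exact sum_abs_g_two_pow_le P hP g Bd D hD hB hg hgD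
    _ = _ := by ring

/-- Elementary symmetric sums. -/
def es {R : Type*} [CommSemiring R] (P : Finset ℕ) (a : ℕ → R) (j : ℕ) : R :=
  ∑ e ∈ P.powersetCard j, ∏ p ∈ e, a p

lemma es_zero {R : Type*} [CommSemiring R] (P : Finset ℕ) (a : ℕ → R) : es P a 0 = 1 := by simp [es]

lemma es_empty_succ {R : Type*} [CommSemiring R] (a : ℕ → R) (j : ℕ) : es ∅ a (j + 1) = 0 := by
  unfold es
  rw [powersetCard_eq_empty.mpr (by simp)]
  simp

lemma es_insert_succ {R : Type*} [CommSemiring R] (P : Finset ℕ) (a : ℕ → R) (q : ℕ) (hq : q ∉ P)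
    (j : ℕ) : es (insert q P) a (j + 1) = es P a (j + 1) + a q * es P a j := by
  unfold es
  rw [powersetCard_succ_insert hq, sum_union]
  · congr 1; rw [sum_image, mul_sum]
    · apply sum_congr rfl; intro e he; rw [prod_insert]; intro h; exact hq ((mem_powersetCard.mp he).1 h)
    · intro e he e' he' h
      have h1 : q ∉ e := fun h => hq ((mem_powersetCard.mp he).1 h)
      have h2 : q ∉ e' := fun h => hq ((mem_powersetCard.mp he').1 h); rw [← erase_insert h1, ← erase_insert h2, h]
  · rw [disjoint_left]; intro e he he'
    rw [mem_image] at he'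
    obtain ⟨e', _, rfl⟩ := he'; exact hq ((mem_powersetCard.mp he).1 (mem_insert_self _ _))

lemma es_nonneg (P : Finset ℕ) (a : ℕ → ℝ) (ha : ∀ p ∈ P, 0 ≤ a p) (j : ℕ) : 0 ≤ es P a j := by
  unfold es
  apply sum_nonneg
  intro e he
  exact prod_nonneg fun p hp => ha p ((mem_powersetCard.mp he).1 hp)

lemma es_mono (P : Finset ℕ) (a b : ℕ → ℝ) (ha : ∀ p ∈ P, 0 ≤ a p) (hab : ∀ p ∈ P, a p ≤ b p)
    (j : ℕ) : es P a j ≤ es P b j := by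
  unfold es
  apply sum_le_sum
  intro e he
  have hsub := (mem_powersetCard.mp he).1
  exact Finset.prod_le_prod (fun p hp => ha p (hsub hp)) fun p hp => hab p (hsub hp)

lemma pow_add_mul_le (S a : ℝ) (hS : 0 ≤ S) (ha : 0 ≤ a) (j : ℕ) :
    S ^ (j + 1) + (j + 1) * (a * S ^ j) ≤ (S + a) ^ (j + 1) := by
  induction j with
  | zero => simp
  | succ j ih =>
    rw [pow_succ (S + a)]
    have h : (S ^ (j + 1) + (j + 1) * (a * S ^ j)) * (S + a) ≤ (S + a) ^ (j + 1) * (S + a) := by gcongr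
    refine le_trans ?_ h; push_cast
    have : 0 ≤ a * a * S ^ j * (j + 1) := by positivity
    ring_nf at this ⊢; linarith

lemma es_le (P : Finset ℕ) (a : ℕ → ℝ) (ha : ∀ p ∈ P, 0 ≤ a p) (j : ℕ) :
    es P a j ≤ (∑ p ∈ P, a p) ^ j / j.factorial := by
  induction P using Finset.induction_on generalizing j with
  | empty =>
    cases j with
    | zero => simp [es_zero]
    | succ j => rw [es_empty_succ]; simp
  | insert q P hq ih =>
    cases j with
    | zero => simp [es_zero]
    | succ j =>
      have ha' : ∀ p ∈ P, 0 ≤ a p := fun p hp => ha p (mem_insert_of_mem hp)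
      have hq0 := ha q (mem_insert_self _ _)
      have hS : 0 ≤ ∑ p ∈ P, a p := sum_nonneg ha'; rw [es_insert_succ P a q hq, sum_insert hq]
      have h1 := ih ha' (j + 1)
      have h2 := mul_le_mul_of_nonneg_left (ih ha' j) hq0; refine (add_le_add h1 h2).trans ?_
      have h3 := pow_add_mul_le (∑ p ∈ P, a p) (a q) hS hq0 j
      have hf : (0 : ℝ) < (j + 1).factorial := by exact_mod_cast Nat.factorial_pos _
      rw [le_div_iff₀ hf, add_mul, div_mul_cancel₀ _ hf.ne', factorial_succ]; push_cast
      have : a q * ((∑ p ∈ P, a p) ^ j / j.factorial) * ((j + 1) * j.factorial)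
        = (j + 1) * (a q * (∑ p ∈ P, a p) ^ j) := by field_simp
      rw [this, add_comm (a q)]; exact h3

/-- Bonferroni-type truncation of a product with factors in the unit disc. -/
lemma bonferroni (P : Finset ℕ) (t : ℕ → ℂ) (ht : ∀ p ∈ P, ‖1 + t p‖ ≤ 1) (j : ℕ) :
    ‖∏ p ∈ P, (1 + t p) - ∑ i ∈ range j, es P t i‖ ≤ es P (fun p => ‖t p‖) j := by
  induction P using Finset.induction_on generalizing j with
  | empty =>
    cases j with
    | zero => simp [es_zero]
    | succ j => rw [es_empty_succ, sum_range_succ']; simp [es_zero, es_empty_succ]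
  | insert q P hq ih =>
    have ht' : ∀ p ∈ P, ‖1 + t p‖ ≤ 1 := fun p hp => ht p (mem_insert_of_mem hp)
    cases j with
    | zero =>
      simp only [range_zero, sum_empty, sub_zero, es_zero]; rw [norm_prod]
      exact Finset.prod_le_one (fun _ _ => norm_nonneg _) ht
    | succ j =>
      have h1 := ih ht' (j + 1)
      have h2 := ih ht' j; rw [es_insert_succ _ _ _ hq, prod_insert hq]
      have : (1 + t q) * ∏ p ∈ P, (1 + t p) - ∑ i ∈ range (j + 1), es (insert q P) t i
        = (∏ p ∈ P, (1 + t p) - ∑ i ∈ range (j + 1), es P t i)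
          + t q * (∏ p ∈ P, (1 + t p) - ∑ i ∈ range j, es P t i) := by
        rw [sum_range_succ', sum_range_succ' (fun i => es P t i)]
        simp only [es_insert_succ _ _ _ hq, es_zero, sum_add_distrib, ← mul_sum]; ring
      rw [this]; refine (norm_add_le _ _).trans ?_; rw [norm_mul]
      exact add_le_add h1 (mul_le_mul_of_nonneg_left h2 (norm_nonneg _))

lemma lam_sq_es (N1 N2 : ℕ) (h12 : N1 ≤ N2) (t : ℕ → ℕ → ℂ) (P P1 S : Finset ℕ)
    (hP : ∀ p ∈ P, p.Prime) (hP1 : ∀ p ∈ P1, p.Prime) (hS : ∀ p ∈ S, p.Prime)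
    (hPS : Disjoint P S) (hPP1 : Disjoint P P1) (hSP1 : Disjoint P1 S)
    (hper : ∀ p ∈ P1 ∪ S, ∀ n, t p (n % p) = t p n) (g : Finset ℕ → ℝ) (Bd D : ℝ)
    (hD : 0 ≤ D) (hB : 0 ≤ Bd) (hg : ∀ e, |g e| ≤ Bd)
    (hgD : ∀ e, D < ((∏ p ∈ e, p : ℕ) : ℝ) → g e = 0) (i : ℕ) :
    ‖∑ n ∈ Ioc N1 N2, (Lam P g n : ℂ) ^ 2 * (es P1 (fun p => t p n) i * ∏ p ∈ S, t p n)
      - ((N2 : ℂ) - N1) * (HH P g : ℂ) * (es P1 (fun p => avg p (t p)) i * ∏ p ∈ S, avg p (t p))‖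
      ≤ Bd ^ 2 * D ^ 4 * (es P1 (fun p => lone p (t p)) i * ∏ p ∈ S, lone p (t p)) := by
  have hkey : ∀ e ∈ P1.powersetCard i,
      ‖∑ n ∈ Ioc N1 N2, (Lam P g n : ℂ) ^ 2 * ((∏ p ∈ e, t p n) * ∏ p ∈ S, t p n)
      - ((N2 : ℂ) - N1) * (HH P g : ℂ) * ((∏ p ∈ e, avg p (t p)) * ∏ p ∈ S, avg p (t p))‖
      ≤ Bd ^ 2 * D ^ 4 * ((∏ p ∈ e, lone p (t p)) * ∏ p ∈ S, lone p (t p)) := by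
    intro e he
    have he1 := (mem_powersetCard.mp he).1
    have hd : Disjoint e S := disjoint_of_subset_left he1 hSP1
    have h := lam_sq_sum N1 N2 h12 t P (e ∪ S) hP (by
        intro p hp
        rcases mem_union.mp hp with hp | hp
        · exact hP1 p (he1 hp)
        · exact hS p hp)
      (by
        rw [disjoint_union_right]; exact ⟨disjoint_of_subset_right he1 hPP1, hPS⟩)
      (fun p hp => hper p (union_subset_union_left he1 hp)) g Bd D hD hB hg hgD
    simpa only [prod_union hd] using h
  have e1 : ∑ n ∈ Ioc N1 N2, (Lam P g n : ℂ) ^ 2 * (es P1 (fun p => t p n) i * ∏ p ∈ S, t p n)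
      = ∑ e ∈ P1.powersetCard i, ∑ n ∈ Ioc N1 N2, (Lam P g n : ℂ) ^ 2 *
        ((∏ p ∈ e, t p n) * ∏ p ∈ S, t p n) := by
    rw [sum_comm]; apply sum_congr rfl; intro n _; rw [es, sum_mul, mul_sum]
  have e2 : ((N2 : ℂ) - N1) * (HH P g : ℂ) * (es P1 (fun p => avg p (t p)) i * ∏ p ∈ S, avg p (t p))
      = ∑ e ∈ P1.powersetCard i, ((N2 : ℂ) - N1) * (HH P g : ℂ) *
        ((∏ p ∈ e, avg p (t p)) * ∏ p ∈ S, avg p (t p)) := by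
    rw [es, sum_mul, mul_sum]
  rw [e1, e2, ← sum_sub_distrib, es, sum_mul, mul_sum]
  exact (norm_sum_le _ _).trans (sum_le_sum hkey)

lemma HH_nonneg (P : Finset ℕ) (hP : ∀ p ∈ P, p.Prime) (g : Finset ℕ → ℝ) : 0 ≤ HH P g := by
  unfold HH vv
  apply sum_nonneg
  intro e he
  apply mul_nonneg _ (sq_nonneg _)
  apply prod_nonneg
  intro p hp
  have h2 : (2 : ℝ) ≤ p := by exact_mod_cast (hP p (mem_powerset.mp he hp)).two_le
  apply div_nonneg <;> linarith

/-- The main sieve asymptotic: Selberg weights on `P`, truncated inclusion-exclusion on `P1`. -/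
lemma sieve_core (N1 N2 : ℕ) (h12 : N1 ≤ N2) (t : ℕ → ℕ → ℂ) (P P1 S : Finset ℕ)
    (hP : ∀ p ∈ P, p.Prime) (hP1 : ∀ p ∈ P1, p.Prime) (hS : ∀ p ∈ S, p.Prime)
    (hPS : Disjoint P S) (hPP1 : Disjoint P P1) (hSP1 : Disjoint P1 S)
    (hper : ∀ p ∈ P1 ∪ S, ∀ n, t p (n % p) = t p n) (ht : ∀ p ∈ P1, ∀ n, ‖1 + t p n‖ ≤ 1)
    (g : Finset ℕ → ℝ) (Bd D : ℝ)
    (hD : 0 ≤ D) (hB : 0 ≤ Bd) (hg : ∀ e, |g e| ≤ Bd)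
    (hgD : ∀ e, D < ((∏ p ∈ e, p : ℕ) : ℝ) → g e = 0) (K : ℕ) :
    ‖∑ n ∈ Ioc N1 N2, (Lam P g n : ℂ) ^ 2 * ((∏ p ∈ P1, (1 + t p n)) * ∏ p ∈ S, t p n)
      - ((N2 : ℂ) - N1) * (HH P g : ℂ) * ((∏ p ∈ P1, (1 + avg p (t p))) * ∏ p ∈ S, avg p (t p))‖
      ≤ 2 * (((N2 : ℝ) - N1) * HH P g * (es P1 (fun p => lone p (t p) / p) K *
          ∏ p ∈ S, (lone p (t p) / p)))
        + Bd ^ 2 * D ^ 4 * ((∑ i ∈ range (K + 1), es P1 (fun p => lone p (t p)) i)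
          * ∏ p ∈ S, lone p (t p)) := by
  set M : ℝ := (N2 : ℝ) - N1 with hM
  have hM0 : 0 ≤ M := by rw [hM, sub_nonneg]; exact_mod_cast h12
  have hMc : (N2 : ℂ) - N1 = (M : ℂ) := by rw [hM]; push_cast; rfl
  rw [hMc]
  have hH := HH_nonneg P hP g
  have hi := fun i => lam_sq_es N1 N2 h12 t P P1 S hP hP1 hS hPS hPP1 hSP1 hper g Bd D hD hB hg hgD i
  rw [hMc] at hi
  -- the truncated expansion
  have h1 : ‖∑ n ∈ Ioc N1 N2, (Lam P g n : ℂ) ^ 2 *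
        ((∑ i ∈ range K, es P1 (fun p => t p n) i) * ∏ p ∈ S, t p n)
      - (M : ℂ) * (HH P g : ℂ) * ((∑ i ∈ range K, es P1 (fun p => avg p (t p)) i)
        * ∏ p ∈ S, avg p (t p))‖
      ≤ Bd ^ 2 * D ^ 4 * ((∑ i ∈ range K, es P1 (fun p => lone p (t p)) i)
          * ∏ p ∈ S, lone p (t p)) := by
    have e1 : ∑ n ∈ Ioc N1 N2, (Lam P g n : ℂ) ^ 2 *
        ((∑ i ∈ range K, es P1 (fun p => t p n) i) * ∏ p ∈ S, t p n)
        = ∑ i ∈ range K, ∑ n ∈ Ioc N1 N2, (Lam P g n : ℂ) ^ 2 *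
          (es P1 (fun p => t p n) i * ∏ p ∈ S, t p n) := by
      rw [sum_comm]; apply sum_congr rfl; intro n _; rw [sum_mul, mul_sum]
    rw [e1, sum_mul, mul_sum, ← sum_sub_distrib, sum_mul, mul_sum]
    exact (norm_sum_le _ _).trans (sum_le_sum fun i _ => hi i)
  -- tail of the sum over n
  have hpern : ∀ p ∈ P1 ∪ S, ∀ n, ((‖t p (n % p)‖ : ℝ) : ℂ) = ((‖t p n‖ : ℝ) : ℂ) :=
    fun p hp n => by rw [hper p hp n]
  have hlone : ∀ p, lone p (fun n => ((‖t p n‖ : ℝ) : ℂ)) = lone p (t p) := by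
    intro p; unfold lone; apply sum_congr rfl; intro b _; rw [norm_real, norm_norm]
  have havg : ∀ p, avg p (fun n => ((‖t p n‖ : ℝ) : ℂ)) = ((lone p (t p) / p : ℝ) : ℂ) := by
    intro p
    unfold lone avg; push_cast; rfl
  have h2 := lam_sq_es N1 N2 h12 (fun p n => ((‖t p n‖ : ℝ) : ℂ)) P P1 S hP hP1 hS hPS hPP1 hSP1
    hpern g Bd D hD hB hg hgD K
  simp only [hlone, havg] at h2
  rw [hMc] at h2
  have h3 : ‖∑ n ∈ Ioc N1 N2, (Lam P g n : ℂ) ^ 2 * ((∏ p ∈ P1, (1 + t p n)) * ∏ p ∈ S, t p n)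
      - ∑ n ∈ Ioc N1 N2, (Lam P g n : ℂ) ^ 2 *
        ((∑ i ∈ range K, es P1 (fun p => t p n) i) * ∏ p ∈ S, t p n)‖
      ≤ M * HH P g * (es P1 (fun p => lone p (t p) / p) K * ∏ p ∈ S, (lone p (t p) / p))
        + Bd ^ 2 * D ^ 4 * (es P1 (fun p => lone p (t p)) K * ∏ p ∈ S, lone p (t p)) := by
    have hR : ‖∑ n ∈ Ioc N1 N2, (Lam P g n : ℂ) ^ 2 * ((∏ p ∈ P1, (1 + t p n)) * ∏ p ∈ S, t p n)
      - ∑ n ∈ Ioc N1 N2, (Lam P g n : ℂ) ^ 2 *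
        ((∑ i ∈ range K, es P1 (fun p => t p n) i) * ∏ p ∈ S, t p n)‖
        ≤ ∑ n ∈ Ioc N1 N2, (Lam P g n) ^ 2 * (es P1 (fun p => ‖t p n‖) K * ∏ p ∈ S, ‖t p n‖) := by
      rw [← sum_sub_distrib]; refine (norm_sum_le _ _).trans (sum_le_sum fun n _ => ?_)
      rw [← mul_sub, ← sub_mul, norm_mul, norm_mul, norm_pow, norm_real, norm_eq_abs,
        sq_abs, norm_prod]
      apply mul_le_mul_of_nonneg_left _ (sq_nonneg _)
      apply mul_le_mul_of_nonneg_right _ (prod_nonneg fun _ _ => norm_nonneg _)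
      exact bonferroni P1 (fun p => t p n) (fun p hp => ht p hp n) K
    refine hR.trans ?_
    set R := ∑ n ∈ Ioc N1 N2, (Lam P g n) ^ 2 * (es P1 (fun p => ‖t p n‖) K * ∏ p ∈ S, ‖t p n‖)
      with hRdef
    have hRc : ∑ n ∈ Ioc N1 N2, (Lam P g n : ℂ) ^ 2 *
        (es P1 (fun p => ((‖t p n‖ : ℝ) : ℂ)) K * ∏ p ∈ S, ((‖t p n‖ : ℝ) : ℂ)) = (R : ℂ) := by
      rw [hRdef]; simp only [es]; push_cast; rfl
    rw [hRc] at h2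
    have hmc : (M : ℂ) * (HH P g : ℂ) * (es P1 (fun p => ((lone p (t p) / p : ℝ) : ℂ)) K *
        ∏ p ∈ S, ((lone p (t p) / p : ℝ) : ℂ))
        = ((M * HH P g * (es P1 (fun p => lone p (t p) / p) K * ∏ p ∈ S, (lone p (t p) / p)) : ℝ) : ℂ) := by
      simp only [es]; push_cast; rfl
    rw [hmc, ← Complex.ofReal_sub, norm_real, norm_eq_abs] at h2
    have := (abs_le.mp h2).2; linarith
  -- tail of the main term
  have havgle : ∀ p, ‖avg p (t p)‖ ≤ lone p (t p) / p := by
    intro p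
    unfold avg lone; rw [norm_div, Complex.norm_natCast]; gcongr; exact norm_sum_le _ _
  have h4 : ‖(M : ℂ) * (HH P g : ℂ) * ((∑ i ∈ range K, es P1 (fun p => avg p (t p)) i)
        * ∏ p ∈ S, avg p (t p))
      - (M : ℂ) * (HH P g : ℂ) * ((∏ p ∈ P1, (1 + avg p (t p))) * ∏ p ∈ S, avg p (t p))‖
      ≤ M * HH P g * (es P1 (fun p => lone p (t p) / p) K * ∏ p ∈ S, (lone p (t p) / p)) := by
    rw [← mul_sub, ← sub_mul, norm_mul, norm_mul, norm_mul, norm_real, norm_real,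
      norm_of_nonneg hM0, norm_of_nonneg hH]
    apply mul_le_mul_of_nonneg_left _ (by positivity); apply mul_le_mul
    · rw [norm_sub_rev]
      refine (bonferroni P1 (fun p => avg p (t p)) ?_ K).trans ?_
      · intro p hp
        have hp0 : (0 : ℝ) < p := by exact_mod_cast (hP1 p hp).pos
        have hp0' : (p : ℂ) ≠ 0 := by exact_mod_cast (hP1 p hp).ne_zero
        have : 1 + avg p (t p) = (∑ b ∈ range p, (1 + t p b)) / p := by
          unfold avg; rw [sum_add_distrib]; simp; field_simp
        rw [this, norm_div, Complex.norm_natCast, div_le_one hp0]; refine (norm_sum_le _ _).trans ?_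
        refine (sum_le_sum fun b _ => ht p hp b).trans ?_; simp
      · exact es_mono P1 _ _ (fun p _ => norm_nonneg _) (fun p _ => havgle p) K
    · rw [norm_prod]
      exact Finset.prod_le_prod (fun _ _ => norm_nonneg _) fun p _ => havgle p
    · exact norm_nonneg _
    · apply es_nonneg; intro p _
      have := lone_nonneg p (t p); positivity
  have htri := norm_sub_le_norm_sub_add_norm_sub
    (∑ n ∈ Ioc N1 N2, (Lam P g n : ℂ) ^ 2 * ((∏ p ∈ P1, (1 + t p n)) * ∏ p ∈ S, t p n))
    (∑ n ∈ Ioc N1 N2, (Lam P g n : ℂ) ^ 2 *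
        ((∑ i ∈ range K, es P1 (fun p => t p n) i) * ∏ p ∈ S, t p n))
    ((M : ℂ) * (HH P g : ℂ) * ((∏ p ∈ P1, (1 + avg p (t p))) * ∏ p ∈ S, avg p (t p)))
  have htri2 := norm_sub_le_norm_sub_add_norm_sub
    (∑ n ∈ Ioc N1 N2, (Lam P g n : ℂ) ^ 2 *
        ((∑ i ∈ range K, es P1 (fun p => t p n) i) * ∏ p ∈ S, t p n))
    ((M : ℂ) * (HH P g : ℂ) * ((∑ i ∈ range K, es P1 (fun p => avg p (t p)) i)
        * ∏ p ∈ S, avg p (t p)))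
    ((M : ℂ) * (HH P g : ℂ) * ((∏ p ∈ P1, (1 + avg p (t p))) * ∏ p ∈ S, avg p (t p)))
  rw [sum_range_succ (fun i => es P1 (fun p => lone p (t p)) i) K]
  have : Bd ^ 2 * D ^ 4 * ((∑ i ∈ range K, es P1 (fun p => lone p (t p)) i
      + es P1 (fun p => lone p (t p)) K) * ∏ p ∈ S, lone p (t p))
      = Bd ^ 2 * D ^ 4 * ((∑ i ∈ range K, es P1 (fun p => lone p (t p)) i) * ∏ p ∈ S, lone p (t p))
      + Bd ^ 2 * D ^ 4 * (es P1 (fun p => lone p (t p)) K * ∏ p ∈ S, lone p (t p)) := by ring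
  rw [this]
  linarith

/-- The Brun cut `X ^ (1 / (log log X) ^ (3/2))`. -/
noncomputable def zz (X : ℝ) : ℝ := exp (log X / (log (log X) * √(log (log X))))

lemma tendsto_LL : Tendsto (fun X : ℝ => log (log X)) atTop atTop :=
  tendsto_log_atTop.comp tendsto_log_atTop

lemma eventually_LL_le (c : ℝ) (hc : 0 < c) :
    ∀ᶠ X : ℝ in atTop, log (log X) ≤ c * log X := by
  have h := (isLittleO_log_id_atTop.comp_tendsto tendsto_log_atTop).bound hc
  filter_upwards [h, tendsto_log_atTop.eventually_ge_atTop 0] with X h1 h2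
  simp only [Function.comp, id, norm_eq_abs] at h1
  rw [abs_of_nonneg h2] at h1
  exact (le_abs_self _).trans h1

lemma card_primesLE_le (z : ℕ) (P : Finset ℕ) (hP : P ⊆ primesLE z) : P.card ≤ z := by
  calc P.card ≤ (primesLE z).card := card_le_card hP
    _ ≤ (Icc 1 z).card := by rw [Nat.primesLE_eq_filter_Icc_one]; exact card_filter_le _ _
    _ = z := by simp

lemma pow_div_factorial_le (a : ℝ) (K : ℕ) (ha : 0 ≤ a) (hK : 10 * a ≤ K) (hK0 : 0 < K) :
    a ^ K / K.factorial ≤ exp (-K) := by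
  have hKpos : (0 : ℝ) < K := by exact_mod_cast hK0
  have h1 : (K : ℝ) ^ K / K.factorial ≤ exp K := pow_div_factorial_le_exp K hKpos.le K
  have h2 : a ^ K ≤ ((K : ℝ) / 10) ^ K := by apply pow_le_pow_left₀ ha; linarith
  have h3 : ((1 : ℝ) / 10) ^ K ≤ exp (-2 * K) := by
    have : exp (-2 * (K : ℝ)) = exp (-2) ^ K := by rw [← exp_nat_mul]; ring_nf
    rw [this]; apply pow_le_pow_left₀ (by norm_num); rw [exp_neg, one_div]; apply inv_anti₀ (exp_pos _)
    have := exp_one_lt_d9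
    have h4 : exp 2 = exp 1 * exp 1 := by rw [← exp_add]; norm_num
    rw [h4]; nlinarith [exp_pos 1]
  calc a ^ K / K.factorial ≤ ((K : ℝ) / 10) ^ K / K.factorial := by gcongr
    _ = (1 / 10) ^ K * ((K : ℝ) ^ K / K.factorial) := by rw [div_pow, div_pow, one_pow]; ring
    _ ≤ exp (-2 * K) * exp K := by gcongr
    _ = exp (-K) := by rw [← exp_add]; ring_nf

lemma brun_tail (γ : ℝ) (hγ : 0 < γ) : ∀ᶠ X : ℝ in atTop, ∃ K : ℕ, ∀ z : ℕ, (z : ℝ) ≤ zz X →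
    ∀ P1 : Finset ℕ, P1 ⊆ primesLE z → ∀ l : ℕ → ℝ, (∀ p ∈ P1, 0 ≤ l p ∧ l p ≤ 5) →
    es P1 (fun p => l p / p) K ≤ 1 / log X ^ 50 ∧ ∑ i ∈ range (K + 1), es P1 l i ≤ X ^ γ := by
  obtain ⟨C, hC0, hC⟩ := sum_inv_prime_le
  filter_upwards [tendsto_LL.eventually_ge_atTop (5 * C + 5), eventually_LL_le (γ / 400) (by positivity),
    tendsto_LL.eventually_ge_atTop ((122 / γ) ^ 2 + 1), tendsto_log_atTop.eventually_ge_atTop 1,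
    eventually_ge_atTop 1] with X hL hLγ hL2 hlog hX1
  set L := log (log X)
  have hL1 : 1 ≤ L := by nlinarith
  refine ⟨⌈60 * L⌉₊, ?_⟩
  intro z hz P1 hP1 l hl
  set K := ⌈60 * L⌉₊
  have hK1 : 60 * L ≤ K := Nat.le_ceil _
  have hK2 : (K : ℝ) ≤ 61 * L := by
    have := Nat.ceil_lt_add_one (show 0 ≤ 60 * L by linarith); linarith
  have hK0 : 0 < K := by
    have : (0 : ℝ) < K := by linarith
    exact_mod_cast this
  have hexpL : exp L = log X := exp_log (by linarith)
  have hs1 : 1 ≤ √L := one_le_sqrt.2 hL1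
  have hzX : zz X ≤ X := by
    conv_rhs => rw [← exp_log (show 0 < X by linarith)]
    apply exp_le_exp.2; apply div_le_self (by linarith); nlinarith
  have hsum : ∑ p ∈ P1, l p / p ≤ 6 * L := by
    by_cases hz2 : 2 ≤ z
    · have h1 : ∑ p ∈ P1, l p / p ≤ ∑ p ∈ primesLE z, 5 * (1 / (p : ℝ)) := by
        calc ∑ p ∈ P1, l p / p ≤ ∑ p ∈ P1, 5 * (1 / (p : ℝ)) := by
              apply sum_le_sum; intro p hp; rw [mul_one_div]
              exact div_le_div_of_nonneg_right (hl p hp).2 (Nat.cast_nonneg _)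
          _ ≤ _ := sum_le_sum_of_subset_of_nonneg hP1 (fun _ _ _ => by positivity)
      rw [← mul_sum] at h1
      have h2 := hC z hz2
      have h3 : log (log z) ≤ L := by
        have hz2' : (2 : ℝ) ≤ z := by exact_mod_cast hz2
        apply log_le_log (log_pos (by linarith)); apply log_le_log (by linarith) (hz.trans hzX)
      linarith
    · have : P1 = ∅ := by
        rw [eq_empty_iff_forall_notMem]; intro p hp
        have := mem_primesLE.1 (hP1 hp)
        have := this.2.two_le; omega
      rw [this]; simp; linarith
  have hln : ∀ p ∈ P1, 0 ≤ l p / p := fun p hp => div_nonneg (hl p hp).1 (Nat.cast_nonneg _)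
  constructor
  · calc es P1 (fun p => l p / p) K ≤ (∑ p ∈ P1, l p / p) ^ K / K.factorial := es_le _ _ hln K
      _ ≤ (6 * L) ^ K / K.factorial := by
          gcongr; exact sum_nonneg hln
      _ ≤ exp (-K) := pow_div_factorial_le _ _ (by linarith) (by linarith) hK0
      _ ≤ exp (-(50 * L)) := exp_le_exp.2 (by linarith)
      _ = 1 / log X ^ 50 := by rw [exp_neg, ← hexpL, ← exp_nat_mul, one_div]; norm_num
  · set Z := zz X
    have hZ1 : 1 ≤ Z := by apply one_le_exp; positivity
    have hes : ∀ i ∈ range (K + 1), es P1 l i ≤ (5 * Z) ^ K := by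
      intro i hi
      have hi' : i ≤ K := by simpa [Nat.lt_succ_iff] using hi
      have hs : ∑ p ∈ P1, l p ≤ 5 * Z := by
        calc ∑ p ∈ P1, l p ≤ ∑ p ∈ P1, (5 : ℝ) := sum_le_sum fun p hp => (hl p hp).2
          _ = 5 * P1.card := by rw [sum_const, nsmul_eq_mul]; ring
          _ ≤ 5 * z := by
              have : (P1.card : ℝ) ≤ z := by exact_mod_cast card_primesLE_le z P1 hP1
              linarith
          _ ≤ 5 * Z := by linarith
      have hs0 : 0 ≤ ∑ p ∈ P1, l p := sum_nonneg fun p hp => (hl p hp).1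
      calc es P1 l i ≤ (∑ p ∈ P1, l p) ^ i / i.factorial := es_le _ _ (fun p hp => (hl p hp).1) i
        _ ≤ (∑ p ∈ P1, l p) ^ i := div_le_self (by positivity) (by exact_mod_cast Nat.one_le_iff_ne_zero.2 (Nat.factorial_ne_zero i))
        _ ≤ (5 * Z) ^ i := by gcongr
        _ ≤ (5 * Z) ^ K := pow_le_pow_right₀ (by linarith) hi'
    have hK1' : ((K : ℝ) + 1) ≤ 2 ^ K := by
      have : K + 1 ≤ 2 ^ K := Nat.lt_two_pow_self; exact_mod_cast this
    have hlogZ : log Z = log X / (L * √L) := log_exp _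
    have hsq : 122 / γ ≤ √L := by apply le_sqrt_of_sq_le; linarith
    calc ∑ i ∈ range (K + 1), es P1 l i ≤ ∑ i ∈ range (K + 1), (5 * Z) ^ K := sum_le_sum hes
      _ = (K + 1) * (5 * Z) ^ K := by rw [sum_const, card_range, nsmul_eq_mul]; push_cast; ring
      _ ≤ 2 ^ K * (5 * Z) ^ K := by gcongr
      _ = (10 * Z) ^ K := by rw [← mul_pow]; ring_nf
      _ = exp (K * log (10 * Z)) := by rw [exp_nat_mul, exp_log (by linarith)]
      _ ≤ exp (γ * log X) := by
          apply exp_le_exp.2; rw [log_mul (by norm_num) (by linarith), hlogZ]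
          have h10 : log 10 ≤ 3 := by
            rw [log_le_iff_le_exp (by norm_num)]
            have := exp_one_gt_d9
            have h4 : exp 3 = exp 1 * exp 1 * exp 1 := by rw [← exp_add, ← exp_add]; norm_num
            rw [h4]; nlinarith [mul_pos (exp_pos 1) (exp_pos 1)]
          have ha : (K : ℝ) * (log X / (L * √L)) ≤ γ / 2 * log X := by
            have h61 : (K : ℝ) * (log X / (L * √L)) ≤ 61 * L * (log X / (L * √L)) := by gcongr
            have h62 : 61 * L * (log X / (L * √L)) = 61 * log X / √L := by field_simp
            have h63 : 61 * log X / √L ≤ γ / 2 * log X := by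
              rw [div_le_iff₀ (by linarith)]; rw [div_le_iff₀ hγ] at hsq; nlinarith
            linarith
          have hb : (K : ℝ) * log 10 ≤ γ / 2 * log X := by
            have : (K : ℝ) * log 10 ≤ 61 * L * 3 := by apply mul_le_mul hK2 h10 (log_nonneg (by norm_num)) (by linarith)
            nlinarith
          rw [mul_add]; linarith
      _ = X ^ γ := by rw [rpow_def_of_pos (by linarith)]; ring_nf

lemma HH_le (P : Finset ℕ) (hP : ∀ p ∈ P, p.Prime) (g : Finset ℕ → ℝ) (Bd : ℝ)
    (hg : ∀ e ⊆ P, |g e| ≤ Bd) : HH P g ≤ Bd ^ 2 * ∏ p ∈ P, (1 + 1 / ((p : ℝ) - 1)) := by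
  unfold HH vv
  have h1 : ∏ p ∈ P, (1 + 1 / ((p : ℝ) - 1)) = ∑ e ∈ P.powerset, ∏ p ∈ e, 1 / ((p : ℝ) - 1) := by rw [prod_one_add]
  rw [h1, mul_sum]
  apply sum_le_sum
  intro e he
  rw [mul_comm]
  have hv : 0 ≤ ∏ p ∈ e, 1 / ((p : ℝ) - 1) := by
    apply prod_nonneg; intro p hp
    have := (hP p (mem_powerset.1 he hp)).one_lt
    have : (1 : ℝ) < p := by exact_mod_cast this
    apply div_nonneg <;> linarith
  apply mul_le_mul_of_nonneg_right _ hv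
  exact sq_le_sq' (by linarith [(abs_le.1 (hg e (mem_powerset.1 he))).1]) (abs_le.1 (hg e (mem_powerset.1 he))).2

lemma prod_le_prod_primesLE (P : Finset ℕ) (n : ℕ) (hP : P ⊆ primesLE n) :
    ∏ p ∈ P, (1 + 1 / ((p : ℝ) - 1)) ≤ ∏ p ∈ primesLE n, (1 + 1 / ((p : ℝ) - 1)) := by
  have hge : ∀ p ∈ primesLE n, (1 : ℝ) ≤ 1 + 1 / ((p : ℝ) - 1) := by
    intro p hp
    have := (mem_primesLE.1 hp).2.one_lt
    have : (1 : ℝ) < p := by exact_mod_cast this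
    have : 0 ≤ 1 / ((p : ℝ) - 1) := div_nonneg zero_le_one (by linarith); linarith
  rw [← prod_sdiff hP]
  apply le_mul_of_one_le_left
  · exact prod_nonneg fun p hp => zero_le_one.trans (hge p (hP hp))
  · calc (1 : ℝ) = ∏ _p ∈ primesLE n \ P, (1 : ℝ) := by simp
      _ ≤ _ := Finset.prod_le_prod (fun _ _ => zero_le_one) (fun p hp => hge p (mem_sdiff.1 hp).1)

lemma sieve_main (γ : ℝ) (hγ : 0 < γ) : ∀ᶠ X : ℝ in atTop, ∀ z : ℕ, (z : ℝ) ≤ zz X →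
    ∀ (N1 N2 : ℕ) (_ : N1 ≤ N2) (t : ℕ → ℕ → ℂ) (P P1 S : Finset ℕ)
    (_ : P ⊆ primesLE ⌊X⌋₊) (_ : P1 ⊆ primesLE z) (_ : ∀ p ∈ S, p.Prime)
    (_ : Disjoint P S) (_ : Disjoint P P1) (_ : Disjoint P1 S)
    (_ : ∀ p ∈ P1 ∪ S, ∀ n, t p (n % p) = t p n) (_ : ∀ p ∈ P1, ∀ n, ‖1 + t p n‖ ≤ 1)
    (_ : ∀ p ∈ P1, lone p (t p) ≤ 5)
    (g : Finset ℕ → ℝ) (Bd : ℝ) (_ : 0 ≤ Bd) (_ : ∀ e, |g e| ≤ Bd)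
    (_ : ∀ e, X ^ γ < ((∏ p ∈ e, p : ℕ) : ℝ) → g e = 0),
    ‖∑ n ∈ Ioc N1 N2, (Lam P g n : ℂ) ^ 2 * ((∏ p ∈ P1, (1 + t p n)) * ∏ p ∈ S, t p n)
      - ((N2 : ℂ) - N1) * (HH P g : ℂ) * ((∏ p ∈ P1, (1 + avg p (t p))) * ∏ p ∈ S, avg p (t p))‖
      ≤ Bd ^ 2 * (((N2 : ℝ) - N1) / log X ^ 48 * ∏ p ∈ S, (lone p (t p) / p)
        + X ^ (5 * γ) * ∏ p ∈ S, lone p (t p)) := by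
  obtain ⟨C, hC0, hC⟩ := prod_primes_le
  filter_upwards [brun_tail γ hγ, tendsto_log_atTop.eventually_ge_atTop (2 * C + 1),
    eventually_ge_atTop 2] with X hX hlog hX2
  intro z hz N1 N2 h12 t P P1 S hP hP1 hS hPS hPP1 hSP1 hper ht hlone g Bd hB hg hgD
  obtain ⟨K, hK⟩ := hX
  obtain ⟨k1, k2⟩ := hK z hz P1 hP1 (fun p => lone p (t p)) (fun p hp => ⟨lone_nonneg _ _, hlone p hp⟩)
  have hPp : ∀ p ∈ P, p.Prime := fun p hp => (mem_primesLE.1 (hP hp)).2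
  have core := sieve_core N1 N2 h12 t P P1 S hPp (fun p hp => (mem_primesLE.1 (hP1 hp)).2) hS hPS hPP1
    hSP1 hper ht g Bd (X ^ γ) (by positivity) hB hg hgD K
  refine core.trans ?_
  have hlen : (0 : ℝ) ≤ (N2 : ℝ) - N1 := by rw [sub_nonneg]; exact_mod_cast h12
  have hl0 : 0 < log X := by linarith
  have hfl : 2 ≤ ⌊X⌋₊ := le_floor (by exact_mod_cast hX2)
  have hHH : HH P g ≤ Bd ^ 2 * (C * log X) := by
    refine (HH_le P hPp g Bd (fun e _ => hg e)).trans ?_; gcongr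
    refine (prod_le_prod_primesLE P _ hP).trans ((hC _ hfl).trans ?_); gcongr; exact floor_le (by linarith)
  have hs1 : 0 ≤ ∏ p ∈ S, (lone p (t p) / p) :=
    prod_nonneg fun p _ => div_nonneg (lone_nonneg _ _) (Nat.cast_nonneg _)
  have hs2 : 0 ≤ ∏ p ∈ S, lone p (t p) := prod_nonneg fun p _ => lone_nonneg _ _
  have h1 : 2 * (((N2 : ℝ) - N1) * HH P g * (es P1 (fun p => lone p (t p) / p) K *
          ∏ p ∈ S, (lone p (t p) / p))) ≤ 2 * (((N2 : ℝ) - N1) * (Bd ^ 2 * (C * log X)) *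
          (1 / log X ^ 50 * ∏ p ∈ S, (lone p (t p) / p))) := by
    gcongr
    exact mul_nonneg (es_nonneg _ _ (fun p _ => div_nonneg (lone_nonneg _ _) (Nat.cast_nonneg _)) _) hs1
  have h2 : 2 * (((N2 : ℝ) - N1) * (Bd ^ 2 * (C * log X)) *
          (1 / log X ^ 50 * ∏ p ∈ S, (lone p (t p) / p))) ≤
          Bd ^ 2 * (((N2 : ℝ) - N1) / log X ^ 48 * ∏ p ∈ S, (lone p (t p) / p)) := by
    have : 2 * (((N2 : ℝ) - N1) * (Bd ^ 2 * (C * log X)) *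
          (1 / log X ^ 50 * ∏ p ∈ S, (lone p (t p) / p))) =
          (2 * C / log X) * (Bd ^ 2 * (((N2 : ℝ) - N1) / log X ^ 48 * ∏ p ∈ S, (lone p (t p) / p))) := by
      field_simp
    rw [this]; apply mul_le_of_le_one_left (by positivity)
    rw [div_le_one hl0]; linarith
  have h3 : Bd ^ 2 * (X ^ γ) ^ 4 * ((∑ i ∈ range (K + 1), es P1 (fun p => lone p (t p)) i)
          * ∏ p ∈ S, lone p (t p)) ≤ Bd ^ 2 * (X ^ γ) ^ 4 * (X ^ γ * ∏ p ∈ S, lone p (t p)) := by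
    gcongr
  have h4 : (X ^ γ) ^ 4 * X ^ γ = X ^ (5 * γ) := by
    rw [← rpow_mul_natCast (by linarith), ← rpow_add (by linarith)]
    congr 1; push_cast; ring
  calc _ ≤ _ := add_le_add (h1.trans h2) h3
    _ = _ := by rw [← h4]; ring

lemma sum_powerset_split {M : Type*} [AddCommMonoid M] (P S : Finset ℕ) (F : Finset ℕ → M) :
    ∑ e ∈ P.powerset, F e = ∑ e0 ∈ (P \ S).powerset, ∑ f ∈ (P ∩ S).powerset, F (e0 ∪ f) := by
  rw [← sum_product']
  refine sum_bij' (fun e _ => (e \ S, e ∩ S)) (fun x _ => x.1 ∪ x.2) ?_ ?_ ?_ ?_ ?_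
  · intro e he; rw [mem_powerset] at he; simp only [mem_product, mem_powerset]
    exact ⟨sdiff_subset_sdiff he (Subset.refl _), inter_subset_inter_right he⟩
  · intro x hx; simp only [mem_product, mem_powerset] at hx ⊢
    exact union_subset (hx.1.trans sdiff_subset) (hx.2.trans inter_subset_left)
  · intro e _; exact sdiff_union_inter e S
  · rintro ⟨a, b⟩ hx; simp only [mem_product, mem_powerset] at hx
    have ha : ∀ p ∈ a, p ∉ S := fun p hp => (mem_sdiff.1 (hx.1 hp)).2
    have hb : ∀ p ∈ b, p ∈ S := fun p hp => (mem_inter.1 (hx.2 hp)).2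
    ext p
    · grind
    · grind
  · intro e _; simp only [sdiff_union_inter]

/-- Splitting of the Selberg form at a set of primes carrying local conditions. -/
lemma Lam_split (P S : Finset ℕ) (g : Finset ℕ → ℝ) (κ : ℕ → ℝ) (ψ : ℕ → ℕ → ℂ) (n : ℕ)
    (hκ : ∀ q ∈ S, q ∈ P → ψ q n * (rr q n : ℂ) = κ q * ψ q n) :
    (Lam P g n : ℂ) * ∏ q ∈ S, ψ q n =
      (Lam (P \ S) (fun e0 => ∑ f ∈ (P ∩ S).powerset, (∏ q ∈ f, κ q) * g (e0 ∪ f)) n : ℂ)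
        * ∏ q ∈ S, ψ q n := by
  have hf : ∀ f ⊆ P ∩ S, (∏ p ∈ f, (rr p n : ℂ)) * ∏ q ∈ S, ψ q n = (∏ p ∈ f, (κ p : ℂ)) * ∏ q ∈ S, ψ q n := by
    intro f hf
    have hfS : f ⊆ S := hf.trans inter_subset_right; rw [← prod_sdiff hfS]
    have : (∏ p ∈ f, (rr p n : ℂ)) * ∏ q ∈ f, ψ q n = (∏ p ∈ f, (κ p : ℂ)) * ∏ q ∈ f, ψ q n := by
      rw [← prod_mul_distrib, ← prod_mul_distrib]; apply prod_congr rfl; intro q hq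
      rw [mul_comm, hκ q (hfS hq) (mem_inter.1 (hf hq)).1]
    linear_combination (∏ x ∈ S \ f, ψ x n) * this
  unfold Lam
  rw [sum_powerset_split P S]
  push_cast
  rw [sum_mul, sum_mul]
  apply sum_congr rfl
  intro e0 he0
  rw [sum_mul, sum_mul, sum_mul]
  apply sum_congr rfl
  intro f hff
  have hd : Disjoint e0 f := by
    rw [Finset.disjoint_left]; intro p hp hpf
    exact (mem_sdiff.1 (mem_powerset.1 he0 hp)).2 (mem_inter.1 (mem_powerset.1 hff hpf)).2
  rw [prod_union hd]
  have := hf f (mem_powerset.1 hff)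
  linear_combination (↑(g (e0 ∪ f)) * (∏ x ∈ e0, (rr x n : ℂ))) * this

/-- The smoothed Selberg coefficient of level `D`. -/
noncomputable def gS (D : ℝ) (e : Finset ℕ) : ℝ := max 0 (1 - log ((∏ p ∈ e, p : ℕ) : ℝ) / log D)

/-- The primes in `(z, z']`. -/
def PZ (z z' : ℕ) : Finset ℕ := primesLE z' \ primesLE z

noncomputable def GS (z z' : ℕ) (D : ℝ) : ℝ := ∑ e ∈ (PZ z z').powerset, gS D e * vv e

/-- The sieve majorant of the `z'`-rough numbers. -/
noncomputable def wt (z z' : ℕ) (D : ℝ) (n : ℕ) : ℝ :=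
  if ∀ p ∈ primesLE z, ¬ p ∣ n then (Lam (PZ z z') (gS D) n / GS z z' D) ^ 2 else 0

lemma gS_nonneg (D : ℝ) (e : Finset ℕ) : 0 ≤ gS D e := le_max_left _ _

lemma gS_le_one (D : ℝ) (hD : 1 ≤ D) (e : Finset ℕ) : gS D e ≤ 1 := by
  unfold gS
  apply max_le zero_le_one
  have : 0 ≤ log ((∏ p ∈ e, p : ℕ) : ℝ) / log D :=
    div_nonneg (log_natCast_nonneg _) (log_nonneg hD)
  linarith

lemma gS_eq_zero (D : ℝ) (hD : 1 < D) (e : Finset ℕ) (he : D < ((∏ p ∈ e, p : ℕ) : ℝ)) : gS D e = 0 := by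
  unfold gS
  apply max_eq_left
  have := log_pos hD
  rw [sub_nonpos, one_le_div this]
  exact log_le_log (by linarith) he.le

lemma mem_PZ {z z' p : ℕ} : p ∈ PZ z z' ↔ z < p ∧ p ≤ z' ∧ p.Prime := by
  rw [PZ, Finset.mem_sdiff, mem_primesLE, mem_primesLE]
  constructor
  · rintro ⟨⟨h1, h2⟩, h3⟩; refine ⟨?_, h1, h2⟩
    by_contra h
    exact h3 ⟨not_lt.1 h, h2⟩
  · rintro ⟨h1, h2, h3⟩; exact ⟨⟨h2, h3⟩, fun h => absurd h.1 (not_le.2 h1)⟩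

lemma PZ_prime {z z' p : ℕ} (h : p ∈ PZ z z') : p.Prime := (mem_PZ.1 h).2.2

lemma vv_nonneg (e : Finset ℕ) (he : ∀ p ∈ e, p.Prime) : 0 ≤ vv e := by
  unfold vv
  apply prod_nonneg; intro p hp
  have := (he p hp).one_lt
  have : (1 : ℝ) < p := by exact_mod_cast this
  apply div_nonneg <;> linarith

lemma vv_nonneg_PZ {z z' : ℕ} {e : Finset ℕ} (he : e ∈ (PZ z z').powerset) : 0 ≤ vv e :=
  vv_nonneg e fun _ hp => PZ_prime (mem_powerset.1 he hp)

lemma one_le_GS (z z' : ℕ) (D : ℝ) : 1 ≤ GS z z' D := by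
  unfold GS
  have h : gS D ∅ * vv ∅ ≤ ∑ e ∈ (PZ z z').powerset, gS D e * vv e :=
    single_le_sum (f := fun e => gS D e * vv e)
      (fun e he => mul_nonneg (gS_nonneg D e) (vv_nonneg_PZ he)) (empty_mem_powerset _)
  have h1 : gS D ∅ * vv ∅ = 1 := by simp [gS, vv]
  linarith

lemma HH_gS_le (z z' : ℕ) (D : ℝ) (hD : 1 ≤ D) : HH (PZ z z') (gS D) ≤ GS z z' D := by
  unfold HH GS
  apply sum_le_sum
  intro e he
  rw [mul_comm]
  apply mul_le_mul_of_nonneg_right _ (vv_nonneg_PZ he)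
  have h0 := gS_nonneg D e
  have h1 := gS_le_one D hD e
  nlinarith

lemma wt_nonneg (z z' : ℕ) (D : ℝ) (n : ℕ) : 0 ≤ wt z z' D n := by
  unfold wt; split_ifs
  · positivity
  · exact le_rfl

lemma wt_eq_one (z z' : ℕ) (D : ℝ) (n : ℕ) (hz : z ≤ z') (hn : ∀ p, p.Prime → p ≤ z' → ¬ p ∣ n) :
    wt z z' D n = 1 := by
  unfold wt
  rw [if_pos]
  · have : Lam (PZ z z') (gS D) n = GS z z' D := by
      unfold Lam GS vv; apply sum_congr rfl; intro e he
      congr 1; apply prod_congr rfl; intro p hp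
      have := mem_PZ.1 (mem_powerset.1 he hp); rw [rr, if_neg (hn p this.2.2 this.2.1)]
    rw [this, div_self (by linarith [one_le_GS z z' D]), one_pow]
  · intro p hp
    have := mem_primesLE.1 hp; exact hn p this.2 (this.1.trans hz)

lemma GS_lower : ∃ c > 0, ∀ (z z' : ℕ) (D : ℝ), 2 ≤ z → z ≤ z' → (z' : ℝ) ^ 2 ≤ D →
    c * log z' / log z ≤ GS z z' D := by
  obtain ⟨C, hC0, hC⟩ := prod_primes_le
  refine ⟨1 / (2 * C), by positivity, ?_⟩
  intro z z' D hz hzz hD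
  have hz' : (2 : ℝ) ≤ z' := by exact_mod_cast hz.trans hzz
  have hzR : (2 : ℝ) ≤ z := by exact_mod_cast hz
  have hlz : 0 < log z := log_pos (by linarith)
  have hlz' : 0 < log z' := log_pos (by linarith)
  set A := (primesLE z').powerset.filter (fun e => ∏ p ∈ e, p ≤ z') with hA
  have h1 : log z' ≤ ∑ n ∈ Icc 1 z', (1 : ℝ) / n := by
    have := log_add_one_le_harmonic z'; rw [harmonic_eq_sum_Icc] at this
    push_cast at this; simp only [one_div]; exact (log_le_log (by linarith) (by linarith)).trans this
  have h2 : ∑ n ∈ Icc 1 z', (1 : ℝ) / n ≤ ∑ e ∈ A, vv e := by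
    rw [← sum_fiberwise_of_maps_to (s := Icc 1 z') (t := A) (g := fun n => n.primeFactors)]
    · apply sum_le_sum; intro e he
      have he' := (mem_powerset.1 (mem_filter.1 he).1); apply sum_inv_le_of_primeFactors_eq
      · intro p hp; exact (mem_primesLE.1 (he' hp)).2
      · intro n hn; rw [mem_filter, mem_Icc] at hn; exact ⟨by omega, hn.2⟩
    · intro n hn; rw [mem_Icc] at hn; rw [hA, mem_filter, mem_powerset]; constructor
      · intro p hp; rw [mem_primesLE]
        exact ⟨(Nat.le_of_mem_primeFactors hp).trans hn.2, prime_of_mem_primeFactors hp⟩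
      · exact (le_of_dvd (by omega) (Nat.prod_primeFactors_dvd n)).trans hn.2
  set F : Finset ℕ → ℝ := fun e => if ∏ p ∈ e \ primesLE z, p ≤ z' then vv e else 0 with hF
  have hvv : ∀ e ∈ (primesLE z').powerset, 0 ≤ vv e := fun e he =>
    vv_nonneg e fun p hp => (mem_primesLE.1 (mem_powerset.1 he hp)).2
  have h3 : ∑ e ∈ A, vv e ≤ ∑ e ∈ (primesLE z').powerset, F e := by
    rw [hA, sum_filter]; apply sum_le_sum; intro e he
    by_cases h : ∏ p ∈ e, p ≤ z'
    · rw [if_pos h, hF]; simp only; rw [if_pos]; refine le_trans ?_ h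
      apply Finset.prod_le_prod_of_subset_of_one_le' sdiff_subset; intro p hp _
      exact (mem_primesLE.1 (mem_powerset.1 he hp)).2.one_le
    · rw [if_neg h, hF]; simp only
      split_ifs
      · exact hvv e he
      · exact le_rfl
  rw [sum_powerset_split _ (primesLE z)] at h3
  have hint : primesLE z' ∩ primesLE z = primesLE z := by
    apply inter_eq_right.2; intro p hp
    rw [mem_primesLE] at hp ⊢; exact ⟨hp.1.trans hzz, hp.2⟩
  rw [hint] at h3
  have h4 : ∑ e0 ∈ (primesLE z' \ primesLE z).powerset, ∑ f ∈ (primesLE z).powerset, F (e0 ∪ f)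
      ≤ ∑ e0 ∈ (PZ z z').powerset, ∑ f ∈ (primesLE z).powerset, 2 * (gS D e0 * vv e0) * vv f := by
    apply sum_le_sum; intro e0 he0; apply sum_le_sum; intro f hf
    have hd : Disjoint e0 (primesLE z) := by
      rw [Finset.disjoint_left]; intro p hp; exact (mem_sdiff.1 (mem_powerset.1 he0 hp)).2
    have hd2 : Disjoint e0 f := hd.mono_right (mem_powerset.1 hf)
    have hs : (e0 ∪ f) \ primesLE z = e0 := by
      rw [union_sdiff_distrib, sdiff_eq_self_of_disjoint hd, sdiff_eq_empty_iff_subset.2 (mem_powerset.1 hf),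
        union_empty]
    have hvf : 0 ≤ vv f := vv_nonneg f fun p hp => (mem_primesLE.1 (mem_powerset.1 hf hp)).2
    have hve : 0 ≤ vv e0 := vv_nonneg_PZ he0; rw [hF]; simp only [hs]
    split_ifs with h
    · have hu : vv (e0 ∪ f) = vv e0 * vv f := by unfold vv; exact prod_union hd2
      rw [hu]
      have hg : 1 / 2 ≤ gS D e0 := by
        unfold gS; apply le_max_of_le_right
        have hpos : (1 : ℝ) ≤ ((∏ p ∈ e0, p : ℕ) : ℝ) := by
          have : 0 < ∏ p ∈ e0, p := prod_pos fun p hp => (PZ_prime (mem_powerset.1 he0 hp)).pos; exact_mod_cast this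
        have h5 : log ((∏ p ∈ e0, p : ℕ) : ℝ) ≤ log z' :=
          log_le_log (by linarith) (by exact_mod_cast h)
        have h6 : 2 * log z' ≤ log D := by
          have : log ((z' : ℝ) ^ 2) ≤ log D := log_le_log (by positivity) hD; rw [log_pow] at this; exact_mod_cast this
        have h7 : log ((∏ p ∈ e0, p : ℕ) : ℝ) / log D ≤ 1 / 2 := by
          rw [div_le_div_iff₀ (by linarith) (by norm_num)]; linarith
        linarith
      nlinarith [mul_nonneg hve hvf]
    · have := gS_nonneg D e0; positivity
  have h5 : ∑ e0 ∈ (PZ z z').powerset, ∑ f ∈ (primesLE z).powerset, 2 * (gS D e0 * vv e0) * vv f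
      = 2 * GS z z' D * ∏ p ∈ primesLE z, (1 + 1 / ((p : ℝ) - 1)) := by
    have h2G : 2 * GS z z' D = ∑ e0 ∈ (PZ z z').powerset, 2 * (gS D e0 * vv e0) := by rw [GS, mul_sum]
    rw [h2G, prod_one_add, sum_mul_sum]; rfl
  have h6 := hC z hz
  have hG := one_le_GS z z' D
  have h7 : log z' ≤ 2 * GS z z' D * (C * log z) := by
    calc log z' ≤ _ := h1.trans (h2.trans (h3.trans (h4.trans h5.le)))
      _ ≤ _ := by gcongr
  rw [div_le_iff₀ hlz, one_div, inv_mul_le_iff₀ (by positivity)]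
  linarith

lemma prod_one_sub_inv_le (z : ℕ) (hz : 2 ≤ z) :
    ∏ p ∈ primesLE z, (1 - 1 / (p : ℝ)) ≤ 1 / log z := by
  have h : ∏ p ∈ primesLE z, (1 - 1 / (p : ℝ)) = (∏ p ∈ primesLE z, (1 + 1 / ((p : ℝ) - 1)))⁻¹ := by
    rw [← prod_inv_distrib]; apply prod_congr rfl; intro p hp
    have := (mem_primesLE.1 hp).2.one_lt
    have h1 : (1 : ℝ) < p := by exact_mod_cast this
    have h2 : (p : ℝ) - 1 ≠ 0 := by linarith
    have h3 : (1 : ℝ) + 1 / ((p : ℝ) - 1) = p / (p - 1) := by field_simp; ring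
    rw [h3, inv_div]; field_simp
  have hzR : (2 : ℝ) ≤ z := by exact_mod_cast hz
  have hl : 0 < log z := log_pos (by linarith)
  rw [h, ← one_div]
  apply one_div_le_one_div_of_le hl
  refine le_trans ?_ (log_le_prod_primes z)
  exact log_le_log (by linarith) (by linarith)

noncomputable def YY (z z' : ℕ) (D : ℝ) : ℝ :=
  HH (PZ z z') (gS D) / GS z z' D ^ 2 * ∏ p ∈ primesLE z, (1 - 1 / (p : ℝ))

/-- The mean of `φ` over the reduced residues modulo the prime `p`. -/
noncomputable def avgo (p : ℕ) (φ : ℕ → ℂ) : ℂ := (∑ b ∈ Ico 1 p, φ b) / ((p : ℂ) - 1)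

lemma eventually_zz_le (γ : ℝ) (hγ : 0 < γ) : ∀ᶠ X : ℝ in atTop, zz X ≤ X ^ γ := by
  filter_upwards [tendsto_LL.eventually_ge_atTop (1 / γ), tendsto_LL.eventually_ge_atTop 1,
    eventually_ge_atTop 1] with X h1 h2 hX
  rw [rpow_def_of_pos (by linarith)]
  apply exp_le_exp.2
  have hl : 0 ≤ log X := log_nonneg hX
  have hs : 1 ≤ √(log (log X)) := one_le_sqrt.2 h2
  rw [div_le_iff₀ (by positivity)]
  rw [div_le_iff₀ hγ] at h1
  have : 1 ≤ γ * (log (log X) * √(log (log X))) := by nlinarith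
  nlinarith

lemma eventually_params (γ γ' : ℝ) (hγ' : 0 < γ') (h2 : 2 * γ' ≤ γ) (h1 : γ ≤ 1) : ∀ᶠ X : ℝ in atTop,
    2 ≤ X ∧ 1 < X ^ γ ∧ zz X ≤ X ^ γ' ∧ ⌊X ^ γ'⌋₊ ≤ ⌊X⌋₊ ∧ γ' / 2 * log X ≤ log ⌊X ^ γ'⌋₊ ∧
      ((⌊X ^ γ'⌋₊ : ℕ) : ℝ) ^ 2 ≤ X ^ γ ∧ 2 ≤ ⌊X ^ γ'⌋₊ ∧ 1 ≤ log X := by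
  have ht := tendsto_rpow_atTop (show 0 < γ' / 2 by positivity)
  filter_upwards [eventually_zz_le γ' hγ', eventually_ge_atTop 2, ht.eventually_ge_atTop 2,
    tendsto_log_atTop.eventually_ge_atTop 1] with X hzz hX hX2 hlog
  have hX1 : 1 < X := by linarith
  have hsq : X ^ γ' = X ^ (γ' / 2) * X ^ (γ' / 2) := by rw [← rpow_add (by linarith)]; ring_nf
  have hfl : X ^ γ' < ⌊X ^ γ'⌋₊ + 1 := lt_floor_add_one _
  have hfle : ((⌊X ^ γ'⌋₊ : ℕ) : ℝ) ≤ X ^ γ' := floor_le (by positivity)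
  have hge : X ^ (γ' / 2) ≤ ⌊X ^ γ'⌋₊ := by nlinarith
  refine ⟨hX, one_lt_rpow hX1 (by linarith), hzz, ?_, ?_, ?_, ?_, hlog⟩
  · apply Nat.floor_le_floor
    calc X ^ γ' ≤ X ^ (1 : ℝ) := rpow_le_rpow_of_exponent_le hX1.le (by linarith)
      _ = X := rpow_one X
  · rw [← log_rpow (by linarith)]; exact log_le_log (by positivity) hge
  · calc ((⌊X ^ γ'⌋₊ : ℕ) : ℝ) ^ 2 ≤ (X ^ γ') ^ 2 := by gcongr
      _ = X ^ (2 * γ') := by rw [← rpow_mul_natCast (by linarith)]; ring_nf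
      _ ≤ X ^ γ := rpow_le_rpow_of_exponent_le hX1.le h2
  · exact le_floor (by push_cast; nlinarith)

lemma YY_nonneg (z z' : ℕ) (D : ℝ) : 0 ≤ YY z z' D := by
  unfold YY
  apply mul_nonneg
  · exact div_nonneg (HH_nonneg _ (fun p hp => PZ_prime hp) _) (by positivity)
  · apply prod_nonneg; intro p hp
    have := (mem_primesLE.1 hp).2.one_lt
    have h1 : (1 : ℝ) < p := by exact_mod_cast this
    rw [sub_nonneg, div_le_one (by linarith)]; linarith

lemma inv_GS_mul_prod_le : ∃ C > 0, ∀ (z z' : ℕ) (D : ℝ), 2 ≤ z → z ≤ z' → (z' : ℝ) ^ 2 ≤ D →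
    (GS z z' D)⁻¹ * ∏ p ∈ primesLE z, (1 - 1 / (p : ℝ)) ≤ C / log z' := by
  obtain ⟨c, hc, hG⟩ := GS_lower
  refine ⟨1 / c, by positivity, ?_⟩
  intro z z' D hz hzz hD
  have h1 := hG z z' D hz hzz hD
  have h2 := prod_one_sub_inv_le z hz
  have hzR : (2 : ℝ) ≤ z := by exact_mod_cast hz
  have hzR' : (2 : ℝ) ≤ z' := by exact_mod_cast hz.trans hzz
  have hl : 0 < log z := log_pos (by linarith)
  have hl' : 0 < log z' := log_pos (by linarith)
  have h3 : (GS z z' D)⁻¹ ≤ (c * log z' / log z)⁻¹ := inv_anti₀ (by positivity) h1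
  calc (GS z z' D)⁻¹ * ∏ p ∈ primesLE z, (1 - 1 / (p : ℝ))
      ≤ (GS z z' D)⁻¹ * (1 / log z) := by
        have := one_le_GS z z' D; gcongr
    _ ≤ (c * log z' / log z)⁻¹ * (1 / log z) := by gcongr
    _ = 1 / c / log z' := by field_simp

lemma YY_le : ∃ C > 0, ∀ (z z' : ℕ) (D : ℝ), 2 ≤ z → z ≤ z' → (z' : ℝ) ^ 2 ≤ D →
    YY z z' D ≤ C / log z' := by
  obtain ⟨C, hC, h⟩ := inv_GS_mul_prod_le
  refine ⟨C, hC, ?_⟩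
  intro z z' D hz hzz hD
  refine le_trans ?_ (h z z' D hz hzz hD)
  have hG := one_le_GS z z' D
  have hD1 : 1 ≤ D := by
    have hzR' : (2 : ℝ) ≤ z' := by exact_mod_cast hz.trans hzz
    nlinarith
  unfold YY
  apply mul_le_mul_of_nonneg_right
  · rw [div_le_iff₀ (by positivity), pow_two, inv_mul_cancel_left₀ (by linarith)]; exact HH_gS_le z z' D hD1
  · apply prod_nonneg; intro p hp
    have := (mem_primesLE.1 hp).2.one_lt
    have h1 : (1 : ℝ) < p := by exact_mod_cast this
    rw [sub_nonneg, div_le_one (by linarith)]; linarith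

lemma dvd_mod_iff_dvd (p n : ℕ) : p ∣ n % p ↔ p ∣ n := by rw [Nat.dvd_mod_iff (dvd_refl p)]

lemma wt_corr (γ γ' : ℝ) (hγ' : 0 < γ') (h2 : 2 * γ' ≤ γ) (h1 : γ ≤ 1) : ∀ᶠ X : ℝ in atTop, ∀ z : ℕ,
    (z : ℝ) ≤ zz X → ∀ N1 N2 : ℕ, N1 ≤ N2 → ∀ u : ℕ → ℕ → ℂ, (∀ p n, u p (n % p) = u p n) →
    (∀ p n, ‖u p n‖ ≤ 1) → (∀ p ∈ primesLE z, ∑ b ∈ Ico 1 p, ‖u p b - 1‖ ≤ 4) →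
    ‖∑ n ∈ Ioc N1 N2, (wt z ⌊X ^ γ'⌋₊ (X ^ γ) n : ℂ) * ∏ p ∈ primesLE z, u p n
      - ((N2 : ℂ) - N1) * (YY z ⌊X ^ γ'⌋₊ (X ^ γ) : ℂ) * ∏ p ∈ primesLE z, avgo p (u p)‖
      ≤ ((N2 : ℝ) - N1) / log X ^ 48 + X ^ (5 * γ) := by
  filter_upwards [sieve_main γ (by linarith), eventually_params γ γ' hγ' h2 h1] with X hs hpar
  obtain ⟨hX2, hXγ, hzzX, hfl, -, -, -, hl1⟩ := hpar
  intro z hz N1 N2 h12 u hper hu1 hu4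
  set z' := ⌊X ^ γ'⌋₊
  set D := X ^ γ
  set t : ℕ → ℕ → ℂ := fun p n => (if p ∣ n then 0 else u p n) - 1 with ht
  have h1t : ∀ p n, 1 + t p n = if p ∣ n then 0 else u p n := fun p n => by simp only [ht]; ring
  have hsum : ∀ p : ℕ, p.Prime → ∀ F : ℕ → ℂ, ∑ b ∈ range p, F b = F 0 + ∑ b ∈ Ico 1 p, F b := by
    intro p hp F; rw [range_eq_Ico, sum_eq_sum_Ico_succ_bot hp.pos]
  have hsumR : ∀ p : ℕ, p.Prime → ∀ F : ℕ → ℝ, ∑ b ∈ range p, F b = F 0 + ∑ b ∈ Ico 1 p, F b := by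
    intro p hp F; rw [range_eq_Ico, sum_eq_sum_Ico_succ_bot hp.pos]
  have hnd : ∀ p b, b ∈ Ico 1 p → ¬ p ∣ b := by
    intro p b hb hd; rw [mem_Ico] at hb; exact absurd (le_of_dvd (by omega) hd) (by omega)
  have key := hs z hz N1 N2 h12 t (PZ z z') (primesLE z) ∅ ?_ (Subset.refl _) (by simp) (by simp)
    (by rw [PZ]; exact sdiff_disjoint) (by simp) ?_ ?_ ?_ (gS D) 1 zero_le_one ?_
    (fun e he => gS_eq_zero D hXγ e he)
  · simp only [prod_empty, mul_one, one_pow, one_mul] at key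
    have havg : ∀ p ∈ primesLE z, 1 + avg p (t p) = ((1 - 1 / (p : ℝ) : ℝ) : ℂ) * avgo p (u p) := by
      intro p hp
      have hpp := (mem_primesLE.1 hp).2
      have hp0 : (p : ℂ) ≠ 0 := by exact_mod_cast hpp.ne_zero
      have hp1 : (p : ℂ) - 1 ≠ 0 := by rw [sub_ne_zero]; exact_mod_cast hpp.one_lt.ne'
      rw [avg, avgo, hsum p hpp]
      have e1 : ∑ b ∈ Ico 1 p, t p b = ∑ b ∈ Ico 1 p, u p b - ((p : ℂ) - 1) := by
        have : ∑ b ∈ Ico 1 p, t p b = ∑ b ∈ Ico 1 p, (u p b - 1) := by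
          apply sum_congr rfl; intro b hb; simp only [ht]; rw [if_neg (hnd p b hb)]
        rw [this, sum_sub_distrib, sum_const, Nat.card_Ico, nsmul_eq_mul, Nat.cast_sub hpp.one_le]
        push_cast; ring
      have e2 : t p 0 = -1 := by simp [ht]
      rw [e1, e2]; push_cast; field_simp; ring
    rw [prod_congr rfl havg, prod_mul_distrib] at key
    have hG := one_le_GS z z' D
    have hGC : (GS z z' D : ℂ) ≠ 0 := by
      have : GS z z' D ≠ 0 := by linarith
      exact_mod_cast this
    have hterm : ∀ n, (wt z z' D n : ℂ) * ∏ p ∈ primesLE z, u p n =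
        ((GS z z' D : ℂ) ^ 2)⁻¹ * ((Lam (PZ z z') (gS D) n : ℂ) ^ 2 * ∏ p ∈ primesLE z, (1 + t p n)) := by
      intro n; unfold wt
      split_ifs with h
      · have : ∏ p ∈ primesLE z, (1 + t p n) = ∏ p ∈ primesLE z, u p n := by
          apply prod_congr rfl; intro p hp; rw [h1t, if_neg (h p hp)]
        rw [this]; push_cast; field_simp
      · push Not at h
        obtain ⟨p, hp, hd⟩ := h
        have : ∏ p ∈ primesLE z, (1 + t p n) = 0 := by
          apply prod_eq_zero hp; rw [h1t, if_pos hd]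
        rw [this]; simp
    have heq : ∑ n ∈ Ioc N1 N2, (wt z z' D n : ℂ) * ∏ p ∈ primesLE z, u p n
      - ((N2 : ℂ) - N1) * (YY z z' D : ℂ) * ∏ p ∈ primesLE z, avgo p (u p) =
      ((GS z z' D : ℂ) ^ 2)⁻¹ * (∑ n ∈ Ioc N1 N2, (Lam (PZ z z') (gS D) n : ℂ) ^ 2 * ∏ p ∈ primesLE z, (1 + t p n)
        - ((N2 : ℂ) - N1) * (HH (PZ z z') (gS D) : ℂ) * ((∏ p ∈ primesLE z, ((1 - 1 / (p : ℝ) : ℝ) : ℂ)) *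
          ∏ p ∈ primesLE z, avgo p (u p))) := by
      rw [sum_congr rfl fun n _ => hterm n, ← mul_sum, YY]; push_cast; field_simp
    rw [heq, norm_mul]
    have hn1 : ‖((GS z z' D : ℂ) ^ 2)⁻¹‖ ≤ 1 := by
      rw [norm_inv, norm_pow, norm_real, norm_eq_abs, sq_abs]; exact inv_le_one_of_one_le₀ (by nlinarith)
    calc _ ≤ 1 * _ := mul_le_mul_of_nonneg_right hn1 (norm_nonneg _)
      _ ≤ _ := by rw [one_mul]; exact key
  · intro p hp
    have := mem_PZ.1 hp; exact mem_primesLE.2 ⟨this.2.1.trans hfl, this.2.2⟩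
  · intro p _ n; simp only [ht, dvd_mod_iff_dvd, hper]
  · intro p _ n; rw [h1t]
    split_ifs
    · simp
    · exact hu1 p n
  · intro p hp
    have hpp := (mem_primesLE.1 hp).2; rw [lone, hsumR p hpp]
    have : ∑ b ∈ Ico 1 p, ‖t p b‖ = ∑ b ∈ Ico 1 p, ‖u p b - 1‖ := by
      apply sum_congr rfl; intro b hb; simp only [ht]; rw [if_neg (hnd p b hb)]
    rw [this]
    have e2 : ‖t p 0‖ = 1 := by simp [ht]
    rw [e2]; linarith [hu4 p hp]
  · intro e; rw [abs_of_nonneg (gS_nonneg _ _)]; exact gS_le_one _ hXγ.le _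

lemma prod_le_prod_union (e f : Finset ℕ) (hf : ∀ p ∈ f, p.Prime) : ∏ p ∈ e, p ≤ ∏ p ∈ e ∪ f, p := by
  apply Finset.prod_le_prod_of_subset_of_one_le' subset_union_left
  intro p hp hpe
  rcases mem_union.1 hp with h | h
  · exact absurd h hpe
  · exact (hf p h).one_le

lemma gS_union_le (D : ℝ) (hD : 1 < D) (e f : Finset ℕ) (hf : ∀ p ∈ f, p.Prime) : gS D (e ∪ f) ≤ gS D e := by
  unfold gS
  apply max_le_max le_rfl
  apply sub_le_sub_left
  apply div_le_div_of_nonneg_right _ (log_pos hD).le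
  by_cases h : ∏ p ∈ e, p = 0
  · rw [h]; simp only [Nat.cast_zero, log_zero]; exact log_natCast_nonneg _
  · apply log_le_log (by exact_mod_cast Nat.pos_of_ne_zero h); exact_mod_cast prod_le_prod_union e f hf

noncomputable def gT (D : ℝ) (P S : Finset ℕ) (κ : ℕ → ℝ) (e0 : Finset ℕ) : ℝ :=
  ∑ f ∈ (P ∩ S).powerset, (∏ q ∈ f, κ q) * gS D (e0 ∪ f)

lemma abs_gT_le (D : ℝ) (hD : 1 < D) (P S : Finset ℕ) (κ : ℕ → ℝ) (hS : ∀ q ∈ S, q.Prime) (hS2 : S.card ≤ 2)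
    (hκ : ∀ q ∈ S, |κ q| ≤ 1) (e0 : Finset ℕ) : |gT D P S κ e0| ≤ 4 * gS D e0 := by
  unfold gT
  calc |∑ f ∈ (P ∩ S).powerset, (∏ q ∈ f, κ q) * gS D (e0 ∪ f)|
      ≤ ∑ f ∈ (P ∩ S).powerset, |(∏ q ∈ f, κ q) * gS D (e0 ∪ f)| := abs_sum_le_sum_abs _ _
    _ ≤ ∑ f ∈ (P ∩ S).powerset, gS D e0 := by
        apply sum_le_sum; intro f hf
        have hfS : f ⊆ S := (mem_powerset.1 hf).trans inter_subset_right; rw [abs_mul, abs_of_nonneg (gS_nonneg D _)]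
        have h1 : |∏ q ∈ f, κ q| ≤ 1 := by
          rw [abs_prod]
          exact prod_le_one (fun _ _ => abs_nonneg _) (fun q hq => hκ q (hfS hq))
        have h2 := gS_union_le D hD e0 f (fun p hp => hS p (hfS hp))
        have h3 := gS_nonneg D (e0 ∪ f)
        calc _ ≤ 1 * gS D (e0 ∪ f) := by gcongr
          _ ≤ _ := by linarith
    _ = (2 ^ (P ∩ S).card : ℝ) * gS D e0 := by rw [sum_const, card_powerset, nsmul_eq_mul]; push_cast; rfl
    _ ≤ 4 * gS D e0 := by
        apply mul_le_mul_of_nonneg_right _ (gS_nonneg D e0)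
        have : (P ∩ S).card ≤ 2 := (card_le_card inter_subset_right).trans hS2
        calc (2 : ℝ) ^ (P ∩ S).card ≤ 2 ^ 2 := pow_le_pow_right₀ (by norm_num) this
          _ = 4 := by norm_num

/-- The sieve weight with the Brun conditions at the primes of `S` removed. -/
noncomputable def wS (z z' : ℕ) (D : ℝ) (S : Finset ℕ) (n : ℕ) : ℝ :=
  if ∀ p ∈ primesLE z \ S, ¬ p ∣ n then (Lam (PZ z z') (gS D) n / GS z z' D) ^ 2 else 0

lemma wt_le_wS (z z' : ℕ) (D : ℝ) (S : Finset ℕ) (n : ℕ) : wt z z' D n ≤ wS z z' D S n := by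
  unfold wt wS
  split_ifs with h1 h2 h2
  · exact le_rfl
  · exact absurd (fun p hp => h1 p (Finset.mem_sdiff.1 hp).1) h2
  · positivity
  · exact le_rfl

lemma wt_eq_wS (z z' : ℕ) (D : ℝ) (S : Finset ℕ) (hS : Disjoint (primesLE z) S) (n : ℕ) :
    wt z z' D n = wS z z' D S n := by
  unfold wt wS
  rw [sdiff_eq_self_of_disjoint hS]

noncomputable def YS (z z' : ℕ) (D : ℝ) (S : Finset ℕ) (κ : ℕ → ℝ) : ℝ :=
  HH (PZ z z' \ S) (gT D (PZ z z') S κ) / GS z z' D ^ 2 * ∏ p ∈ primesLE z \ S, (1 - 1 / (p : ℝ))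

lemma prod_one_sub_nonneg (P : Finset ℕ) (hP : ∀ p ∈ P, p.Prime) : 0 ≤ ∏ p ∈ P, (1 - 1 / (p : ℝ)) := by
  apply prod_nonneg
  intro p hp
  have h1 : (1 : ℝ) < p := by exact_mod_cast (hP p hp).one_lt
  rw [sub_nonneg, div_le_one (by linarith)]; linarith

lemma YS_nonneg (z z' : ℕ) (D : ℝ) (S : Finset ℕ) (κ : ℕ → ℝ) : 0 ≤ YS z z' D S κ := by
  unfold YS
  apply mul_nonneg
  · exact div_nonneg (HH_nonneg _ (fun p hp => PZ_prime (mem_sdiff.1 hp).1) _) (by positivity)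
  · exact prod_one_sub_nonneg _ fun p hp => (mem_primesLE.1 (mem_sdiff.1 hp).1).2

lemma YS_le : ∃ C > 0, ∀ (z z' : ℕ) (D : ℝ) (S : Finset ℕ) (κ : ℕ → ℝ), 2 ≤ z → z ≤ z' → (z' : ℝ) ^ 2 ≤ D →
    (∀ q ∈ S, q.Prime) → S.card ≤ 2 → (∀ q ∈ S, |κ q| ≤ 1) →
    YS z z' D S κ ≤ C / log z' := by
  obtain ⟨C, hC, h⟩ := inv_GS_mul_prod_le
  refine ⟨64 * C, by positivity, ?_⟩
  intro z z' D S κ hz hzz hD hS hS2 hκ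
  have hG := one_le_GS z z' D
  have hzR' : (2 : ℝ) ≤ z' := by exact_mod_cast hz.trans hzz
  have hD1 : 1 < D := by nlinarith
  have h1 : HH (PZ z z' \ S) (gT D (PZ z z') S κ) ≤ 16 * GS z z' D := by
    calc HH (PZ z z' \ S) (gT D (PZ z z') S κ) ≤ ∑ e ∈ (PZ z z' \ S).powerset, 16 * (gS D e * vv e) := by
          unfold HH; apply sum_le_sum; intro e he
          have hv : 0 ≤ vv e := vv_nonneg_PZ (mem_powerset.2 ((mem_powerset.1 he).trans sdiff_subset))
          have h2 := abs_gT_le D hD1 (PZ z z') S κ hS hS2 hκ e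
          have h3 : gT D (PZ z z') S κ e ^ 2 ≤ 16 * gS D e := by
            have h4 := gS_nonneg D e
            have h5 := gS_le_one D hD1.le e
            have := sq_le_sq' (by linarith [(abs_le.1 h2).1]) (abs_le.1 h2).2; nlinarith
          nlinarith
      _ ≤ ∑ e ∈ (PZ z z').powerset, 16 * (gS D e * vv e) := by
          apply sum_le_sum_of_subset_of_nonneg (powerset_mono.2 sdiff_subset); intro e he _
          have := vv_nonneg_PZ he
          have := gS_nonneg D e; positivity
      _ = 16 * GS z z' D := by rw [GS, mul_sum]
  have hSZ : ∀ q ∈ primesLE z ∩ S, q.Prime := fun q hq => hS q (mem_inter.1 hq).2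
  have h2 : ∏ p ∈ primesLE z \ S, (1 - 1 / (p : ℝ)) ≤ 4 * ∏ p ∈ primesLE z, (1 - 1 / (p : ℝ)) := by
    rw [← prod_inter_mul_prod_sdiff (primesLE z) S]
    have h3 : (1 / 4 : ℝ) ≤ ∏ p ∈ primesLE z ∩ S, (1 - 1 / (p : ℝ)) := by
      calc (1 / 4 : ℝ) = (1 / 2) ^ 2 := by norm_num
        _ ≤ (1 / 2) ^ (primesLE z ∩ S).card :=
            pow_le_pow_of_le_one (by norm_num) (by norm_num) ((card_le_card inter_subset_right).trans hS2)
        _ = ∏ p ∈ primesLE z ∩ S, (1 / 2 : ℝ) := by rw [prod_const]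
        _ ≤ _ := by
            apply Finset.prod_le_prod
            · intros; norm_num
            · intro p hp
              have : (2 : ℝ) ≤ p := by exact_mod_cast (hSZ p hp).two_le
              have : 1 / (p : ℝ) ≤ 1 / 2 := one_div_le_one_div_of_le (by norm_num) this; linarith
    have h4 := prod_one_sub_nonneg (primesLE z \ S) fun p hp => (mem_primesLE.1 (mem_sdiff.1 hp).1).2; nlinarith
  have h5 := h z z' D hz hzz hD
  have h7 := prod_one_sub_nonneg (primesLE z \ S) fun p hp => (mem_primesLE.1 (mem_sdiff.1 hp).1).2
  unfold YS
  calc _ ≤ 16 * GS z z' D / GS z z' D ^ 2 * (4 * ∏ p ∈ primesLE z, (1 - 1 / (p : ℝ))) := by gcongr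
    _ = 64 * ((GS z z' D)⁻¹ * ∏ p ∈ primesLE z, (1 - 1 / (p : ℝ))) := by
        have hG0 : GS z z' D ≠ 0 := by linarith
        generalize ∏ p ∈ primesLE z, (1 - 1 / (p : ℝ)) = w
        field_simp; norm_num; ring
    _ ≤ 64 * (C / log z') := by gcongr
    _ = _ := by ring

lemma wt_local (γ γ' : ℝ) (hγ' : 0 < γ') (h2 : 2 * γ' ≤ γ) (h1 : γ ≤ 1) : ∀ᶠ X : ℝ in atTop, ∀ z : ℕ,
    (z : ℝ) ≤ zz X → ∀ N1 N2 : ℕ, N1 ≤ N2 → ∀ (S : Finset ℕ) (ψ : ℕ → ℕ → ℂ) (κ : ℕ → ℝ),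
    (∀ q ∈ S, q.Prime) → S.card ≤ 2 → (∀ q ∈ S, |κ q| ≤ 1) → (∀ q ∈ S, ∀ n, ψ q (n % q) = ψ q n) →
    (∀ n, ∀ q ∈ S, q ∈ PZ z ⌊X ^ γ'⌋₊ → ψ q n * (rr q n : ℂ) = κ q * ψ q n) →
    ‖∑ n ∈ Ioc N1 N2, (wS z ⌊X ^ γ'⌋₊ (X ^ γ) S n : ℂ) * ∏ q ∈ S, ψ q n
      - ((N2 : ℂ) - N1) * (YS z ⌊X ^ γ'⌋₊ (X ^ γ) S κ : ℂ) * ∏ q ∈ S, avg q (ψ q)‖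
      ≤ 16 * (((N2 : ℝ) - N1) / log X ^ 48 * ∏ q ∈ S, (lone q (ψ q) / q) +
        X ^ (5 * γ) * ∏ q ∈ S, lone q (ψ q)) := by
  filter_upwards [sieve_main γ (by linarith), eventually_params γ γ' hγ' h2 h1] with X hs hpar
  obtain ⟨hX2, hXγ, hzzX, hfl, -, -, -, hl1⟩ := hpar
  intro z hz N1 N2 h12 S ψ κ hS hS2 hκ hper hκψ
  set z' := ⌊X ^ γ'⌋₊
  set D := X ^ γ
  set t : ℕ → ℕ → ℂ := fun p n => if p ∈ S then ψ p n else if p ∣ n then -1 else 0 with ht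
  have htS : ∀ q ∈ S, t q = ψ q := fun q hq => by funext n; simp only [ht]; rw [if_pos hq]
  have htn : ∀ p ∈ primesLE z \ S, t p = fun n => if p ∣ n then -1 else 0 := fun p hp => by funext n; simp only [ht]; rw [if_neg (mem_sdiff.1 hp).2]
  have hpr : ∀ p ∈ primesLE z \ S, p.Prime := fun p hp => (mem_primesLE.1 (mem_sdiff.1 hp).1).2
  have key := hs z hz N1 N2 h12 t (PZ z z' \ S) (primesLE z \ S) S ?_ sdiff_subset hS
    sdiff_disjoint ?_ sdiff_disjoint ?_ ?_ ?_ (gT D (PZ z z') S κ) 4 (by norm_num) ?_ ?_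
  · have e1 : ∏ p ∈ S, avg p (t p) = ∏ p ∈ S, avg p (ψ p) := prod_congr rfl fun q hq => by rw [htS q hq]
    have e2 : ∏ p ∈ S, lone p (t p) = ∏ p ∈ S, lone p (ψ p) := prod_congr rfl fun q hq => by rw [htS q hq]
    have e3 : ∏ p ∈ S, (lone p (t p) / p) = ∏ p ∈ S, (lone p (ψ p) / p) :=
      prod_congr rfl fun q hq => by rw [htS q hq]
    have e4 : ∀ n, ∏ p ∈ S, t p n = ∏ p ∈ S, ψ p n := fun n => prod_congr rfl fun q hq => by rw [htS q hq]
    have e5 : ∏ p ∈ primesLE z \ S, (1 + avg p (t p)) =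
        ((∏ p ∈ primesLE z \ S, (1 - 1 / (p : ℝ)) : ℝ) : ℂ) := by
      push_cast; apply prod_congr rfl; intro p hp; rw [htn p hp, avg, sum_range_dvd p (hpr p hp)]; ring
    rw [e1, e2, e3, e5] at key; simp only [e4] at key
    have hG := one_le_GS z z' D
    have hGC : (GS z z' D : ℂ) ≠ 0 := by
      have : GS z z' D ≠ 0 := by linarith
      exact_mod_cast this
    have hterm : ∀ n, (wS z z' D S n : ℂ) * ∏ q ∈ S, ψ q n =
        ((GS z z' D : ℂ) ^ 2)⁻¹ * ((Lam (PZ z z' \ S) (gT D (PZ z z') S κ) n : ℂ) ^ 2 *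
          ((∏ p ∈ primesLE z \ S, (1 + t p n)) * ∏ p ∈ S, ψ p n)) := by
      intro n
      have hL := Lam_split (PZ z z') S (gS D) κ ψ n (hκψ n)
      change (Lam (PZ z z') (gS D) n : ℂ) * ∏ q ∈ S, ψ q n =
        (Lam (PZ z z' \ S) (gT D (PZ z z') S κ) n : ℂ) * ∏ q ∈ S, ψ q n at hL
      have hL2 : (Lam (PZ z z') (gS D) n : ℂ) ^ 2 * ∏ q ∈ S, ψ q n =
          (Lam (PZ z z' \ S) (gT D (PZ z z') S κ) n : ℂ) ^ 2 * ∏ q ∈ S, ψ q n := by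
        linear_combination ((Lam (PZ z z') (gS D) n : ℂ) + (Lam (PZ z z' \ S) (gT D (PZ z z') S κ) n : ℂ)) * hL
      unfold wS
      split_ifs with h
      · have : ∏ p ∈ primesLE z \ S, (1 + t p n) = 1 := by
          apply prod_eq_one; intro p hp; rw [htn p hp]; simp only; rw [if_neg (h p hp), add_zero]
        rw [this, one_mul, ← hL2]; push_cast; field_simp
      · push Not at h
        obtain ⟨p, hp, hd⟩ := h
        have : ∏ p ∈ primesLE z \ S, (1 + t p n) = 0 := by
          apply prod_eq_zero hp; rw [htn p hp]; simp only
          rw [if_pos hd]; ring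
        rw [this]; simp
    have heq : ∑ n ∈ Ioc N1 N2, (wS z z' D S n : ℂ) * ∏ q ∈ S, ψ q n
      - ((N2 : ℂ) - N1) * (YS z z' D S κ : ℂ) * ∏ q ∈ S, avg q (ψ q) =
      ((GS z z' D : ℂ) ^ 2)⁻¹ * (∑ n ∈ Ioc N1 N2, (Lam (PZ z z' \ S) (gT D (PZ z z') S κ) n : ℂ) ^ 2 *
          ((∏ p ∈ primesLE z \ S, (1 + t p n)) * ∏ p ∈ S, ψ p n)
        - ((N2 : ℂ) - N1) * (HH (PZ z z' \ S) (gT D (PZ z z') S κ) : ℂ) *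
          (((∏ p ∈ primesLE z \ S, (1 - 1 / (p : ℝ)) : ℝ) : ℂ) * ∏ q ∈ S, avg q (ψ q))) := by
      rw [sum_congr rfl fun n _ => hterm n, ← mul_sum, YS]; push_cast; field_simp
    rw [heq, norm_mul]
    have hn1 : ‖((GS z z' D : ℂ) ^ 2)⁻¹‖ ≤ 1 := by
      rw [norm_inv, norm_pow, norm_real, norm_eq_abs, sq_abs]; exact inv_le_one_of_one_le₀ (by nlinarith)
    calc _ ≤ 1 * _ := mul_le_mul_of_nonneg_right hn1 (norm_nonneg _)
      _ ≤ _ := by rw [one_mul]; refine key.trans (le_of_eq (by norm_num))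
  · intro p hp
    have := mem_PZ.1 (mem_sdiff.1 hp).1; exact mem_primesLE.2 ⟨this.2.1.trans hfl, this.2.2⟩
  · rw [PZ]
    exact (sdiff_disjoint.mono_left sdiff_subset).mono_right sdiff_subset
  · intro p hp n
    rcases mem_union.1 hp with h | h
    · rw [htn p h]; simp only [dvd_mod_iff_dvd]
    · rw [htS p h]; exact hper p h n
  · intro p hp n; rw [htn p hp]; simp only
    split_ifs <;> simp
  · intro p hp; rw [htn p hp, lone]
    calc ∑ b ∈ range p, ‖(if p ∣ b then (-1 : ℂ) else 0)‖ = ∑ b ∈ range p, if b = 0 then (1 : ℝ) else 0 := by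
          apply sum_congr rfl; intro b hb
          by_cases h : b = 0
          · simp [h]
          · have : ¬ p ∣ b := fun hd => absurd (le_of_dvd (Nat.pos_of_ne_zero h) hd) (by rw [mem_range] at hb; omega)
            simp [h, this]
      _ ≤ 5 := by
          rw [sum_ite_eq']
          split_ifs <;> norm_num
  · intro e; refine (abs_gT_le D hXγ _ S κ hS hS2 hκ e).trans ?_; linarith [gS_le_one D hXγ.le e]
  · intro e he; unfold gT; apply sum_eq_zero; intro f hf; rw [gS_eq_zero D hXγ, mul_zero]; refine lt_of_lt_of_le he ?_
    exact_mod_cast prod_le_prod_union e f fun p hp => hS p (mem_inter.1 (mem_powerset.1 hf hp)).2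

lemma norm_avg_le (q : ℕ) (φ : ℕ → ℂ) : ‖avg q φ‖ ≤ lone q φ / q := by
  unfold avg lone
  rw [norm_div, Complex.norm_natCast]
  gcongr
  exact norm_sum_le _ _

lemma wS_upper (γ γ' : ℝ) (hγ' : 0 < γ') (h2 : 2 * γ' ≤ γ) (h1 : γ ≤ 1) : ∃ C > 0, ∀ᶠ X : ℝ in atTop, ∀ z : ℕ,
    2 ≤ z → (z : ℝ) ≤ zz X → ∀ N1 N2 : ℕ, N1 ≤ N2 → ∀ (S : Finset ℕ) (ψ : ℕ → ℕ → ℂ) (κ : ℕ → ℝ),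
    (∀ q ∈ S, q.Prime) → S.card ≤ 2 → (∀ q ∈ S, |κ q| ≤ 1) → (∀ q ∈ S, ∀ n, ψ q (n % q) = ψ q n) →
    (∀ n, ∀ q ∈ S, q ∈ PZ z ⌊X ^ γ'⌋₊ → ψ q n * (rr q n : ℂ) = κ q * ψ q n) →
    ‖∑ n ∈ Ioc N1 N2, (wS z ⌊X ^ γ'⌋₊ (X ^ γ) S n : ℂ) * ∏ q ∈ S, ψ q n‖
      ≤ C * (((N2 : ℝ) - N1) / log X) * ∏ q ∈ S, (lone q (ψ q) / q) +
        16 * X ^ (5 * γ) * ∏ q ∈ S, lone q (ψ q) := by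
  obtain ⟨C, hC, hY⟩ := YS_le
  refine ⟨2 * C / γ' + 16, by positivity, ?_⟩
  filter_upwards [wt_local γ γ' hγ' h2 h1, eventually_params γ γ' hγ' h2 h1] with X hX hpar
  obtain ⟨hX2, hXγ, hzzX, hfl, hlz, hsq, hz2, hl1⟩ := hpar
  intro z hz hzX N1 N2 h12 S ψ κ hS hS2 hκ hper hκψ
  have hmain := hX z hzX N1 N2 h12 S ψ κ hS hS2 hκ hper hκψ
  set z' := ⌊X ^ γ'⌋₊
  have hzz' : z ≤ z' := le_floor (hzX.trans hzzX)
  have hYS := hY z z' (X ^ γ) S κ hz hzz' hsq hS hS2 hκ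
  have hYS0 := YS_nonneg z z' (X ^ γ) S κ
  have hlen : (0 : ℝ) ≤ (N2 : ℝ) - N1 := by rw [sub_nonneg]; exact_mod_cast h12
  have hp0 : 0 ≤ ∏ q ∈ S, (lone q (ψ q) / q) := prod_nonneg fun q _ => div_nonneg (lone_nonneg _ _) (Nat.cast_nonneg _)
  have hav : ‖∏ q ∈ S, avg q (ψ q)‖ ≤ ∏ q ∈ S, (lone q (ψ q) / q) := by
    rw [norm_prod]
    exact Finset.prod_le_prod (fun _ _ => norm_nonneg _) fun q _ => norm_avg_le q _
  have hYS' : YS z z' (X ^ γ) S κ ≤ 2 * C / γ' * (1 / log X) := by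
    refine hYS.trans ?_
    have : 0 < γ' / 2 * log X := by positivity
    calc C / log z' ≤ C / (γ' / 2 * log X) := by gcongr
      _ = _ := by field_simp
  have h48 : ((N2 : ℝ) - N1) / log X ^ 48 ≤ ((N2 : ℝ) - N1) / log X := by
    apply div_le_div_of_nonneg_left hlen (by linarith); exact le_self_pow₀ hl1 (by norm_num)
  have hm : ‖((N2 : ℂ) - N1) * (YS z z' (X ^ γ) S κ : ℂ) * ∏ q ∈ S, avg q (ψ q)‖ ≤
      2 * C / γ' * (((N2 : ℝ) - N1) / log X) * ∏ q ∈ S, (lone q (ψ q) / q) := by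
    rw [norm_mul, norm_mul, norm_real, norm_of_nonneg hYS0]
    have : ‖(N2 : ℂ) - N1‖ = (N2 : ℝ) - N1 := by
      rw [show (N2 : ℂ) - N1 = (((N2 : ℝ) - N1 : ℝ) : ℂ) by push_cast; rfl, norm_real,
        norm_of_nonneg hlen]
    rw [this]
    calc _ ≤ ((N2 : ℝ) - N1) * (2 * C / γ' * (1 / log X)) * ∏ q ∈ S, (lone q (ψ q) / q) := by gcongr
      _ = _ := by ring
  have htri := norm_sub_norm_le (∑ n ∈ Ioc N1 N2, (wS z z' (X ^ γ) S n : ℂ) * ∏ q ∈ S, ψ q n)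
    (((N2 : ℂ) - N1) * (YS z z' (X ^ γ) S κ : ℂ) * ∏ q ∈ S, avg q (ψ q))
  have h5 : ((N2 : ℝ) - N1) / log X ^ 48 * ∏ q ∈ S, (lone q (ψ q) / q) ≤
      ((N2 : ℝ) - N1) / log X * ∏ q ∈ S, (lone q (ψ q) / q) := by gcongr
  linarith

lemma wt_sum_le (γ γ' : ℝ) (hγ' : 0 < γ') (h2 : 2 * γ' ≤ γ) (h1 : γ ≤ 1) : ∃ C > 0, ∀ᶠ X : ℝ in atTop, ∀ z : ℕ,
    2 ≤ z → (z : ℝ) ≤ zz X → ∀ N1 N2 : ℕ, N1 ≤ N2 →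
    ∑ n ∈ Ioc N1 N2, wt z ⌊X ^ γ'⌋₊ (X ^ γ) n ≤ C * (((N2 : ℝ) - N1) / log X) + 16 * X ^ (5 * γ) := by
  obtain ⟨C, hC, h⟩ := wS_upper γ γ' hγ' h2 h1
  refine ⟨C, hC, ?_⟩
  filter_upwards [h] with X hX
  intro z hz hzX N1 N2 h12
  have := hX z hz hzX N1 N2 h12 ∅ (fun _ _ => 0) 0 (by simp) (by simp) (by simp) (by simp) (by simp)
  simp only [prod_empty, mul_one] at this
  refine le_trans ?_ this
  refine le_trans (le_of_eq ?_) (re_le_norm _)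
  rw [re_sum]
  refine sum_congr rfl fun n _ => ?_
  rw [ofReal_re, wt_eq_wS _ _ _ ∅ (by simp)]

lemma lone_modEq (q b : ℕ) (hq : 0 < q) : lone q (fun n => if n % q = b % q then (1 : ℂ) else 0) = 1 := by
  unfold lone
  rw [sum_eq_single (b % q)]
  · simp
  · intro c hc hcb
    have : ¬ c % q = b % q := by rwa [mod_eq_of_lt (mem_range.1 hc)]
    simp only [if_neg this, norm_zero]
  · intro h; exact absurd (mem_range.2 (Nat.mod_lt _ hq)) h

lemma wt_residue (γ γ' : ℝ) (hγ' : 0 < γ') (h2 : 2 * γ' ≤ γ) (h1 : γ ≤ 1) : ∃ C > 0, ∀ᶠ X : ℝ in atTop, ∀ z : ℕ,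
    2 ≤ z → (z : ℝ) ≤ zz X → ∀ N1 N2 : ℕ, N1 ≤ N2 → ∀ q b : ℕ, q.Prime →
    ∑ n ∈ Ioc N1 N2 with n % q = b % q, wt z ⌊X ^ γ'⌋₊ (X ^ γ) n
      ≤ C * (((N2 : ℝ) - N1) / (q * log X)) + 16 * X ^ (5 * γ) := by
  obtain ⟨C, hC, h⟩ := wS_upper γ γ' hγ' h2 h1
  refine ⟨C, hC, ?_⟩
  filter_upwards [h] with X hX
  intro z hz hzX N1 N2 h12 q b hq
  have hq1 : (1 : ℝ) < q := by exact_mod_cast hq.one_lt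
  have hq2 : (2 : ℝ) ≤ q := by exact_mod_cast hq.two_le
  have := hX z hz hzX N1 N2 h12 {q} (fun p n => if n % p = b % p then (1 : ℂ) else 0)
    (fun p => if p ∣ b then -1 else 1 / ((p : ℝ) - 1)) (by simpa using hq) (by simp) (by
      intro p hp
      rw [mem_singleton] at hp; subst hp
      split_ifs
      · simp
      · rw [abs_of_nonneg (by apply one_div_nonneg.2; linarith), div_le_one (by linarith)]; linarith)
    (by intro p _ n; simp) (by
      intro n p hp _
      split_ifs with h1 h2 h2
      · unfold rr
        rw [if_pos ((ModEq.dvd_iff h1 dvd_rfl).2 h2)]; simp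
      · unfold rr
        rw [if_neg fun h3 => h2 ((ModEq.dvd_iff h1 dvd_rfl).1 h3)]; simp
      · simp
      · simp)
  simp only [prod_singleton] at this
  rw [lone_modEq q b hq.pos] at this
  calc _ ≤ ∑ n ∈ Ioc N1 N2, (if n % q = b % q then wS z ⌊X ^ γ'⌋₊ (X ^ γ) {q} n else 0) := by
        rw [sum_filter]; apply sum_le_sum; intro n _
        split_ifs
        · exact wt_le_wS _ _ _ _ _
        · exact le_rfl
    _ = (∑ n ∈ Ioc N1 N2, (wS z ⌊X ^ γ'⌋₊ (X ^ γ) {q} n : ℂ) * (if n % q = b % q then (1 : ℂ) else 0)).re := by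
        rw [re_sum]; refine sum_congr rfl fun n _ => ?_
        split_ifs <;> simp
    _ ≤ _ := (re_le_norm _).trans this
    _ = _ := by field_simp

lemma YS_dvd_le : ∃ C > 0, ∀ (z z' : ℕ) (D : ℝ) (p : ℕ), 2 ≤ z → z ≤ z' → (z' : ℝ) ^ 2 ≤ D → p ∈ PZ z z' →
    YS z z' D {p} (fun _ => -1) ≤ C * (log p / log D) ^ 2 / log z' := by
  obtain ⟨c, hc, hG⟩ := GS_lower
  obtain ⟨C, hC, hP⟩ := prod_primes_le
  refine ⟨C / c ^ 2, by positivity, ?_⟩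
  intro z z' D p hz hzz hD hp
  have hz1 : (1 : ℝ) < z := by exact_mod_cast hz
  have hz1' : (2 : ℝ) ≤ z' := by exact_mod_cast hz.trans hzz
  have hlz : 0 < log z := log_pos hz1
  have hlz' : 0 < log z' := log_pos (by linarith)
  have hD1 : 1 < D := by nlinarith
  have hlD : 0 < log D := log_pos hD1
  have hpp := (mem_PZ.1 hp).2.2
  have hlp : 0 < log p := log_pos (by exact_mod_cast hpp.one_lt)
  have hg : ∀ e ⊆ PZ z z' \ {p}, |gT D (PZ z z') {p} (fun _ => -1) e| ≤ log p / log D := by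
    intro e he
    have hpe : p ∉ e := fun h => by simpa using he h
    have hint : PZ z z' ∩ {p} = {p} := inter_singleton_of_mem hp
    have h1 : gT D (PZ z z') {p} (fun _ => -1) e = gS D e - gS D (insert p e) := by
      unfold gT
      rw [hint, show ({p} : Finset ℕ).powerset = {∅, {p}} from rfl, sum_pair (by simp)]
      simp only [prod_empty, prod_singleton, union_empty, one_mul]
      rw [union_comm, ← insert_eq]; ring
    have h2 : log ((∏ q ∈ insert p e, q : ℕ) : ℝ) = log p + log ((∏ q ∈ e, q : ℕ) : ℝ) := by
      rw [prod_insert hpe]; push_cast; rw [log_mul]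
      · exact_mod_cast hpp.ne_zero
      · rw [← Nat.cast_prod]
        exact_mod_cast (prod_pos fun q hq => (PZ_prime (Finset.mem_sdiff.1 (he hq)).1).pos).ne'
    rw [h1]; unfold gS; refine (abs_max_sub_max_le_max _ _ _ _).trans ?_; rw [h2, sub_self, abs_zero]
    apply max_le (by positivity)
    rw [show 1 - log ((∏ q ∈ e, q : ℕ) : ℝ) / log D - (1 - (log p + log ((∏ q ∈ e, q : ℕ) : ℝ)) / log D)
      = log p / log D by ring, abs_of_nonneg (by positivity)]
  have h1 := HH_le (PZ z z' \ {p}) (fun q hq => PZ_prime (Finset.mem_sdiff.1 hq).1) _ _ hg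
  have h2 : ∏ q ∈ PZ z z' \ {p}, (1 + 1 / ((q : ℝ) - 1)) ≤ C * log z' / log z := by
    have ha := prod_le_prod_primesLE (PZ z z' \ {p} ∪ primesLE z) z' (by
      intro q hq
      rcases mem_union.1 hq with h | h
      · have := mem_PZ.1 (Finset.mem_sdiff.1 h).1; exact mem_primesLE.2 ⟨this.2.1, this.2.2⟩
      · have := mem_primesLE.1 h; exact mem_primesLE.2 ⟨this.1.trans hzz, this.2⟩)
    rw [prod_union] at ha
    · have hb := log_le_prod_primes z
      have hb' : log z ≤ log (z + 1) := log_le_log (by linarith) (by linarith)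
      have hd := hP z' (hz.trans hzz); rw [le_div_iff₀ hlz]; refine le_trans ?_ (ha.trans hd)
      apply mul_le_mul_of_nonneg_left (hb'.trans hb); apply prod_nonneg; intro q hq
      have : (1 : ℝ) < q := by exact_mod_cast (PZ_prime (Finset.mem_sdiff.1 hq).1).one_lt
      have : 0 ≤ 1 / ((q : ℝ) - 1) := one_div_nonneg.2 (by linarith); linarith
    · rw [Finset.disjoint_left]; intro q hq hq'
      have := (mem_PZ.1 (Finset.mem_sdiff.1 hq).1).1
      have := (mem_primesLE.1 hq').1; omega
  have h3 := hG z z' D hz hzz hD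
  have h4 : ∏ q ∈ primesLE z \ {p}, (1 - 1 / (q : ℝ)) ≤ 1 / log z := by
    rw [Finset.sdiff_singleton_eq_erase, Finset.erase_eq_of_notMem]
    · exact prod_one_sub_inv_le z hz
    · intro h
      have := (mem_PZ.1 hp).1
      have := (mem_primesLE.1 h).1; omega
  have h5 := prod_one_sub_nonneg (primesLE z \ {p}) fun q hq => (mem_primesLE.1 (Finset.mem_sdiff.1 hq).1).2
  have h7 : HH (PZ z z' \ {p}) (gT D (PZ z z') {p} (fun _ => -1)) ≤
      (log p / log D) ^ 2 * (C * log z' / log z) := h1.trans (by gcongr)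
  unfold YS
  calc _ ≤ ((log p / log D) ^ 2 * (C * log z' / log z)) /
        (c * log z' / log z) ^ 2 * (1 / log z) := by gcongr
    _ = _ := by field_simp

lemma lone_dvd (q : ℕ) (hq : q.Prime) : lone q (fun n => if q ∣ n then (1 : ℂ) else 0) = 1 := by
  rw [← lone_modEq q 0 hq.pos]
  unfold lone
  refine sum_congr rfl fun n _ => ?_
  have h0 : n % q = 0 % q ↔ q ∣ n := by rw [Nat.zero_mod, Nat.dvd_iff_mod_eq_zero]
  by_cases h : q ∣ n
  · simp only [if_pos h, if_pos (h0.2 h)]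
  · simp only [if_neg h, if_neg fun h' => h (h0.1 h')]

lemma wt_nonrough : ∃ C > 0, ∀ (γ γ' : ℝ), 0 < γ' → 2 * γ' ≤ γ → γ ≤ 1 → ∀ᶠ X : ℝ in atTop, ∀ z : ℕ,
    2 ≤ z → (z : ℝ) ≤ zz X → ∀ N1 N2 : ℕ, N1 ≤ N2 →
    ∑ n ∈ Ioc N1 N2 with ∃ p ∈ primesLE ⌊X ^ γ'⌋₊, p ∣ n, wt z ⌊X ^ γ'⌋₊ (X ^ γ) n
      ≤ C * (γ' / γ ^ 2) * (((N2 : ℝ) - N1) / log X) + 16 * X ^ (5 * γ + γ') := by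
  obtain ⟨C, hC, hY⟩ := YS_dvd_le
  refine ⟨4 * C + 64, by positivity, ?_⟩
  intro γ γ' hγ' h2 h1
  have hγ : 0 < γ := by linarith
  filter_upwards [wt_local γ γ' hγ' h2 h1, eventually_params γ γ' hγ' h2 h1,
    tendsto_log_atTop.eventually_ge_atTop (6 / γ')] with X hX hpar hlX6
  obtain ⟨hX2, hXγ, hzzX, hfl, hlz, hsq, hz2, hl1⟩ := hpar
  intro z hz hzX N1 N2 h12
  set z' := ⌊X ^ γ'⌋₊
  set D := X ^ γ with hD
  have hzz' : z ≤ z' := le_floor (hzX.trans hzzX)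
  have hlen : (0 : ℝ) ≤ (N2 : ℝ) - N1 := by rw [sub_nonneg]; exact_mod_cast h12
  have hlD : log D = γ * log X := by rw [hD, log_rpow (by linarith)]
  have hz'le : (z' : ℝ) ≤ X ^ γ' := floor_le (by positivity)
  have hztwo : (2 : ℝ) ≤ z' := by exact_mod_cast hz2
  have hlz'0 : 0 < log z' := log_pos (by linarith)
  have hlz'le : log z' ≤ γ' * log X := by
    rw [← log_rpow (by linarith)]; exact log_le_log (by linarith) hz'le
  have h6 : 6 ≤ γ' * log X := by rw [div_le_iff₀ hγ'] at hlX6; linarith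
  have key : ∀ p ∈ PZ z z', ∑ n ∈ Ioc N1 N2 with p ∣ n, wt z z' D n ≤
      ((N2 : ℝ) - N1) * (C * (log p / log D) ^ 2 / log z') * (1 / p) +
        16 * (((N2 : ℝ) - N1) / log X ^ 48 * (1 / p) + X ^ (5 * γ)) := by
    intro p hp
    have hpp := PZ_prime hp
    have hdis : Disjoint (primesLE z) {p} := by
      rw [disjoint_singleton_right]; intro h
      have := (mem_PZ.1 hp).1
      have := (mem_primesLE.1 h).1; omega
    have hmain := hX z hzX N1 N2 h12 {p} (fun q n => if q ∣ n then (1 : ℂ) else 0) (fun _ => -1)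
      (by simpa using hpp) (by simp) (by simp) (by intro q _ n; simp only [dvd_mod_iff_dvd]) (by
        intro n q _ _; unfold rr
        split_ifs <;> simp)
    simp only [prod_singleton] at hmain; rw [lone_dvd p hpp] at hmain
    have hav : avg p (fun n => if p ∣ n then (1 : ℂ) else 0) = ((1 / p : ℝ) : ℂ) := by
      unfold avg
      rw [sum_range_dvd p hpp]; push_cast; simp
    rw [hav] at hmain
    have hre := (re_le_norm _).trans hmain
    have heq : ∑ n ∈ Ioc N1 N2, (wS z z' D {p} n : ℂ) * (if p ∣ n then (1 : ℂ) else 0) -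
        ((N2 : ℂ) - N1) * (YS z z' D {p} (fun _ => -1) : ℂ) * ((1 / p : ℝ) : ℂ)
        = ((∑ n ∈ Ioc N1 N2 with p ∣ n, wt z z' D n -
          ((N2 : ℝ) - N1) * YS z z' D {p} (fun _ => -1) * (1 / p) : ℝ) : ℂ) := by
      push_cast
      congr 1; rw [sum_filter]; refine sum_congr rfl fun n _ => ?_; rw [wt_eq_wS _ _ _ {p} hdis]
      split_ifs <;> simp
    rw [heq, ofReal_re] at hre
    have hYp := hY z z' D p hz hzz' hsq hp
    have : ((N2 : ℝ) - N1) * YS z z' D {p} (fun _ => -1) * (1 / p) ≤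
      ((N2 : ℝ) - N1) * (C * (log p / log D) ^ 2 / log z') * (1 / p) := by gcongr
    linarith
  have hsub : PZ z z' ⊆ primesLE z' := sdiff_subset
  have hS1 : ∑ p ∈ PZ z z', log p / (p : ℝ) ≤ 2 * (γ' * log X) := by
    refine (sum_le_sum_of_subset_of_nonneg hsub ?_).trans ((sum_log_div_prime_le z' (by omega)).trans (by linarith))
    intro p _ _; exact div_nonneg (log_natCast_nonneg p) (Nat.cast_nonneg p)
  have hpos : ∀ p ∈ PZ z z', 1 < (p : ℝ) := fun p hp => by exact_mod_cast (PZ_prime hp).one_lt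
  have hS2 : ∑ p ∈ PZ z z', (log p / log D) ^ 2 * (1 / p) ≤
      log z' * (2 * (γ' * log X)) / log D ^ 2 := by
    calc _ ≤ ∑ p ∈ PZ z z', log z' / log D ^ 2 * (log p / (p : ℝ)) := by
          apply sum_le_sum; intro p hp
          have h1 := hpos p hp
          have h2 : log p ≤ log z' := log_le_log (by linarith) (by exact_mod_cast (mem_PZ.1 hp).2.1)
          have h3 : 0 < log p := log_pos h1
          calc _ = log p / log D ^ 2 * (log p / p) := by ring
            _ ≤ _ := by gcongr
      _ = log z' / log D ^ 2 * ∑ p ∈ PZ z z', (log p / (p : ℝ)) := by rw [mul_sum]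
      _ ≤ log z' / log D ^ 2 * (2 * (γ' * log X)) := by gcongr
      _ = _ := by ring
  have hS3 : ∑ p ∈ PZ z z', 1 / (p : ℝ) ≤ 4 * (γ' * log X) := by
    calc _ ≤ ∑ p ∈ PZ z z', 2 * (log p / (p : ℝ)) := by
          apply sum_le_sum; intro p hp
          have h1 := hpos p hp
          have h2 : (2 : ℝ) ≤ p := by exact_mod_cast (PZ_prime hp).two_le
          have h3 : 0.69 < log p := lt_of_lt_of_le (by linarith [log_two_gt_d9]) (log_le_log (by norm_num) h2)
          rw [← mul_div_assoc]; gcongr; linarith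
      _ = 2 * ∑ p ∈ PZ z z', (log p / (p : ℝ)) := by rw [mul_sum]
      _ ≤ _ := by linarith
  have hcard : ((PZ z z').card : ℝ) ≤ X ^ γ' := le_trans (by exact_mod_cast card_primesLE_le z' _ hsub) hz'le
  calc _ ≤ ∑ p ∈ PZ z z', ∑ n ∈ Ioc N1 N2 with p ∣ n, wt z z' D n := by
        simp only [sum_filter]; rw [sum_comm]; apply sum_le_sum; intro n _
        split_ifs with h
        · obtain ⟨p, hp', hpn⟩ := h
          obtain ⟨hpz, hp⟩ := mem_primesLE.1 hp'
          by_cases hpz1 : p ≤ z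
          · have : wt z z' D n = 0 := by
              unfold wt; rw [if_neg]
              intro h; exact h p (mem_primesLE.2 ⟨hpz1, hp⟩) hpn
            rw [this]; simp
          · have := single_le_sum (f := fun p => if p ∣ n then wt z z' D n else 0) (s := PZ z z')
              (fun q _ => by split_ifs; exacts [wt_nonneg _ _ _ _, le_rfl])
              (mem_PZ.2 ⟨by omega, hpz, hp⟩)
            simpa [hpn] using this
        · exact sum_nonneg fun q _ => by split_ifs; exacts [wt_nonneg _ _ _ _, le_rfl]
    _ ≤ ∑ p ∈ PZ z z', (((N2 : ℝ) - N1) * (C * (log p / log D) ^ 2 / log z') * (1 / p) +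
        16 * (((N2 : ℝ) - N1) / log X ^ 48 * (1 / p) + X ^ (5 * γ))) := sum_le_sum key
    _ = ((N2 : ℝ) - N1) * C / log z' * (∑ p ∈ PZ z z', (log p / log D) ^ 2 * (1 / p)) +
        16 * (((N2 : ℝ) - N1) / log X ^ 48) * (∑ p ∈ PZ z z', 1 / (p : ℝ)) + 16 * ((PZ z z').card * X ^ (5 * γ)) := by
        rw [mul_sum, mul_sum, ← nsmul_eq_mul (PZ z z').card, ← sum_const, mul_sum, ← sum_add_distrib, ← sum_add_distrib]
        refine sum_congr rfl fun p _ => ?_; ring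
    _ ≤ ((N2 : ℝ) - N1) * C / log z' * (log z' * (2 * (γ' * log X)) / log D ^ 2) +
        16 * (((N2 : ℝ) - N1) / log X ^ 48) * (4 * (γ' * log X)) + 16 * (X ^ γ' * X ^ (5 * γ)) := by
        gcongr
    _ ≤ 2 * C * (γ' / γ ^ 2) * (((N2 : ℝ) - N1) / log X) +
        64 * (γ' / γ ^ 2) * (((N2 : ℝ) - N1) / log X) + 16 * X ^ (5 * γ + γ') := by
        apply add_le_add (add_le_add _ _) _
        · apply le_of_eq; rw [hlD]
          have : log X ≠ 0 := by linarith
          field_simp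
        · have e1 : γ' ≤ γ' / γ ^ 2 := by
            rw [le_div_iff₀ (by positivity)]
            have : γ ^ 2 ≤ 1 := by nlinarith
            nlinarith
          have e2 : 1 / log X ^ 47 ≤ 1 / log X := by
            apply one_div_le_one_div_of_le (by linarith); exact le_self_pow₀ hl1 (by norm_num)
          calc _ = 64 * γ' * (((N2 : ℝ) - N1) * (1 / log X ^ 47)) := by
                have : log X ≠ 0 := by linarith
                field_simp; ring
            _ ≤ 64 * (γ' / γ ^ 2) * (((N2 : ℝ) - N1) * (1 / log X)) := by gcongr
            _ = _ := by ring
        · rw [← rpow_add (by linarith), add_comm γ']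
    _ ≤ _ := by
        have : 0 ≤ C * (γ' / γ ^ 2) * (((N2 : ℝ) - N1) / log X) := by positivity
        linarith

/-- The centred indicator of `q ∣ b n + 1`, supported on `q ∤ n`. -/
noncomputable def xi (q b n : ℕ) : ℝ :=
  (if q ∣ b * n + 1 then 1 else 0) - (if q ∣ n then 0 else 1 / ((q : ℝ) - 1))

lemma dvd_mul_mod_add_one (q b n : ℕ) : q ∣ b * (n % q) + 1 ↔ q ∣ b * n + 1 := by
  apply ModEq.dvd_iff _ dvd_rfl
  exact ModEq.add_right 1 (ModEq.mul_left b (Nat.mod_modEq n q))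

lemma xi_mod (q b n : ℕ) : xi q b (n % q) = xi q b n := by
  unfold xi
  simp only [dvd_mul_mod_add_one, dvd_mod_iff_dvd]

lemma xi_eq_zero (q b n : ℕ) (hq : q.Prime) (h : q ∣ n) : xi q b n = 0 := by
  unfold xi
  rw [if_pos h, if_neg, sub_zero]
  intro h1
  have := (Nat.dvd_add_right (h.mul_left b)).1 h1
  exact hq.one_lt.ne' (dvd_one.1 this)

lemma sum_range_dvd_mul_add_one {M : Type*} [AddCommMonoid M] (q b : ℕ) (hq : q.Prime) (hb : ¬ q ∣ b) (v : M) :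
    ∑ n ∈ range q, (if q ∣ b * n + 1 then v else 0) = v := by
  have hcop : Nat.Coprime b q := ((Nat.Prime.coprime_iff_not_dvd hq).2 hb).symm
  obtain ⟨c, -, hc⟩ := Nat.exists_mul_mod_eq_one_of_coprime hcop hq.one_lt
  have hc1 : b * c ≡ 1 [MOD q] := by unfold ModEq; rw [hc, mod_eq_of_lt hq.one_lt]
  have hmem : ((q - 1) * c) % q ∈ range q := mem_range.2 (Nat.mod_lt _ hq.pos)
  have hroot : q ∣ b * ((q - 1) * c) + 1 := by
    have h1 : b * ((q - 1) * c) + 1 ≡ (q - 1) * 1 + 1 [MOD q] := by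
      rw [show b * ((q - 1) * c) = (q - 1) * (b * c) by ring]; exact ModEq.add_right 1 (ModEq.mul_left _ hc1)
    rw [h1.dvd_iff dvd_rfl, mul_one, Nat.sub_add_cancel hq.one_le]
  rw [sum_eq_single (((q - 1) * c) % q)]
  · rw [if_pos ((dvd_mul_mod_add_one _ _ _).2 hroot)]
  · intro n hn hne; rw [if_neg]; intro h; apply hne
    have h2 : b * n + 1 ≡ b * ((q - 1) * c) + 1 [MOD q] :=
      ((Nat.modEq_zero_iff_dvd.2 h).trans (Nat.modEq_zero_iff_dvd.2 hroot).symm)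
    have h3 := ModEq.add_right_cancel' 1 h2
    have h4 := ModEq.cancel_left_of_coprime hcop.symm h3; rw [← mod_eq_of_lt (mem_range.1 hn)]; exact h4
  · intro h; exact absurd hmem h

lemma avg_xi (q b : ℕ) (hq : q.Prime) (hb : ¬ q ∣ b) : avg q (fun n => (xi q b n : ℂ)) = 0 := by
  have h1 : (q : ℂ) - 1 ≠ 0 := by rw [sub_ne_zero]; exact_mod_cast hq.one_lt.ne'
  unfold avg xi
  push_cast
  rw [sum_sub_distrib]
  have e1 : ∑ n ∈ range q, (((if q ∣ b * n + 1 then (1 : ℝ) else 0 : ℝ)) : ℂ) = 1 := by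
    rw [← sum_range_dvd_mul_add_one q b hq hb (1 : ℂ)]
    exact sum_congr rfl fun n _ => by split_ifs <;> simp
  have e2 : ∑ n ∈ range q, (((if q ∣ n then (0 : ℝ) else 1 / ((q : ℝ) - 1) : ℝ)) : ℂ) = 1 := by
    rw [show (1 : ℂ) = 0 + (q - 1) * (1 / ((q : ℂ) - 1)) by field_simp; ring, ← sum_range_dvd q hq]
    exact sum_congr rfl fun n _ => by split_ifs <;> simp
  rw [e1, e2]; simp

lemma abs_xi_le (q b n : ℕ) (hq : q.Prime) :
    |xi q b n| ≤ (if q ∣ b * n + 1 then 1 else 0) + (if q ∣ n then 0 else 1 / ((q : ℝ) - 1)) := by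
  have hq1 : (1 : ℝ) < q := by exact_mod_cast hq.one_lt
  have h1 : 0 ≤ 1 / ((q : ℝ) - 1) := one_div_nonneg.2 (by linarith)
  unfold xi
  refine (abs_sub _ _).trans (le_of_eq ?_)
  congr 1
  · split_ifs <;> simp
  · split_ifs
    · simp
    · exact abs_of_nonneg h1

lemma lone_xi_le (q b : ℕ) (hq : q.Prime) (hb : ¬ q ∣ b) : lone q (fun n => (xi q b n : ℂ)) ≤ 2 := by
  unfold lone
  simp only [norm_real, norm_eq_abs]
  refine (sum_le_sum fun n _ => abs_xi_le q b n hq).trans ?_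
  rw [sum_add_distrib, sum_range_dvd_mul_add_one q b hq hb]
  have e2 := sum_range_dvd q hq 0 (1 / ((q : ℂ) - 1))
  have e3 : ((∑ n ∈ range q, (if q ∣ n then (0 : ℝ) else 1 / ((q : ℝ) - 1)) : ℝ) : ℂ) = ((1 : ℝ) : ℂ) := by
    have h1 : (q : ℂ) - 1 ≠ 0 := by rw [sub_ne_zero]; exact_mod_cast hq.one_lt.ne'
    rw [show 0 + ((q : ℂ) - 1) * (1 / ((q : ℂ) - 1)) = 1 by field_simp; ring] at e2; push_cast; rw [← e2]
    exact sum_congr rfl fun n _ => by split_ifs <;> simp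
  rw [Complex.ofReal_inj.1 e3]; norm_num

lemma abs_xi_le_one (q b n : ℕ) (hq : q.Prime) : |xi q b n| ≤ 1 := by
  have hq1 : (2 : ℝ) ≤ q := by exact_mod_cast hq.two_le
  have h1 : 0 ≤ 1 / ((q : ℝ) - 1) := one_div_nonneg.2 (by linarith)
  have h2 : 1 / ((q : ℝ) - 1) ≤ 1 := by rw [div_le_one (by linarith)]; linarith
  unfold xi
  rw [abs_le]
  split_ifs <;> constructor <;> linarith

lemma lone_xi_sq_le (q b : ℕ) (hq : q.Prime) (hb : ¬ q ∣ b) :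
    lone q (fun n => (xi q b n : ℂ) * (xi q b n : ℂ)) ≤ 2 := by
  refine le_trans ?_ (lone_xi_le q b hq hb)
  unfold lone
  apply sum_le_sum
  intro n _
  rw [norm_mul, norm_real, norm_eq_abs]
  have := abs_xi_le_one q b n hq
  nlinarith [abs_nonneg (xi q b n)]

lemma xi_mul_rr (q b n : ℕ) (hq : q.Prime) : xi q b n * rr q n = 1 / ((q : ℝ) - 1) * xi q b n := by
  by_cases h : q ∣ n
  · rw [xi_eq_zero q b n hq h]; ring
  · unfold rr; rw [if_neg h]; ring

lemma wt_turan (γ γ' θ : ℝ) (hγ' : 0 < γ') (h2 : 2 * γ' ≤ γ) (h1 : γ ≤ 1) (hθ : 0 < θ) (hθ1 : θ ≤ 1) :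
    ∃ C > 0, ∀ᶠ X : ℝ in atTop, ∀ z : ℕ, 2 ≤ z → (z : ℝ) ≤ zz X → ∀ N1 N2 : ℕ, N1 ≤ N2 →
    ∀ (Q : Finset ℕ) (b : ℕ) (g : ℕ → ℝ), (∀ q ∈ Q, q.Prime ∧ z < q ∧ (q : ℝ) ≤ X ^ θ ∧ ¬ q ∣ b) →
    ∑ n ∈ Ioc N1 N2, wt z ⌊X ^ γ'⌋₊ (X ^ γ) n * (∑ q ∈ Q, g q * xi q b n) ^ 2
      ≤ C * (∑ q ∈ Q, g q ^ 2 / q) * (((N2 : ℝ) - N1) / log X + X ^ (5 * γ + 2 * θ)) := by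
  obtain ⟨C, hC, hup⟩ := wS_upper γ γ' hγ' h2 h1
  refine ⟨2 * C + 1000, by positivity, ?_⟩
  filter_upwards [wt_local γ γ' hγ' h2 h1, hup, eventually_params γ γ' hγ' h2 h1] with X hX hup hpar
  obtain ⟨hX2, hXγ, hzzX, hfl, hlz, hsq, hz2, hl1⟩ := hpar
  intro z hz hzX N1 N2 h12 Q b g hQ
  set z' := ⌊X ^ γ'⌋₊
  set D := X ^ γ
  have hlen : (0 : ℝ) ≤ (N2 : ℝ) - N1 := by rw [sub_nonneg]; exact_mod_cast h12
  set len := (N2 : ℝ) - N1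
  have hX5 : 0 < X ^ (5 * γ) := by positivity
  have hdisj : ∀ S ⊆ Q, Disjoint (primesLE z) S := by
    intro S hS; rw [Finset.disjoint_left]; intro q hq hqS
    have := (mem_primesLE.1 hq).1
    have := (hQ q (hS hqS)).2.1; omega
  have hκ : ∀ q ∈ Q, |1 / ((q : ℝ) - 1)| ≤ 1 := by
    intro q hq
    have hq2 : (2 : ℝ) ≤ q := by exact_mod_cast (hQ q hq).1.two_le
    rw [abs_of_nonneg (one_div_nonneg.2 (by linarith)), div_le_one (by linarith)]; linarith
  have hdiag : ∀ q ∈ Q, ∑ n ∈ Ioc N1 N2, wt z z' D n * (xi q b n * xi q b n) ≤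
      C * (len / log X) * (2 / q) + 32 * X ^ (5 * γ) := by
    intro q hq
    obtain ⟨hqp, hzq, hqθ, hqb⟩ := hQ q hq
    have hm := hup z hz hzX N1 N2 h12 {q} (fun p n => (xi p b n : ℂ) * (xi p b n : ℂ))
      (fun p => 1 / ((p : ℝ) - 1)) (by simpa using hqp) (by simp)
      (by intro p hp; rw [mem_singleton] at hp; subst hp; exact hκ p hq)
      (by intro p _ n; simp only [xi_mod]) (by
        intro n p hp _
        rw [mem_singleton] at hp; subst hp
        have := xi_mul_rr p b n hqp
        have h2 : (xi p b n : ℂ) * (rr p n : ℂ) = ((1 / ((p : ℝ) - 1) : ℝ) : ℂ) * xi p b n := by exact_mod_cast this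
        linear_combination (xi p b n : ℂ) * h2)
    simp only [prod_singleton] at hm
    have hl := lone_xi_sq_le q b hqp hqb
    have hl0 := lone_nonneg q (fun n => (xi q b n : ℂ) * (xi q b n : ℂ))
    have heq : (∑ n ∈ Ioc N1 N2, (wS z z' D {q} n : ℂ) * ((xi q b n : ℂ) * (xi q b n : ℂ)))
        = ((∑ n ∈ Ioc N1 N2, wt z z' D n * (xi q b n * xi q b n) : ℝ) : ℂ) := by
      push_cast; refine sum_congr rfl fun n _ => ?_; rw [wt_eq_wS _ _ _ {q} (hdisj _ (by simpa using hq))]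
    rw [heq, norm_real] at hm; refine (le_norm_self _).trans (hm.trans ?_)
    calc _ ≤ C * (len / log X) * (2 / q) + 16 * X ^ (5 * γ) * 2 := by gcongr
      _ = _ := by ring
  have hoff : ∀ q ∈ Q, ∀ q' ∈ Q, q ≠ q' → |∑ n ∈ Ioc N1 N2, wt z z' D n * (xi q b n * xi q' b n)| ≤
      64 * (len / log X ^ 48 * (1 / q * (1 / q')) + X ^ (5 * γ)) := by
    intro q hq q' hq' hne
    have hm := hX z hzX N1 N2 h12 {q, q'} (fun p n => (xi p b n : ℂ))
      (fun p => 1 / ((p : ℝ) - 1)) (by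
        intro p hp; rw [mem_insert, mem_singleton] at hp
        rcases hp with rfl | rfl
        exacts [(hQ _ hq).1, (hQ _ hq').1]) card_le_two
      (by intro p hp; rw [mem_insert, mem_singleton] at hp; rcases hp with rfl | rfl; exacts [hκ _ hq, hκ _ hq'])
      (by intro p _ n; simp only [xi_mod]) (by
        intro n p hp _
        have hpp : p.Prime := by
          rw [mem_insert, mem_singleton] at hp
          rcases hp with rfl | rfl
          exacts [(hQ _ hq).1, (hQ _ hq').1]
        exact_mod_cast xi_mul_rr p b n hpp)
    simp only [prod_pair hne] at hm; rw [avg_xi q b (hQ q hq).1 (hQ q hq).2.2.2, zero_mul, mul_zero, sub_zero] at hm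
    have heq : (∑ n ∈ Ioc N1 N2, (wS z z' D {q, q'} n : ℂ) * ((xi q b n : ℂ) * (xi q' b n : ℂ)))
        = ((∑ n ∈ Ioc N1 N2, wt z z' D n * (xi q b n * xi q' b n) : ℝ) : ℂ) := by
      push_cast; refine sum_congr rfl fun n _ => ?_
      rw [wt_eq_wS _ _ _ {q, q'} (hdisj _ (by intro p hp; rw [mem_insert, mem_singleton] at hp; rcases hp with rfl | rfl <;> assumption))]
    rw [heq, norm_real, norm_eq_abs] at hm; refine hm.trans ?_
    have hl := lone_xi_le q b (hQ q hq).1 (hQ q hq).2.2.2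
    have hl' := lone_xi_le q' b (hQ q' hq').1 (hQ q' hq').2.2.2
    have hl0 := lone_nonneg q (fun n => (xi q b n : ℂ))
    have hl0' := lone_nonneg q' (fun n => (xi q' b n : ℂ))
    calc _ ≤ 16 * (len / log X ^ 48 * (2 / q * (2 / q')) + X ^ (5 * γ) * (2 * 2)) := by gcongr
      _ = _ := by ring
  have hexp : ∑ n ∈ Ioc N1 N2, wt z z' D n * (∑ q ∈ Q, g q * xi q b n) ^ 2 =
      ∑ q ∈ Q, ∑ q' ∈ Q, g q * g q' * ∑ n ∈ Ioc N1 N2, wt z z' D n * (xi q b n * xi q' b n) := by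
    have : ∀ n, wt z z' D n * (∑ q ∈ Q, g q * xi q b n) ^ 2 =
        ∑ q ∈ Q, ∑ q' ∈ Q, g q * g q' * (wt z z' D n * (xi q b n * xi q' b n)) := by
      intro n; rw [sq, sum_mul_sum, mul_sum]; refine sum_congr rfl fun q _ => ?_; rw [mul_sum]
      refine sum_congr rfl fun q' _ => ?_; ring
    simp only [this]; rw [sum_comm]; refine sum_congr rfl fun q _ => ?_; rw [sum_comm]
    refine sum_congr rfl fun q' _ => ?_; rw [mul_sum]
  set V := ∑ q ∈ Q, g q ^ 2 / (q : ℝ) with hV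
  have hV0 : 0 ≤ V := sum_nonneg fun q _ => by positivity
  have hterm : ∀ q ∈ Q, ∀ q' ∈ Q, g q * g q' * ∑ n ∈ Ioc N1 N2, wt z z' D n * (xi q b n * xi q' b n) ≤
      (if q = q' then C * (len / log X) * 2 * (g q ^ 2 / q) else 0) +
        64 * (len / log X ^ 48) * ((|g q| / q) * (|g q'| / q')) + 64 * X ^ (5 * γ) * (|g q| * |g q'|) := by
    intro q hq q' hq'
    have hgg := mul_nonneg (abs_nonneg (g q)) (abs_nonneg (g q'))
    have h48 : 0 ≤ 64 * (len / log X ^ 48) * ((|g q| / q) * (|g q'| / q')) := by positivity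
    by_cases h : q = q'
    · subst h; rw [if_pos rfl]
      have h3 : |g q| * |g q| = g q * g q := abs_mul_abs_self _
      have := mul_le_mul_of_nonneg_left (hdiag q hq) (mul_self_nonneg (g q))
      have h5 : g q * g q * (C * (len / log X) * (2 / q) + 32 * X ^ (5 * γ))
        = C * (len / log X) * 2 * (g q ^ 2 / q) + 32 * X ^ (5 * γ) * (g q * g q) := by ring
      rw [h3]; nlinarith [mul_nonneg hX5.le (mul_self_nonneg (g q))]
    · rw [if_neg h, zero_add]; refine (le_abs_self _).trans ?_; rw [abs_mul, abs_mul]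
      calc _ ≤ |g q| * |g q'| * (64 * (len / log X ^ 48 * (1 / q * (1 / q')) + X ^ (5 * γ))) := by gcongr; exact hoff q hq q' hq' h
        _ = _ := by ring
  have hS1 : ∑ q ∈ Q, 1 / (q : ℝ) ≤ 14 * log X := by
    have hQs : Q ⊆ primesLE ⌊X⌋₊ := by
      intro q hq
      obtain ⟨hqp, -, hqθ, -⟩ := hQ q hq; refine mem_primesLE.2 ⟨le_floor (hqθ.trans ?_), hqp⟩
      calc X ^ θ ≤ X ^ (1 : ℝ) := rpow_le_rpow_of_exponent_le (by linarith) hθ1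
        _ = X := rpow_one X
    have hf1 : 1 ≤ ⌊X⌋₊ := le_floor (by push_cast; linarith)
    calc _ ≤ ∑ q ∈ Q, 2 * (log q / (q : ℝ)) := by
          apply sum_le_sum; intro q hq
          have h2 : (2 : ℝ) ≤ q := by exact_mod_cast (hQ q hq).1.two_le
          have h3 : 0.69 < log q := lt_of_lt_of_le (by linarith [log_two_gt_d9]) (log_le_log (by norm_num) h2)
          rw [← mul_div_assoc]; gcongr; linarith
      _ = 2 * ∑ q ∈ Q, log q / (q : ℝ) := by rw [mul_sum]
      _ ≤ 2 * ∑ q ∈ primesLE ⌊X⌋₊, log q / (q : ℝ) := by gcongr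
      _ ≤ 2 * (log ⌊X⌋₊ + 6) := by gcongr; exact sum_log_div_prime_le _ hf1
      _ ≤ 2 * (log X + 6) := by
          gcongr; exact floor_le (by linarith)
      _ ≤ _ := by linarith
  have hS2 : ∑ q ∈ Q, (q : ℝ) ≤ X ^ (2 * θ) := by
    have hQs : Q ⊆ primesLE ⌊X ^ θ⌋₊ := fun q hq =>
      mem_primesLE.2 ⟨le_floor (hQ q hq).2.2.1, (hQ q hq).1⟩
    calc _ ≤ ∑ q ∈ Q, X ^ θ := sum_le_sum fun q hq => (hQ q hq).2.2.1
      _ = Q.card * X ^ θ := by rw [sum_const, nsmul_eq_mul]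
      _ ≤ X ^ θ * X ^ θ := by
          gcongr
          exact le_trans (by exact_mod_cast card_primesLE_le _ Q hQs) (floor_le (by positivity))
      _ = _ := by rw [← rpow_add (by linarith)]; ring_nf
  have hqpos : ∀ q ∈ Q, (0 : ℝ) < q := fun q hq => by exact_mod_cast (hQ q hq).1.pos
  have hCS1 : (∑ q ∈ Q, |g q| / (q : ℝ)) ^ 2 ≤ V * (14 * log X) := by
    refine le_trans ?_ (mul_le_mul_of_nonneg_left hS1 hV0); apply sum_sq_le_sum_mul_sum_of_sq_le_mul
    · intro q _; positivity
    · intro q _; positivity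
    · intro q hq
      have := hqpos q hq; apply le_of_eq; rw [div_pow, sq_abs]; field_simp
  have hCS2 : (∑ q ∈ Q, |g q|) ^ 2 ≤ V * X ^ (2 * θ) := by
    refine le_trans ?_ (mul_le_mul_of_nonneg_left hS2 hV0); apply sum_sq_le_sum_mul_sum_of_sq_le_mul
    · intro q _; positivity
    · intro q _; positivity
    · intro q hq
      have := hqpos q hq; apply le_of_eq; rw [sq_abs]; field_simp
  have h47 : len / log X ^ 48 * (14 * log X) ≤ 14 * (len / log X) := by
    have e2 : 1 / log X ^ 47 ≤ 1 / log X := by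
      apply one_div_le_one_div_of_le (by linarith); exact le_self_pow₀ hl1 (by norm_num)
    calc _ = 14 * (len * (1 / log X ^ 47)) := by
          have : log X ≠ 0 := by linarith
          field_simp
      _ ≤ 14 * (len * (1 / log X)) := by gcongr
      _ = _ := by ring
  rw [hexp]
  calc _ ≤ ∑ q ∈ Q, ∑ q' ∈ Q, ((if q = q' then C * (len / log X) * 2 * (g q ^ 2 / q) else 0) +
        64 * (len / log X ^ 48) * ((|g q| / q) * (|g q'| / q')) + 64 * X ^ (5 * γ) * (|g q| * |g q'|)) :=
        sum_le_sum fun q hq => sum_le_sum fun q' hq' => hterm q hq q' hq'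
    _ = C * (len / log X) * 2 * V + 64 * (len / log X ^ 48) * (∑ q ∈ Q, |g q| / (q : ℝ)) ^ 2 +
        64 * X ^ (5 * γ) * (∑ q ∈ Q, |g q|) ^ 2 := by
        simp only [sum_add_distrib]
        congr 1
        · congr 1
          · rw [hV, mul_sum]; refine sum_congr rfl fun q hq => ?_; rw [sum_ite_eq, if_pos hq]
          · rw [sq, sum_mul_sum, mul_sum]; exact sum_congr rfl fun q _ => by rw [mul_sum]
        · rw [sq, sum_mul_sum, mul_sum]; exact sum_congr rfl fun q _ => by rw [mul_sum]
    _ ≤ C * (len / log X) * 2 * V + 64 * (len / log X ^ 48) * (V * (14 * log X)) +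
        64 * X ^ (5 * γ) * (V * X ^ (2 * θ)) := by gcongr
    _ = C * (len / log X) * 2 * V + 64 * V * (len / log X ^ 48 * (14 * log X)) +
        64 * V * X ^ (5 * γ + 2 * θ) := by rw [rpow_add (by linarith)]; ring
    _ ≤ C * (len / log X) * 2 * V + 64 * V * (14 * (len / log X)) +
        64 * V * X ^ (5 * γ + 2 * θ) := by gcongr
    _ ≤ _ := by
        have a1 : 0 ≤ V * (len / log X) := by positivity
        have a2 : 0 ≤ V * X ^ (5 * γ + 2 * θ) := by positivity
        have a3 : 0 ≤ C * (V * X ^ (5 * γ + 2 * θ)) := by positivity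
        nlinarith

lemma norm_prod_sub_prod_le_sum {ι : Type*} (T : Finset ι) (a b : ι → ℂ) (ha : ∀ i ∈ T, ‖a i‖ ≤ 1) (hb : ∀ i ∈ T, ‖b i‖ ≤ 1) :
    ‖∏ i ∈ T, a i - ∏ i ∈ T, b i‖ ≤ ∑ i ∈ T, ‖a i - b i‖ := by
  classical
  induction T using Finset.induction_on with
  | empty => simp
  | insert i T hi ih =>
    rw [prod_insert hi, prod_insert hi, sum_insert hi]
    have h1 := ih (fun j hj => ha j (mem_insert_of_mem hj)) (fun j hj => hb j (mem_insert_of_mem hj))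
    have h2 : ‖∏ j ∈ T, a j‖ ≤ 1 := by rw [norm_prod]; exact prod_le_one (fun _ _ => norm_nonneg _) fun j hj => ha j (mem_insert_of_mem hj)
    have h3 : a i * ∏ j ∈ T, a j - b i * ∏ j ∈ T, b j = (a i - b i) * ∏ j ∈ T, a j + b i * (∏ j ∈ T, a j - ∏ j ∈ T, b j) := by ring
    rw [h3]; refine (norm_add_le _ _).trans ?_; rw [norm_mul, norm_mul]
    have h4 := hb i (mem_insert_self _ _)
    nlinarith [norm_nonneg (a i - b i), norm_nonneg (b i), norm_nonneg (∏ j ∈ T, a j - ∏ j ∈ T, b j), norm_nonneg (∏ j ∈ T, a j)]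

/-- The multiplicative test function `∏_{q ∈ Q, q ∣ a n + 1} v q`. -/
noncomputable def Hm (Q : Finset ℕ) (v : ℕ → ℂ) (a n : ℕ) : ℂ := ∏ q ∈ Q, if q ∣ a * n + 1 then v q else 1

/-- The mean value of `Hm Q v a` over residues coprime to `Q`. -/
noncomputable def phi (Q : Finset ℕ) (v : ℕ → ℂ) (a : ℕ) : ℂ :=
  ∏ q ∈ Q, if q ∣ a then 1 else 1 + (v q - 1) / ((q : ℂ) - 1)

noncomputable def cfac (a p1 p2 q : ℕ) (v w : ℂ) : ℂ :=
  if q ∣ a then 1 else 1 + (v - 1) / ((q : ℂ) - 1) + (w - 1) / ((q : ℂ) - 1) +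
    (if p1 % q = p2 % q then (v - 1) * (w - 1) / ((q : ℂ) - 1) else 0)

lemma prime_sub_one_ne_zero (q : ℕ) (hq : q.Prime) : (q : ℂ) - 1 ≠ 0 := by rw [sub_ne_zero]; exact_mod_cast hq.one_lt.ne'

lemma sum_Ico_dvd_mul_add_one (q b : ℕ) (hq : q.Prime) (hb : ¬ q ∣ b) (v : ℂ) :
    ∑ n ∈ Ico 1 q, (if q ∣ b * n + 1 then v else 0) = v := by
  have h := sum_range_dvd_mul_add_one q b hq hb v
  rw [range_eq_Ico, Finset.sum_eq_sum_Ico_succ_bot hq.pos] at h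
  rw [mul_zero, zero_add, if_neg (by rw [dvd_one]; exact hq.one_lt.ne'), zero_add] at h
  exact h

lemma avgo_pair (q a p1 p2 : ℕ) (hq : q.Prime) (h1 : ¬ q ∣ p1) (h2 : ¬ q ∣ p2) (v w : ℂ) :
    avgo q (fun n => (if q ∣ a * p1 * n + 1 then v else 1) * (if q ∣ a * p2 * n + 1 then w else 1)) = cfac a p1 p2 q v w := by
  have hq0 := prime_sub_one_ne_zero q hq
  have hcard : ((Ico 1 q).card : ℂ) = q - 1 := by rw [Nat.card_Ico, Nat.cast_sub hq.one_le]; simp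
  unfold cfac avgo
  split_ifs with ha he
  · have : ∀ n ∈ Ico 1 q, (if q ∣ a * p1 * n + 1 then v else 1) * (if q ∣ a * p2 * n + 1 then w else 1) = 1 := by
      intro n _
      have h3 : ∀ p, ¬ q ∣ a * p * n + 1 := by
        intro p h
        have := (Nat.dvd_add_right ((ha.mul_right p).mul_right n)).1 h; exact hq.one_lt.ne' (dvd_one.1 this)
      rw [if_neg (h3 p1), if_neg (h3 p2), one_mul]
    rw [sum_congr rfl this, sum_const, nsmul_eq_mul, hcard, mul_one, div_self hq0]
  · have hb1 : ¬ q ∣ a * p1 := fun h => (hq.dvd_mul.1 h).elim ha h1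
    have : ∀ n ∈ Ico 1 q, (if q ∣ a * p1 * n + 1 then v else 1) * (if q ∣ a * p2 * n + 1 then w else 1)
        = 1 + (if q ∣ a * p1 * n + 1 then v * w - 1 else 0) := by
      intro n _
      have h3 : q ∣ a * p2 * n + 1 ↔ q ∣ a * p1 * n + 1 := by
        apply ModEq.dvd_iff _ dvd_rfl
        exact ModEq.add_right 1 (ModEq.mul_right n (ModEq.mul_left a (Eq.symm he)))
      simp only [h3]
      split_ifs <;> ring
    rw [sum_congr rfl this, sum_add_distrib, sum_Ico_dvd_mul_add_one q _ hq hb1, sum_const, nsmul_eq_mul, hcard]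
    field_simp; ring
  · have hb1 : ¬ q ∣ a * p1 := fun h => (hq.dvd_mul.1 h).elim ha h1
    have hb2 : ¬ q ∣ a * p2 := fun h => (hq.dvd_mul.1 h).elim ha h2
    have : ∀ n ∈ Ico 1 q, (if q ∣ a * p1 * n + 1 then v else 1) * (if q ∣ a * p2 * n + 1 then w else 1)
        = 1 + (if q ∣ a * p1 * n + 1 then v - 1 else 0) + (if q ∣ a * p2 * n + 1 then w - 1 else 0) := by
      intro n _
      by_cases e1 : q ∣ a * p1 * n + 1
      · by_cases e2 : q ∣ a * p2 * n + 1
        · exfalso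
          apply he
          have h3 : a * p1 * n + 1 ≡ a * p2 * n + 1 [MOD q] :=
            (Nat.modEq_zero_iff_dvd.2 e1).trans (Nat.modEq_zero_iff_dvd.2 e2).symm
          have h4 := ModEq.add_right_cancel' 1 h3
          have hn : ¬ q ∣ n := fun h => hq.one_lt.ne' (dvd_one.1 ((Nat.dvd_add_right (h.mul_left _)).1 e1))
          have h5 := ModEq.cancel_right_of_coprime ((Nat.Prime.coprime_iff_not_dvd hq).2 hn) h4
          exact ModEq.cancel_left_of_coprime ((Nat.Prime.coprime_iff_not_dvd hq).2 ha) h5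
        · rw [if_pos e1, if_neg e2, if_pos e1, if_neg e2]; ring
      · rw [if_neg e1, if_neg e1]
        split_ifs <;> ring
    rw [sum_congr rfl this, sum_add_distrib, sum_add_distrib, sum_Ico_dvd_mul_add_one q _ hq hb1,
      sum_Ico_dvd_mul_add_one q _ hq hb2, sum_const, nsmul_eq_mul, hcard]
    field_simp; ring

lemma norm_avgo_le_one (q : ℕ) (hq : q.Prime) (φ : ℕ → ℂ) (h : ∀ n, ‖φ n‖ ≤ 1) : ‖avgo q φ‖ ≤ 1 := by
  have hq1 : (1 : ℝ) < q := by exact_mod_cast hq.one_lt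
  unfold avgo
  rw [norm_div, show (q : ℂ) - 1 = (((q : ℝ) - 1 : ℝ) : ℂ) by push_cast; rfl, norm_real,
    norm_of_nonneg (by linarith), div_le_one (by linarith)]
  calc _ ≤ ∑ n ∈ Ico 1 q, (1 : ℝ) := (norm_sum_le _ _).trans (sum_le_sum fun n _ => h n)
    _ = _ := by rw [sum_const, Nat.card_Ico, nsmul_eq_mul, mul_one, Nat.cast_sub hq.one_le]; simp

lemma norm_cfac_le_one (q a p1 p2 : ℕ) (hq : q.Prime) (h1 : ¬ q ∣ p1) (h2 : ¬ q ∣ p2) (v w : ℂ) (hv : ‖v‖ ≤ 1)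
    (hw : ‖w‖ ≤ 1) : ‖cfac a p1 p2 q v w‖ ≤ 1 := by
  rw [← avgo_pair q a p1 p2 hq h1 h2]
  apply norm_avgo_le_one q hq
  intro n
  rw [norm_mul]
  apply mul_le_one₀ _ (norm_nonneg _)
  · split_ifs; exacts [hw, by simp]
  · split_ifs; exacts [hv, by simp]

lemma cfac_one_right (a p1 p2 q : ℕ) (v : ℂ) : cfac a p1 p2 q v 1 = if q ∣ a then 1 else 1 + (v - 1) / ((q : ℂ) - 1) := by unfold cfac; split_ifs <;> simp

lemma cfac_one_left (a p1 p2 q : ℕ) (v : ℂ) : cfac a p1 p2 q 1 v = if q ∣ a then 1 else 1 + (v - 1) / ((q : ℂ) - 1) := by unfold cfac; split_ifs <;> simp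

lemma norm_phi_factor_le (q a : ℕ) (hq : q.Prime) (v : ℂ) (hv : ‖v‖ ≤ 1) :
    ‖(if q ∣ a then 1 else 1 + (v - 1) / ((q : ℂ) - 1) : ℂ)‖ ≤ 1 := by
  have h1 : ¬ q ∣ 1 := by rw [dvd_one]; exact hq.one_lt.ne'
  rw [← cfac_one_right a 1 1 q v]
  exact norm_cfac_le_one q a 1 1 hq h1 h1 v 1 hv (by simp)

lemma norm_phi_le_one (Q : Finset ℕ) (hQ : ∀ q ∈ Q, q.Prime) (v : ℕ → ℂ) (hv : ∀ q ∈ Q, ‖v q‖ ≤ 1) (a : ℕ) : ‖phi Q v a‖ ≤ 1 := by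
  unfold phi
  rw [norm_prod]
  exact prod_le_one (fun _ _ => norm_nonneg _) fun q hq => norm_phi_factor_le q a (hQ q hq) _ (hv q hq)

lemma norm_Hm_le_one (Q : Finset ℕ) (v : ℕ → ℂ) (hv : ∀ q ∈ Q, ‖v q‖ ≤ 1) (a n : ℕ) : ‖Hm Q v a n‖ ≤ 1 := by
  unfold Hm
  rw [norm_prod]
  refine prod_le_one (fun _ _ => norm_nonneg _) fun q hq => ?_
  split_ifs
  · exact hv q hq
  · simp

lemma norm_cfac_sub_le (q a p1 p2 : ℕ) (hq : q.Prime) (v w : ℂ) (hv : ‖v‖ ≤ 1) (hw : ‖w‖ ≤ 1) :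
    ‖cfac a p1 p2 q v w - (if q ∣ a then 1 else 1 + (v - 1) / ((q : ℂ) - 1)) *
      (if q ∣ a then 1 else 1 + (w - 1) / ((q : ℂ) - 1))‖ ≤
      4 / ((q : ℝ) - 1) ^ 2 + (if p1 % q = p2 % q then 4 / ((q : ℝ) - 1) else 0) := by
  have hq1 : (1 : ℝ) < q := by exact_mod_cast hq.one_lt
  have hq0 := prime_sub_one_ne_zero q hq
  have hn : ‖(q : ℂ) - 1‖ = (q : ℝ) - 1 := by rw [show (q : ℂ) - 1 = (((q : ℝ) - 1 : ℝ) : ℂ) by push_cast; rfl, norm_real, norm_of_nonneg (by linarith)]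
  have hvw : ‖(v - 1) * (w - 1)‖ ≤ 4 := by
    rw [norm_mul]
    have h1 : ‖v - 1‖ ≤ 2 := (norm_sub_le _ _).trans (by rw [norm_one]; linarith)
    have h2 : ‖w - 1‖ ≤ 2 := (norm_sub_le _ _).trans (by rw [norm_one]; linarith)
    nlinarith [norm_nonneg (v - 1), norm_nonneg (w - 1)]
  have hsq : ‖(v - 1) * (w - 1) / ((q : ℂ) - 1) ^ 2‖ ≤ 4 / ((q : ℝ) - 1) ^ 2 := by rw [norm_div, norm_pow, hn]; gcongr
  have hone : ‖(v - 1) * (w - 1) / ((q : ℂ) - 1)‖ ≤ 4 / ((q : ℝ) - 1) := by rw [norm_div, hn]; gcongr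
  unfold cfac
  split_ifs with h1 h2 h2
  · simp; positivity
  · simp; positivity
  · have : 1 + (v - 1) / ((q : ℂ) - 1) + (w - 1) / ((q : ℂ) - 1) + (v - 1) * (w - 1) / ((q : ℂ) - 1) -
      (1 + (v - 1) / ((q : ℂ) - 1)) * (1 + (w - 1) / ((q : ℂ) - 1)) =
      (v - 1) * (w - 1) / ((q : ℂ) - 1) - (v - 1) * (w - 1) / ((q : ℂ) - 1) ^ 2 := by
      field_simp; ring
    rw [this]; refine (norm_sub_le _ _).trans ?_; linarith
  · have : 1 + (v - 1) / ((q : ℂ) - 1) + (w - 1) / ((q : ℂ) - 1) + 0 -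
      (1 + (v - 1) / ((q : ℂ) - 1)) * (1 + (w - 1) / ((q : ℂ) - 1)) =
      - ((v - 1) * (w - 1) / ((q : ℂ) - 1) ^ 2) := by
      field_simp; ring
    rw [this, norm_neg]; linarith

lemma corr_pair (γ γ' : ℝ) (hγ' : 0 < γ') (h2 : 2 * γ' ≤ γ) (h1 : γ ≤ 1) : ∀ᶠ X : ℝ in atTop, ∀ z : ℕ,
    (z : ℝ) ≤ zz X → ∀ N1 N2 : ℕ, N1 ≤ N2 → ∀ (Q : Finset ℕ) (v w : ℕ → ℂ) (a p1 p2 : ℕ), Q ⊆ primesLE z →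
    (∀ q ∈ Q, ‖v q‖ ≤ 1) → (∀ q ∈ Q, ‖w q‖ ≤ 1) → (∀ q ∈ Q, ¬ q ∣ p1 ∧ ¬ q ∣ p2) →
    ‖∑ n ∈ Ioc N1 N2, (wt z ⌊X ^ γ'⌋₊ (X ^ γ) n : ℂ) * (Hm Q v (a * p1) n * Hm Q w (a * p2) n)
      - ((N2 : ℂ) - N1) * (YY z ⌊X ^ γ'⌋₊ (X ^ γ) : ℂ) * ∏ q ∈ Q, cfac a p1 p2 q (v q) (w q)‖
      ≤ ((N2 : ℝ) - N1) / log X ^ 48 + X ^ (5 * γ) := by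
  filter_upwards [wt_corr γ γ' hγ' h2 h1] with X hX
  intro z hz N1 N2 h12 Q v w a p1 p2 hQ hv hw hp
  set u : ℕ → ℕ → ℂ := fun p n => if p ∈ Q then
    (if p ∣ a * p1 * n + 1 then v p else 1) * (if p ∣ a * p2 * n + 1 then w p else 1) else 1 with hu
  have hu1 : ∀ p n, ‖u p n‖ ≤ 1 := by
    intro p n; simp only [hu]
    split_ifs with h3
    all_goals first | (rw [norm_mul]; exact mul_le_one₀ (by first | exact hv _ h3 | simp) (norm_nonneg _) (by first | exact hw _ h3 | simp)) | simp
  have hm := hX z hz N1 N2 h12 u (by intro p n; simp only [hu, dvd_mul_mod_add_one]) hu1 (by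
    intro p hp'
    have hpp := (mem_primesLE.1 hp').2
    by_cases hpQ : p ∈ Q
    · simp only [hu, if_pos hpQ]
      by_cases ha : p ∣ a
      · have h3 : ∀ c n, ¬ p ∣ a * c * n + 1 := by
          intro c n h
          have := (Nat.dvd_add_right ((ha.mul_right c).mul_right n)).1 h; exact hpp.one_lt.ne' (dvd_one.1 this)
        simp only [if_neg (h3 _ _)]; simp
      · have hb1 : ¬ p ∣ a * p1 := fun h => (hpp.dvd_mul.1 h).elim ha (hp p hpQ).1
        have hb2 : ¬ p ∣ a * p2 := fun h => (hpp.dvd_mul.1 h).elim ha (hp p hpQ).2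
        have e1 : ∀ n ∈ Ico 1 p, ‖(if p ∣ a * p1 * n + 1 then v p else 1) * (if p ∣ a * p2 * n + 1 then w p else 1) - 1‖
            ≤ ‖(if p ∣ a * p1 * n + 1 then 2 else 0 : ℂ) + (if p ∣ a * p2 * n + 1 then 2 else 0 : ℂ)‖ := by
          intro n _
          have t1 : ‖v p - 1‖ ≤ 2 := (norm_sub_le _ _).trans (by rw [norm_one]; linarith [hv p hpQ])
          have t2 : ‖w p - 1‖ ≤ 2 := (norm_sub_le _ _).trans (by rw [norm_one]; linarith [hw p hpQ])
          have t3 : ‖v p * w p - 1‖ ≤ 4 := by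
            refine (norm_sub_le _ _).trans ?_; rw [norm_one, norm_mul]
            have := mul_le_one₀ (hv p hpQ) (norm_nonneg _) (hw p hpQ); linarith
          split_ifs
          · norm_num; exact t3
          · simpa using t1
          · simpa using t2
          · simp
        refine (sum_le_sum e1).trans ?_
        have e2 : ∀ n, ‖(if p ∣ a * p1 * n + 1 then 2 else 0 : ℂ) + (if p ∣ a * p2 * n + 1 then 2 else 0 : ℂ)‖ =
          ((if p ∣ a * p1 * n + 1 then 2 else 0 : ℂ) + (if p ∣ a * p2 * n + 1 then 2 else 0 : ℂ)).re := by
          intro n; split_ifs <;> norm_num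
        simp only [e2]
        rw [← re_sum, sum_add_distrib, sum_Ico_dvd_mul_add_one p _ hpp hb1, sum_Ico_dvd_mul_add_one p _ hpp hb2]
        norm_num
    · simp only [hu, if_neg hpQ]
      simp)
  have e1 : ∀ n, ∏ p ∈ primesLE z, u p n = Hm Q v (a * p1) n * Hm Q w (a * p2) n := by
    intro n; unfold Hm; rw [← prod_mul_distrib, ← prod_subset hQ]
    · exact prod_congr rfl fun q hq => by simp only [hu, if_pos hq]
    · intro q _ hq; simp only [hu, if_neg hq]
  have e2 : ∏ p ∈ primesLE z, avgo p (u p) = ∏ q ∈ Q, cfac a p1 p2 q (v q) (w q) := by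
    rw [← prod_subset hQ]
    · refine prod_congr rfl fun q hq => ?_
      rw [← avgo_pair q a p1 p2 (mem_primesLE.1 (hQ hq)).2 (hp q hq).1 (hp q hq).2]
      congr 1
      funext n
      simp only [hu, if_pos hq]
    · intro q hq hqQ
      have hqp := (mem_primesLE.1 hq).2; unfold avgo; simp only [hu, if_neg hqQ]
      rw [sum_const, Nat.card_Ico, nsmul_eq_mul, mul_one, Nat.cast_sub hqp.one_le]; simp only [Nat.cast_one]
      exact div_self (prime_sub_one_ne_zero q hqp)
  simp only [e1] at hm
  rw [e2] at hm
  exact hm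

lemma star_Hm (Q : Finset ℕ) (v : ℕ → ℂ) (a n : ℕ) :
    (starRingEnd ℂ) (Hm Q v a n) = Hm Q (fun q => (starRingEnd ℂ) (v q)) a n := by
  unfold Hm
  rw [map_prod]
  refine prod_congr rfl fun q _ => ?_
  split_ifs <;> simp

lemma star_phi (Q : Finset ℕ) (v : ℕ → ℂ) (a : ℕ) :
    (starRingEnd ℂ) (phi Q v a) = phi Q (fun q => (starRingEnd ℂ) (v q)) a := by
  unfold phi
  rw [map_prod]
  refine prod_congr rfl fun q _ => ?_
  split_ifs <;> simp

lemma Hm_one (Q : Finset ℕ) (a n : ℕ) : Hm Q (fun _ => 1) a n = 1 := by unfold Hm; simp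

lemma corr_single (γ γ' : ℝ) (hγ' : 0 < γ') (h2 : 2 * γ' ≤ γ) (h1 : γ ≤ 1) : ∀ᶠ X : ℝ in atTop, ∀ z : ℕ,
    (z : ℝ) ≤ zz X → ∀ N1 N2 : ℕ, N1 ≤ N2 → ∀ (Q : Finset ℕ) (v : ℕ → ℂ) (a : ℕ), Q ⊆ primesLE z →
    (∀ q ∈ Q, ‖v q‖ ≤ 1) →
    ‖∑ n ∈ Ioc N1 N2, (wt z ⌊X ^ γ'⌋₊ (X ^ γ) n : ℂ) * (Hm Q v a n - phi Q v a)‖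
      ≤ 2 * (((N2 : ℝ) - N1) / log X ^ 48 + X ^ (5 * γ)) := by
  filter_upwards [corr_pair γ γ' hγ' h2 h1] with X hX
  intro z hz N1 N2 h12 Q v a hQ hv
  have hQp : ∀ q ∈ Q, q.Prime := fun q hq => (mem_primesLE.1 (hQ hq)).2
  have hc : ∀ q ∈ Q, ¬ q ∣ 1 ∧ ¬ q ∣ 1 := by
    intro q hq
    rw [dvd_one]; exact ⟨(hQp q hq).one_lt.ne', (hQp q hq).one_lt.ne'⟩
  have e1 := hX z hz N1 N2 h12 Q v (fun _ => 1) a 1 1 hQ hv (by simp) hc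
  have e2 := hX z hz N1 N2 h12 Q (fun _ => 1) (fun _ => 1) a 1 1 hQ (by simp) (by simp) hc
  have hphi : ∏ q ∈ Q, cfac a 1 1 q (v q) 1 = phi Q v a := by unfold phi; exact prod_congr rfl fun q _ => cfac_one_right _ _ _ _ _
  have hone : ∏ q ∈ Q, cfac a 1 1 q 1 1 = 1 := by apply prod_eq_one; intro q _; rw [cfac_one_right]; simp
  rw [hphi] at e1
  rw [hone] at e2
  simp only [Hm_one, mul_one] at e1 e2
  have hn := norm_phi_le_one Q hQp v hv a
  set E := ((N2 : ℝ) - N1) / log X ^ 48 + X ^ (5 * γ)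
  set Yc := ((N2 : ℂ) - N1) * (YY z ⌊X ^ γ'⌋₊ (X ^ γ) : ℂ)
  have : ∑ n ∈ Ioc N1 N2, (wt z ⌊X ^ γ'⌋₊ (X ^ γ) n : ℂ) * (Hm Q v a n - phi Q v a) =
    (∑ n ∈ Ioc N1 N2, (wt z ⌊X ^ γ'⌋₊ (X ^ γ) n : ℂ) * Hm Q v a n - Yc * phi Q v a) -
    phi Q v a * (∑ n ∈ Ioc N1 N2, (wt z ⌊X ^ γ'⌋₊ (X ^ γ) n : ℂ) - Yc) := by
    simp only [mul_sub, sum_sub_distrib, ← sum_mul]; ring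
  rw [this]
  refine (norm_sub_le _ _).trans ?_
  rw [norm_mul]
  nlinarith [norm_nonneg (phi Q v a), norm_nonneg (∑ n ∈ Ioc N1 N2, (wt z ⌊X ^ γ'⌋₊ (X ^ γ) n : ℂ) - Yc)]

lemma corr_centred (γ γ' : ℝ) (hγ' : 0 < γ') (h2 : 2 * γ' ≤ γ) (h1 : γ ≤ 1) : ∀ᶠ X : ℝ in atTop, ∀ z : ℕ,
    (z : ℝ) ≤ zz X → ∀ N1 N2 : ℕ, N1 ≤ N2 → ∀ (Q : Finset ℕ) (v : ℕ → ℂ) (a p1 p2 : ℕ), Q ⊆ primesLE z →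
    (∀ q ∈ Q, ‖v q‖ ≤ 1) → (∀ q ∈ Q, ¬ q ∣ p1 ∧ ¬ q ∣ p2) →
    ‖∑ n ∈ Ioc N1 N2, (wt z ⌊X ^ γ'⌋₊ (X ^ γ) n : ℂ) *
      ((Hm Q v (a * p1) n - phi Q v a) * (starRingEnd ℂ) (Hm Q v (a * p2) n - phi Q v a))‖
      ≤ ((N2 : ℝ) - N1) * YY z ⌊X ^ γ'⌋₊ (X ^ γ) *
          ∑ q ∈ Q, (4 / ((q : ℝ) - 1) ^ 2 + (if p1 % q = p2 % q then 4 / ((q : ℝ) - 1) else 0))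
        + 4 * (((N2 : ℝ) - N1) / log X ^ 48 + X ^ (5 * γ)) := by
  filter_upwards [corr_pair γ γ' hγ' h2 h1] with X hX
  intro z hz N1 N2 h12 Q v a p1 p2 hQ hv hc
  have hQp : ∀ q ∈ Q, q.Prime := fun q hq => (mem_primesLE.1 (hQ hq)).2
  have hN : (0 : ℝ) ≤ (N2 : ℝ) - N1 := by rw [sub_nonneg]; exact_mod_cast h12
  set w : ℕ → ℂ := fun q => (starRingEnd ℂ) (v q) with hw
  have hw1 : ∀ q ∈ Q, ‖w q‖ ≤ 1 := by intro q hq; simp only [hw, RCLike.norm_conj]; exact hv q hq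
  have e1 := hX z hz N1 N2 h12 Q v w a p1 p2 hQ hv hw1 hc
  have e2 := hX z hz N1 N2 h12 Q v (fun _ => 1) a p1 p2 hQ hv (by simp) hc
  have e3 := hX z hz N1 N2 h12 Q (fun _ => 1) w a p1 p2 hQ (by simp) hw1 hc
  have e4 := hX z hz N1 N2 h12 Q (fun _ => 1) (fun _ => 1) a p1 p2 hQ (by simp) (by simp) hc
  have hphi2 : ∏ q ∈ Q, cfac a p1 p2 q (v q) 1 = phi Q v a := by unfold phi; exact prod_congr rfl fun q _ => cfac_one_right _ _ _ _ _
  have hphi3 : ∏ q ∈ Q, cfac a p1 p2 q 1 (w q) = phi Q w a := by unfold phi; exact prod_congr rfl fun q _ => cfac_one_left _ _ _ _ _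
  have hone : ∏ q ∈ Q, cfac a p1 p2 q 1 1 = 1 := by apply prod_eq_one; intro q _; rw [cfac_one_right]; simp
  rw [hphi2] at e2
  rw [hphi3] at e3
  rw [hone] at e4
  simp only [Hm_one, mul_one, one_mul] at e2 e3 e4
  have hn := norm_phi_le_one Q hQp v hv a
  have hn2 := norm_phi_le_one Q hQp w hw1 a
  set E := ((N2 : ℝ) - N1) / log X ^ 48 + X ^ (5 * γ)
  set Y := YY z ⌊X ^ γ'⌋₊ (X ^ γ)
  have hY0 : 0 ≤ Y := YY_nonneg _ _ _
  set Yc := ((N2 : ℂ) - N1) * (Y : ℂ)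
  set W : ℕ → ℂ := fun n => (wt z ⌊X ^ γ'⌋₊ (X ^ γ) n : ℂ)
  have hstar : ∀ n, (starRingEnd ℂ) (Hm Q v (a * p2) n - phi Q v a) = Hm Q w (a * p2) n - phi Q w a := by intro n; rw [map_sub, star_Hm, star_phi]
  simp only [hstar]
  set A1 := ∑ n ∈ Ioc N1 N2, W n * (Hm Q v (a * p1) n * Hm Q w (a * p2) n)
  set A2 := ∑ n ∈ Ioc N1 N2, W n * Hm Q v (a * p1) n
  set A3 := ∑ n ∈ Ioc N1 N2, W n * Hm Q w (a * p2) n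
  set A4 := ∑ n ∈ Ioc N1 N2, W n
  set P := ∏ q ∈ Q, cfac a p1 p2 q (v q) (w q) with hP
  have hmain : ‖Yc * (P - phi Q v a * phi Q w a)‖ ≤ ((N2 : ℝ) - N1) * Y *
          ∑ q ∈ Q, (4 / ((q : ℝ) - 1) ^ 2 + (if p1 % q = p2 % q then 4 / ((q : ℝ) - 1) else 0)) := by
    have : Yc = ((((N2 : ℝ) - N1) * Y : ℝ) : ℂ) := by push_cast; rfl
    rw [this, norm_mul, norm_real, norm_of_nonneg (by positivity)]; refine mul_le_mul_of_nonneg_left ?_ (by positivity)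
    unfold phi; rw [hP, ← prod_mul_distrib]
    refine (norm_prod_sub_prod_le_sum Q _ _ (fun q hq => norm_cfac_le_one q a p1 p2 (hQp q hq) (hc q hq).1 (hc q hq).2 _ _ (hv q hq) (hw1 q hq)) ?_).trans ?_
    · intro q hq; rw [norm_mul]
      exact mul_le_one₀ (norm_phi_factor_le q a (hQp q hq) _ (hv q hq)) (norm_nonneg _) (norm_phi_factor_le q a (hQp q hq) _ (hw1 q hq))
    · exact sum_le_sum fun q hq => norm_cfac_sub_le q a p1 p2 (hQp q hq) _ _ (hv q hq) (hw1 q hq)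
  have : ∑ n ∈ Ioc N1 N2, W n * ((Hm Q v (a * p1) n - phi Q v a) * (Hm Q w (a * p2) n - phi Q w a)) =
      Yc * (P - phi Q v a * phi Q w a) + (A1 - Yc * P) - phi Q w a * (A2 - Yc * phi Q v a)
        - phi Q v a * (A3 - Yc * phi Q w a) + phi Q v a * phi Q w a * (A4 - Yc) := by
    have e : ∑ n ∈ Ioc N1 N2, W n * ((Hm Q v (a * p1) n - phi Q v a) * (Hm Q w (a * p2) n - phi Q w a)) =
        A1 - phi Q w a * A2 - phi Q v a * A3 + phi Q v a * phi Q w a * A4 := by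
      simp only [A1, A2, A3, A4, mul_sum, ← sum_sub_distrib, ← sum_add_distrib]; exact sum_congr rfl fun n _ => by ring
    rw [e]; ring
  rw [this]
  have s2 : ‖phi Q w a * (A2 - Yc * phi Q v a)‖ ≤ E := by rw [norm_mul]; exact (mul_le_of_le_one_left (norm_nonneg _) hn2).trans e2
  have s3 : ‖phi Q v a * (A3 - Yc * phi Q w a)‖ ≤ E := by rw [norm_mul]; exact (mul_le_of_le_one_left (norm_nonneg _) hn).trans e3
  have s4 : ‖phi Q v a * phi Q w a * (A4 - Yc)‖ ≤ E := by
    rw [norm_mul]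
    refine (mul_le_of_le_one_left (norm_nonneg _) ?_).trans e4
    rw [norm_mul]; exact mul_le_one₀ hn (norm_nonneg _) hn2
  refine (norm_add_le _ _).trans ?_
  refine (add_le_add_left ((norm_sub_le _ _).trans (add_le_add_left ((norm_sub_le _ _).trans (add_le_add_left (norm_add_le _ _) _)) _)) _).trans ?_
  linarith

lemma sum_log_PZ_le (z V : ℕ) : ∑ p ∈ PZ z V, log p ≤ 2 * V := by
  have h1 := Chebyshev.theta_le_log4_mul_x (x := (V : ℝ)) (Nat.cast_nonneg V)
  rw [Chebyshev.theta_eq_sum_primesLE_log] at h1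
  have h2 : ∑ p ∈ PZ z V, log p ≤ ∑ p ∈ primesLE V, log p := by
    apply sum_le_sum_of_subset_of_nonneg
    · unfold PZ; exact sdiff_subset
    · intro p _ _; positivity
  have h3 : log 4 ≤ 2 := by rw [show (4 : ℝ) = 2 ^ 2 by norm_num, log_pow]; have := log_two_lt_d9; push_cast; linarith
  have : log 4 * V ≤ 2 * V := by gcongr
  linarith

lemma sum_log_modEq_le (γ γ' : ℝ) (hγ' : 0 < γ') (h2 : 2 * γ' ≤ γ) (h1 : γ ≤ 1) : ∃ C > 0, ∀ᶠ X : ℝ in atTop, ∀ z : ℕ,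
    2 ≤ z → (z : ℝ) ≤ zz X → ∀ z0 : ℕ, ⌊X ^ γ'⌋₊ ≤ z0 → ∀ V : ℕ, (V : ℝ) ≤ X → ∀ q b : ℕ, q.Prime →
    ∑ p ∈ PZ z0 V with p % q = b % q, log p ≤ C * (V / q) + 16 * X ^ (5 * γ) * log X := by
  obtain ⟨C, hC, h⟩ := wt_residue γ γ' hγ' h2 h1
  refine ⟨C, hC, ?_⟩
  filter_upwards [h, eventually_params γ γ' hγ' h2 h1] with X hX hpar
  obtain ⟨hX2, hXγ, hzzX, hfl, -, -, -, hl1⟩ := hpar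
  intro z hz hzz z0 hz0 V hV q b hq
  have hq0 : (0 : ℝ) < q := by exact_mod_cast hq.pos
  have h3 := hX z hz hzz 0 V (Nat.zero_le _) q b hq
  have hzz' : z ≤ ⌊X ^ γ'⌋₊ := le_floor (hzz.trans hzzX)
  have h4 : ∑ p ∈ PZ z0 V with p % q = b % q, log p ≤
      log X * ∑ n ∈ Ioc 0 V with n % q = b % q, wt z ⌊X ^ γ'⌋₊ (X ^ γ) n := by
    rw [mul_sum]
    refine (sum_le_sum (g := fun n => log X * wt z ⌊X ^ γ'⌋₊ (X ^ γ) n) ?_).trans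
      (sum_le_sum_of_subset_of_nonneg ?_ ?_)
    · intro p hp; rw [mem_filter, mem_PZ] at hp; rw [wt_eq_one z _ _ p hzz', mul_one]
      · apply log_le_log
        · exact_mod_cast hp.1.2.2.pos
        · refine le_trans ?_ hV; exact_mod_cast hp.1.2.1
      · intro r hr hrz hrp
        have := (Nat.prime_dvd_prime_iff_eq hr hp.1.2.2).1 hrp; omega
    · intro p hp; rw [mem_filter, mem_PZ] at hp; rw [mem_filter, mem_Ioc]; exact ⟨⟨hp.1.2.2.pos, hp.1.2.1⟩, hp.2⟩
    · intro n _ _; exact mul_nonneg (by linarith) (wt_nonneg _ _ _ _)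
  refine h4.trans ((mul_le_mul_of_nonneg_left h3 (by linarith)).trans (le_of_eq ?_))
  have : log X ≠ 0 := by linarith
  rw [Nat.cast_zero, sub_zero]
  field_simp

lemma log_pairs_le (γ γ' : ℝ) (hγ' : 0 < γ') (h2 : 2 * γ' ≤ γ) (h1 : γ ≤ 1) : ∃ C > 0, ∀ᶠ X : ℝ in atTop, ∀ z : ℕ,
    2 ≤ z → (z : ℝ) ≤ zz X → ∀ z0 : ℕ, ⌊X ^ γ'⌋₊ ≤ z0 → ∀ V : ℕ, (V : ℝ) ≤ X → ∀ Q ⊆ primesLE z, ∀ W : ℕ, 1 ≤ W →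
    (∀ q ∈ Q, W < q) →
    ∑ p1 ∈ PZ z0 V, ∑ p2 ∈ PZ z0 V, log p1 * log p2 *
      (∑ q ∈ Q, (4 / ((q : ℝ) - 1) ^ 2 + (if p1 % q = p2 % q then 4 / ((q : ℝ) - 1) else 0)))
      ≤ C * ((V : ℝ) ^ 2 / W) + C * (V * (X ^ (6 * γ) * log X)) := by
  obtain ⟨C, hC, h⟩ := sum_log_modEq_le γ γ' hγ' h2 h1
  refine ⟨8 * C + 160, by positivity, ?_⟩
  filter_upwards [h, eventually_params γ γ' hγ' h2 h1] with X hX hpar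
  obtain ⟨hX2, hXγ, hzzX, hfl, -, -, -, hl1⟩ := hpar
  intro z hz hzz z0 hz0 V hV Q hQ W hW hWq
  have hQp : ∀ q ∈ Q, q.Prime := fun q hq => (mem_primesLE.1 (hQ hq)).2
  have hX0 : 0 < X := by linarith
  set P := PZ z0 V
  set T := ∑ p ∈ P, log p with hT
  have hTV : T ≤ 2 * V := sum_log_PZ_le z0 V
  set E := 16 * X ^ (5 * γ) * log X with hE
  have e1 : ∀ p1 ∈ P, ∀ q ∈ Q, ∑ p2 ∈ P, log p1 * log p2 * (4 / ((q : ℝ) - 1) ^ 2 + (if p1 % q = p2 % q then 4 / ((q : ℝ) - 1) else 0))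
      ≤ log p1 * (4 / ((q : ℝ) - 1) ^ 2 * T + 4 / ((q : ℝ) - 1) * (C * (V / q) + E)) := by
    intro p1 hp1 q hq
    have h3 := hX z hz hzz z0 hz0 V hV q p1 (hQp q hq)
    have hq1 : (1 : ℝ) < q := by exact_mod_cast (hQp q hq).one_lt
    have : ∑ p2 ∈ P, log p1 * log p2 * (4 / ((q : ℝ) - 1) ^ 2 + (if p1 % q = p2 % q then 4 / ((q : ℝ) - 1) else 0))
      = log p1 * (4 / ((q : ℝ) - 1) ^ 2 * T + 4 / ((q : ℝ) - 1) * ∑ p2 ∈ P with p2 % q = p1 % q, log p2) := by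
      rw [sum_filter, hT, mul_sum, mul_sum, ← sum_add_distrib, mul_sum]; refine sum_congr rfl fun p2 _ => ?_
      by_cases hc : p1 % q = p2 % q
      · rw [if_pos hc, if_pos hc.symm]; ring
      · rw [if_neg hc, if_neg (fun h => hc h.symm)]; ring
    rw [this]
    have : 0 < (q : ℝ) - 1 := by linarith
    gcongr
  have e2 : ∀ q ∈ Q, T * (4 / ((q : ℝ) - 1) ^ 2 * T + 4 / ((q : ℝ) - 1) * (C * (V / q) + E)) ≤
      (32 + 8 * C) * (V : ℝ) ^ 2 * (1 / ((q : ℝ) * ((q : ℝ) - 1))) + 8 * V * E := by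
    intro q hq
    have hq2 : (2 : ℝ) ≤ q := by exact_mod_cast (hQp q hq).two_le
    have hd : 0 < (q : ℝ) - 1 := by linarith
    have b1 : 4 / ((q : ℝ) - 1) ^ 2 ≤ 8 * (1 / ((q : ℝ) * ((q : ℝ) - 1))) := by
      rw [mul_one_div, div_le_div_iff₀ (by positivity) (by positivity)]; nlinarith
    have b2 : 4 / ((q : ℝ) - 1) ≤ 4 := by rw [div_le_iff₀ hd]; linarith
    calc T * (4 / ((q : ℝ) - 1) ^ 2 * T + 4 / ((q : ℝ) - 1) * (C * (V / q) + E))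
        ≤ (2 * V) * (8 * (1 / ((q : ℝ) * ((q : ℝ) - 1))) * (2 * V) + (4 / ((q : ℝ) - 1) * (C * (V / q)) + 4 * E)) := by
          rw [mul_add (4 / ((q : ℝ) - 1))]; gcongr
      _ = _ := by field_simp; ring
  have e3 : ∑ q ∈ Q, 1 / ((q : ℝ) * ((q : ℝ) - 1)) ≤ 1 / W := sum_inv_mul_pred_le Q W hW hWq
  have e4 : (Q.card : ℝ) ≤ X ^ γ := by
    have : Q.card ≤ z := card_primesLE_le z Q hQ
    have h5 : (Q.card : ℝ) ≤ z := by exact_mod_cast this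
    refine h5.trans (hzz.trans (hzzX.trans ?_)); exact rpow_le_rpow_of_exponent_le (by linarith) (by linarith)
  calc _ = ∑ p1 ∈ P, ∑ q ∈ Q, ∑ p2 ∈ P, log p1 * log p2 * (4 / ((q : ℝ) - 1) ^ 2 + (if p1 % q = p2 % q then 4 / ((q : ℝ) - 1) else 0)) := by
        refine sum_congr rfl fun p1 _ => ?_; rw [sum_comm]; simp only [mul_sum]
    _ ≤ ∑ p1 ∈ P, ∑ q ∈ Q, log p1 * (4 / ((q : ℝ) - 1) ^ 2 * T + 4 / ((q : ℝ) - 1) * (C * (V / q) + E)) :=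
        sum_le_sum fun p1 hp1 => sum_le_sum fun q hq => e1 p1 hp1 q hq
    _ = ∑ q ∈ Q, T * (4 / ((q : ℝ) - 1) ^ 2 * T + 4 / ((q : ℝ) - 1) * (C * (V / q) + E)) := by rw [sum_comm]; simp only [hT, sum_mul]
    _ ≤ ∑ q ∈ Q, ((32 + 8 * C) * (V : ℝ) ^ 2 * (1 / ((q : ℝ) * ((q : ℝ) - 1))) + 8 * V * E) := sum_le_sum e2
    _ = (32 + 8 * C) * (V : ℝ) ^ 2 * ∑ q ∈ Q, 1 / ((q : ℝ) * ((q : ℝ) - 1)) + Q.card * (8 * V * E) := by rw [sum_add_distrib, ← mul_sum, sum_const, nsmul_eq_mul]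
    _ ≤ (32 + 8 * C) * (V : ℝ) ^ 2 * (1 / W) + X ^ γ * (8 * V * E) := by gcongr
    _ = (32 + 8 * C) * ((V : ℝ) ^ 2 / W) + 128 * (V * (X ^ (6 * γ) * log X)) := by rw [hE, show 6 * γ = γ + 5 * γ by ring, rpow_add hX0]; ring
    _ ≤ _ := add_le_add (mul_le_mul_of_nonneg_right (by linarith) (by positivity))
        (mul_le_mul_of_nonneg_right (by linarith) (by positivity))

lemma eventually_log_pow_le (c : ℝ) (k : ℕ) (γ : ℝ) (hγ : 0 < γ) : ∀ᶠ X : ℝ in atTop, c * log X ^ k ≤ X ^ γ := by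
  have h := (isLittleO_log_rpow_rpow_atTop (k : ℝ) hγ).bound (show (0 : ℝ) < 1 / (|c| + 1) by positivity)
  filter_upwards [h, eventually_ge_atTop 1] with X hX h1
  have hl := log_nonneg h1
  rw [norm_of_nonneg (by positivity), norm_of_nonneg (by positivity), rpow_natCast] at hX
  calc c * log X ^ k ≤ (|c| + 1) * log X ^ k := by gcongr; linarith [le_abs_self c]
    _ ≤ (|c| + 1) * (1 / (|c| + 1) * X ^ γ) := by gcongr
    _ = X ^ γ := by field_simp

lemma norm_sum_sq_le_pairs (S I P : Finset ℕ) (hS : S ⊆ I) (w c : ℕ → ℝ) (hw : ∀ n, 0 ≤ w n) (hwS : ∀ n ∈ S, w n = 1)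
    (hc : ∀ p, 0 ≤ c p) (G : ℕ → ℕ → ℂ) (N : ℕ) :
    ‖∑ n ∈ S, ∑ p ∈ P with p * n ≤ N, (c p : ℂ) * G p n‖ ^ 2 ≤
      S.card * ∑ p1 ∈ P, ∑ p2 ∈ P, c p1 * c p2 *
        ‖∑ n ∈ I with p1 * n ≤ N ∧ p2 * n ≤ N, (w n : ℂ) * (G p1 n * (starRingEnd ℂ) (G p2 n))‖ := by
  set F : ℕ → ℂ := fun n => ∑ p ∈ P with p * n ≤ N, (c p : ℂ) * G p n with hF
  have h1 : ‖∑ n ∈ S, F n‖ ^ 2 ≤ S.card * ∑ n ∈ S, ‖F n‖ ^ 2 := by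
    calc ‖∑ n ∈ S, F n‖ ^ 2 ≤ (∑ n ∈ S, ‖F n‖) ^ 2 := by gcongr; exact norm_sum_le _ _
      _ ≤ _ := sq_sum_le_card_mul_sum_sq
  have h2 : ∑ n ∈ S, ‖F n‖ ^ 2 ≤ ∑ n ∈ I, w n * ‖F n‖ ^ 2 := by
    calc ∑ n ∈ S, ‖F n‖ ^ 2 = ∑ n ∈ S, w n * ‖F n‖ ^ 2 := sum_congr rfl fun n hn => by rw [hwS n hn, one_mul]
      _ ≤ _ := sum_le_sum_of_subset_of_nonneg hS fun n _ _ => mul_nonneg (hw n) (sq_nonneg _)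
  have h3 : ((∑ n ∈ I, w n * ‖F n‖ ^ 2 : ℝ) : ℂ) = ∑ p1 ∈ P, ∑ p2 ∈ P, ((c p1 * c p2 : ℝ) : ℂ) *
        ∑ n ∈ I with p1 * n ≤ N ∧ p2 * n ≤ N, (w n : ℂ) * (G p1 n * (starRingEnd ℂ) (G p2 n)) := by
    push_cast
    have e1 : ∀ n ∈ I, (w n : ℂ) * (‖F n‖ : ℂ) ^ 2 = ∑ p1 ∈ P, ∑ p2 ∈ P, (if p1 * n ≤ N ∧ p2 * n ≤ N then
        (c p1 : ℂ) * (c p2 : ℂ) * ((w n : ℂ) * (G p1 n * (starRingEnd ℂ) (G p2 n))) else 0) := by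
      intro n _; rw [← Complex.mul_conj']; simp only [hF, map_sum, sum_filter]; rw [sum_mul_sum, mul_sum]
      refine sum_congr rfl fun p1 _ => ?_; rw [mul_sum]; refine sum_congr rfl fun p2 _ => ?_
      by_cases a1 : p1 * n ≤ N
      · by_cases a2 : p2 * n ≤ N
        · simp only [a1, a2, if_true, and_self, map_mul, Complex.conj_ofReal]; ring
        · simp [a2]
      · simp [a1]
    rw [sum_congr rfl e1, sum_comm]; refine sum_congr rfl fun p1 _ => ?_; rw [sum_comm]
    refine sum_congr rfl fun p2 _ => ?_; rw [sum_filter, mul_sum]; refine sum_congr rfl fun n _ => ?_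
    split_ifs <;> simp
  have h4 : ∑ n ∈ I, w n * ‖F n‖ ^ 2 ≤ ∑ p1 ∈ P, ∑ p2 ∈ P, c p1 * c p2 *
        ‖∑ n ∈ I with p1 * n ≤ N ∧ p2 * n ≤ N, (w n : ℂ) * (G p1 n * (starRingEnd ℂ) (G p2 n))‖ := by
    have h0 : 0 ≤ ∑ n ∈ I, w n * ‖F n‖ ^ 2 := sum_nonneg fun n _ => mul_nonneg (hw n) (sq_nonneg _)
    have : ∑ n ∈ I, w n * ‖F n‖ ^ 2 = ‖((∑ n ∈ I, w n * ‖F n‖ ^ 2 : ℝ) : ℂ)‖ := by rw [norm_real, norm_of_nonneg h0]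
    rw [this, h3]
    refine (norm_sum_le _ _).trans (sum_le_sum fun p1 _ => (norm_sum_le _ _).trans (sum_le_sum fun p2 _ => ?_))
    rw [norm_mul, norm_real, norm_of_nonneg (mul_nonneg (hc _) (hc _))]
  exact h1.trans (mul_le_mul_of_nonneg_left (h2.trans h4) (Nat.cast_nonneg _))

set_option maxHeartbeats 1600000 in
lemma block_bound (γ γ' ε : ℝ) (hγ' : 0 < γ') (h2 : 2 * γ' ≤ γ) (h8 : 8 * γ ≤ ε) (hε : ε ≤ 1) : ∃ C > 0, ∀ᶠ X : ℝ in atTop,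
    ∀ z : ℕ, 2 ≤ z → (z : ℝ) ≤ zz X → ∀ Q ⊆ primesLE z, ∀ v : ℕ → ℂ, (∀ q ∈ Q, ‖v q‖ ≤ 1) → ∀ a W : ℕ, 1 ≤ W →
    (∀ q ∈ Q, W < q) → ∀ N i : ℕ, (N : ℝ) ≤ X →
    ‖∑ n ∈ Ico (2 ^ i) (2 ^ (i + 1)) with 1 < n ∧ ∀ p ∈ primesLE ⌊X ^ ε⌋₊, ¬ p ∣ n,
      ∑ p ∈ PZ ⌊X ^ ε⌋₊ (N / n), (log p : ℂ) * (Hm Q v (a * p) n - phi Q v a)‖ ≤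
      C * (N / log X) * √(1 / W + 1 / log X) := by
  have hγ : 0 < γ := by linarith
  obtain ⟨C1, hC1, k1⟩ := wt_sum_le γ γ' hγ' h2 (by linarith)
  obtain ⟨C2, hC2, k2⟩ := log_pairs_le γ γ' hγ' h2 (by linarith)
  obtain ⟨C3, hC3, k3⟩ := YY_le
  set K := 2 * C3 / γ' * (2 * C2) + 48 with hK
  have hK0 : 0 < K := by positivity
  refine ⟨√((C1 + 16) * K), by positivity, ?_⟩
  filter_upwards [k1, k2, corr_centred γ γ' hγ' h2 (by linarith), eventually_params γ γ' hγ' h2 (by linarith),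
    eventually_log_pow_le 4 2 γ hγ] with X h1 h3 h4 hpar hlg
  obtain ⟨hX2, hXγ, hzzX, hfl, hlogz, hztwo, hzlow, hl1⟩ := hpar
  intro z hz hzz Q hQ v hv a W hW hWq N i hN
  have hX0 : 0 < X := by linarith
  have hX1 : 1 ≤ X := by linarith
  set z0 := ⌊X ^ ε⌋₊
  set z' := ⌊X ^ γ'⌋₊
  have hz0z' : z' ≤ z0 := Nat.floor_le_floor (rpow_le_rpow_of_exponent_le hX1 (by linarith))
  have hzz' : z ≤ z' := le_floor (hzz.trans hzzX)
  set S := (Ico (2 ^ i) (2 ^ (i + 1))).filter (fun n => 1 < n ∧ ∀ p ∈ primesLE z0, ¬ p ∣ n) with hS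
  set V := N / 2 ^ i with hV
  have hRHS : 0 ≤ √((C1 + 16) * K) * (N / log X) * √(1 / W + 1 / log X) := by positivity
  have hinner : ∀ n ∈ S, ∑ p ∈ PZ z0 (N / n), (log p : ℂ) * (Hm Q v (a * p) n - phi Q v a) =
      ∑ p ∈ PZ z0 V with p * n ≤ N, (log p : ℂ) * (Hm Q v (a * p) n - phi Q v a) := by
    intro n hn; rw [hS, mem_filter, mem_Ico] at hn; refine sum_congr ?_ fun _ _ => rfl
    ext p
    rw [mem_filter, mem_PZ, mem_PZ, Nat.le_div_iff_mul_le (by omega)]; constructor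
    · rintro ⟨e1, e2, e3⟩; refine ⟨⟨e1, ?_, e3⟩, e2⟩; rw [hV, Nat.le_div_iff_mul_le (by positivity)]
      exact (Nat.mul_le_mul_left p hn.1.1).trans e2
    · rintro ⟨⟨e1, -, e3⟩, e2⟩; exact ⟨e1, e2, e3⟩
  rw [sum_congr rfl hinner]
  rcases le_or_gt V z0 with hVz | hVz
  · have : PZ z0 V = ∅ := by rw [eq_empty_iff_forall_notMem]; intro p hp; rw [mem_PZ] at hp; omega
    simp only [this, filter_empty, sum_empty, sum_const_zero, norm_zero]; exact hRHS
  rcases le_or_gt (2 ^ (i + 1)) z0 with hMz | hMz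
  · have : S = ∅ := by
      rw [eq_empty_iff_forall_notMem]; intro n hn; rw [hS, mem_filter, mem_Ico] at hn
      obtain ⟨hn1, hn2, hn3⟩ := hn
      have hp := Nat.minFac_prime (show n ≠ 1 by omega); refine hn3 _ (mem_primesLE.2 ⟨?_, hp⟩) (Nat.minFac_dvd n)
      have := Nat.minFac_le (show 0 < n by omega); omega
    rw [this]; simp only [sum_empty, norm_zero]; exact hRHS
  set M : ℝ := 2 ^ i with hM
  have hM0 : 0 < M := by positivity
  have hXe : X ^ ε < z0 + 1 := lt_floor_add_one _
  have hVX : X ^ ε ≤ V := by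
    have : (z0 : ℝ) + 1 ≤ V := by exact_mod_cast hVz
    linarith
  have hMX : X ^ ε ≤ 2 * M := by
    have : (z0 : ℝ) + 1 ≤ 2 ^ (i + 1) := by exact_mod_cast hMz
    rw [pow_succ] at this; rw [hM]; linarith
  have hMV : M * V ≤ N := by
    have : 2 ^ i * V ≤ N := Nat.mul_div_le N (2 ^ i)
    rw [hM]; exact_mod_cast this
  have hM1 : (1 : ℝ) ≤ M := by rw [hM]; exact one_le_pow₀ (by norm_num)
  have hVle : (V : ℝ) ≤ X := by nlinarith
  set l := log X
  have hX6 : X ^ (5 * γ) * l ^ 2 * 4 ≤ X ^ ε := by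
    calc X ^ (5 * γ) * l ^ 2 * 4 = X ^ (5 * γ) * (4 * l ^ 2) := by ring
      _ ≤ X ^ (5 * γ) * X ^ γ := by gcongr
      _ = X ^ (5 * γ + γ) := by rw [rpow_add hX0]
      _ ≤ _ := rpow_le_rpow_of_exponent_le hX1 (by linarith)
  have hX7 : X ^ (6 * γ) * l ^ 2 ≤ X ^ ε := by
    calc X ^ (6 * γ) * l ^ 2 ≤ X ^ (6 * γ) * X ^ γ := by gcongr; nlinarith
      _ = X ^ (6 * γ + γ) := by rw [rpow_add hX0]
      _ ≤ _ := rpow_le_rpow_of_exponent_le hX1 (by linarith)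
  set I := Ioc (2 ^ i - 1) (2 ^ (i + 1) - 1) with hI
  have hpow : 1 ≤ 2 ^ i := Nat.one_le_two_pow
  have hSI : S ⊆ I := by
    intro n hn; rw [hS, mem_filter, mem_Ico] at hn; rw [hI, mem_Ioc]
    have := hn.1; omega
  have hcs := norm_sum_sq_le_pairs S I (PZ z0 V) hSI (wt z z' (X ^ γ)) (fun p => log p) (wt_nonneg _ _ _)
    (fun n hn => by
      rw [hS, mem_filter] at hn
      exact wt_eq_one z z' _ n hzz' fun p hp hpz => hn.2.2 p (mem_primesLE.2 ⟨hpz.trans hz0z', hp⟩))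
    (fun p => by positivity) (fun p n => Hm Q v (a * p) n - phi Q v a) N
  have hcard : (S.card : ℝ) ≤ (C1 + 16) * (M / l) := by
    have e1 := h1 z hz hzz (2 ^ i - 1) (2 ^ (i + 1) - 1) (by rw [pow_succ]; omega)
    have e2 : (S.card : ℝ) ≤ ∑ n ∈ I, wt z z' (X ^ γ) n := by
      have e3 : (S.card : ℝ) = ∑ n ∈ S, wt z z' (X ^ γ) n := by
        rw [card_eq_sum_ones]; push_cast; refine sum_congr rfl fun n hn => ?_; rw [hS, mem_filter] at hn
        exact (wt_eq_one z z' _ n hzz' fun p hp hpz => hn.2.2 p (mem_primesLE.2 ⟨hpz.trans hz0z', hp⟩)).symm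
      rw [e3]
      exact sum_le_sum_of_subset_of_nonneg hSI fun n _ _ => wt_nonneg _ _ _ _
    have e4 : (((2 ^ (i + 1) - 1 : ℕ) : ℝ) - ((2 ^ i - 1 : ℕ) : ℝ)) = M := by rw [Nat.cast_sub (by rw [pow_succ]; omega), Nat.cast_sub hpow]; push_cast; rw [hM, pow_succ]; ring
    rw [e4] at e1
    have e5 : X ^ (5 * γ) ≤ M / l := by
      rw [le_div_iff₀ (by linarith)]
      have : X ^ (5 * γ) * l ≤ X ^ (5 * γ) * l ^ 2 := by gcongr; nlinarith
      linarith
    linarith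
  have hpairs : ∀ p1 ∈ PZ z0 V, ∀ p2 ∈ PZ z0 V,
      ‖∑ n ∈ I with p1 * n ≤ N ∧ p2 * n ≤ N, (wt z z' (X ^ γ) n : ℂ) *
        ((Hm Q v (a * p1) n - phi Q v a) * (starRingEnd ℂ) (Hm Q v (a * p2) n - phi Q v a))‖ ≤
      (2 * C3 / γ') * (M / l) * (∑ q ∈ Q, (4 / ((q : ℝ) - 1) ^ 2 + (if p1 % q = p2 % q then 4 / ((q : ℝ) - 1) else 0)))
      + 12 * (M / l ^ 2) := by
    intro p1 hp1 p2 hp2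
    rw [mem_PZ] at hp1 hp2
    have hfil : I.filter (fun n => p1 * n ≤ N ∧ p2 * n ≤ N) = Ioc (2 ^ i - 1) (min (2 ^ (i + 1) - 1) (min (N / p1) (N / p2))) := by
      ext n
      rw [mem_filter, hI, mem_Ioc, mem_Ioc, le_min_iff, le_min_iff, Nat.le_div_iff_mul_le hp1.2.2.pos, Nat.le_div_iff_mul_le hp2.2.2.pos,
        mul_comm n p1, mul_comm n p2]
      tauto
    rw [hfil]
    have hle : ∀ p, p ≤ V → p.Prime → 2 ^ i - 1 ≤ N / p := by
      intro p hp hpp; rw [Nat.le_div_iff_mul_le hpp.pos]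
      have : 2 ^ i * p ≤ N := (Nat.mul_le_mul_left _ hp).trans (Nat.mul_div_le N (2 ^ i))
      exact (Nat.mul_le_mul_right p (Nat.sub_le _ _)).trans this
    have hN12 : 2 ^ i - 1 ≤ min (2 ^ (i + 1) - 1) (min (N / p1) (N / p2)) := by
      rw [le_min_iff, le_min_iff]
      refine ⟨by rw [pow_succ]; omega, hle p1 hp1.2.1 hp1.2.2, hle p2 hp2.2.1 hp2.2.2⟩
    set N2 := min (2 ^ (i + 1) - 1) (min (N / p1) (N / p2))
    have hnd : ∀ p, z0 < p → p.Prime → ∀ q ∈ Q, ¬ q ∣ p := by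
      intro p hp hpp q hq hqp
      have hq' := mem_primesLE.1 (hQ hq)
      have := (Nat.prime_dvd_prime_iff_eq hq'.2 hpp).1 hqp; omega
    refine (h4 z hzz (2 ^ i - 1) N2 hN12 Q v a p1 p2 hQ hv fun q hq => ⟨hnd p1 hp1.1 hp1.2.2 q hq, hnd p2 hp2.1 hp2.2.2 q hq⟩).trans ?_
    have hlen : (N2 : ℝ) - ((2 ^ i - 1 : ℕ) : ℝ) ≤ M := by
      have : (N2 : ℝ) ≤ ((2 ^ (i + 1) - 1 : ℕ) : ℝ) := by exact_mod_cast min_le_left _ _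
      rw [Nat.cast_sub (by rw [pow_succ]; omega)] at this; rw [Nat.cast_sub hpow]
      push_cast at this ⊢; rw [pow_succ] at this
      rw [hM]; linarith
    have hYle : YY z z' (X ^ γ) ≤ 2 * C3 / γ' / l := by
      refine (k3 z z' (X ^ γ) hz hzz' hztwo).trans ?_
      have : 2 * C3 / γ' / l = C3 / (γ' / 2 * l) := by field_simp
      rw [this]
      have : 0 < γ' / 2 * l := by positivity
      gcongr
    have hsum0 : 0 ≤ ∑ q ∈ Q, (4 / ((q : ℝ) - 1) ^ 2 + (if p1 % q = p2 % q then 4 / ((q : ℝ) - 1) else 0)) := by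
      apply sum_nonneg; intro q hq
      have hq1 : (1 : ℝ) < q := by exact_mod_cast (mem_primesLE.1 (hQ hq)).2.one_lt
      have : 0 < (q : ℝ) - 1 := by linarith
      split_ifs <;> positivity
    have e48 : ((N2 : ℝ) - ((2 ^ i - 1 : ℕ) : ℝ)) / l ^ 48 ≤ M / l ^ 2 := by
      gcongr; norm_num
    have e5 : X ^ (5 * γ) ≤ M / l ^ 2 * 2 := by
      rw [div_mul_eq_mul_div, le_div_iff₀ (by positivity)]; linarith
    have e6 : ((N2 : ℝ) - ((2 ^ i - 1 : ℕ) : ℝ)) * YY z z' (X ^ γ) ≤ (2 * C3 / γ') * (M / l) := by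
      calc _ ≤ M * (2 * C3 / γ' / l) := mul_le_mul hlen hYle (YY_nonneg _ _ _) hM0.le
        _ = _ := by ring
    have e7 := mul_le_mul_of_nonneg_right e6 hsum0; linarith
  have hdouble : ∑ p1 ∈ PZ z0 V, ∑ p2 ∈ PZ z0 V, log p1 * log p2 *
      ‖∑ n ∈ I with p1 * n ≤ N ∧ p2 * n ≤ N, (wt z z' (X ^ γ) n : ℂ) *
        ((Hm Q v (a * p1) n - phi Q v a) * (starRingEnd ℂ) (Hm Q v (a * p2) n - phi Q v a))‖ ≤
      K * (M * V ^ 2 / l * (1 / W + 1 / l)) := by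
    have e1 := h3 z hz hzz z0 hz0z' V hVle Q hQ W hW hWq
    have hT := sum_log_PZ_le z0 V
    calc _ ≤ ∑ p1 ∈ PZ z0 V, ∑ p2 ∈ PZ z0 V, ((2 * C3 / γ') * (M / l) * (log p1 * log p2 *
          ∑ q ∈ Q, (4 / ((q : ℝ) - 1) ^ 2 + (if p1 % q = p2 % q then 4 / ((q : ℝ) - 1) else 0)))
          + 12 * (M / l ^ 2) * (log p1 * log p2)) := by
          refine sum_le_sum fun p1 hp1 => sum_le_sum fun p2 hp2 => ?_
          have := mul_le_mul_of_nonneg_left (hpairs p1 hp1 p2 hp2) (show 0 ≤ log p1 * log p2 by positivity)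
          refine this.trans (le_of_eq (by ring))
      _ = (2 * C3 / γ') * (M / l) * (∑ p1 ∈ PZ z0 V, ∑ p2 ∈ PZ z0 V, log p1 * log p2 *
          ∑ q ∈ Q, (4 / ((q : ℝ) - 1) ^ 2 + (if p1 % q = p2 % q then 4 / ((q : ℝ) - 1) else 0)))
          + 12 * (M / l ^ 2) * ((∑ p ∈ PZ z0 V, log p) * (∑ p ∈ PZ z0 V, log p)) := by
          rw [sum_mul_sum]; simp only [sum_add_distrib, mul_sum]
      _ ≤ (2 * C3 / γ') * (M / l) * (C2 * ((V : ℝ) ^ 2 / W) + C2 * (V * (V / l)))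
          + 12 * (M / l ^ 2) * ((2 * V) * (2 * V)) := by
          have e2 : X ^ (6 * γ) * l ≤ V / l := by rw [le_div_iff₀ (by linarith)]; nlinarith
          have e3 : C2 * (V * (X ^ (6 * γ) * l)) ≤ C2 * (V * (V / l)) := by gcongr
          gcongr; linarith
      _ = (2 * C3 / γ' * C2) * (M * V ^ 2 / l * (1 / W + 1 / l)) + 48 * (M * V ^ 2 / l * (1 / l)) := by
          have hl0 : l ≠ 0 := by linarith
          have hW0 : (W : ℝ) ≠ 0 := by positivity
          field_simp; ring
      _ ≤ _ := by
          rw [hK]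
          have p1 : 0 ≤ M * V ^ 2 / l * (1 / W) := by positivity
          have p2 : 0 ≤ (2 * C3 / γ' * C2) * (M * V ^ 2 / l * (1 / W + 1 / l)) := by positivity
          rw [mul_add (M * (V : ℝ) ^ 2 / l)] at p2 ⊢; linarith
  have hfin : ‖∑ n ∈ S, ∑ p ∈ PZ z0 V with p * n ≤ N, (log p : ℂ) * (Hm Q v (a * p) n - phi Q v a)‖ ^ 2 ≤
      (√((C1 + 16) * K) * (N / l) * √(1 / W + 1 / l)) ^ 2 := by
    rw [mul_pow, mul_pow, sq_sqrt (by positivity), sq_sqrt (by positivity)]; refine hcs.trans ?_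
    calc _ ≤ (C1 + 16) * (M / l) * (K * (M * V ^ 2 / l * (1 / W + 1 / l))) :=
          mul_le_mul hcard hdouble (by
            apply sum_nonneg; intro p1 _; apply sum_nonneg; intro p2 _; positivity) (by positivity)
      _ = (C1 + 16) * K * (M * V / l) ^ 2 * (1 / W + 1 / l) := by field_simp
      _ ≤ _ := by gcongr
  exact (abs_le_of_sq_le_sq' hfin hRHS).2

/-- Integers in `(0, N]` free of prime factors up to `z`. -/
def Rgh (z N : ℕ) : Finset ℕ := (Ioc 0 N).filter fun n => ∀ p ∈ primesLE z, ¬ p ∣ n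

lemma mem_Rgh {z N n : ℕ} : n ∈ Rgh z N ↔ (0 < n ∧ n ≤ N) ∧ ∀ p ∈ primesLE z, ¬ p ∣ n := by unfold Rgh; rw [mem_filter, mem_Ioc]

lemma lt_of_mem_Rgh {z N n p : ℕ} (hn : n ∈ Rgh z N) (hp : p.Prime) (hpn : p ∣ n) : z < p := by
  by_contra h
  exact (mem_Rgh.1 hn).2 p (mem_primesLE.2 ⟨by omega, hp⟩) hpn

lemma PZ_subset_Rgh (z N : ℕ) : PZ z N ⊆ Rgh z N := by
  intro p hp
  rw [mem_PZ] at hp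
  rw [mem_Rgh]
  refine ⟨⟨hp.2.2.pos, hp.2.1⟩, fun r hr hrp => ?_⟩
  rw [mem_primesLE] at hr
  have := (Nat.prime_dvd_prime_iff_eq hr.2 hp.2.2).1 hrp
  omega

lemma typeI_bound : ∃ C > 0, ∀ (γ γ' : ℝ), 0 < γ' → 2 * γ' ≤ γ → γ ≤ 1 → ∀ᶠ X : ℝ in atTop, ∀ z : ℕ,
    2 ≤ z → (z : ℝ) ≤ zz X → ∀ N : ℕ, ∀ (Q : Finset ℕ) (v : ℕ → ℂ) (a : ℕ), Q ⊆ primesLE z →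
    (∀ q ∈ Q, ‖v q‖ ≤ 1) →
    ‖∑ n ∈ Rgh ⌊X ^ γ'⌋₊ N, (Hm Q v a n - phi Q v a)‖
      ≤ C * (γ' / γ ^ 2) * (N / log X) + 2 * (N / log X ^ 48) + 34 * X ^ (5 * γ + γ') := by
  obtain ⟨C, hC, h⟩ := wt_nonrough
  refine ⟨2 * C, by positivity, ?_⟩
  intro γ γ' hγ' h2 h1
  filter_upwards [h γ γ' hγ' h2 h1, corr_single γ γ' hγ' h2 h1, eventually_params γ γ' hγ' h2 h1] with X hX hX2 hpar
  obtain ⟨hX2', hXγ, hzzX, hfl, -, -, -, hl1⟩ := hpar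
  intro z hz hzz N Q v a hQ hv
  have hQp : ∀ q ∈ Q, q.Prime := fun q hq => (mem_primesLE.1 (hQ hq)).2
  have hzz' : z ≤ ⌊X ^ γ'⌋₊ := le_floor (hzz.trans hzzX)
  set z' := ⌊X ^ γ'⌋₊
  have e1 := hX z hz hzz 0 N (Nat.zero_le _)
  have e2 := hX2 z hzz 0 N (Nat.zero_le _) Q v a hQ hv
  rw [Nat.cast_zero, sub_zero] at e1 e2
  set g : ℕ → ℂ := fun n => Hm Q v a n - phi Q v a
  have hg2 : ∀ n, ‖g n‖ ≤ 2 := by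
    intro n; refine (norm_sub_le _ _).trans ?_
    have := norm_Hm_le_one Q v hv a n
    have := norm_phi_le_one Q hQp v hv a; linarith
  have hsplit : ∑ n ∈ Ioc 0 N, (wt z z' (X ^ γ) n : ℂ) * g n = ∑ n ∈ Rgh z' N, g n +
      ∑ n ∈ Ioc 0 N with ∃ p ∈ primesLE z', p ∣ n, (wt z z' (X ^ γ) n : ℂ) * g n := by
    rw [← sum_filter_add_sum_filter_not (Ioc 0 N) (fun n => ∀ p ∈ primesLE z', ¬ p ∣ n)]
    congr 1
    · unfold Rgh; refine sum_congr rfl fun n hn => ?_; rw [mem_filter] at hn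
      rw [wt_eq_one z z' _ n hzz' fun p hp hpz => hn.2 p (mem_primesLE.2 ⟨hpz, hp⟩)]; simp
    · refine sum_congr ?_ fun _ _ => rfl
      ext n; simp
  have hnon : ‖∑ n ∈ Ioc 0 N with ∃ p ∈ primesLE z', p ∣ n, (wt z z' (X ^ γ) n : ℂ) * g n‖ ≤
      2 * (C * (γ' / γ ^ 2) * (N / log X) + 16 * X ^ (5 * γ + γ')) := by
    refine (norm_sum_le _ _).trans ?_
    refine le_trans ?_ (mul_le_mul_of_nonneg_left e1 (by norm_num)); rw [mul_sum]; refine sum_le_sum fun n _ => ?_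
    rw [norm_mul, norm_real, norm_of_nonneg (wt_nonneg _ _ _ _), mul_comm]
    exact mul_le_mul_of_nonneg_right (hg2 n) (wt_nonneg _ _ _ _)
  have : ∑ n ∈ Rgh z' N, g n = ∑ n ∈ Ioc 0 N, (wt z z' (X ^ γ) n : ℂ) * g n -
      ∑ n ∈ Ioc 0 N with ∃ p ∈ primesLE z', p ∣ n, (wt z z' (X ^ γ) n : ℂ) * g n := by rw [hsplit]; ring
  rw [this]
  refine (norm_sub_le _ _).trans ((add_le_add e2 hnon).trans ?_)
  have : X ^ (5 * γ) ≤ X ^ (5 * γ + γ') := rpow_le_rpow_of_exponent_le (by linarith) (by linarith)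
  linarith

lemma sum_Rgh_primeFactors {M : Type*} [AddCommMonoid M] (z N : ℕ) (F : ℕ → ℕ → M) :
    ∑ m ∈ Rgh z N, ∑ p ∈ m.primeFactors, F p (m / p) = ∑ n ∈ Rgh z N, ∑ p ∈ PZ z (N / n), F p n := by
  rw [sum_sigma', sum_sigma']
  refine sum_bij' (fun x _ => ⟨x.1 / x.2, x.2⟩) (fun y _ => ⟨y.2 * y.1, y.2⟩) ?_ ?_ ?_ ?_ ?_
  · rintro ⟨m, p⟩ h
    rw [mem_sigma] at h ⊢
    obtain ⟨hm, hp⟩ := h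
    dsimp only at hm hp ⊢
    have hpp := prime_of_mem_primeFactors hp
    have hpm := dvd_of_mem_primeFactors hp
    have hm' := mem_Rgh.1 hm
    have hpos : 0 < m / p := Nat.div_pos (le_of_dvd hm'.1.1 hpm) hpp.pos; constructor
    · rw [mem_Rgh]
      exact ⟨⟨hpos, (Nat.div_le_self _ _).trans hm'.1.2⟩, fun r hr hrm => hm'.2 r hr (hrm.trans (Nat.div_dvd_of_dvd hpm))⟩
    · rw [mem_PZ]; refine ⟨lt_of_mem_Rgh hm hpp hpm, ?_, hpp⟩; rw [Nat.le_div_iff_mul_le hpos, mul_div_cancel' hpm]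
      exact hm'.1.2
  · rintro ⟨n, p⟩ h
    rw [mem_sigma] at h ⊢
    obtain ⟨hn, hp⟩ := h
    dsimp only at hn hp ⊢
    rw [mem_PZ] at hp
    have hn' := mem_Rgh.1 hn
    have hpn : p * n ≤ N := (Nat.le_div_iff_mul_le hn'.1.1).1 hp.2.1
    have hpos : 0 < p * n := Nat.mul_pos hp.2.2.pos hn'.1.1; constructor
    · rw [mem_Rgh]; refine ⟨⟨hpos, hpn⟩, fun r hr hrm => ?_⟩
      have hr' := mem_primesLE.1 hr
      rcases (hr'.2.dvd_mul).1 hrm with h1 | h1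
      · have := (Nat.prime_dvd_prime_iff_eq hr'.2 hp.2.2).1 h1; omega
      · exact hn'.2 r hr h1
    · exact mem_primeFactors.2 ⟨hp.2.2, dvd_mul_right _ _, hpos.ne'⟩
  · rintro ⟨m, p⟩ h; rw [mem_sigma] at h
    have hpm := dvd_of_mem_primeFactors h.2; simp only [mul_div_cancel' hpm]
  · rintro ⟨n, p⟩ h; rw [mem_sigma, mem_PZ] at h; simp only [Nat.mul_div_cancel_left n h.2.2.2.pos]
  · rintro ⟨m, p⟩ _; rfl

lemma sum_Rgh_dyadic {M : Type*} [AddCommMonoid M] (z N : ℕ) (F : ℕ → M) (hF : ∀ n, N < n → F n = 0) (hN : 1 ≤ N) :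
    ∑ n ∈ Rgh z N, F n = F 1 + ∑ i ∈ range (Nat.log 2 N + 1),
      ∑ n ∈ Ico (2 ^ i) (2 ^ (i + 1)) with 1 < n ∧ ∀ p ∈ primesLE z, ¬ p ∣ n, F n := by
  have h1 : 1 ∈ Rgh z N := by
    rw [mem_Rgh]; refine ⟨⟨one_pos, hN⟩, fun p hp h => ?_⟩; exact (mem_primesLE.1 hp).2.one_lt.ne' (dvd_one.1 h)
  rw [← add_sum_erase _ _ h1]
  congr 1
  rw [← sum_fiberwise_of_maps_to (g := Nat.log 2) (t := range (Nat.log 2 N + 1))]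
  · refine sum_congr rfl fun i _ => ?_; apply sum_subset
    · intro n hn; rw [mem_filter, mem_erase, mem_Rgh] at hn
      obtain ⟨⟨hn1, hn2, hn3⟩, hn4⟩ := hn; rw [mem_filter, mem_Ico]
      have hn0 : n ≠ 0 := by omega
      rw [← hn4]
      exact ⟨⟨Nat.pow_log_le_self 2 hn0, Nat.lt_pow_succ_log_self (by norm_num) n⟩, by omega, hn3⟩
    · intro n hn hn'; rw [mem_filter, mem_Ico] at hn; apply hF
      by_contra hnN
      apply hn'; rw [mem_filter, mem_erase, mem_Rgh]
      exact ⟨⟨by omega, ⟨by omega, by omega⟩, hn.2.2⟩, Nat.log_eq_of_pow_le_of_lt_pow hn.1.1 hn.1.2⟩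
  · intro n hn; rw [mem_erase, mem_Rgh] at hn; rw [mem_range]
    have := Nat.log_mono_right (b := 2) hn.2.1.2; omega

lemma card_Rgh_not_squarefree_le (z N : ℕ) (hz : 1 ≤ z) :
    (((Rgh z N).filter fun n => ¬ Squarefree n).card : ℝ) ≤ N / z := by
  have hsub : (Rgh z N).filter (fun n => ¬ Squarefree n) ⊆ (PZ z N).biUnion fun p => (Ioc 0 N).filter fun n => p ^ 2 ∣ n := by
    intro n hn; rw [mem_filter] at hn
    obtain ⟨hn1, hn2⟩ := hn; rw [Nat.squarefree_iff_prime_squarefree] at hn2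
    push Not at hn2
    obtain ⟨p, hp, hpn⟩ := hn2
    have hn' := mem_Rgh.1 hn1; rw [mem_biUnion]
    refine ⟨p, mem_PZ.2 ⟨lt_of_mem_Rgh hn1 hp ((dvd_mul_right p p).trans hpn), ?_, hp⟩, ?_⟩
    · exact (le_of_dvd hn'.1.1 ((dvd_mul_right p p).trans hpn)).trans hn'.1.2
    · rw [mem_filter, mem_Ioc, pow_two]; exact ⟨hn'.1, hpn⟩
  have h1 : (((Rgh z N).filter fun n => ¬ Squarefree n).card : ℝ) ≤ ∑ p ∈ PZ z N, ((N / p ^ 2 : ℕ) : ℝ) := by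
    have := (card_le_card hsub).trans card_biUnion_le; simp only [Nat.Ioc_filter_dvd_card_eq_div] at this
    exact_mod_cast this
  refine h1.trans ?_
  have h2 := sum_inv_mul_pred_le (PZ z N) z hz (fun q hq => (mem_PZ.1 hq).1)
  calc ∑ p ∈ PZ z N, ((N / p ^ 2 : ℕ) : ℝ) ≤ ∑ p ∈ PZ z N, N * (1 / ((p : ℝ) * ((p : ℝ) - 1))) := by
        refine sum_le_sum fun p hp => ?_
        have hp1 : (1 : ℝ) < p := by exact_mod_cast (PZ_prime hp).one_lt
        refine Nat.cast_div_le.trans ?_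
        rw [mul_one_div]; push_cast; gcongr; nlinarith
    _ ≤ N * (1 / z) := by rw [← mul_sum]; gcongr
    _ = _ := by ring

lemma sum_log_primeFactors_nonneg (m : ℕ) : 0 ≤ ∑ p ∈ m.primeFactors, log p :=
  sum_nonneg fun p _ => by positivity

lemma sum_log_primeFactors_eq (m : ℕ) (hm : Squarefree m) : ∑ p ∈ m.primeFactors, log p = log m := by
  conv_rhs => rw [← Nat.prod_primeFactors_of_squarefree hm]
  push_cast
  rw [log_prod]
  intro p hp
  exact_mod_cast (prime_of_mem_primeFactors hp).ne_zero

lemma sum_log_primeFactors_le (m : ℕ) (hm : 0 < m) : ∑ p ∈ m.primeFactors, log p ≤ log m := by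
  rw [← log_prod]
  · apply log_le_log
    · apply prod_pos; intro p hp; exact_mod_cast (prime_of_mem_primeFactors hp).pos
    · have := le_of_dvd hm (Nat.prod_primeFactors_dvd m); rw [← Nat.cast_prod]; exact Nat.cast_le.2 this
  · intro p hp; exact_mod_cast (prime_of_mem_primeFactors hp).ne_zero

lemma rough_log_sum_le (z N : ℕ) (hz : 1 ≤ z) (hN : 1 ≤ N) (T : ℝ) (hT : 1 ≤ T) :
    ∑ m ∈ Rgh z N, (log N - ∑ p ∈ m.primeFactors, log p) ≤
      log T * (Rgh z N).card + log N * (N / T + N / z) := by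
  have hlN : 0 ≤ log N := by positivity
  have hlT : 0 ≤ log T := log_nonneg hT
  have hN0 : (0 : ℝ) < N := by exact_mod_cast hN
  have hterm : ∀ m ∈ Rgh z N, log N - ∑ p ∈ m.primeFactors, log p ≤
      log T + ((if (m : ℝ) ≤ N / T then log N else 0) + (if ¬ Squarefree m then log N else 0)) := by
    intro m hm
    have hm' := mem_Rgh.1 hm
    have hm0 : (0 : ℝ) < m := by exact_mod_cast hm'.1.1
    have h0 := sum_log_primeFactors_nonneg m
    by_cases h1 : (m : ℝ) ≤ N / T
    · rw [if_pos h1]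
      split_ifs <;> linarith
    · by_cases h2 : Squarefree m
      · rw [if_neg h1, if_neg (not_not.2 h2), sum_log_primeFactors_eq m h2]
        push Not at h1
        have : (N : ℝ) ≤ T * m := by rw [div_lt_iff₀ (by linarith)] at h1; linarith
        have := log_le_log hN0 this; rw [log_mul (by linarith) hm0.ne'] at this; linarith
      · rw [if_neg h1, if_pos h2]; linarith
  refine (sum_le_sum hterm).trans ?_
  rw [sum_add_distrib, sum_add_distrib, sum_const, nsmul_eq_mul, ← sum_filter, ← sum_filter, sum_const, sum_const,
    nsmul_eq_mul, nsmul_eq_mul]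
  have h1 : (((Rgh z N).filter fun m : ℕ => (m : ℝ) ≤ N / T).card : ℝ) ≤ N / T := by
    have hs : (Rgh z N).filter (fun m : ℕ => (m : ℝ) ≤ N / T) ⊆ Ioc 0 ⌊(N : ℝ) / T⌋₊ := by
      intro m hm; rw [mem_filter, mem_Rgh] at hm; rw [mem_Ioc]; exact ⟨hm.1.1.1, le_floor hm.2⟩
    have := card_le_card hs; rw [Nat.card_Ioc] at this
    have h3 : (((Rgh z N).filter fun m : ℕ => (m : ℝ) ≤ N / T).card : ℝ) ≤ (⌊(N : ℝ) / T⌋₊ : ℝ) := by exact_mod_cast this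
    exact h3.trans (floor_le (by positivity))
  have h2 := card_Rgh_not_squarefree_le z N hz
  nlinarith

/-- The log-weighted identity isolating primes among rough integers. -/
lemma log_mul_norm_sum_primes_le (z N : ℕ) (hN : 1 ≤ N) (g : ℕ → ℂ) (hg : ∀ n, ‖g n‖ ≤ 2) (T2 : ℝ)
    (hT2 : ‖∑ i ∈ range (Nat.log 2 N + 1), ∑ n ∈ Ico (2 ^ i) (2 ^ (i + 1)) with 1 < n ∧ ∀ p ∈ primesLE z, ¬ p ∣ n,
      ∑ p ∈ PZ z (N / n), (log p : ℂ) * g (p * n)‖ ≤ T2) :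
    log N * ‖∑ p ∈ PZ z N, g p‖ ≤ 4 * ∑ m ∈ Rgh z N, (log N - ∑ p ∈ m.primeFactors, log p)
      + log N * ‖∑ n ∈ Rgh z N, g n‖ + T2 := by
  set lam : ℕ → ℝ := fun m => ∑ p ∈ m.primeFactors, log p with hlam
  have hd : ∀ m ∈ Rgh z N, 0 ≤ log N - lam m := by
    intro m hm
    have hm' := mem_Rgh.1 hm
    have h1 := sum_log_primeFactors_le m hm'.1.1
    have h2 : log m ≤ log N := log_le_log (by exact_mod_cast hm'.1.1) (by exact_mod_cast hm'.1.2)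
    simp only [hlam]; linarith
  have hreo : ∑ m ∈ Rgh z N, (lam m : ℂ) * g m = ∑ p ∈ PZ z N, (log p : ℂ) * g p +
      ∑ i ∈ range (Nat.log 2 N + 1), ∑ n ∈ Ico (2 ^ i) (2 ^ (i + 1)) with 1 < n ∧ ∀ p ∈ primesLE z, ¬ p ∣ n,
      ∑ p ∈ PZ z (N / n), (log p : ℂ) * g (p * n) := by
    have e1 : ∑ m ∈ Rgh z N, (lam m : ℂ) * g m = ∑ m ∈ Rgh z N, ∑ p ∈ m.primeFactors, (log p : ℂ) * g (p * (m / p)) := by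
      refine sum_congr rfl fun m _ => ?_; simp only [hlam]; push_cast; rw [sum_mul]; refine sum_congr rfl fun p hp => ?_
      rw [mul_div_cancel' (dvd_of_mem_primeFactors hp)]
    rw [e1, sum_Rgh_primeFactors z N (fun p n => (log p : ℂ) * g (p * n)), sum_Rgh_dyadic z N _ _ hN]
    · simp only [mul_one, Nat.div_one]
    · intro n hn; rw [Nat.div_eq_of_lt hn]
      have : PZ z 0 = ∅ := by
        rw [eq_empty_iff_forall_notMem]; intro p hp; rw [mem_PZ] at hp
        have := hp.2.2.pos; omega
      rw [this, sum_empty]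
  set TT := ∑ i ∈ range (Nat.log 2 N + 1), ∑ n ∈ Ico (2 ^ i) (2 ^ (i + 1)) with 1 < n ∧ ∀ p ∈ primesLE z, ¬ p ∣ n,
      ∑ p ∈ PZ z (N / n), (log p : ℂ) * g (p * n)
  have hpr : ∀ p ∈ PZ z N, lam p = log p := by
    intro p hp; simp only [hlam, (PZ_prime hp).primeFactors, sum_singleton]
  have hid : (log N : ℂ) * ∑ p ∈ PZ z N, g p = ∑ p ∈ PZ z N, ((log N - lam p : ℝ) : ℂ) * g p
      + (log N : ℂ) * ∑ m ∈ Rgh z N, g m - ∑ m ∈ Rgh z N, ((log N - lam m : ℝ) : ℂ) * g m - TT := by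
    have e1 : ∑ p ∈ PZ z N, ((log N - lam p : ℝ) : ℂ) * g p = (log N : ℂ) * ∑ p ∈ PZ z N, g p - ∑ p ∈ PZ z N, (log p : ℂ) * g p := by
      rw [mul_sum, ← sum_sub_distrib]; refine sum_congr rfl fun p hp => ?_
      rw [hpr p hp]; push_cast; ring
    have e2 : ∑ m ∈ Rgh z N, ((log N - lam m : ℝ) : ℂ) * g m = (log N : ℂ) * ∑ p ∈ Rgh z N, g p - ∑ m ∈ Rgh z N, (lam m : ℂ) * g m := by
      rw [mul_sum, ← sum_sub_distrib]; refine sum_congr rfl fun p hp => ?_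
      push_cast; ring
    rw [e1, e2, hreo]; ring
  have hb : ∀ S ⊆ Rgh z N, ‖∑ m ∈ S, ((log N - lam m : ℝ) : ℂ) * g m‖ ≤ 2 * ∑ m ∈ Rgh z N, (log N - lam m) := by
    intro S hS; refine (norm_sum_le _ _).trans ?_; rw [mul_sum]
    refine (sum_le_sum (g := fun m => 2 * (log N - lam m)) fun m hm => ?_).trans
      (sum_le_sum_of_subset_of_nonneg hS fun m hm _ => mul_nonneg (by norm_num) (hd m hm))
    rw [norm_mul, norm_real, norm_of_nonneg (hd m (hS hm)), mul_comm]
    exact mul_le_mul_of_nonneg_right (hg m) (hd m (hS hm))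
  have hl0 : 0 ≤ log N := by positivity
  have : log N * ‖∑ p ∈ PZ z N, g p‖ = ‖(log N : ℂ) * ∑ p ∈ PZ z N, g p‖ := by rw [norm_mul, norm_real, norm_of_nonneg hl0]
  rw [this, hid]
  have b1 := hb _ (PZ_subset_Rgh z N)
  have b2 := hb _ (Subset.refl _)
  have b3 : ‖(log N : ℂ) * ∑ m ∈ Rgh z N, g m‖ = log N * ‖∑ n ∈ Rgh z N, g n‖ := by rw [norm_mul, norm_real, norm_of_nonneg hl0]
  refine (norm_sub_le _ _).trans ?_
  refine (add_le_add_left ((norm_sub_le _ _).trans (add_le_add_left (norm_add_le _ _) _)) _).trans ?_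
  linarith

lemma eventually_log_le_zz : ∀ᶠ X : ℝ in atTop, log X ≤ zz X := by
  have h1 : ∀ᶠ L : ℝ in atTop, L ^ 3 ≤ exp L := by
    filter_upwards [eventually_ge_atTop 1, (tendsto_exp_div_pow_atTop 3).eventually_ge_atTop 1] with L hL h
    rw [le_div_iff₀ (by positivity)] at h; linarith
  filter_upwards [tendsto_LL.eventually h1, tendsto_LL.eventually_ge_atTop 1, tendsto_log_atTop.eventually_ge_atTop 1] with X hX h2 h3
  unfold zz
  set L := log (log X) with hL
  rw [exp_log (by linarith)] at hX
  refine (log_le_iff_le_exp (by linarith)).1 ?_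
  rw [← hL, le_div_iff₀ (by positivity)]
  have : √L ≤ L := by rw [sqrt_le_left (by linarith)]; nlinarith
  calc L * (L * √L) ≤ L * (L * L) := by gcongr
    _ ≤ _ := by linarith

lemma card_Rgh_le (γ γ' : ℝ) (hγ' : 0 < γ') (h2 : 2 * γ' ≤ γ) (h1 : γ ≤ 1) : ∃ C > 0, ∀ᶠ X : ℝ in atTop,
    ∀ N : ℕ, ((Rgh ⌊X ^ γ'⌋₊ N).card : ℝ) ≤ C * (N / log X) + 16 * X ^ (5 * γ) := by
  obtain ⟨C, hC, h⟩ := wt_sum_le γ γ' hγ' h2 h1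
  refine ⟨C, hC, ?_⟩
  filter_upwards [h, eventually_params γ γ' hγ' h2 h1, eventually_log_le_zz, tendsto_log_atTop.eventually_ge_atTop 2] with X hX hpar hzl hl2
  obtain ⟨hX2', hXγ, hzzX, hfl, -, -, hfl2, hl1⟩ := hpar
  intro N
  have := hX 2 le_rfl (by exact_mod_cast hl2.trans hzl) 0 N (Nat.zero_le _)
  rw [Nat.cast_zero, sub_zero] at this
  refine le_trans ?_ this
  rw [card_eq_sum_ones]
  push_cast
  refine (sum_le_sum fun n hn => ?_).trans (sum_le_sum_of_subset_of_nonneg (filter_subset _ _) fun n _ _ => wt_nonneg _ _ _ _)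
  rw [wt_eq_one 2 _ _ n hfl2]
  intro p hp hpz
  exact (mem_Rgh.1 hn).2 p (mem_primesLE.2 ⟨hpz, hp⟩)

lemma norm_Hm_sub_phi_le_two (Q : Finset ℕ) (hQ : ∀ q ∈ Q, q.Prime) (v : ℕ → ℂ) (hv : ∀ q ∈ Q, ‖v q‖ ≤ 1) (a n : ℕ) :
    ‖Hm Q v a n - phi Q v a‖ ≤ 2 := by
  have h1 := norm_Hm_le_one Q v hv a n
  have h2 := norm_phi_le_one Q hQ v hv a
  linarith [norm_sub_le (Hm Q v a n) (phi Q v a)]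

set_option maxHeartbeats 1600000 in
theorem prime_thm (η δ : ℝ) (hη : 0 < η) (hη1 : η ≤ 1) (hδ : 0 < δ) : ∃ W0 : ℕ, 1 ≤ W0 ∧ ∀ᶠ X : ℝ in atTop,
    ∀ z : ℕ, 2 ≤ z → (z : ℝ) ≤ zz X → ∀ Q ⊆ primesLE z, ∀ v : ℕ → ℂ, (∀ q ∈ Q, ‖v q‖ ≤ 1) →
    (∀ q ∈ Q, W0 < q) → ∀ a N : ℕ, (N : ℝ) ≤ X → X ^ η ≤ N →
    ‖∑ p ∈ primesLE N, (Hm Q v a p - phi Q v a)‖ ≤ δ * (N / log X) := by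
  obtain ⟨C0, hC0, hI⟩ := typeI_bound
  obtain ⟨d, hd⟩ : ∃ d, d = δ / 12 := ⟨_, rfl⟩
  have hd0 : 0 < d := by rw [hd]; positivity
  obtain ⟨ε, hε0, hε1, hε2⟩ : ∃ ε : ℝ, 0 < ε ∧ ε ≤ η / 24 ∧ C0 * (ε / (η / 12) ^ 2) ≤ d := by
    refine ⟨min (η / 24) (d * (η / 12) ^ 2 / C0), by positivity, min_le_left _ _, ?_⟩
    calc _ ≤ C0 * ((d * (η / 12) ^ 2 / C0) / (η / 12) ^ 2) := by gcongr; exact min_le_right _ _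
      _ = d := by field_simp
  obtain ⟨C1, hC1, hR⟩ := card_Rgh_le (η / 12) ε hε0 (by linarith) (by linarith)
  obtain ⟨C3, hC3, hB⟩ := block_bound (ε / 8) (ε / 16) ε (by linarith) (by linarith) (by linarith) (by linarith)
  obtain ⟨W0, hW0⟩ := exists_nat_ge (2 * (3 * C3 / d) ^ 2 + 1)
  have hW1 : (1 : ℝ) ≤ W0 := by have := sq_nonneg (3 * C3 / d); linarith
  refine ⟨W0, by exact_mod_cast hW1, ?_⟩
  filter_upwards [hI (η / 12) ε hε0 (by linarith) (by linarith), hR, hB,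
    eventually_params (η / 12) ε hε0 (by linarith) (by linarith),
    eventually_LL_le (d * η / (8 * C1)) (by positivity), eventually_LL_le 1 one_pos,
    eventually_log_pow_le ((128 / η + 34) / d) 1 (η / 2) (by positivity),
    eventually_log_pow_le 2 2 ε hε0,
    tendsto_log_atTop.eventually_ge_atTop (4 / d), tendsto_log_atTop.eventually_ge_atTop (W0 : ℝ),
    tendsto_log_atTop.eventually_ge_atTop (1 / η)] with X kI kR kB hpar hLL1 hLL2 hp1 hp2 hl4 hlW hlη
  obtain ⟨hX2, hXγ, hzzX, hfl, -, -, hfl2, hl1⟩ := hpar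
  intro z hz hzX Q hQ v hv hQW a N hNX hNη
  set l := log X with hl
  have hX0 : 0 < X := by linarith
  set z0 := ⌊X ^ ε⌋₊
  have hN0 : (0 : ℝ) < N := lt_of_lt_of_le (rpow_pos_of_pos hX0 _) hNη
  have hN1 : 1 ≤ N := by exact_mod_cast hN0
  have hlN : η * l ≤ log N := by rw [hl, ← log_rpow hX0]; exact log_le_log (by positivity) hNη
  have hlN1 : 1 ≤ log N := by
    refine le_trans ?_ hlN
    rw [div_le_iff₀ hη] at hlη; linarith
  have hl0 : 0 < l := by linarith
  have hQp : ∀ q ∈ Q, q.Prime := fun q hq => (mem_primesLE.1 (hQ hq)).2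
  have hg : ∀ n, ‖Hm Q v a n - phi Q v a‖ ≤ 2 := norm_Hm_sub_phi_le_two Q hQp v hv a
  -- type II
  have hT2 : ‖∑ i ∈ range (Nat.log 2 N + 1), ∑ n ∈ Ico (2 ^ i) (2 ^ (i + 1)) with 1 < n ∧ ∀ p ∈ primesLE z0, ¬ p ∣ n,
      ∑ p ∈ PZ z0 (N / n), (log p : ℂ) * (Hm Q v a (p * n) - phi Q v a)‖ ≤ log N * (d * (N / l)) := by
    have hb : ∀ i ∈ range (Nat.log 2 N + 1), ‖∑ n ∈ Ico (2 ^ i) (2 ^ (i + 1)) with 1 < n ∧ ∀ p ∈ primesLE z0, ¬ p ∣ n,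
      ∑ p ∈ PZ z0 (N / n), (log p : ℂ) * (Hm Q v a (p * n) - phi Q v a)‖ ≤ (N / l) * (d / 3) := by
      intro i _
      have h := kB z hz hzX Q hQ v hv a W0 (by exact_mod_cast hW1) hQW N i hNX
      have hHm : ∀ p n, Hm Q v a (p * n) = Hm Q v (a * p) n := by intro p n; unfold Hm; rw [mul_assoc]
      simp only [hHm]; refine h.trans ?_
      have hs : √(1 / W0 + 1 / l) ≤ d / (3 * C3) := by
        rw [sqrt_le_left (by positivity)]
        have e1 : 1 / l ≤ 1 / W0 := one_div_le_one_div_of_le (by linarith) hlW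
        have e2 : 2 / (W0 : ℝ) ≤ (d / (3 * C3)) ^ 2 := by
          rw [div_le_iff₀ (by linarith)]
          have : 2 * (3 * C3 / d) ^ 2 ≤ W0 := by linarith
          calc (2 : ℝ) = (d / (3 * C3)) ^ 2 * (2 * (3 * C3 / d) ^ 2) := by field_simp
            _ ≤ _ := by gcongr
        have e3 : 2 / (W0 : ℝ) = 1 / W0 + 1 / W0 := by ring
        linarith
      calc _ ≤ C3 * (N / l) * (d / (3 * C3)) := by gcongr
        _ = _ := by field_simp
    refine (norm_sum_le _ _).trans ((sum_le_sum hb).trans ?_); rw [sum_const, card_range, nsmul_eq_mul]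
    have hlog : ((Nat.log 2 N + 1 : ℕ) : ℝ) ≤ 3 * log N := by
      have h1 : (Nat.log 2 N : ℝ) * log 2 ≤ log N := by
        rw [← log_pow]; apply log_le_log (by positivity); exact_mod_cast Nat.pow_log_le_self 2 (by omega)
      have := log_two_gt_d9; push_cast
      have : (Nat.log 2 N : ℝ) ≤ 2 * log N := by
        have h0 : (0 : ℝ) ≤ Nat.log 2 N := by positivity
        nlinarith
      linarith
    calc _ ≤ 3 * log N * (N / l * (d / 3)) := by gcongr
      _ = _ := by ring
  have hmain := log_mul_norm_sum_primes_le z0 N hN1 (fun n => Hm Q v a n - phi Q v a) hg _ hT2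
  have hrl := rough_log_sum_le z0 N (by omega) hN1 (l ^ 2) (by nlinarith)
  have hRN := kR N
  have hTI := kI z hz hzX N Q v a hQ hv
  rw [log_pow] at hrl
  have hpow : X ^ (5 * (η / 12) + ε) ≤ X ^ (η / 2) := rpow_le_rpow_of_exponent_le (by linarith) (by linarith)
  have hpow2 : X ^ (5 * (η / 12)) ≤ X ^ (η / 2) := rpow_le_rpow_of_exponent_le (by linarith) (by linarith)
  have hpow3 : X ^ ε ≤ X ^ (η / 2) := rpow_le_rpow_of_exponent_le (by linarith) (by linarith)
  have hP : (128 / η + 34) * X ^ (η / 2) ≤ d * (N / l) := by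
    have h1 : X ^ (η / 2) * X ^ (η / 2) ≤ N := by rw [← rpow_add hX0]; convert hNη using 2; ring
    rw [pow_one, div_mul_eq_mul_div, div_le_iff₀ hd0] at hp1; rw [mul_div_assoc', le_div_iff₀ hl0]
    have h0 : 0 < X ^ (η / 2) := rpow_pos_of_pos hX0 _
    calc (128 / η + 34) * X ^ (η / 2) * l = ((128 / η + 34) * l) * X ^ (η / 2) := by ring
      _ ≤ X ^ (η / 2) * d * X ^ (η / 2) := by gcongr
      _ = d * (X ^ (η / 2) * X ^ (η / 2)) := by ring
      _ ≤ _ := by gcongr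
  have hz0l : l ^ 2 ≤ z0 := by
    have : X ^ ε < z0 + 1 := lt_floor_add_one _; nlinarith
  have hl2 : N / l ^ 2 ≤ d / 4 * (N / l) := by
    rw [div_le_iff₀ hd0] at hl4; rw [div_le_iff₀ (by positivity)]
    have : d / 4 * (N / l) * l ^ 2 = N * (d * l / 4) := by field_simp
    rw [this]; nlinarith
  have hz0N : N / (z0 : ℝ) ≤ N / l ^ 2 := by gcongr
  have hl48 : N / l ^ 48 ≤ N / l ^ 2 := by
    gcongr; norm_num
  have hPZ : ‖∑ p ∈ PZ z0 N, (Hm Q v a p - phi Q v a)‖ ≤ 6 * d * (N / l) + (128 / η + 34) * X ^ (η / 2) := by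
    have hc : 0 < log N := by linarith
    have hLL0 : 0 ≤ log l := log_nonneg hl1
    have t1 : 2 * log l * (Rgh z0 N).card ≤ log N * (d / 4 * (N / l) + 32 / η * X ^ (η / 2)) := by
      have u1 : 8 * C1 * log l ≤ d * log N := by
        have : log l ≤ d * η / (8 * C1) * l := hLL1; rw [div_mul_eq_mul_div, le_div_iff₀ (by positivity)] at this
        nlinarith
      have u2 : log l ≤ log N / η := by
        rw [le_div_iff₀ hη]
        have : log l ≤ 1 * l := hLL2; nlinarith
      calc _ ≤ 2 * log l * (C1 * (N / l) + 16 * X ^ (5 * (η / 12))) := by gcongr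
        _ ≤ 2 * log l * (C1 * (N / l) + 16 * X ^ (η / 2)) := by gcongr
        _ = (8 * C1 * log l) * (N / l) / 4 + 32 * log l * X ^ (η / 2) := by ring
        _ ≤ (d * log N) * (N / l) / 4 + 32 * (log N / η) * X ^ (η / 2) := by gcongr
        _ = _ := by ring
    have t2 : log N * (N / l ^ 2 + N / z0) ≤ log N * (d / 2 * (N / l)) := by gcongr; linarith
    have t3 : log N * ‖∑ n ∈ Rgh z0 N, (Hm Q v a n - phi Q v a)‖ ≤ log N * (2 * d * (N / l) + 34 * X ^ (η / 2)) := by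
      gcongr
      have : C0 * (ε / (η / 12) ^ 2) * (N / l) ≤ d * (N / l) := by gcongr
      have h3 : 0 ≤ d * (N / l) := by positivity
      linarith
    refine le_of_mul_le_mul_left ?_ hc
    push_cast at hrl
    calc _ ≤ _ := hmain
      _ ≤ 4 * (log N * (d / 4 * (N / l) + 32 / η * X ^ (η / 2)) + log N * (d / 2 * (N / l)))
        + log N * (2 * d * (N / l) + 34 * X ^ (η / 2)) + log N * (d * (N / l)) := by linarith
      _ = _ := by ring
  have hsub : PZ z0 N ⊆ primesLE N := by intro p hp; rw [mem_PZ] at hp; exact mem_primesLE.2 ⟨hp.2.1, hp.2.2⟩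
  rw [← sum_sdiff hsub]
  have hcard : ((primesLE N \ PZ z0 N).card : ℝ) ≤ X ^ (η / 2) := by
    have hs : primesLE N \ PZ z0 N ⊆ primesLE z0 := by
      intro p hp; rw [Finset.mem_sdiff, mem_PZ, mem_primesLE] at hp; rw [mem_primesLE]; refine ⟨?_, hp.1.2⟩
      by_contra h
      exact hp.2 ⟨by omega, hp.1⟩
    have h1 := card_primesLE_le z0 _ hs
    have h2 : (z0 : ℝ) ≤ X ^ ε := floor_le (by positivity)
    have : ((primesLE N \ PZ z0 N).card : ℝ) ≤ z0 := by exact_mod_cast h1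
    linarith
  have hsm : ‖∑ p ∈ primesLE N \ PZ z0 N, (Hm Q v a p - phi Q v a)‖ ≤ 2 * X ^ (η / 2) := by
    refine (norm_sum_le _ _).trans ((sum_le_card_nsmul _ _ 2 fun p _ => hg p).trans ?_)
    rw [nsmul_eq_mul]; linarith
  have hX2' : 2 * X ^ (η / 2) ≤ (128 / η + 34) * X ^ (η / 2) := by
    have : 0 < 128 / η := by positivity
    gcongr; linarith
  refine (norm_add_le _ _).trans ?_
  have : δ = 12 * d := by rw [hd]; ring
  have h3 : 0 ≤ d * (N / l) := by positivity
  rw [this]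
  linarith

lemma es_weighted_le (P : Finset ℕ) (a g : ℕ → ℝ) (ha : ∀ p ∈ P, 0 ≤ a p) (hg : ∀ p ∈ P, 0 ≤ g p) (j : ℕ) :
    ∑ e ∈ P.powersetCard (j + 1), (∑ q ∈ e, g q) * ∏ p ∈ e, a p ≤ (∑ q ∈ P, g q * a q) * es P a j := by
  have h1 : ∑ e ∈ P.powersetCard (j + 1), (∑ q ∈ e, g q) * ∏ p ∈ e, a p =
      ∑ q ∈ P, ∑ e ∈ P.powersetCard (j + 1) with q ∈ e, g q * ∏ p ∈ e, a p := by
    simp_rw [sum_mul]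
    apply sum_comm'; intro e q; rw [mem_filter, mem_powersetCard]; constructor
    · rintro ⟨⟨h1, h2⟩, h3⟩; exact ⟨⟨⟨h1, h2⟩, h3⟩, h1 h3⟩
    · rintro ⟨⟨⟨h1, h2⟩, h3⟩, _⟩; exact ⟨⟨h1, h2⟩, h3⟩
  rw [h1, sum_mul]
  refine sum_le_sum fun q hq => ?_
  set F := (P.powersetCard (j + 1)).filter (fun e => q ∈ e) with hF
  have h2 : ∑ e ∈ F, g q * ∏ p ∈ e, a p = g q * a q * ∑ e ∈ F, ∏ p ∈ e.erase q, a p := by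
    rw [mul_sum]; refine sum_congr rfl fun e he => ?_; rw [hF, mem_filter] at he
    rw [← mul_prod_erase e a he.2, mul_assoc]
  rw [h2]
  have hinj : Set.InjOn (fun e : Finset ℕ => e.erase q) (F : Set (Finset ℕ)) := by
    intro e he e' he' h
    rw [Finset.mem_coe, hF, mem_filter] at he he'; simp only at h; rw [← insert_erase he.2, ← insert_erase he'.2, h]
  have h3 : ∑ e ∈ F, ∏ p ∈ e.erase q, a p = ∑ e ∈ F.image (fun e => e.erase q), ∏ p ∈ e, a p := by rw [sum_image hinj]
  have h4 : ∑ e ∈ F, ∏ p ∈ e.erase q, a p ≤ es P a j := by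
    rw [h3]; unfold es; apply sum_le_sum_of_subset_of_nonneg
    · intro e he; rw [mem_image] at he
      obtain ⟨e', he', rfl⟩ := he
      rw [hF, mem_filter, mem_powersetCard] at he'; rw [mem_powersetCard]; refine ⟨(erase_subset _ _).trans he'.1.1, ?_⟩
      rw [card_erase_of_mem he'.2, he'.1.2]; rfl
    · intro e he _; exact prod_nonneg fun p hp => ha p ((mem_powersetCard.1 he).1 hp)
  exact mul_le_mul_of_nonneg_left h4 (mul_nonneg (hg q hq) (ha q hq))

lemma add_pow_taylor_le (E a : ℝ) (hE : 0 ≤ E) (ha : 0 ≤ a) (n : ℕ) :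
    (E + a) ^ (n + 2) ≤ E ^ (n + 2) + (n + 2) * a * E ^ (n + 1) + (n + 2) * (n + 1) / 2 * a ^ 2 * (E + a) ^ n := by
  induction n with
  | zero => simp; nlinarith
  | succ n ih =>
    have h1 : (E + a) ^ (n + 3) ≤ (E + a) * (E ^ (n + 2) + (n + 2) * a * E ^ (n + 1) + (n + 2) * (n + 1) / 2 * a ^ 2 * (E + a) ^ n) := by
      calc (E + a) ^ (n + 3) = (E + a) * (E + a) ^ (n + 2) := by ring
        _ ≤ _ := by gcongr
    have h2 : E ^ (n + 1) ≤ (E + a) ^ (n + 1) := by gcongr; linarith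
    have h3 : a ^ 2 * (n + 2) * E ^ (n + 1) ≤ a ^ 2 * (n + 2) * (E + a) ^ (n + 1) := by gcongr
    refine h1.trans ?_
    have : (E + a) * (E ^ (n + 2) + (n + 2) * a * E ^ (n + 1) + (n + 2) * (n + 1) / 2 * a ^ 2 * (E + a) ^ n) =
      E ^ (n + 3) + (n + 3) * a * E ^ (n + 2) + a ^ 2 * (n + 2) * E ^ (n + 1) + (n + 2) * (n + 1) / 2 * a ^ 2 * (E + a) ^ (n + 1) := by ring
    rw [this]; push_cast
    ring_nf at h3 ⊢; linarith

lemma es_bonferroni (P : Finset ℕ) (a : ℕ → ℝ) (ha : ∀ p ∈ P, 0 ≤ a p) (j : ℕ) :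
    (∑ p ∈ P, a p) ^ (j + 2) / (j + 2).factorial - (∑ p ∈ P, a p ^ 2) / 2 * (∑ p ∈ P, a p) ^ j / j.factorial ≤ es P a (j + 2) ∧
    (∑ p ∈ P, a p) ≤ es P a 1 := by
  induction P using Finset.induction_on generalizing j with
  | empty => simp [es_empty_succ]
  | insert q P hq ih =>
    have ha' : ∀ p ∈ P, 0 ≤ a p := fun p hp => ha p (mem_insert_of_mem hp)
    have haq := ha q (mem_insert_self q P)
    have ih' := fun j => ih ha' j
    rw [sum_insert hq, sum_insert hq, es_insert_succ P a q hq, es_insert_succ P a q hq, es_zero]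
    set E := ∑ p ∈ P, a p
    set Q := ∑ p ∈ P, a p ^ 2
    have hE : 0 ≤ E := sum_nonneg ha'; refine ⟨?_, by have := (ih' 0).2; linarith⟩
    have h1 := (ih' j).1
    have ht := add_pow_taylor_le E (a q) hE haq j
    have hfac : ((j + 2).factorial : ℝ) = (j + 2) * ((j + 1) * j.factorial) := by rw [factorial_succ, factorial_succ]; push_cast; ring
    have hfac1 : ((j + 1).factorial : ℝ) = (j + 1) * j.factorial := by rw [factorial_succ]; push_cast; ring
    have hj : (0 : ℝ) < j.factorial := by positivity
    have ht' : (a q + E) ^ (j + 2) / (j + 2).factorial ≤ E ^ (j + 2) / (j + 2).factorial + a q * E ^ (j + 1) / (j + 1).factorial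
        + a q ^ 2 / 2 * (a q + E) ^ j / j.factorial := by
      rw [hfac, hfac1, div_le_iff₀ (by positivity), add_comm (a q) E]; refine ht.trans (le_of_eq ?_); field_simp
    cases j with
    | zero =>
      have h2 := (ih' 0).2
      simp only [zero_add, pow_one, pow_zero, Nat.factorial_zero, Nat.factorial_one, Nat.cast_one, div_one, mul_one] at *
      nlinarith
    | succ i =>
      have h2 := (ih' i).1
      have hb : E ^ (i + 1) + (i + 1) * a q * E ^ i ≤ (a q + E) ^ (i + 1) := by
        have : ∀ n : ℕ, E ^ (n + 1) + (n + 1) * a q * E ^ n ≤ (a q + E) ^ (n + 1) := by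
          intro n
          induction n with
          | zero => simp; linarith
          | succ n ih3 =>
            have : (a q + E) * (E ^ (n + 1) + (n + 1) * a q * E ^ n) ≤ (a q + E) ^ (n + 1 + 1) := by rw [pow_succ' (a q + E)]; gcongr
            refine le_trans ?_ this
            have : 0 ≤ (n + 1) * a q ^ 2 * E ^ n := by positivity
            push_cast
            ring_nf at this ⊢; linarith
        exact this i
      have hb' : E ^ (i + 1) / (i + 1).factorial + a q * E ^ i / i.factorial ≤ (a q + E) ^ (i + 1) / (i + 1).factorial := by
        have hi : ((i + 1).factorial : ℝ) = (i + 1) * i.factorial := by rw [factorial_succ]; push_cast; ring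
        rw [le_div_iff₀ (by positivity)]; refine le_trans (le_of_eq ?_) hb
        rw [hi]; field_simp
      have hQb : Q / 2 * (E ^ (i + 1) / (i + 1).factorial + a q * E ^ i / i.factorial) ≤ Q / 2 * ((a q + E) ^ (i + 1) / (i + 1).factorial) := by gcongr
      have h2' : a q * (E ^ (i + 2) / (i + 2).factorial - Q / 2 * E ^ i / i.factorial) ≤ a q * es P a (i + 2) := by gcongr
      have e1 : (a q ^ 2 + Q) / 2 * (a q + E) ^ (i + 1) / (i + 1).factorial = a q ^ 2 / 2 * (a q + E) ^ (i + 1) / (i + 1).factorial + Q / 2 * ((a q + E) ^ (i + 1) / (i + 1).factorial) := by ring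
      rw [e1]
      have e2 : a q * E ^ (i + 1 + 1) / (i + 1 + 1).factorial = a q * (E ^ (i + 2) / (i + 2).factorial) := by ring
      rw [e2] at ht'
      have e3 : i + 1 + 1 = i + 2 := rfl
      rw [e3] at *
      have e4 : Q / 2 * E ^ (i + 1) / (i + 1).factorial = Q / 2 * (E ^ (i + 1) / (i + 1).factorial) := by ring
      rw [e4] at h1
      have e5 : Q / 2 * E ^ i / i.factorial = Q / 2 * (E ^ i / i.factorial) := by ring
      have e6 : Q / 2 * (a q * E ^ i / i.factorial) = a q * (Q / 2 * (E ^ i / i.factorial)) := by ring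
      rw [e5] at h2'; rw [mul_add, e6] at hQb
      rw [mul_sub] at h2'; linarith

lemma es_ge_half (P : Finset ℕ) (a : ℕ → ℝ) (ha : ∀ p ∈ P, 0 ≤ a p) (j : ℕ)
    (hj : (∑ p ∈ P, a p ^ 2) * (j : ℝ) ^ 2 ≤ (∑ p ∈ P, a p) ^ 2) :
    (∑ p ∈ P, a p) ^ j / j.factorial / 2 ≤ es P a j := by
  have hE : 0 ≤ ∑ p ∈ P, a p := sum_nonneg ha
  match j with
  | 0 => simp [es_zero]; norm_num
  | 1 =>
    have := (es_bonferroni P a ha 0).2; simp only [pow_one, Nat.factorial_one, Nat.cast_one, div_one]; linarith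
  | j + 2 =>
    refine le_trans ?_ (es_bonferroni P a ha j).1
    set E := ∑ p ∈ P, a p
    set Q := ∑ p ∈ P, a p ^ 2
    have hQ : 0 ≤ Q := sum_nonneg fun p _ => sq_nonneg _
    have hfac : ((j + 2).factorial : ℝ) = (j + 2) * ((j + 1) * j.factorial) := by rw [factorial_succ, factorial_succ]; push_cast; ring
    have h1 : Q / 2 * E ^ j / j.factorial ≤ E ^ (j + 2) / (j + 2).factorial / 2 := by
      rw [hfac, div_div, div_le_div_iff₀ (by positivity) (by positivity)]
      push_cast at hj
      have h2 : Q * ((j + 2) * (j + 1)) ≤ E ^ 2 := by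
        refine le_trans ?_ hj; apply mul_le_mul_of_nonneg_left _ hQ
        have : (0 : ℝ) ≤ j := by positivity
        nlinarith
      calc _ = (Q * ((j + 2) * (j + 1))) * (E ^ j * j.factorial) := by ring
        _ ≤ E ^ 2 * (E ^ j * j.factorial) := by gcongr
        _ = _ := by ring
    linarith

/-- Sums of reciprocals over integers with exactly `j` prime factors. -/
lemma sum_inv_weighted_omega (S P : Finset ℕ) (hP : ∀ p ∈ P, p.Prime) (j : ℕ)
    (hS : ∀ a ∈ S, a ≠ 0 ∧ a.primeFactors ⊆ P ∧ a.primeFactors.card = j) (G : Finset ℕ → ℝ) (hG : ∀ e, 0 ≤ G e) :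
    ∑ a ∈ S, (1 : ℝ) / a * G a.primeFactors ≤ ∑ e ∈ P.powersetCard j, G e * ∏ p ∈ e, 1 / ((p : ℝ) - 1) := by
  rw [← sum_fiberwise_of_maps_to (g := Nat.primeFactors) (t := P.powersetCard j)]
  · refine sum_le_sum fun e he => ?_
    have h1 : ∑ a ∈ S with a.primeFactors = e, (1 : ℝ) / a * G a.primeFactors = G e * ∑ a ∈ S with a.primeFactors = e, (1 : ℝ) / a := by
      rw [mul_sum]; refine sum_congr rfl fun a ha => ?_; rw [(mem_filter.1 ha).2, mul_comm]
    rw [h1]; apply mul_le_mul_of_nonneg_left _ (hG e); apply sum_inv_le_of_primeFactors_eq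
    · intro p hp; exact hP p ((mem_powersetCard.1 he).1 hp)
    · intro n hn; rw [mem_filter] at hn; exact ⟨(hS n hn.1).1, hn.2⟩
  · intro a ha; rw [mem_powersetCard]; exact (hS a ha).2

lemma add_pow_le_exp_mul (L C R : ℝ) (hL : 0 < L) (hC : 0 ≤ C) (j : ℕ) (hj : (j : ℝ) ≤ R * L) :
    (L + C) ^ j ≤ exp (C * R) * L ^ j := by
  have h1 : L + C ≤ L * exp (C / L) := by
    have := add_one_le_exp (C / L)
    calc L + C = L * (C / L + 1) := by field_simp; ring
      _ ≤ _ := by gcongr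
  calc (L + C) ^ j ≤ (L * exp (C / L)) ^ j := by gcongr
    _ = exp (j * (C / L)) * L ^ j := by rw [mul_pow, ← exp_nat_mul]; ring
    _ ≤ _ := by
      refine mul_le_mul_of_nonneg_right (exp_le_exp.2 ?_) (by positivity)
      calc (j : ℝ) * (C / L) ≤ R * L * (C / L) := by gcongr
        _ = C * R := by field_simp

lemma pow_div_factorial_step (L R : ℝ) (hL : 0 < L) (i : ℕ) (hi : ((i + 1 : ℕ) : ℝ) ≤ R * L) :
    L ^ i / i.factorial ≤ R * (L ^ (i + 1) / (i + 1).factorial) := by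
  have hf : (0 : ℝ) < i.factorial := by positivity
  rw [factorial_succ, mul_div_assoc', div_le_div_iff₀ hf (by positivity)]
  push_cast at hi ⊢
  calc L ^ i * ((i + 1) * i.factorial) = L ^ i * i.factorial * (i + 1) := by ring
    _ ≤ L ^ i * i.factorial * (R * L) := by gcongr
    _ = _ := by ring

lemma sum_inv_pred_real : ∃ C : ℝ, 0 < C ∧ ∀ᶠ x : ℝ in atTop,
    ∑ p ∈ primesLE ⌊x⌋₊, 1 / ((p : ℝ) - 1) ≤ log (log x) + C := by
  obtain ⟨C, hC, h⟩ := sum_inv_pred_le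
  refine ⟨C, hC, ?_⟩
  filter_upwards [eventually_ge_atTop 2] with x hx
  have h2 : 2 ≤ ⌊x⌋₊ := le_floor (by exact_mod_cast hx)
  refine (h _ h2).trans ?_
  have h2' : (2 : ℝ) ≤ ⌊x⌋₊ := by exact_mod_cast h2
  have : log ⌊x⌋₊ ≤ log x := log_le_log (by linarith) (floor_le (by linarith))
  have := log_le_log (log_pos (by linarith)) this
  linarith

lemma sum_inv_omega_asymp (R : ℝ) (hR : 0 < R) : ∃ C > 0, ∀ᶠ x : ℝ in atTop, ∀ j : ℕ, (j : ℝ) ≤ R * log (log x) →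
    ∀ S : Finset ℕ, (∀ a ∈ S, 0 < a ∧ (a : ℝ) ≤ x ∧ a.primeFactors.card = j) →
    (∑ a ∈ S, (1 : ℝ) / a ≤ C * (log (log x) ^ j / j.factorial)) ∧
    ∀ g : ℕ → ℝ, (∀ q, 0 ≤ g q) → ∑ a ∈ S, (1 : ℝ) / a * ∑ q ∈ a.primeFactors, g q ≤
      C * (∑ q ∈ primesLE ⌊x⌋₊, g q * (1 / ((q : ℝ) - 1))) * (log (log x) ^ j / j.factorial) := by
  obtain ⟨C, hC, h⟩ := sum_inv_pred_real
  refine ⟨exp (C * R) * (1 + R), by positivity, ?_⟩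
  filter_upwards [h, tendsto_LL.eventually_ge_atTop 1] with x hx hL j hj S hS
  set L := log (log x)
  set P := primesLE ⌊x⌋₊ with hPdef
  have hP : ∀ p ∈ P, p.Prime := fun p hp => (mem_primesLE.1 hp).2
  have hb : ∀ p ∈ P, 0 ≤ 1 / ((p : ℝ) - 1) := by
    intro p hp
    have : (2 : ℝ) ≤ p := by exact_mod_cast (hP p hp).two_le
    have : (0 : ℝ) < p - 1 := by linarith
    positivity
  have hS' : ∀ a ∈ S, a ≠ 0 ∧ a.primeFactors ⊆ P ∧ a.primeFactors.card = j := by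
    intro a ha
    obtain ⟨h1, h2, h3⟩ := hS a ha; refine ⟨h1.ne', fun p hp => ?_, h3⟩; rw [hPdef, mem_primesLE]
    exact ⟨(le_of_dvd h1 (dvd_of_mem_primeFactors hp)).trans (le_floor h2), prime_of_mem_primeFactors hp⟩
  have hE0 : 0 ≤ ∑ p ∈ P, 1 / ((p : ℝ) - 1) := sum_nonneg hb
  have hes : ∀ i : ℕ, (i : ℝ) ≤ R * L → es P (fun p => 1 / ((p : ℝ) - 1)) i ≤ exp (C * R) * (L ^ i / i.factorial) := by
    intro i hi; refine (es_le P _ hb i).trans ?_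
    calc _ ≤ (L + C) ^ i / i.factorial := by gcongr
      _ ≤ (exp (C * R) * L ^ i) / i.factorial := by
        gcongr; exact add_pow_le_exp_mul L C R (by linarith) hC.le i hi
      _ = _ := by ring
  have hT : 0 ≤ L ^ j / j.factorial := by positivity
  constructor
  · have h1 := sum_inv_weighted_omega S P hP j hS' (fun _ => 1) (fun _ => zero_le_one)
    simp only [mul_one, one_mul] at h1; refine h1.trans ((hes j hj).trans ?_); rw [mul_assoc, add_mul, one_mul, mul_add]
    have : 0 ≤ exp (C * R) * (R * (L ^ j / j.factorial)) := by positivity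
    linarith
  · intro g hg
    have hsum0 : 0 ≤ ∑ q ∈ P, g q * (1 / ((q : ℝ) - 1)) := sum_nonneg fun q hq => mul_nonneg (hg q) (hb q hq)
    cases j with
    | zero =>
      have : ∑ a ∈ S, (1 : ℝ) / a * ∑ q ∈ a.primeFactors, g q = 0 := by
        refine sum_eq_zero fun a ha => ?_; rw [card_eq_zero.1 (hS' a ha).2.2, sum_empty, mul_zero]
      rw [this]; positivity
    | succ i =>
      have h1 := sum_inv_weighted_omega S P hP (i + 1) hS' (fun e => ∑ q ∈ e, g q) (fun e => sum_nonneg fun q _ => hg q)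
      refine h1.trans ((es_weighted_le P _ g hb (fun p _ => hg p) i).trans ?_)
      have hi : (i : ℝ) ≤ R * L := by push_cast at hj; linarith
      have h3 := pow_div_factorial_step L R (by linarith) i hj
      calc _ ≤ (∑ q ∈ P, g q * (1 / ((q : ℝ) - 1))) * (exp (C * R) * (R * (L ^ (i + 1) / (i + 1).factorial))) := by
            gcongr; exact (hes i hi).trans (by gcongr)
        _ = exp (C * R) * R * (∑ q ∈ P, g q * (1 / ((q : ℝ) - 1))) * (L ^ (i + 1) / (i + 1).factorial) := by ring
        _ ≤ _ := by gcongr; linarith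

lemma eventually_card_primes_ge : ∀ᶠ y : ℝ in atTop, y / log y / 2 ≤ ((primesLE ⌊y⌋₊).card : ℝ) := by
  have h2 := (isLittleO_log_id_atTop).bound (show (0 : ℝ) < 1 / 20 by norm_num)
  filter_upwards [h2, eventually_ge_atTop 100] with y hy h100
  have hly : 0 < log y := log_pos (by linarith)
  simp only [id, norm_eq_abs, abs_of_pos hly, abs_of_pos (show (0 : ℝ) < y by linarith)] at hy
  have hpi := Chebyshev.pi_ge' (x := y) (by linarith)
  have hcard : ((primesLE ⌊y⌋₊).card : ℝ) = Nat.primeCounting ⌊y⌋₊ := by rw [Nat.primeCounting, ← Nat.primesBelow_card_eq_primeCounting']; rfl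
  rw [hcard]
  refine le_trans ?_ hpi
  rw [div_right_comm]
  gcongr
  have h3 : log (y + 2) ≤ log y + 1 := by
    rw [← log_exp 1, ← log_mul (by linarith) (by positivity)]; apply log_le_log (by linarith)
    have := add_one_le_exp (1 : ℝ); nlinarith
  have := log_two_gt_d9
  nlinarith

lemma card_PZ_ge (z N : ℕ) : ((primesLE N).card : ℝ) - z ≤ (PZ z N).card := by
  have h : primesLE N ⊆ PZ z N ∪ primesLE z := by
    intro p hp; rw [mem_primesLE] at hp; rw [Finset.mem_union, mem_PZ, mem_primesLE]
    by_cases h : p ≤ z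
    · exact Or.inr ⟨h, hp.2⟩
    · exact Or.inl ⟨by omega, hp⟩
  have h1 := (card_le_card h).trans (card_union_le _ _)
  have h2 := card_primesLE_le z _ (Subset.refl _)
  have : (primesLE N).card ≤ (PZ z N).card + z := by omega
  have : ((primesLE N).card : ℝ) ≤ (PZ z N).card + z := by exact_mod_cast this
  linarith

lemma card_mul_prime_le_pik (x : ℝ) (P : Finset ℕ) (hP : ∀ p ∈ P, p.Prime) (j z : ℕ) (hz : ∀ p ∈ P, p ≤ z) (G : Finset (Finset ℕ))
    (hG : G ⊆ P.powersetCard j) :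
    ∑ e ∈ G, (PZ z ⌊x / (∏ p ∈ e, p : ℕ)⌋₊).card ≤ pik (j + 1) x := by
  rw [← card_sigma]
  unfold pik
  have hprim : ∀ e ∈ G, ∀ p ∈ e, p.Prime := fun e he p hp => hP p ((mem_powersetCard.1 (hG he)).1 hp)
  have hpos : ∀ e ∈ G, 0 < ∏ p ∈ e, p := fun e he => prod_pos fun p hp => (hprim e he p hp).pos
  have hni : ∀ e ∈ G, ∀ l N, l ∈ PZ z N → l ∉ e := by
    intro e he l N hl hle; rw [mem_PZ] at hl
    have := hz l ((mem_powersetCard.1 (hG he)).1 hle); omega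
  have hpf : ∀ e ∈ G, ∀ l N, l ∈ PZ z N → ((∏ p ∈ e, p) * l).primeFactors = insert l e := by
    intro e he l N hl
    rw [Nat.primeFactors_mul (hpos e he).ne' (PZ_prime hl).ne_zero, Nat.primeFactors_prod (hprim e he), (PZ_prime hl).primeFactors,
      Finset.union_comm, Finset.singleton_union]
  apply card_le_card_of_injOn (fun s => (∏ p ∈ s.1, p) * s.2)
  · rintro ⟨e, l⟩ h; rw [Finset.mem_coe, mem_sigma] at h
    obtain ⟨he, hl⟩ := h
    dsimp only at he hl ⊢
    rw [Finset.mem_coe, mem_filter, mem_Icc, hpf e he l _ hl, card_insert_of_notMem (hni e he l _ hl),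
      (mem_powersetCard.1 (hG he)).2]
    refine ⟨⟨Nat.mul_pos (hpos e he) (PZ_prime hl).pos, ?_⟩, rfl⟩; rw [mem_PZ] at hl
    have h1 : (l : ℝ) ≤ x / (∏ p ∈ e, p : ℕ) := by
      have : l ≠ 0 := hl.2.2.ne_zero; exact (Nat.le_floor_iff' this).1 hl.2.1
    have hp : (0 : ℝ) < (∏ p ∈ e, p : ℕ) := by exact_mod_cast hpos e he
    rw [le_div_iff₀ hp] at h1; apply le_floor
    rw [Nat.cast_mul]; linarith
  · rintro ⟨e, l⟩ h ⟨e', l'⟩ h' heq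
    rw [Finset.mem_coe, mem_sigma] at h h'
    dsimp only at h h' heq
    have h1 : insert l e = insert l' e' := by rw [← hpf e h.1 l _ h.2, ← hpf e' h'.1 l' _ h'.2, heq]
    have h2 : l = l' := by
      by_contra hne
      have : l ∈ insert l' e' := h1 ▸ mem_insert_self l e
      rcases mem_insert.1 this with h3 | h3
      · exact hne h3
      · have := hz l ((mem_powersetCard.1 (hG h'.1)).1 h3)
        have := (mem_PZ.1 h.2).1; omega
    subst h2
    have h3 : e = e' := by rw [← erase_insert (hni e h.1 l _ h.2), ← erase_insert (hni e' h'.1 l _ h'.2), h1]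
    subst h3; rfl

set_option maxHeartbeats 1600000 in
lemma sum_good_es (R ρ : ℝ) (hR : 1 ≤ R) (hρ : 0 < ρ) (hρ1 : R * ρ ≤ 1 / 50) (W : ℕ) (hW : 1 ≤ W) (hWR : 4 * R ^ 2 ≤ W) :
    ∃ c > 0, ∀ᶠ x : ℝ in atTop, ∀ j : ℕ, (j : ℝ) ≤ R * log (log x) →
      c * (log (log x) ^ j / j.factorial) ≤
        ∑ e ∈ (PZ W ⌊x ^ ρ⌋₊).powersetCard j with ((∏ p ∈ e, p : ℕ) : ℝ) ≤ x ^ (1 / 3 : ℝ), ∏ p ∈ e, 1 / (p : ℝ) := by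
  have hρ2 : ρ ≤ 1 / 50 := by nlinarith
  set C2 := 1 + W + |log (ρ / 2)| with hC2
  refine ⟨exp (-(C2 * (2 * R))) / 4, by positivity, ?_⟩
  filter_upwards [tendsto_LL.eventually_ge_atTop (2 * C2), tendsto_LL.eventually_ge_atTop 1,
    eventually_params (2 * ρ) ρ hρ le_rfl (by linarith), tendsto_log_atTop.eventually_ge_atTop (1000 * R)] with x hx1 hx2 hpar hlR j hj
  obtain ⟨hX2, hXγ, hzzX, hfl, hfllog, -, hfl2, hl1⟩ := hpar
  set L := log (log x) with hL
  set V := ⌊x ^ ρ⌋₊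
  set P := PZ W V with hP
  have hx0 : 0 < x := by linarith
  have hPp : ∀ p ∈ P, p.Prime := fun p hp => PZ_prime hp
  have ha : ∀ p ∈ P, 0 ≤ 1 / (p : ℝ) := fun p _ => by positivity
  set E := ∑ p ∈ P, 1 / (p : ℝ)
  have hEge : L ≤ E + C2 := by
    have h1 := sum_inv_prime_ge V hfl2
    have h2 : L + log (ρ / 2) ≤ log (log V) := by
      rw [hL, add_comm, ← log_mul (by positivity) (by linarith)]; exact log_le_log (by positivity) hfllog
    have h3 : ∑ p ∈ primesLE V, (1 : ℝ) / p ≤ E + W := by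
      have hsub : primesLE V ⊆ P ∪ primesLE W := by
        intro p hp; rw [mem_primesLE] at hp; rw [Finset.mem_union, hP, mem_PZ, mem_primesLE]
        by_cases h : p ≤ W
        · exact Or.inr ⟨h, hp.2⟩
        · exact Or.inl ⟨by omega, hp⟩
      have hdisj : Disjoint P (primesLE W) := by
        rw [Finset.disjoint_left]; intro p hp hp2
        rw [hP, mem_PZ] at hp; rw [mem_primesLE] at hp2; omega
      refine (sum_le_sum_of_subset_of_nonneg hsub fun p _ _ => by positivity).trans ?_; rw [sum_union hdisj]
      apply add_le_add le_rfl; refine (sum_le_card_nsmul _ _ 1 fun p hp => ?_).trans ?_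
      · have : (1 : ℝ) ≤ p := by exact_mod_cast (mem_primesLE.1 hp).2.one_lt.le
        rw [div_le_one (by linarith)]; exact this
      · rw [nsmul_eq_mul, mul_one]; exact_mod_cast card_primesLE_le W _ (Subset.refl _)
    have h4 := neg_abs_le (log (ρ / 2))
    rw [hC2]; linarith
  have hC20 : 0 ≤ C2 := by positivity
  have hE0 : 0 < E := by linarith
  have hjE : (j : ℝ) ≤ 2 * R * E := by nlinarith
  have hLE : exp (-(C2 * (2 * R))) * L ^ j ≤ E ^ j := by
    have h1 := add_pow_le_exp_mul E C2 (2 * R) hE0 hC20 j hjE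
    have h2 : L ^ j ≤ (E + C2) ^ j := by gcongr
    rw [exp_neg, inv_mul_le_iff₀ (by positivity)]; linarith
  have hQ : ∑ p ∈ P, (1 / (p : ℝ)) ^ 2 ≤ (1 : ℝ) / (W : ℝ) := by
    refine le_trans (sum_le_sum fun p hp => ?_) (sum_inv_mul_pred_le P W hW fun q hq => (mem_PZ.1 hq).1)
    have : (2 : ℝ) ≤ p := by exact_mod_cast (hPp p hp).two_le
    rw [div_pow, one_pow]
    apply one_div_le_one_div_of_le (by nlinarith) (by nlinarith)
  have hW0 : (0 : ℝ) < W := by exact_mod_cast hW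
  have hhalf := es_ge_half P (fun p => 1 / (p : ℝ)) ha j (by
    calc _ ≤ (1 / (W : ℝ)) * (2 * R * E) ^ 2 := by gcongr
      _ = (4 * R ^ 2 / W) * E ^ 2 := by ring
      _ ≤ 1 * E ^ 2 := by gcongr; rw [div_le_one hW0]; exact hWR
      _ = _ := one_mul _)
  have hbad : ∑ e ∈ P.powersetCard j with ¬ ((∏ p ∈ e, p : ℕ) : ℝ) ≤ x ^ (1 / 3 : ℝ), ∏ p ∈ e, 1 / (p : ℝ) ≤
      E ^ j / j.factorial / 4 := by
    have hl0 : 0 < log x := by linarith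
    have h1 : ∑ e ∈ P.powersetCard j with ¬ ((∏ p ∈ e, p : ℕ) : ℝ) ≤ x ^ (1 / 3 : ℝ), ∏ p ∈ e, 1 / (p : ℝ) ≤
        ∑ e ∈ P.powersetCard j, (∑ p ∈ e, 3 / log x * log p) * ∏ p ∈ e, 1 / (p : ℝ) := by
      refine (sum_le_sum (g := fun e : Finset ℕ => (∑ p ∈ e, 3 / log x * log p) * ∏ p ∈ e, 1 / (p : ℝ)) fun e he => ?_).trans
        (sum_le_sum_of_subset_of_nonneg (filter_subset _ _) fun e _ _ => ?_)
      · rw [mem_filter] at he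
        have hpe : ∀ p ∈ e, p.Prime := fun p hp => hPp p ((mem_powersetCard.1 he.1).1 hp)
        refine le_mul_of_one_le_left (prod_nonneg fun p _ => by positivity) ?_
        rw [← mul_sum, ← log_prod (fun p hp => by exact_mod_cast (hpe p hp).ne_zero), div_mul_eq_mul_div, le_div_iff₀ hl0]
        have h2 := log_le_log (by positivity) (le_of_lt (not_le.1 he.2)); rw [log_rpow hx0] at h2
        push_cast at h2; linarith
      · exact mul_nonneg (sum_nonneg fun p _ => by positivity) (prod_nonneg fun p _ => by positivity)
    refine h1.trans ?_
    cases j with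
    | zero =>
      rw [powersetCard_zero, sum_singleton, sum_empty, zero_mul]; positivity
    | succ i =>
      refine (es_weighted_le P (fun p => 1 / (p : ℝ)) (fun p => 3 / log x * log p) ha (fun p _ => by positivity) i).trans ?_
      have hs : ∑ q ∈ P, 3 / log x * log q * (1 / (q : ℝ)) ≤ 3 / log x * (ρ * log x + 6) := by
        have e1 : ∑ q ∈ P, 3 / log x * log q * (1 / (q : ℝ)) = 3 / log x * ∑ q ∈ P, log q / q := by rw [mul_sum]; refine sum_congr rfl fun q _ => by ring
        rw [e1]; gcongr
        have hsub : P ⊆ primesLE V := by intro p hp; rw [hP, mem_PZ] at hp; exact mem_primesLE.2 hp.2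
        refine (sum_le_sum_of_subset_of_nonneg hsub fun p _ _ => by positivity).trans ?_
        refine (sum_log_div_prime_le V (by omega)).trans ?_
        have : log V ≤ ρ * log x := by
          rw [← log_rpow hx0]; apply log_le_log (by exact_mod_cast (by omega : 0 < V)); exact floor_le (by positivity)
        linarith
      have hes := es_le P (fun p => 1 / (p : ℝ)) ha i
      have hst := pow_div_factorial_step E (2 * R) hE0 i hjE
      have hes0 := es_nonneg P (fun p => 1 / (p : ℝ)) ha i
      have hK : 3 / log x * (ρ * log x + 6) * (2 * R) ≤ 1 / 4 := by
        rw [div_mul_eq_mul_div, div_mul_eq_mul_div, div_le_iff₀ hl0]; nlinarith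
      calc _ ≤ 3 / log x * (ρ * log x + 6) * (2 * R * (E ^ (i + 1) / (i + 1).factorial)) := by
            gcongr; exact hes.trans hst
        _ = (3 / log x * (ρ * log x + 6) * (2 * R)) * (E ^ (i + 1) / (i + 1).factorial) := by ring
        _ ≤ 1 / 4 * (E ^ (i + 1) / (i + 1).factorial) := by gcongr
        _ = _ := by ring
  have hsplit := sum_filter_add_sum_filter_not (P.powersetCard j) (fun e => ((∏ p ∈ e, p : ℕ) : ℝ) ≤ x ^ (1 / 3 : ℝ)) (fun e => ∏ p ∈ e, 1 / (p : ℝ))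
  have hfin : exp (-(C2 * (2 * R))) / 4 * (L ^ j / j.factorial) ≤ E ^ j / j.factorial / 4 := by
    calc _ = (exp (-(C2 * (2 * R))) * L ^ j) / j.factorial / 4 := by ring
      _ ≤ _ := by gcongr
  unfold es at hhalf
  refine hfin.trans ?_
  have h9 : E ^ j / j.factorial / 4 = E ^ j / j.factorial / 2 - E ^ j / j.factorial / 4 := by ring
  rw [h9]
  linarith

/-- The expected order of magnitude of `π_k(x)`. -/
noncomputable def TT (k : ℕ) (x : ℝ) : ℝ := x / log x * (log (log x) ^ (k - 1) / (k - 1).factorial)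

theorem pik_ge (R : ℝ) (hR : 0 < R) : ∃ c > 0, ∀ᶠ x : ℝ in atTop, ∀ k : ℕ, 1 ≤ k → (k : ℝ) ≤ R * log (log x) →
    c * TT k x ≤ pik k x := by
  obtain ⟨R1, hR1⟩ : ∃ R1, R1 = R + 1 := ⟨_, rfl⟩
  have hR1' : 1 ≤ R1 := by linarith
  obtain ⟨ρ, hρd⟩ : ∃ ρ, ρ = 1 / (50 * R1) := ⟨_, rfl⟩
  have hρ : 0 < ρ := by rw [hρd]; positivity
  have hρ1 : R1 * ρ ≤ 1 / 50 := by rw [hρd]; apply le_of_eq; field_simp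
  have hρ2 : ρ ≤ 1 / 50 := by nlinarith
  obtain ⟨W, hW⟩ := exists_nat_ge (4 * R1 ^ 2)
  have hW1 : 1 ≤ W := by
    have : (1 : ℝ) ≤ W := by nlinarith
    exact_mod_cast this
  obtain ⟨c, hc, h⟩ := sum_good_es R1 ρ hR1' hρ hρ1 W hW1 hW
  refine ⟨c / 4, by positivity, ?_⟩
  obtain ⟨y0, hy0⟩ := eventually_atTop.1 eventually_card_primes_ge
  filter_upwards [h, tendsto_LL.eventually_ge_atTop 1, eventually_ge_atTop 2, tendsto_log_atTop.eventually_ge_atTop 1,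
    (tendsto_rpow_atTop (show (0 : ℝ) < 2 / 3 by norm_num)).eventually_ge_atTop y0,
    eventually_log_pow_le 4 1 (2 / 3 - 1 / 50) (by norm_num)] with x hx hL h2 hl1 hxy hpow
  intro k hk hkR
  have hx0 : 0 < x := by linarith
  obtain ⟨j, rfl⟩ : ∃ j, k = j + 1 := ⟨k - 1, by omega⟩
  unfold TT
  rw [Nat.add_sub_cancel]
  have hj : (j : ℝ) ≤ R1 * log (log x) := by push_cast at hkR; nlinarith
  have h1 := hx j hj
  set V := ⌊x ^ ρ⌋₊
  set G := ((PZ W V).powersetCard j).filter (fun e => ((∏ p ∈ e, p : ℕ) : ℝ) ≤ x ^ (1 / 3 : ℝ)) with hG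
  have hcount := card_mul_prime_le_pik x (PZ W V) (fun p hp => PZ_prime hp) j V (fun p hp => (mem_PZ.1 hp).2.1) G (filter_subset _ _)
  have hcount' : ∑ e ∈ G, ((PZ V ⌊x / (∏ p ∈ e, p : ℕ)⌋₊).card : ℝ) ≤ pik (j + 1) x := by exact_mod_cast hcount
  refine le_trans ?_ hcount'
  have hterm : ∀ e ∈ G, x / log x / 4 * ∏ p ∈ e, 1 / (p : ℝ) ≤ ((PZ V ⌊x / (∏ p ∈ e, p : ℕ)⌋₊).card : ℝ) := by
    intro e he; rw [hG, mem_filter, mem_powersetCard] at he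
    obtain ⟨⟨he1, he2⟩, he3⟩ := he
    have hpos : 0 < ∏ p ∈ e, p := prod_pos fun p hp => (PZ_prime (he1 hp)).pos
    have hpos' : (1 : ℝ) ≤ (∏ p ∈ e, p : ℕ) := by exact_mod_cast hpos
    have hprod : ∏ p ∈ e, 1 / (p : ℝ) = 1 / ((∏ p ∈ e, p : ℕ) : ℝ) := by rw [prod_div_distrib, prod_const_one]; push_cast; rfl
    rw [hprod]
    set A : ℝ := ((∏ p ∈ e, p : ℕ) : ℝ)
    have hy1 : x ^ (2 / 3 : ℝ) ≤ x / A := by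
      rw [le_div_iff₀ (by linarith)]
      calc _ ≤ x ^ (2 / 3 : ℝ) * x ^ (1 / 3 : ℝ) := by gcongr
        _ = x := by rw [← rpow_add hx0]; norm_num
    have hyx : x / A ≤ x := div_le_self hx0.le hpos'
    have h3 := hy0 (x / A) (hxy.trans hy1)
    have h4 := card_PZ_ge V ⌊x / A⌋₊
    have h5 : (V : ℝ) ≤ x ^ (1 / 50 : ℝ) :=
      (floor_le (by positivity)).trans (rpow_le_rpow_of_exponent_le (by linarith) hρ2)
    have hy0' : (1 : ℝ) < x / A := lt_of_lt_of_le (one_lt_rpow (by linarith) (by norm_num)) hy1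
    have h6 : x / A / log x ≤ x / A / log (x / A) := by
      apply div_le_div_of_nonneg_left (by linarith) (log_pos hy0'); exact log_le_log (by linarith) hyx
    have h7 : x ^ (1 / 50 : ℝ) ≤ x / A / log x / 4 := by
      rw [div_div, le_div_iff₀ (by positivity)]; refine le_trans ?_ hy1; rw [pow_one] at hpow
      calc x ^ (1 / 50 : ℝ) * (log x * 4) = x ^ (1 / 50 : ℝ) * (4 * log x) := by ring
        _ ≤ x ^ (1 / 50 : ℝ) * x ^ (2 / 3 - 1 / 50 : ℝ) := by gcongr
        _ = _ := by rw [← rpow_add hx0]; norm_num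
    have e1 : x / log x / 4 * (1 / A) = x / A / log x / 4 := by field_simp
    rw [e1]; linarith
  calc _ = x / log x / 4 * (c * (log (log x) ^ j / j.factorial)) := by ring
    _ ≤ x / log x / 4 * ∑ e ∈ G, ∏ p ∈ e, 1 / (p : ℝ) := by gcongr
    _ ≤ _ := by rw [mul_sum]; exact sum_le_sum hterm

/-- Lower bound of `TT` by a power of `log`, and comparison of power-saving quantities. -/
lemma rpow_le_TT (R κ δ : ℝ) (hR : 0 < R) (hκ : 0 < κ) (hδ : 0 < δ) : ∀ᶠ x : ℝ in atTop, ∀ k : ℕ, 1 ≤ k →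
    (k : ℝ) ≤ R * log (log x) → x ^ (1 - κ) ≤ δ * TT k x := by
  obtain ⟨R1, hR1⟩ : ∃ R1, R1 = R + 1 := ⟨_, rfl⟩
  have hR1' : 1 ≤ R1 := by linarith
  obtain ⟨K, hK⟩ := exists_nat_ge (R1 * log R1 + 1)
  filter_upwards [tendsto_LL.eventually_ge_atTop 1, eventually_ge_atTop 2, tendsto_log_atTop.eventually_ge_atTop 1,
    eventually_log_pow_le (1 / δ) K κ hκ] with x hL h2 hl1 hpow
  intro k hk hkR
  have hx0 : 0 < x := by linarith
  obtain ⟨j, rfl⟩ : ∃ j, k = j + 1 := ⟨k - 1, by omega⟩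
  unfold TT
  rw [Nat.add_sub_cancel]
  set L := log (log x)
  have hj : (j : ℝ) ≤ R1 * L := by push_cast at hkR; nlinarith
  have hLj : 1 / log x ^ (R1 * log R1) ≤ L ^ j / j.factorial := by
    have h1 : (j.factorial : ℝ) ≤ (R1 * L) ^ j := by
      calc (j.factorial : ℝ) ≤ (j : ℝ) ^ j := by exact_mod_cast Nat.factorial_le_pow j
        _ ≤ _ := by gcongr
    have h2 : R1 ^ j ≤ log x ^ (R1 * log R1) := by
      rw [← rpow_natCast, rpow_def_of_pos (by linarith), rpow_def_of_pos (by linarith)]; apply exp_le_exp.2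
      have : 0 ≤ log R1 := log_nonneg hR1'
      calc log R1 * j ≤ log R1 * (R1 * L) := by gcongr
        _ = _ := by ring
    rw [div_le_div_iff₀ (by positivity) (by positivity), one_mul]
    calc (j.factorial : ℝ) ≤ (R1 * L) ^ j := h1
      _ = L ^ j * R1 ^ j := by rw [mul_pow]; ring
      _ ≤ _ := by gcongr
  have hlK : log x ^ (R1 * log R1) * log x ≤ log x ^ K := by
    rw [← rpow_add_one (by linarith), ← rpow_natCast]; exact rpow_le_rpow_of_exponent_le hl1 hK
  have hsplit : x ^ (1 - κ) * x ^ κ = x := by rw [← rpow_add hx0]; norm_num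
  have hxk : 0 < x ^ κ := rpow_pos_of_pos hx0 _
  have h3 : log x ^ (R1 * log R1) * log x ≤ δ * x ^ κ := by
    rw [div_mul_eq_mul_div, one_mul, div_le_iff₀ hδ] at hpow; linarith
  calc x ^ (1 - κ) = x / x ^ κ := by rw [eq_div_iff hxk.ne', hsplit]
    _ ≤ δ * (x / log x * (1 / log x ^ (R1 * log R1))) := by
      have e : δ * (x / log x * (1 / log x ^ (R1 * log R1))) = δ * x / (log x ^ (R1 * log R1) * log x) := by field_simp
      rw [e, div_le_div_iff₀ hxk (by positivity)]
      calc x * (log x ^ (R1 * log R1) * log x) ≤ x * (δ * x ^ κ) := by gcongr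
        _ = _ := by ring
    _ ≤ _ := by gcongr

/-- The integers `m ≤ x` with `ω(m) = k`. -/
noncomputable def MM (k : ℕ) (x : ℝ) : Finset ℕ := (Finset.Icc 1 ⌊x⌋₊).filter (fun n => n.primeFactors.card = k)

lemma pik_eq_card_MM (k : ℕ) (x : ℝ) : pik k x = (MM k x).card := rfl

lemma mem_MM {k m : ℕ} {x : ℝ} : m ∈ MM k x ↔ (1 ≤ m ∧ m ≤ ⌊x⌋₊) ∧ m.primeFactors.card = k := by unfold MM; rw [mem_filter, mem_Icc]

lemma card_sq_dvd_le (N D : ℕ) (hD : 1 ≤ D) (S : Finset ℕ) (hS : ∀ m ∈ S, (1 ≤ m ∧ m ≤ N) ∧ ∃ d, d ^ 2 ∣ m ∧ D < d) :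
    (S.card : ℝ) ≤ N / D := by
  have hsub : S ⊆ (Ioc D N).biUnion fun d => (Ioc 0 N).filter fun m => d ^ 2 ∣ m := by
    intro m hm
    obtain ⟨⟨h1, h2⟩, d, hd, hDd⟩ := hS m hm; rw [mem_biUnion]; refine ⟨d, ?_, ?_⟩
    · rw [mem_Ioc]; refine ⟨hDd, ?_⟩
      have := le_of_dvd h1 hd; nlinarith
    · rw [mem_filter, mem_Ioc]; exact ⟨⟨h1, h2⟩, hd⟩
  have h1 : S.card ≤ ∑ d ∈ Ioc D N, ((Ioc 0 N).filter fun m => d ^ 2 ∣ m).card := (card_le_card hsub).trans card_biUnion_le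
  have h2 : (S.card : ℝ) ≤ ∑ d ∈ Ioc D N, (((Ioc 0 N).filter fun m => d ^ 2 ∣ m).card : ℝ) := by exact_mod_cast h1
  refine h2.trans ?_
  have h3 : ∀ d ∈ Ioc D N, (((Ioc 0 N).filter fun m => d ^ 2 ∣ m).card : ℝ) ≤ N * (1 / ((d : ℝ) * ((d : ℝ) - 1))) := by
    intro d hd; rw [mem_Ioc] at hd; rw [Nat.Ioc_filter_dvd_card_eq_div]; refine Nat.cast_div_le.trans ?_
    have : (2 : ℝ) ≤ d := by exact_mod_cast (by omega : 2 ≤ d)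
    rw [div_eq_mul_one_div]; push_cast; apply mul_le_mul_of_nonneg_left _ (by positivity)
    apply one_div_le_one_div_of_le <;> nlinarith
  refine (sum_le_sum h3).trans ?_
  rw [← mul_sum, div_eq_mul_one_div]
  exact mul_le_mul_of_nonneg_left (sum_inv_mul_pred_le _ D hD fun q hq => (mem_Ioc.1 hq).1) (by positivity)

/-- If `m` has no large square divisor, most of `log m` comes from primes exactly dividing `m`. -/
lemma log_le_sum_exact (m D : ℕ) (hm : 0 < m) (hD : ∀ d, d ^ 2 ∣ m → d ≤ D) :
    log m - 3 * log D ≤ ∑ p ∈ m.primeFactors with ¬ p ^ 2 ∣ m, log p := by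
  obtain ⟨s, r, hrs, hs⟩ := Nat.sq_mul_squarefree m
  have hr0 : 0 < r := by rcases Nat.eq_zero_or_pos r with h | h; · subst h; simp at hrs; omega
                         · exact h
  have hs0 : 0 < s := by rcases Nat.eq_zero_or_pos s with h | h; · subst h; simp at hrs; omega
                         · exact h
  have hrD : r ≤ D := hD r ⟨s, hrs.symm⟩
  have hlogr : log r ≤ log D := log_le_log (by exact_mod_cast hr0) (by exact_mod_cast hrD)
  have hlogm : log m = 2 * log r + log s := by
    rw [← hrs]; push_cast
    rw [log_mul (by positivity) (by positivity), log_pow]; norm_num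
  have h1 : ∑ p ∈ s.primeFactors, log p = log s := sum_log_primeFactors_eq s hs
  have h2 : ∑ p ∈ s.primeFactors, log p ≤ ∑ p ∈ m.primeFactors with ¬ p ^ 2 ∣ m, log p + ∑ p ∈ r.primeFactors, log p := by
    have hsub : s.primeFactors ⊆ (m.primeFactors.filter fun p => ¬ p ^ 2 ∣ m) ∪ r.primeFactors := by
      intro p hp
      have hpp := prime_of_mem_primeFactors hp
      have hps := dvd_of_mem_primeFactors hp; rw [Finset.mem_union, mem_filter]
      by_cases hpr : p ∣ r
      · exact Or.inr (mem_primeFactors.2 ⟨hpp, hpr, hr0.ne'⟩)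
      · left
        refine ⟨mem_primeFactors.2 ⟨hpp, hrs ▸ (hps.trans (dvd_mul_left s (r ^ 2))), hm.ne'⟩, fun h => ?_⟩
        have hco : Nat.Coprime (p ^ 2) (r ^ 2) := Nat.Coprime.pow 2 2 ((Nat.Prime.coprime_iff_not_dvd hpp).2 hpr)
        have h3 : p ^ 2 ∣ s := hco.dvd_of_dvd_mul_left (hrs ▸ h)
        have := (Nat.squarefree_iff_prime_squarefree.1 hs) p hpp; exact this (by rwa [← sq])
    refine (sum_le_sum_of_subset_of_nonneg hsub fun p _ _ => by positivity).trans ?_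
    have := sum_union_inter (s₁ := m.primeFactors.filter fun p => ¬ p ^ 2 ∣ m) (s₂ := r.primeFactors) (f := fun p : ℕ => log p)
    have h0 : 0 ≤ ∑ p ∈ (m.primeFactors.filter fun p => ¬ p ^ 2 ∣ m) ∩ r.primeFactors, log p := sum_nonneg fun p _ => by positivity
    linarith
  have h3 := sum_log_primeFactors_le r hr0
  linarith

lemma primeFactors_div_of_exact {m p : ℕ} (hp : p ∈ m.primeFactors) (h2 : ¬ p ^ 2 ∣ m) :
    (m / p).primeFactors = m.primeFactors.erase p := by
  have hpp := prime_of_mem_primeFactors hp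
  have hpm := dvd_of_mem_primeFactors hp
  have hm0 : m ≠ 0 := (mem_primeFactors.1 hp).2.2
  obtain ⟨a, rfl⟩ := hpm
  have ha0 : a ≠ 0 := right_ne_zero_of_mul hm0
  rw [Nat.mul_div_cancel_left _ hpp.pos, Nat.primeFactors_mul hpp.ne_zero ha0, hpp.primeFactors]
  rw [Finset.singleton_union, erase_insert]
  intro h
  exact h2 (by rw [sq]; exact Nat.mul_dvd_mul_left p (dvd_of_mem_primeFactors h))

lemma sum_log_primes_le (n : ℕ) : ∑ p ∈ primesLE n, log p ≤ 2 * n := by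
  rw [← Chebyshev.theta_eq_sum_primesLE_log]
  refine (Chebyshev.theta_le_log4_mul_x (by positivity)).trans ?_
  have : log 4 ≤ 2 := by
    rw [show (4 : ℝ) = 2 ^ 2 by norm_num, log_pow]
    have := log_two_lt_d9
    norm_num; linarith
  gcongr

lemma sum_exact_primes_le (x : ℝ) (hx : 0 ≤ x) (M A : Finset ℕ) (hM : ∀ m ∈ M, 1 ≤ m ∧ m ≤ ⌊x⌋₊)
    (hA : ∀ m ∈ M, ∀ p ∈ m.primeFactors, ¬ p ^ 2 ∣ m → m / p ∈ A) :
    ∑ m ∈ M, ∑ p ∈ m.primeFactors with ¬ p ^ 2 ∣ m, log p ≤ 2 * x * ∑ a ∈ A, (1 : ℝ) / a := by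
  have h1 : ∑ m ∈ M, ∑ p ∈ m.primeFactors with ¬ p ^ 2 ∣ m, log p ≤ ∑ a ∈ A, ∑ p ∈ primesLE ⌊x / a⌋₊, log p := by
    rw [sum_sigma', sum_sigma']
    set F := M.sigma fun m => m.primeFactors.filter fun p => ¬ p ^ 2 ∣ m with hF
    have hinj : Set.InjOn (fun s : (_ : ℕ) × ℕ => (⟨s.1 / s.2, s.2⟩ : (_ : ℕ) × ℕ)) (F : Set _) := by
      rintro ⟨m, p⟩ h ⟨m', p'⟩ h' heq
      rw [Finset.mem_coe, hF, mem_sigma, mem_filter] at h h'; simp only [Sigma.mk.injEq, heq_eq_eq] at heq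
      obtain ⟨e1, rfl⟩ := heq
      have : m = m' := by
        dsimp only at h h'
        rw [← mul_div_cancel' (dvd_of_mem_primeFactors h.2.1), e1, mul_div_cancel' (dvd_of_mem_primeFactors h'.2.1)]
      subst this; rfl
    have : ∑ s ∈ F, log s.2 = ∑ s ∈ F.image (fun s : (_ : ℕ) × ℕ => (⟨s.1 / s.2, s.2⟩ : (_ : ℕ) × ℕ)), log s.2 := by rw [sum_image hinj]
    rw [this]; apply sum_le_sum_of_subset_of_nonneg
    · intro t ht; rw [mem_image] at ht
      obtain ⟨⟨m, p⟩, hs, rfl⟩ := ht; rw [hF, mem_sigma, mem_filter] at hs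
      dsimp only at hs ⊢
      obtain ⟨hm, hp, hp2⟩ := hs; rw [mem_sigma, mem_primesLE]
      have hpp := prime_of_mem_primeFactors hp
      have hpm := dvd_of_mem_primeFactors hp; refine ⟨hA m hm p hp hp2, ?_, hpp⟩
      have hm1 := hM m hm
      have hmx : (m : ℝ) ≤ x := (le_floor_iff hx).1 hm1.2
      have hpos : 0 < m / p := Nat.div_pos (le_of_dvd hm1.1 hpm) hpp.pos; apply le_floor
      rw [le_div_iff₀ (by exact_mod_cast hpos)]
      have : p * (m / p) = m := mul_div_cancel' hpm
      have h5 : (p : ℝ) * ((m / p : ℕ) : ℝ) = m := by exact_mod_cast this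
      linarith
    · intro t _ _; positivity
  refine h1.trans ?_
  rw [mul_sum]
  refine sum_le_sum fun a _ => (sum_log_primes_le _).trans ?_
  have : ((⌊x / a⌋₊ : ℕ) : ℝ) ≤ x / a := floor_le (by positivity)
  calc _ ≤ 2 * (x / a) := by gcongr
    _ = _ := by ring

/-- The contribution to `log m` of the primes at most `D`. -/
noncomputable def lam (D m : ℕ) : ℝ := ∑ p ∈ m.primeFactors with p ≤ D, log p

/-- The exceptional integers: small, with a large square divisor, or with a large smooth part. -/
def Bad (β x : ℝ) (D m : ℕ) : Prop :=
  (m : ℝ) ^ 2 ≤ x ∨ (∃ d, d ^ 2 ∣ m ∧ D < d) ∨ β / 2 * log x ≤ lam D m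

open Classical in
theorem bad_count (R β δ : ℝ) (hR : 0 < R) (hβ : 0 < β) (hβ2 : β ≤ 1 / 2) (hδ : 0 < δ) : ∃ η0 > 0, η0 ≤ β / 20 ∧ ∀ η : ℝ, 0 < η → η ≤ η0 →
    ∀ᶠ x : ℝ in atTop, ∀ k : ℕ, 1 ≤ k → (k : ℝ) ≤ R * log (log x) →
      (((MM k x).filter fun m => Bad β x ⌊x ^ η⌋₊ m).card : ℝ) ≤ δ * TT k x := by
  obtain ⟨C, hC, hCx⟩ := sum_inv_omega_asymp R hR
  refine ⟨min (β / 20) (δ * β / (384 * C)), by positivity, min_le_left _ _, fun η hη hη0 => ?_⟩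
  have hη1 : η ≤ β / 20 := hη0.trans (min_le_left _ _)
  have hη2 : 384 * C * η ≤ δ * β := by
    have := hη0.trans (min_le_right _ _)
    rw [le_div_iff₀ (by positivity)] at this; linarith
  filter_upwards [hCx, rpow_le_TT R (1 / 2) (δ / 3) hR (by norm_num) (by positivity), rpow_le_TT R η (δ / 6) hR hη (by positivity),
    eventually_ge_atTop 2, (tendsto_rpow_atTop hη).eventually_ge_atTop 2,
    tendsto_log_atTop.eventually_ge_atTop (6 / η), tendsto_log_atTop.eventually_ge_atTop 1] with x hx hT1 hT2 h2 hxη hlη hl1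
  intro k hk hkR
  have hx0 : 0 < x := by linarith
  have hl0 : 0 < log x := by linarith
  set D := ⌊x ^ η⌋₊ with hD
  have hD2 : 2 ≤ D := le_floor hxη
  have hDle : (D : ℝ) ≤ x ^ η := floor_le (by positivity)
  have hDge : x ^ η / 2 ≤ D := by
    have := lt_floor_add_one (x ^ η)
    rw [← hD] at this; linarith
  have hlogD : log D ≤ η * log x := by rw [← log_rpow hx0]; exact log_le_log (by positivity) hDle
  set S1 := (MM k x).filter fun m : ℕ => (m : ℝ) ^ 2 ≤ x
  set S2 := (MM k x).filter fun m : ℕ => ∃ d, d ^ 2 ∣ m ∧ D < d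
  set S3 := (MM k x).filter fun m : ℕ => x < (m : ℝ) ^ 2 ∧ (∀ d, d ^ 2 ∣ m → d ≤ D) ∧ β / 2 * log x ≤ lam D m with hS3
  have hcov : (MM k x).filter (fun m => Bad β x D m) ⊆ S1 ∪ S2 ∪ S3 := by
    intro m hm; rw [mem_filter] at hm; rw [Finset.mem_union, Finset.mem_union, mem_filter, mem_filter, mem_filter]
    by_cases h1 : (m : ℝ) ^ 2 ≤ x
    · exact Or.inl (Or.inl ⟨hm.1, h1⟩)
    by_cases h2 : ∃ d, d ^ 2 ∣ m ∧ D < d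
    · exact Or.inl (Or.inr ⟨hm.1, h2⟩)
    rcases hm.2 with h | h | h
    · exact absurd h h1
    · exact absurd h h2
    · push Not at h1 h2
      exact Or.inr ⟨hm.1, h1, h2, h⟩
  have hcard : (((MM k x).filter fun m => Bad β x D m).card : ℝ) ≤ S1.card + S2.card + S3.card := by
    exact_mod_cast (card_le_card hcov).trans ((card_union_le _ _).trans (Nat.add_le_add_right (card_union_le _ _) _))
  have hc1 : (S1.card : ℝ) ≤ δ / 3 * TT k x := by
    refine le_trans ?_ (hT1 k hk hkR)
    have : S1 ⊆ Icc 1 ⌊x ^ (1 - 1 / 2 : ℝ)⌋₊ := by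
      intro m hm; rw [mem_filter, mem_MM] at hm; rw [mem_Icc]; refine ⟨hm.1.1.1, le_floor ?_⟩
      rw [show (1 - 1 / 2 : ℝ) = 1 / 2 by norm_num, ← sqrt_eq_rpow]; exact le_sqrt_of_sq_le hm.2
    have h3 := card_le_card this; rw [Nat.card_Icc, Nat.add_sub_cancel] at h3
    exact le_trans (by exact_mod_cast h3) (floor_le (by positivity))
  have hc2 : (S2.card : ℝ) ≤ δ / 3 * TT k x := by
    have h3 := card_sq_dvd_le ⌊x⌋₊ D (by omega) S2 (fun m hm => by rw [mem_filter, mem_MM] at hm; exact ⟨hm.1.1, hm.2⟩)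
    have h4 := hT2 k hk hkR
    have h5 : (⌊x⌋₊ : ℝ) ≤ x := floor_le hx0.le
    have h6 : (⌊x⌋₊ : ℝ) / D ≤ 2 * x ^ (1 - η) := by
      rw [rpow_sub hx0, rpow_one, div_le_iff₀ (by positivity)]
      have : 0 < x ^ η := by positivity
      calc (⌊x⌋₊ : ℝ) ≤ 2 * (x / x ^ η) * (x ^ η / 2) := by field_simp; linarith
        _ ≤ _ := by gcongr
    linarith
  have hc3 : (S3.card : ℝ) ≤ δ / 3 * TT k x := by
    set g : ℕ → ℝ := fun q => if q ≤ D then log q else 0 with hg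
    have hg0 : ∀ q, 0 ≤ g q := fun q => by rw [hg]; dsimp only; split_ifs <;> positivity
    have hlam : ∀ m, lam D m = ∑ q ∈ m.primeFactors, g q := fun m => by unfold lam; rw [sum_filter]
    set A := (Icc 1 ⌊x⌋₊).filter fun a => a.primeFactors.card = k - 1 ∧ β / 4 * log x ≤ lam D a with hA
    have hk1 : ((k - 1 : ℕ) : ℝ) ≤ R * log (log x) := le_trans (by exact_mod_cast Nat.sub_le k 1) hkR
    obtain ⟨-, hs⟩ := hx (k - 1) hk1 A (fun a ha => by
      rw [hA, mem_filter, mem_Icc] at ha; exact ⟨by omega, (le_floor_iff hx0.le).1 ha.1.2, ha.2.1⟩)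
    have hs2 := hs g hg0
    set TL := log (log x) ^ (k - 1) / ((k - 1).factorial : ℝ) with hTL
    have hTL0 : 0 ≤ TL := by
      have : 0 ≤ log (log x) := log_nonneg hl1; positivity
    have hgsum : ∑ q ∈ primesLE ⌊x⌋₊, g q * (1 / ((q : ℝ) - 1)) ≤ 4 * η * log x := by
      have e1 : ∑ q ∈ primesLE ⌊x⌋₊, g q * (1 / ((q : ℝ) - 1)) ≤ ∑ q ∈ primesLE D, 2 * (log q / q) := by
        rw [← sum_filter_add_sum_filter_not _ (fun q => q ≤ D)]
        have : ∑ q ∈ primesLE ⌊x⌋₊ with ¬ q ≤ D, g q * (1 / ((q : ℝ) - 1)) = 0 := by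
          apply sum_eq_zero; intro q hq; rw [mem_filter] at hq; rw [hg]; simp [hq.2]
        rw [this, add_zero]
        refine le_trans (sum_le_sum (g := fun q : ℕ => 2 * (log q / q)) ?_) (sum_le_sum_of_subset_of_nonneg ?_ ?_)
        · intro q hq; rw [mem_filter, mem_primesLE] at hq
          have hq2 : (2 : ℝ) ≤ q := by exact_mod_cast hq.1.2.two_le
          rw [hg]; simp only [hq.2, if_true]
          have hlq : 0 ≤ log q := by positivity
          have : 1 / ((q : ℝ) - 1) ≤ 2 / q := by rw [div_le_div_iff₀ (by linarith) (by linarith)]; linarith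
          calc _ ≤ log q * (2 / q) := mul_le_mul_of_nonneg_left this hlq
            _ = _ := by ring
        · intro q hq; rw [mem_filter, mem_primesLE] at hq; exact mem_primesLE.2 ⟨hq.2, hq.1.2⟩
        · intro q _ _; positivity
      refine e1.trans ?_; rw [← mul_sum]
      have := sum_log_div_prime_le D (by omega)
      have h6 : 6 ≤ η * log x := by rw [div_le_iff₀ hη] at hlη; linarith
      linarith
    have hAsum : ∑ a ∈ A, (1 : ℝ) / a * (β / 4 * log x) ≤ C * (4 * η * log x) * TL := by
      refine le_trans (sum_le_sum fun a ha => ?_) (hs2.trans ?_)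
      · rw [← hlam]; rw [hA, mem_filter] at ha; exact mul_le_mul_of_nonneg_left ha.2.2 (by positivity)
      · exact mul_le_mul_of_nonneg_right (mul_le_mul_of_nonneg_left hgsum hC.le) hTL0
    rw [← sum_mul] at hAsum
    have hAsum2 : (∑ a ∈ A, (1 : ℝ) / a) * β ≤ 16 * C * η * TL := by
      have : ((∑ a ∈ A, (1 : ℝ) / a) * β) * log x ≤ (16 * C * η * TL) * log x := by linarith
      exact le_of_mul_le_mul_right this hl0
    have hex := sum_exact_primes_le x hx0.le S3 A (fun m hm => by rw [hS3, mem_filter, mem_MM] at hm; exact hm.1.1) (by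
      intro m hm p hp hp2; rw [hS3, mem_filter, mem_MM] at hm
      obtain ⟨⟨⟨hm1, hmx⟩, hmk⟩, -, hsq, hlm⟩ := hm
      have hpp := prime_of_mem_primeFactors hp
      have hpm := dvd_of_mem_primeFactors hp
      have hpf := primeFactors_div_of_exact hp hp2; rw [hA, mem_filter, mem_Icc, hpf, card_erase_of_mem hp]
      refine ⟨⟨Nat.div_pos (le_of_dvd hm1 hpm) hpp.pos, (Nat.div_le_self _ _).trans hmx⟩, by omega, ?_⟩
      rw [hlam] at hlm ⊢; rw [hpf]
      have e := add_sum_erase m.primeFactors g hp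
      have egp : g p ≤ η * log x := by
        rw [hg]; dsimp only
        split_ifs with h
        · exact le_trans (log_le_log (by exact_mod_cast hpp.pos) (by exact_mod_cast h)) hlogD
        · positivity
      nlinarith)
    have hlow : ∑ m ∈ S3, (1 / 4 * log x) ≤ ∑ m ∈ S3, ∑ p ∈ m.primeFactors with ¬ p ^ 2 ∣ m, log p := by
      refine sum_le_sum fun m hm => ?_; rw [hS3, mem_filter, mem_MM] at hm
      obtain ⟨⟨⟨hm1, hmx⟩, hmk⟩, hmx2, hsq, hlm⟩ := hm
      have e1 := log_le_sum_exact m D (by omega) hsq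
      have e2 : log x ≤ 2 * log m := by
        have := log_le_log hx0 hmx2.le
        rw [log_pow] at this; exact_mod_cast this
      nlinarith
    rw [sum_const, nsmul_eq_mul] at hlow
    have h7 := hlow.trans hex
    have h8 : (S3.card : ℝ) * β * log x ≤ 8 * x * (16 * C * η * TL) := by
      calc (S3.card : ℝ) * β * log x = 4 * β * (S3.card * (1 / 4 * log x)) := by ring
        _ ≤ 4 * β * (2 * x * ∑ a ∈ A, (1 : ℝ) / a) := by gcongr
        _ = 8 * x * ((∑ a ∈ A, (1 : ℝ) / a) * β) := by ring
        _ ≤ _ := by gcongr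
    have h9 : (S3.card : ℝ) * β ≤ 128 * C * η * TT k x := by
      unfold TT; rw [← hTL]; rw [← mul_le_mul_iff_left₀ hl0]; refine h8.trans (le_of_eq ?_)
      field_simp; ring
    have hTT0 : 0 ≤ TT k x := by unfold TT; positivity
    have h10 : (S3.card : ℝ) * β ≤ (δ / 3 * TT k x) * β := by
      have := mul_le_mul_of_nonneg_right hη2 hTT0; nlinarith
    exact le_of_mul_le_mul_right h10 hβ
  linarith

lemma mem_PZ_max {D a N ℓ : ℕ} : ℓ ∈ PZ (max (a.primeFactors.sup id) D) N ↔
    (∀ q ∈ a.primeFactors, q < ℓ) ∧ D < ℓ ∧ ℓ ≤ N ∧ ℓ.Prime := by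
  rw [mem_PZ, max_lt_iff]
  constructor
  · rintro ⟨⟨h1, h2⟩, h3, h4⟩
    exact ⟨fun q hq => lt_of_le_of_lt (le_sup (f := id) hq) h1, h2, h3, h4⟩
  · rintro ⟨h1, h2, h3, h4⟩; exact ⟨⟨(Finset.sup_lt_iff (by exact h4.pos)).2 h1, h2⟩, h3, h4⟩

open Classical in
/-- Splitting off the largest prime factor. -/
theorem sum_MM_decomp (R δ : ℝ) (hR : 0 < R) (hδ : 0 < δ) : ∃ η0 > 0, η0 ≤ 1 / 40 ∧ ∀ η : ℝ, 0 < η → η ≤ η0 →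
    ∀ᶠ x : ℝ in atTop, ∀ k : ℕ, 1 ≤ k → (k : ℝ) ≤ R * log (log x) → ∀ Ψ : ℕ → ℂ, (∀ m, ‖Ψ m‖ ≤ 2) →
      ‖∑ m ∈ MM k x, Ψ m‖ ≤ δ * TT k x + ∑ a ∈ Icc 1 ⌊x⌋₊ with a.primeFactors.card = k - 1,
        ‖∑ ℓ ∈ PZ (max (a.primeFactors.sup id) ⌊x ^ η⌋₊) ⌊x / a⌋₊, Ψ (a * ℓ)‖ := by
  obtain ⟨η0, h0, h1, hb⟩ := bad_count R (1 / 2) (δ / 2) hR (by norm_num) (by norm_num) (by positivity)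
  refine ⟨η0, h0, by linarith, fun η hη hηη => ?_⟩
  filter_upwards [hb η hη hηη, eventually_ge_atTop 2, (tendsto_rpow_atTop hη).eventually_ge_atTop 2] with x hx h2 hxη
  intro k hk hkR Ψ hΨ
  have hx0 : 0 < x := by linarith
  have hx := hx k hk hkR
  have hl0 : 0 < log x := log_pos (by linarith)
  set D := ⌊x ^ η⌋₊
  have hD2 : 2 ≤ D := le_floor hxη
  have hDle : (D : ℝ) ≤ x ^ η := floor_le (by positivity)
  have hlogD : log D ≤ η * log x := by rw [← log_rpow hx0]; exact log_le_log (by positivity) hDle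
  set A := (Icc 1 ⌊x⌋₊).filter fun a => a.primeFactors.card = k - 1 with hA
  set F := A.sigma fun a => PZ (max (a.primeFactors.sup id) D) ⌊x / a⌋₊ with hF
  have hF' : ∀ a ℓ, (⟨a, ℓ⟩ : (_ : ℕ) × ℕ) ∈ F → ((1 ≤ a ∧ a ≤ ⌊x⌋₊) ∧ a.primeFactors.card = k - 1) ∧
      (∀ q ∈ a.primeFactors, q < ℓ) ∧ D < ℓ ∧ ℓ ≤ ⌊x / a⌋₊ ∧ ℓ.Prime := by
    intro a ℓ h; rw [hF, mem_sigma, mem_PZ_max, hA, mem_filter, mem_Icc] at h; exact h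
  have hle : ∀ a ℓ a' ℓ', (⟨a, ℓ⟩ : (_ : ℕ) × ℕ) ∈ F → (⟨a', ℓ'⟩ : (_ : ℕ) × ℕ) ∈ F → a * ℓ = a' * ℓ' → ℓ' ≤ ℓ := by
    intro a ℓ a' ℓ' h h' e
    obtain ⟨h1, h2, -, -, h3⟩ := hF' _ _ h
    obtain ⟨-, -, -, -, h3'⟩ := hF' _ _ h'
    rcases h3'.dvd_mul.1 (Dvd.intro_left a' e.symm : ℓ' ∣ a * ℓ) with hd | hd
    · exact (h2 ℓ' (mem_primeFactors.2 ⟨h3', hd, by omega⟩)).le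
    · exact le_of_dvd h3.pos hd
  have hinj : Set.InjOn (fun s : (_ : ℕ) × ℕ => s.1 * s.2) (F : Set _) := by
    rintro ⟨a, ℓ⟩ h ⟨a', ℓ'⟩ h' e
    rw [Finset.mem_coe] at h h'
    dsimp only at e
    obtain rfl : ℓ = ℓ' := le_antisymm (hle _ _ _ _ h' h e.symm) (hle _ _ _ _ h h' e)
    obtain rfl : a = a' := Nat.eq_of_mul_eq_mul_right (hF' _ _ h).2.2.2.2.pos e; rfl
  set G := F.image fun s : (_ : ℕ) × ℕ => s.1 * s.2 with hG
  have hsumG : ∑ m ∈ G, Ψ m = ∑ a ∈ A, ∑ ℓ ∈ PZ (max (a.primeFactors.sup id) D) ⌊x / a⌋₊, Ψ (a * ℓ) := by rw [hG, sum_image hinj, hF, sum_sigma]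
  have hGM : G ⊆ MM k x := by
    intro m hm; rw [hG, mem_image] at hm
    obtain ⟨⟨a, ℓ⟩, h, rfl⟩ := hm
    obtain ⟨⟨⟨ha1, ha2⟩, ha3⟩, h2, h3, h4, h5⟩ := hF' _ _ h; rw [mem_MM]
    dsimp only
    refine ⟨⟨Nat.mul_pos ha1 h5.pos, le_floor ?_⟩, ?_⟩
    · have : (ℓ : ℝ) ≤ x / a := (le_floor_iff (by positivity)).1 h4; rw [le_div_iff₀ (by exact_mod_cast ha1)] at this
      push_cast; linarith
    · rw [Nat.primeFactors_mul (by omega) h5.ne_zero, h5.primeFactors, card_union_of_disjoint, ha3, card_singleton]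
      · omega
      · rw [Finset.disjoint_singleton_right]
        intro hq; exact (h2 _ hq).ne rfl
  have hbad : MM k x \ G ⊆ (MM k x).filter fun m => Bad (1 / 2) x D m := by
    intro m hm; rw [Finset.mem_sdiff] at hm; rw [mem_filter]; refine ⟨hm.1, ?_⟩
    obtain ⟨hm1, hmG⟩ := hm; rw [mem_MM] at hm1
    obtain ⟨⟨hm1, hmx⟩, hmk⟩ := hm1
    by_contra hB
    unfold Bad at hB
    push Not at hB
    obtain ⟨hB1, hB2, hB3⟩ := hB
    have hne : m.primeFactors.Nonempty := by rw [← card_pos]; omega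
    obtain ⟨p, hp, hpmax⟩ := exists_max_image m.primeFactors id hne
    have hpp := prime_of_mem_primeFactors hp
    have hpm := dvd_of_mem_primeFactors hp
    by_cases hpD : p ≤ D
    · have e1 := log_le_sum_exact m D (by omega) hB2
      have e2 : log x ≤ 2 * log m := by
        have := log_le_log hx0 hB1.le
        rw [log_pow] at this; exact_mod_cast this
      have e3 : ∑ p ∈ m.primeFactors with ¬ p ^ 2 ∣ m, log p ≤ lam D m := by
        unfold lam; apply sum_le_sum_of_subset_of_nonneg
        · intro q hq
          rw [mem_filter] at hq ⊢; exact ⟨hq.1, (hpmax q hq.1).trans hpD⟩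
        · intro q _ _; positivity
      nlinarith
    · push Not at hpD
      have hp2 : ¬ p ^ 2 ∣ m := fun h => by have := hB2 p h; omega
      apply hmG; rw [hG, mem_image]
      have hpf := primeFactors_div_of_exact hp hp2
      have hpos : 0 < m / p := Nat.div_pos (le_of_dvd hm1 hpm) hpp.pos; refine ⟨⟨m / p, p⟩, ?_, Nat.div_mul_cancel hpm⟩
      rw [hF, mem_sigma, mem_PZ_max, hA, mem_filter, mem_Icc, hpf, card_erase_of_mem hp]
      refine ⟨⟨⟨hpos, (Nat.div_le_self _ _).trans hmx⟩, by omega⟩, ?_, hpD, le_floor ?_, hpp⟩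
      · intro q hq; rw [mem_erase] at hq; exact lt_of_le_of_ne (hpmax q hq.2) hq.1
      · rw [le_div_iff₀ (by exact_mod_cast hpos)]
        have h6 : (p : ℝ) * ((m / p : ℕ) : ℝ) = m := by exact_mod_cast mul_div_cancel' hpm
        dsimp only
        rw [h6]; exact (le_floor_iff hx0.le).1 hmx
  rw [← sum_sdiff hGM, hsumG]
  refine (norm_add_le _ _).trans (add_le_add ?_ (norm_sum_le _ _))
  refine (norm_sum_le _ _).trans ((sum_le_sum fun m _ => hΨ m).trans ?_)
  rw [sum_const, nsmul_eq_mul]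
  have : ((MM k x \ G).card : ℝ) ≤ (((MM k x).filter fun m => Bad (1 / 2) x D m).card : ℝ) := by exact_mod_cast card_le_card hbad
  linarith

lemma exists_smooth_mul_rough (D m : ℕ) (hm : 1 ≤ m) : ∃ b c, m = b * c ∧ 1 ≤ b ∧ 1 ≤ c ∧
    (∀ p, p.Prime → p ∣ b → p ≤ D) ∧ ∀ p, p.Prime → p ∣ c → D < p := by
  induction m using induction_on_primes with
  | zero => omega
  | one => exact ⟨1, 1, by simp, le_rfl, le_rfl, fun p hp h => absurd (dvd_one.1 h) hp.one_lt.ne', fun p hp h => absurd (dvd_one.1 h) hp.one_lt.ne'⟩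
  | prime_mul q a hq ih =>
    obtain ⟨b, c, rfl, hb, hc, h1, h2⟩ := ih (Nat.pos_of_ne_zero fun h => by subst h; simp at hm)
    by_cases h : q ≤ D
    · refine ⟨q * b, c, by ring, Nat.mul_pos hq.pos hb, hc, fun p hp hd => ?_, h2⟩
      rcases hp.dvd_mul.1 hd with h' | h'
      · rwa [(Nat.prime_dvd_prime_iff_eq hp hq).1 h']
      · exact h1 p hp h'
    · refine ⟨b, q * c, by ring, hb, Nat.mul_pos hq.pos hc, h1, fun p hp hd => ?_⟩
      rcases hp.dvd_mul.1 hd with h' | h'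
      · rw [(Nat.prime_dvd_prime_iff_eq hp hq).1 h']; omega
      · exact h2 p hp h'

lemma pow_div_factorial_steps (L R : ℝ) (hL : 0 < L) (hR : 0 < R) (d j : ℕ) (h : ((j + d : ℕ) : ℝ) ≤ R * L) :
    L ^ j / j.factorial ≤ R ^ d * (L ^ (j + d) / (j + d).factorial) := by
  induction d with
  | zero => simp
  | succ d ih =>
    have h1 := pow_div_factorial_step L R hL (j + d) (by exact_mod_cast h)
    refine (ih (le_trans (by push_cast; linarith) h)).trans ?_; rw [pow_succ, mul_assoc]
    exact mul_le_mul_of_nonneg_left h1 (by positivity)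

lemma card_primeFactors_rough_le (x η : ℝ) (hx : 1 < x) (c : ℕ) (hc : 1 ≤ c) (hcx : (c : ℝ) ≤ x)
    (h : ∀ p, p.Prime → p ∣ c → ⌊x ^ η⌋₊ < p) : (c.primeFactors.card : ℝ) * η ≤ 1 := by
  have h1 : (x ^ η) ^ c.primeFactors.card ≤ x := by
    calc (x ^ η) ^ c.primeFactors.card = ∏ p ∈ c.primeFactors, x ^ η := by rw [prod_const]
      _ ≤ ∏ p ∈ c.primeFactors, (p : ℝ) := by
        refine Finset.prod_le_prod (fun p _ => by positivity) fun p hp => ?_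
        exact (Nat.lt_of_floor_lt (h p (prime_of_mem_primeFactors hp) (dvd_of_mem_primeFactors hp))).le
      _ = ((∏ p ∈ c.primeFactors, p : ℕ) : ℝ) := by push_cast; rfl
      _ ≤ c := by exact_mod_cast le_of_dvd hc (Nat.prod_primeFactors_dvd c)
      _ ≤ x := hcx
  rw [← rpow_natCast, ← rpow_mul (by linarith)] at h1
  nth_rewrite 2 [← rpow_one x] at h1
  have := (rpow_le_rpow_left_iff hx).1 h1
  linarith

open Classical in
/-- Majorizing an event on the level set of `ω` by events on rough integers. -/
theorem MM_majorant (R β δ : ℝ) (hR : 0 < R) (hβ : 0 < β) (hβ2 : β ≤ 1 / 2) (hδ : 0 < δ) : ∃ η0 > 0, η0 ≤ β / 20 ∧ ∀ η : ℝ, 0 < η → η ≤ η0 →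
    ∃ C > 0, ∀ᶠ x : ℝ in atTop, ∀ k : ℕ, 1 ≤ k → (k : ℝ) ≤ R * log (log x) →
      ∃ 𝔅 : Finset ℕ, (∀ b ∈ 𝔅, 1 ≤ b ∧ (b : ℝ) ≤ x ^ β) ∧ ∑ b ∈ 𝔅, x / b / log x ≤ C * TT k x ∧
        ∀ Ev : ℕ → Prop, (((MM k x).filter Ev).card : ℝ) ≤ δ * TT k x +
          ∑ b ∈ 𝔅, (((Ioc 0 ⌊x / b⌋₊).filter fun c => (∀ p, p.Prime → p ≤ ⌊x ^ η⌋₊ → ¬ p ∣ c) ∧ Ev (b * c)).card : ℝ) := by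
  obtain ⟨η0, h0, h1, hb⟩ := bad_count R β δ hR hβ hβ2 hδ
  refine ⟨η0, h0, h1, fun η hη hηη => ?_⟩
  obtain ⟨C, hC, hCx⟩ := sum_inv_omega_asymp R hR
  obtain ⟨K, hK⟩ := exists_nat_ge (1 / η)
  set R' := max R 1
  have hR'1 : 1 ≤ R' := le_max_right _ _
  refine ⟨(K + 1) * (C * R' ^ K), by positivity, ?_⟩
  filter_upwards [hb η hη hηη, eventually_ge_atTop 2, (tendsto_rpow_atTop hη).eventually_ge_atTop 2, hCx,
    tendsto_LL.eventually_ge_atTop 1] with x hx h2 hxη hCx hL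
  intro k hk hkR
  have hx0 : 0 < x := by linarith
  have hx := hx k hk hkR
  have hl0 : 0 < log x := log_pos (by linarith)
  set D := ⌊x ^ η⌋₊
  have hD2 : 2 ≤ D := le_floor hxη
  have hDle : (D : ℝ) ≤ x ^ η := floor_le (by positivity)
  have hlogD : log D ≤ η * log x := by rw [← log_rpow hx0]; exact log_le_log (by positivity) hDle
  set L := log (log x) with hLd
  set 𝔅 := (Icc 1 ⌊x ^ β⌋₊).filter fun b => b.primeFactors.card + 1 ≤ k ∧ k ≤ b.primeFactors.card + K with h𝔅
  have hmem : ∀ b, b ∈ 𝔅 ↔ (1 ≤ b ∧ (b : ℝ) ≤ x ^ β) ∧ b.primeFactors.card + 1 ≤ k ∧ k ≤ b.primeFactors.card + K := by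
    intro b; rw [h𝔅, mem_filter, mem_Icc, le_floor_iff (by positivity)]
  refine ⟨𝔅, fun b h => ((hmem b).1 h).1, ?_, fun Ev => ?_⟩
  · have e1 : ∑ b ∈ 𝔅, (1 : ℝ) / b ≤ (K + 1) * (C * R' ^ K) * (L ^ (k - 1) / (k - 1).factorial) := by
      rw [← sum_fiberwise_of_maps_to (t := range (K + 1)) (g := fun b => k - 1 - b.primeFactors.card)
        (fun b h => by rw [mem_range]; have := (hmem b).1 h; omega)]
      have : ∀ d ∈ range (K + 1), ∑ b ∈ 𝔅 with k - 1 - b.primeFactors.card = d, (1 : ℝ) / b ≤ C * R' ^ K * (L ^ (k - 1) / (k - 1).factorial) := by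
        intro d hd; rw [mem_range] at hd
        rcases Finset.eq_empty_or_nonempty (𝔅.filter fun b => k - 1 - b.primeFactors.card = d) with he | ⟨b0, hb0⟩
        · rw [he, sum_empty]; positivity
        rw [mem_filter, hmem] at hb0
        obtain ⟨j, hj⟩ : ∃ j, k - 1 = j + d := ⟨k - 1 - d, by omega⟩
        have hkj : ((k - 1 : ℕ) : ℝ) ≤ R * L := le_trans (by exact_mod_cast Nat.sub_le k 1) hkR
        have hjd : ((j + d : ℕ) : ℝ) ≤ R' * L := by
          rw [← hj]
          exact hkj.trans (mul_le_mul_of_nonneg_right (le_max_left _ _) (by linarith))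
        have hjR : (j : ℝ) ≤ R * L := le_trans (by exact_mod_cast (by omega : j ≤ k - 1)) hkj
        obtain ⟨hs, -⟩ := hCx j hjR (𝔅.filter fun b => k - 1 - b.primeFactors.card = d) (fun a ha => by
          rw [mem_filter, hmem] at ha; refine ⟨by omega, ha.1.1.2.trans ?_, by omega⟩
          calc x ^ β ≤ x ^ (1 : ℝ) := rpow_le_rpow_of_exponent_le (by linarith) (by linarith)
            _ = x := rpow_one x)
        refine hs.trans ?_
        have h3 := pow_div_factorial_steps L R' (by linarith) (by linarith) d j hjd; rw [← hj] at h3; rw [mul_assoc]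
        refine mul_le_mul_of_nonneg_left (h3.trans ?_) hC.le
        refine mul_le_mul_of_nonneg_right (pow_le_pow_right₀ hR'1 (by omega)) (by positivity)
      refine (sum_le_sum this).trans ?_
      rw [sum_const, card_range, nsmul_eq_mul]; push_cast; apply le_of_eq; ring
    calc ∑ b ∈ 𝔅, x / b / log x = x / log x * ∑ b ∈ 𝔅, (1 : ℝ) / b := by rw [mul_sum]; refine sum_congr rfl fun b _ => by field_simp
      _ ≤ x / log x * ((K + 1) * (C * R' ^ K) * (L ^ (k - 1) / (k - 1).factorial)) := by gcongr
      _ = _ := by unfold TT; rw [← hLd]; ring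
  · set T : ℕ → Finset ℕ := fun b => (Ioc 0 ⌊x / b⌋₊).filter fun c => (∀ p, p.Prime → p ≤ D → ¬ p ∣ c) ∧ Ev (b * c)
    have hcov : (MM k x).filter Ev ⊆ ((MM k x).filter fun m => Bad β x D m) ∪ 𝔅.biUnion fun b => (T b).image fun c => b * c := by
      intro m hm; rw [mem_filter] at hm; rw [Finset.mem_union, mem_filter]
      by_cases hB : Bad β x D m
      · exact Or.inl ⟨hm.1, hB⟩
      right
      obtain ⟨hm, hEv⟩ := hm; rw [mem_MM] at hm
      obtain ⟨⟨hm1, hmx⟩, hmk⟩ := hm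
      have hmx' : (m : ℝ) ≤ x := (le_floor_iff hx0.le).1 hmx
      unfold Bad at hB
      push Not at hB
      obtain ⟨hB1, hB2, hB3⟩ := hB
      obtain ⟨b, c, rfl, hb1, hc1, hbs, hcr⟩ := exists_smooth_mul_rough D m hm1
      have hpfb : (b * c).primeFactors.filter (fun p => p ≤ D) = b.primeFactors := by
        ext p
        rw [mem_filter, mem_primeFactors, mem_primeFactors]; constructor
        · rintro ⟨⟨hp, hd, h0⟩, hpD⟩
          refine ⟨hp, (hp.dvd_mul.1 hd).resolve_right fun h => ?_, by omega⟩
          have := hcr p hp h; omega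
        · rintro ⟨hp, hd, h0⟩; exact ⟨⟨hp, hd.mul_right c, by omega⟩, hbs p hp hd⟩
      have hlogb : log b ≤ β * log x := by
        have e1 := log_le_sum_exact b D hb1 fun d hd => hB2 d (hd.mul_right c)
        have e2 : ∑ p ∈ b.primeFactors with ¬ p ^ 2 ∣ b, log p ≤ lam D (b * c) := by
          unfold lam; rw [hpfb]
          exact sum_le_sum_of_subset_of_nonneg (filter_subset _ _) fun q _ _ => by positivity
        nlinarith
      have hbx : (b : ℝ) ≤ x ^ β := by rw [← log_le_log_iff (by exact_mod_cast hb1) (by positivity), log_rpow hx0]; exact hlogb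
      have hc : c ≠ 1 := by
        rintro rfl
        have := log_lt_log hx0 hB1; rw [log_pow] at this
        push_cast at this; rw [mul_one] at this; nlinarith
      have hbc : Nat.Coprime b c := Nat.Coprime.symm (Nat.coprime_of_dvd fun p hp h1 h2 => by have := hcr p hp h1; have := hbs p hp h2; omega)
      rw [Nat.Coprime.primeFactors_mul hbc, card_union_of_disjoint hbc.disjoint_primeFactors] at hmk
      have hcx : (c : ℝ) ≤ x / b := by rw [le_div_iff₀ (by exact_mod_cast hb1)]; push_cast at hmx'; linarith
      have hcpos : 1 ≤ c.primeFactors.card := by rw [Nat.succ_le_iff, card_pos, Nat.nonempty_primeFactors]; omega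
      have hcK : c.primeFactors.card ≤ K := by
        have e1 := card_primeFactors_rough_le x η (by linarith) c hc1 (hcx.trans (div_le_self hx0.le (by exact_mod_cast hb1))) hcr
        have e2 : (c.primeFactors.card : ℝ) ≤ K := by
          refine le_trans ?_ hK
          rw [le_div_iff₀ hη]; exact e1
        exact_mod_cast e2
      rw [mem_biUnion]
      refine ⟨b, (hmem b).2 ⟨⟨hb1, hbx⟩, by omega, by omega⟩, mem_image.2 ⟨c, ?_, rfl⟩⟩; rw [mem_filter, mem_Ioc]
      exact ⟨⟨hc1, le_floor hcx⟩, fun p hp hpD hd => by have := hcr p hp hd; omega, hEv⟩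
    have h3 : (((MM k x).filter Ev).card : ℝ) ≤ ((MM k x).filter fun m => Bad β x D m).card + ∑ b ∈ 𝔅, ((T b).card : ℝ) := by
      have := (card_le_card hcov).trans ((card_union_le _ _).trans (Nat.add_le_add_left
        (card_biUnion_le.trans (sum_le_sum fun b _ => card_image_le)) _))
      exact_mod_cast this
    linarith

/-- To bound an event on the level set of `ω`, it suffices to bound it on rough integers. -/
theorem MM_event (R β δ : ℝ) (hR : 0 < R) (hβ : 0 < β) (hβ2 : β ≤ 1 / 2) (hδ : 0 < δ) : ∃ η > 0, η ≤ β / 20 ∧ ∃ τ > 0,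
    ∀ᶠ x : ℝ in atTop, ∀ k : ℕ, 1 ≤ k → (k : ℝ) ≤ R * log (log x) → ∀ Ev : ℕ → Prop,
      (∀ b : ℕ, 1 ≤ b → (b : ℝ) ≤ x ^ β → ∀ S ⊆ Ioc 0 ⌊x / b⌋₊, (∀ c ∈ S, (∀ p, p.Prime → p ≤ ⌊x ^ η⌋₊ → ¬ p ∣ c) ∧ Ev (b * c)) →
        (S.card : ℝ) ≤ τ * (x / b / log x)) → ∀ M ⊆ MM k x, (∀ m ∈ M, Ev m) → (M.card : ℝ) ≤ δ * TT k x := by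
  classical
  obtain ⟨η0, h0, h1, h⟩ := MM_majorant R β (δ / 2) hR hβ hβ2 (by positivity)
  obtain ⟨C, hC, hx⟩ := h η0 h0 le_rfl
  refine ⟨η0, h0, h1, δ / (2 * C), by positivity, ?_⟩
  filter_upwards [hx] with x hx
  intro k hk hkR Ev hEv M hM hMe
  obtain ⟨𝔅, hB1, hB2, hB3⟩ := hx k hk hkR
  have h3 : (M.card : ℝ) ≤ (((MM k x).filter Ev).card : ℝ) := by exact_mod_cast card_le_card fun m hm => mem_filter.2 ⟨hM hm, hMe m hm⟩
  refine h3.trans ((hB3 Ev).trans ?_)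
  have h4 := sum_le_sum fun b hb => hEv b (hB1 b hb).1 (hB1 b hb).2 _ (filter_subset _ _) fun c hc => (mem_filter.1 hc).2
  refine (add_le_add_right h4 _).trans ?_
  rw [← mul_sum]
  have h5 := mul_le_mul_of_nonneg_left hB2 (show 0 ≤ δ / (2 * C) by positivity)
  have : δ / (2 * C) * (C * TT k x) = δ / 2 * TT k x := by field_simp
  linarith

/-- Few `m` have `m + 1` divisible by a prime from a thin set. -/
theorem MM_thin (R β δ : ℝ) (hR : 0 < R) (hβ : 0 < β) (hβ2 : β ≤ 1 / 2) (hδ : 0 < δ) : ∃ τ > 0,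
    ∀ᶠ x : ℝ in atTop, ∀ k : ℕ, 1 ≤ k → (k : ℝ) ≤ R * log (log x) → ∀ Q : Finset ℕ,
      (∀ q ∈ Q, q.Prime ∧ (q : ℝ) ≤ x ^ (1 - 2 * β)) → ∑ q ∈ Q, (1 : ℝ) / q ≤ τ →
      ∀ M ⊆ MM k x, (∀ m ∈ M, ∃ q ∈ Q, q ∣ m + 1) → (M.card : ℝ) ≤ δ * TT k x := by
  obtain ⟨η, hη, hη1, τ, hτ, h⟩ := MM_event R β δ hR hβ hβ2 hδ
  obtain ⟨C, hC, hw⟩ := wt_residue (2 * η) η hη le_rfl (by linarith)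
  refine ⟨τ / (2 * C), by positivity, ?_⟩
  filter_upwards [h, hw, eventually_params (2 * η) η hη le_rfl (by linarith), eventually_log_pow_le (32 / τ) 1 (β / 2) (by positivity),
    eventually_log_le_zz, tendsto_log_atTop.eventually_ge_atTop 2] with x hx hw hpar hlp hzz hl2
  obtain ⟨hX2, hXγ, hzzX, hfl, hlz, hsq, hz2, hl1⟩ := hpar
  have hx0 : 0 < x := by linarith
  intro k hk hkR Q hQ hQs
  refine hx k hk hkR (fun m => ∃ q ∈ Q, q ∣ m + 1) fun b hb1 hbx S hS hSc => ?_
  set D := ⌊x ^ η⌋₊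
  set N := ⌊x / b⌋₊
  have hb0 : (0 : ℝ) < b := by exact_mod_cast hb1
  have hNx : (N : ℝ) ≤ x / b := floor_le (by positivity)
  have hcov : S ⊆ Q.biUnion fun q => S.filter fun c => q ∣ b * c + 1 := by
    intro c hc
    obtain ⟨-, q, hq, hd⟩ := hSc c hc; exact mem_biUnion.2 ⟨q, hq, mem_filter.2 ⟨hc, hd⟩⟩
  have h1 : (S.card : ℝ) ≤ ∑ q ∈ Q, ((S.filter fun c => q ∣ b * c + 1).card : ℝ) := by exact_mod_cast (card_le_card hcov).trans card_biUnion_le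
  have h2 : ∀ q ∈ Q, ((S.filter fun c => q ∣ b * c + 1).card : ℝ) ≤ C * (x / b / log x) * (1 / q) + 16 * x ^ (10 * η) := by
    intro q hq
    have hqp := (hQ q hq).1
    have hq0 : (0 : ℝ) < q := by exact_mod_cast hqp.pos
    rcases Finset.eq_empty_or_nonempty (S.filter fun c => q ∣ b * c + 1) with he | ⟨c0, hc0⟩
    · rw [he, card_empty]; push_cast; positivity
    rw [mem_filter] at hc0
    have h3 := hw 2 le_rfl (by push_cast; linarith) 0 N (Nat.zero_le _) q c0 hqp
    have h4 : ((S.filter fun c => q ∣ b * c + 1).card : ℝ) ≤ ∑ n ∈ Ioc 0 N with n % q = c0 % q, wt 2 D (x ^ (2 * η)) n := by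
      rw [card_eq_sum_ones]; push_cast
      refine le_trans (sum_le_sum (g := fun n => wt 2 D (x ^ (2 * η)) n) fun c hc => ?_) (sum_le_sum_of_subset_of_nonneg ?_ fun n _ _ => wt_nonneg _ _ _ _)
      · rw [wt_eq_one 2 D _ c hz2 (hSc c (mem_filter.1 hc).1).1]
      · intro c hc
        rw [mem_filter] at hc ⊢; refine ⟨hS hc.1, ?_⟩
        have hqb : Nat.Coprime q b := by
          rw [Nat.Prime.coprime_iff_not_dvd hqp]; intro hd
          have := (Nat.dvd_add_right (hd.mul_right c)).1 hc.2; exact hqp.one_lt.ne' (dvd_one.1 this)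
        have e1 : b * c + 1 ≡ b * c0 + 1 [MOD q] :=
          ((Nat.modEq_zero_iff_dvd).2 hc.2).trans ((Nat.modEq_zero_iff_dvd).2 hc0.2).symm
        exact ModEq.cancel_left_of_coprime hqb (ModEq.add_right_cancel' 1 e1)
    refine h4.trans (h3.trans (add_le_add ?_ (le_of_eq ?_)))
    · push_cast; rw [sub_zero]
      calc C * ((N : ℝ) / (q * log x)) ≤ C * (x / b / (q * log x)) := by gcongr
        _ = _ := by field_simp
    · congr 2; ring
  have h3 : (Q.card : ℝ) ≤ x ^ (1 - 2 * β) := by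
    have : Q ⊆ primesLE ⌊x ^ (1 - 2 * β)⌋₊ := fun q hq => mem_primesLE.2 ⟨le_floor (hQ q hq).2, (hQ q hq).1⟩
    exact le_trans (by exact_mod_cast card_primesLE_le _ Q this) (floor_le (by positivity))
  have h4 : 16 * x ^ (10 * η) * x ^ (1 - 2 * β) ≤ τ / 2 * (x / b / log x) := by
    have e1 : x ^ (10 * η) * x ^ (1 - 2 * β) ≤ x ^ (1 - β) / x ^ (β / 2) := by
      rw [← rpow_sub hx0, ← rpow_add hx0]; exact rpow_le_rpow_of_exponent_le (by linarith) (by linarith)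
    have e2 : x ^ (1 - β) ≤ x / b := by
      rw [rpow_sub hx0, rpow_one]; exact div_le_div_of_nonneg_left hx0.le hb0 hbx
    have e3 : 32 / τ * log x ≤ x ^ (β / 2) := by rw [pow_one] at hlp; exact hlp
    calc 16 * x ^ (10 * η) * x ^ (1 - 2 * β) ≤ 16 * (x ^ (1 - β) / x ^ (β / 2)) := by rw [mul_assoc]; gcongr
      _ ≤ 16 * (x / b / (32 / τ * log x)) := by gcongr
      _ = _ := by field_simp; norm_num
  calc (S.card : ℝ) ≤ ∑ q ∈ Q, (C * (x / b / log x) * (1 / q) + 16 * x ^ (10 * η)) := h1.trans (sum_le_sum h2)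
    _ = C * (x / b / log x) * (∑ q ∈ Q, (1 : ℝ) / q) + 16 * x ^ (10 * η) * Q.card := by rw [sum_add_distrib, ← mul_sum, sum_const, nsmul_eq_mul]; ring
    _ ≤ C * (x / b / log x) * (τ / (2 * C)) + 16 * x ^ (10 * η) * x ^ (1 - 2 * β) := by gcongr
    _ = τ / 2 * (x / b / log x) + 16 * x ^ (10 * η) * x ^ (1 - 2 * β) := by field_simp
    _ ≤ _ := by linarith

lemma not_dvd_add_one {q n : ℕ} (hq : q.Prime) (h : q ∣ n) : ¬ q ∣ n + 1 := fun h1 =>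
  hq.one_lt.ne' (dvd_one.1 ((Nat.dvd_add_right h).1 h1))

lemma sum_xi_eq (Q : Finset ℕ) (hQ : ∀ q ∈ Q, q.Prime) (g : ℕ → ℝ) (b c : ℕ) :
    ∑ q ∈ Q with ¬ q ∣ b, g q * xi q b c = (∑ q ∈ Q with q ∣ b * c + 1, g q - ∑ q ∈ Q, g q / ((q : ℝ) - 1)) +
      ∑ q ∈ Q with q ∣ b * c, g q / ((q : ℝ) - 1) := by
  rw [sum_filter, sum_filter, sum_filter, ← sum_sub_distrib, ← sum_add_distrib]
  refine sum_congr rfl fun q hq => ?_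
  have hp := hQ q hq
  by_cases hb : q ∣ b
  · have h1 := not_dvd_add_one hp (hb.mul_right c)
    simp only [hb, h1, hb.mul_right c, not_true, if_true, if_false]; ring
  · rw [if_pos hb]; unfold xi
    by_cases hc : q ∣ c
    · have h1 := not_dvd_add_one hp (hc.mul_left b); simp only [hc, h1, hc.mul_left b, if_true, if_false]; ring
    · have : ¬ q ∣ b * c := fun h => (hp.dvd_mul.1 h).elim hb hc; rw [if_neg hc, if_neg this]
      split_ifs <;> ring

/-- A Turán–Kubilius inequality for `m + 1` with `m` in the level set of `ω`. -/
theorem MM_turan (R κ δ : ℝ) (hR : 0 < R) (hκ : 0 < κ) (hδ : 0 < δ) : ∃ τ > 0,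
    ∀ᶠ x : ℝ in atTop, ∀ k : ℕ, 1 ≤ k → (k : ℝ) ≤ R * log (log x) → ∀ z : ℕ, 2 ≤ z → (z : ℝ) ≤ zz x →
      2 * (R * log (log x)) ≤ κ * z → ∀ (Q : Finset ℕ) (g : ℕ → ℝ),
      (∀ q ∈ Q, q.Prime ∧ z < q ∧ (q : ℝ) ≤ x ^ (1 / 20 : ℝ) ∧ |g q| ≤ 1) → ∑ q ∈ Q, g q ^ 2 / q ≤ τ →
      ∀ M ⊆ MM k x, (∀ m ∈ M, κ < |∑ q ∈ Q with q ∣ m + 1, g q - ∑ q ∈ Q, g q / ((q : ℝ) - 1)|) → (M.card : ℝ) ≤ δ * TT k x := by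
  obtain ⟨η, hη, hη1, τ, hτ, h⟩ := MM_event R (1 / 2) δ hR (by norm_num) (by norm_num) hδ
  obtain ⟨C, hC, hw⟩ := wt_turan (2 * η) η (1 / 20) hη le_rfl (by linarith) (by norm_num) (by norm_num)
  refine ⟨τ * κ ^ 2 / (8 * C), by positivity, ?_⟩
  filter_upwards [h, hw, eventually_params (2 * η) η hη le_rfl (by linarith), eventually_log_pow_le 1 1 (3 / 20) (by norm_num)] with x hx hw hpar hlp
  obtain ⟨hX2, hXγ, hzzX, hfl, hlz, hsq, hz2, hl1⟩ := hpar
  have hx0 : 0 < x := by linarith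
  have hl0 : 0 < log x := by linarith
  intro k hk hkR z hz hzx hzR Q g hQ hQs M hM hMe
  refine hx k hk hkR (fun m => m.primeFactors.card = k ∧ κ < |∑ q ∈ Q with q ∣ m + 1, g q - ∑ q ∈ Q, g q / ((q : ℝ) - 1)|) ?_ M hM
    fun m hm => ⟨(mem_MM.1 (hM hm)).2, hMe m hm⟩
  intro b hb1 hbx S hS hSc
  set D := ⌊x ^ η⌋₊
  set N := ⌊x / b⌋₊
  have hb0 : (0 : ℝ) < b := by exact_mod_cast hb1
  have hNx : (N : ℝ) ≤ x / b := floor_le (by positivity)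
  have hzD : z ≤ D := le_floor (hzx.trans hzzX)
  have h3 := hw z hz hzx 0 N (Nat.zero_le _) (Q.filter fun q => ¬ q ∣ b) b g (fun q hq => by
    rw [mem_filter] at hq; exact ⟨(hQ q hq.1).1, (hQ q hq.1).2.1, (hQ q hq.1).2.2.1, hq.2⟩)
  have h4 : ∑ q ∈ Q with ¬ q ∣ b, g q ^ 2 / q ≤ τ * κ ^ 2 / (8 * C) :=
    le_trans (sum_le_sum_of_subset_of_nonneg (filter_subset _ _) fun q _ _ => by positivity) hQs
  have h5 : ∀ c ∈ S, κ ^ 2 / 4 ≤ wt z D (x ^ (2 * η)) c * (∑ q ∈ Q with ¬ q ∣ b, g q * xi q b c) ^ 2 := by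
    intro c hc
    obtain ⟨hr, hck, hcE⟩ := hSc c hc
    rw [wt_eq_one z D _ c hzD hr, one_mul, sum_xi_eq Q (fun q hq => (hQ q hq).1)]
    have hc0 : 0 < c := (mem_Ioc.1 (hS hc)).1
    have hsub : (Q.filter fun q => q ∣ b * c) ⊆ (b * c).primeFactors := fun q hq => by
      rw [mem_filter] at hq
      exact mem_primeFactors.2 ⟨(hQ q hq.1).1, hq.2, (Nat.mul_pos hb1 hc0).ne'⟩
    have hz0 : (0 : ℝ) < z := by exact_mod_cast (by omega : 0 < z)
    have h6 : |∑ q ∈ Q with q ∣ b * c, g q / ((q : ℝ) - 1)| ≤ κ / 2 := by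
      refine (abs_sum_le_sum_abs _ _).trans ((sum_le_sum (g := fun _ => 1 / (z : ℝ)) fun q hq => ?_).trans ?_)
      · rw [mem_filter] at hq
        obtain ⟨hp, hzq, -, hg⟩ := hQ q hq.1
        have : (z : ℝ) + 1 ≤ q := by exact_mod_cast hzq
        rw [abs_div, abs_of_pos (show (0 : ℝ) < q - 1 by linarith)]; exact div_le_div₀ (by norm_num) hg hz0 (by linarith)
      · rw [sum_const, nsmul_eq_mul, mul_one_div, div_le_iff₀ hz0]
        have : ((Q.filter fun q => q ∣ b * c).card : ℝ) ≤ k := by exact_mod_cast (card_le_card hsub).trans_eq hck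
        linarith
    have h7 : κ / 2 ≤ |(∑ q ∈ Q with q ∣ b * c + 1, g q - ∑ q ∈ Q, g q / ((q : ℝ) - 1)) + ∑ q ∈ Q with q ∣ b * c, g q / ((q : ℝ) - 1)| := by
      have := abs_sub_abs_le_abs_sub (∑ q ∈ Q with q ∣ b * c + 1, g q - ∑ q ∈ Q, g q / ((q : ℝ) - 1)) (-∑ q ∈ Q with q ∣ b * c, g q / ((q : ℝ) - 1))
      rw [sub_neg_eq_add, abs_neg] at this; linarith
    rw [← sq_abs (_ + _)]; nlinarith
  have h6 : (S.card : ℝ) * (κ ^ 2 / 4) ≤ C * (τ * κ ^ 2 / (8 * C)) * (2 * (x / b / log x)) := by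
    calc (S.card : ℝ) * (κ ^ 2 / 4) = ∑ c ∈ S, κ ^ 2 / 4 := by rw [sum_const, nsmul_eq_mul]
      _ ≤ _ := sum_le_sum h5
      _ ≤ _ := sum_le_sum_of_subset_of_nonneg hS fun n _ _ => mul_nonneg (wt_nonneg _ _ _ _) (sq_nonneg _)
      _ ≤ _ := h3
      _ ≤ _ := by
        have e1 : x ^ (5 * (2 * η) + 2 * (1 / 20)) ≤ x / b / log x := by
          rw [pow_one, one_mul] at hlp
          have e2 : x ^ (1 - 1 / 2 : ℝ) ≤ x / b := by
            rw [rpow_sub hx0, rpow_one]; exact div_le_div_of_nonneg_left hx0.le hb0 hbx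
          rw [le_div_iff₀ hl0]
          calc x ^ (5 * (2 * η) + 2 * (1 / 20)) * log x ≤ x ^ (5 * (2 * η) + 2 * (1 / 20)) * x ^ (3 / 20 : ℝ) := by gcongr
            _ = x ^ (5 * (2 * η) + 2 * (1 / 20) + 3 / 20) := (rpow_add hx0 _ _).symm
            _ ≤ x ^ (1 - 1 / 2 : ℝ) := rpow_le_rpow_of_exponent_le (by linarith) (by linarith)
            _ ≤ _ := e2
        have e3 : ((N : ℝ) - (0 : ℕ)) / log x ≤ x / b / log x := by rw [Nat.cast_zero, sub_zero]; gcongr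
        refine mul_le_mul (mul_le_mul_of_nonneg_left h4 hC.le) (by linarith) ?_ (by positivity)
        rw [Nat.cast_zero, sub_zero]; positivity
  have h7 : C * (τ * κ ^ 2 / (8 * C)) * (2 * (x / b / log x)) = τ * (x / b / log x) * (κ ^ 2 / 4) := by field_simp; norm_num
  rw [h7] at h6
  exact le_of_mul_le_mul_right h6 (by positivity)

/-- Few `m` have `m + 1` divisible by a prime close to `x`. -/
theorem MM_large_prime (R δ : ℝ) (hR : 0 < R) (hδ : 0 < δ) : ∃ β : ℝ, 0 < β ∧ β ≤ 1 / 2 ∧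
    ∀ᶠ x : ℝ in atTop, ∀ k : ℕ, 1 ≤ k → (k : ℝ) ≤ R * log (log x) →
      ∀ M ⊆ MM k x, (∀ m ∈ M, ∃ q : ℕ, q.Prime ∧ x ^ (1 - 2 * β) < q ∧ q ∣ m + 1) → (M.card : ℝ) ≤ δ * TT k x := by
  obtain ⟨τ, hτ, h⟩ := MM_turan R (1 / 2) δ hR (by norm_num) hδ
  obtain ⟨C, hC, hCn⟩ := sum_inv_prime_le
  set V := max 1 (1 / τ)
  have hV1 : 1 ≤ V := le_max_left _ _
  have hVτ : 1 / V ≤ τ := by rw [div_le_iff₀ (by linarith), ← div_le_iff₀' hτ]; exact le_max_right _ _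
  obtain ⟨β, hβd⟩ : ∃ β, β = exp (-(C + V + 1)) / 160 := ⟨_, rfl⟩
  have hβ : 0 < β := by rw [hβd]; positivity
  have hβ1 : β ≤ 1 / 160 := by
    rw [hβd]
    have : exp (-(C + V + 1)) ≤ 1 := exp_le_one_iff.2 (by linarith); linarith
  refine ⟨β, hβ, by linarith, ?_⟩
  filter_upwards [h, eventually_zz_le (3 * β) (by positivity), eventually_log_le_zz, eventually_ge_atTop 2, tendsto_LL.eventually_ge_atTop 1,
    eventually_LL_le (1 / (8 * R)) (by positivity), tendsto_log_atTop.eventually_ge_atTop 8,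
    (tendsto_rpow_atTop (show (0 : ℝ) < β by positivity)).eventually_ge_atTop 4,
    (tendsto_rpow_atTop (show (0 : ℝ) < 1 / 20 by norm_num)).eventually_ge_atTop 4] with x hx hzz hlz h2 hL hLl hl8 hxβ hx20
  have hx0 : 0 < x := by linarith
  intro k hk hkR M hM hMe
  set z := ⌊zz x⌋₊ with hz
  have hzle : (z : ℝ) ≤ zz x := floor_le (by linarith)
  have hzge : zz x - 1 ≤ z := by have := lt_floor_add_one (zz x); rw [← hz] at this; linarith
  set a := ⌊x ^ (3 * β)⌋₊
  set c := ⌊x ^ (1 / 20 : ℝ)⌋₊ with hc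
  have hza : z ≤ a := Nat.floor_le_floor hzz
  have hc2 : 2 ≤ c := le_floor (by push_cast; linarith)
  have ha2 : 2 ≤ a := le_floor (by push_cast; linarith)
  set Q := PZ a c with hQ
  have hsum : V ≤ ∑ q ∈ Q, 1 / ((q : ℝ) - 1) := by
    have e1 := sum_inv_prime_ge c hc2
    have e2 := hCn a ha2
    have e3 : ∑ p ∈ primesLE c, (1 : ℝ) / p ≤ ∑ p ∈ primesLE a, (1 : ℝ) / p + ∑ q ∈ Q, 1 / ((q : ℝ) - 1) := by
      have : primesLE c ⊆ primesLE a ∪ Q := by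
        intro p hp; rw [mem_primesLE] at hp; rw [Finset.mem_union, mem_primesLE, hQ, mem_PZ]
        by_cases h : p ≤ a
        · exact Or.inl ⟨h, hp.2⟩
        · exact Or.inr ⟨by omega, hp⟩
      refine (sum_le_sum_of_subset_of_nonneg this fun q _ _ => by positivity).trans ?_
      have h0 := sum_union_inter (s₁ := primesLE a) (s₂ := Q) (f := fun p : ℕ => (1 : ℝ) / p)
      have h1 : 0 ≤ ∑ p ∈ primesLE a ∩ Q, (1 : ℝ) / p := sum_nonneg fun p _ => by positivity
      have h2 : ∑ q ∈ Q, (1 : ℝ) / q ≤ ∑ q ∈ Q, 1 / ((q : ℝ) - 1) := by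
        refine sum_le_sum fun q hq => ?_
        have : (2 : ℝ) ≤ q := by exact_mod_cast (PZ_prime hq).two_le
        exact one_div_le_one_div_of_le (by linarith) (by linarith)
      linarith
    have e4 : log x / 40 ≤ log c := by
      have : x ^ (1 / 40 : ℝ) ≤ c := by
        have h1 := lt_floor_add_one (x ^ (1 / 20 : ℝ)); rw [← hc] at h1
        have h3 : x ^ (1 / 20 : ℝ) = x ^ (1 / 40 : ℝ) * x ^ (1 / 40 : ℝ) := by rw [← rpow_add hx0]; norm_num
        have h4 : 0 ≤ x ^ (1 / 40 : ℝ) := by positivity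
        nlinarith
      have := log_le_log (by positivity) this
      rw [log_rpow hx0] at this; linarith
    have e5 : log a ≤ 3 * β * log x := by
      rw [← log_rpow hx0]; exact log_le_log (by positivity) (floor_le (by positivity))
    have e6 : log (log x / 40) ≤ log (log c) := log_le_log (by positivity) e4
    have e7 : log (log a) ≤ log (3 * β * log x) :=
      log_le_log (log_pos (by exact_mod_cast (by omega : 1 < a))) e5
    have e8 : log (3 * β * log x) + (C + V + 1) ≤ log (log x / 40) := by
      rw [← log_exp (C + V + 1), ← log_mul (by positivity) (by positivity)]; apply log_le_log (by positivity)
      have : β * exp (C + V + 1) = 1 / 160 := by rw [hβd, div_mul_eq_mul_div, ← exp_add, neg_add_cancel, exp_zero]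
      calc 3 * β * log x * exp (C + V + 1) = 3 * (β * exp (C + V + 1)) * log x := by ring
        _ ≤ _ := by rw [this]; linarith
    linarith
  set V' := ∑ q ∈ Q, 1 / ((q : ℝ) - 1) with hV'
  have hV'0 : 0 < V' := by linarith
  refine hx k hk hkR z (le_floor (by push_cast; linarith)) hzle ?_ Q (fun _ => 1 / V') ?_ ?_ M hM ?_
  · have : R * log (log x) ≤ log x / 8 := by
      calc _ ≤ R * (1 / (8 * R) * log x) := by gcongr
        _ = _ := by field_simp
    linarith
  · intro q hq; rw [hQ, mem_PZ] at hq
    refine ⟨hq.2.2, by omega, (le_floor_iff (by positivity)).1 hq.2.1, ?_⟩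
    rw [abs_of_pos (by positivity), div_le_one hV'0]; linarith
  · have : ∑ q ∈ Q, (1 / V') ^ 2 / q ≤ (1 / V') ^ 2 * V' := by
      rw [hV', mul_sum]; refine sum_le_sum fun q hq => ?_
      have : (2 : ℝ) ≤ q := by exact_mod_cast (PZ_prime hq).two_le
      rw [div_eq_mul_one_div]
      exact mul_le_mul_of_nonneg_left (one_div_le_one_div_of_le (by linarith) (by linarith)) (by positivity)
    refine this.trans (le_trans (le_of_eq ?_) ((one_div_le_one_div_of_le (by linarith) hsum).trans hVτ)); field_simp
  · intro m hm
    obtain ⟨q, hq, hqx, hd⟩ := hMe m hm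
    have hemp : Q.filter (fun p => p ∣ m + 1) = ∅ := by
      rw [Finset.filter_eq_empty_iff]; intro p hp hpd; rw [hQ, mem_PZ] at hp
      have hpx : (p : ℝ) ≤ x ^ (1 / 20 : ℝ) := (le_floor_iff (by positivity)).1 hp.2.1
      have hpa : x ^ (3 * β) < p := Nat.lt_of_floor_lt hp.1
      have hne : p ≠ q := by
        rintro rfl
        have : x ^ (1 / 20 : ℝ) ≤ x ^ (1 - 2 * β) := rpow_le_rpow_of_exponent_le (by linarith) (by linarith); linarith
      have hpq : p * q ∣ m + 1 := ((Nat.coprime_primes hp.2.2 hq).2 hne).mul_dvd_of_dvd_of_dvd hpd hd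
      have hle := le_of_dvd (Nat.succ_pos m) hpq
      have hmx : (m : ℝ) ≤ x := (le_floor_iff hx0.le).1 (mem_MM.1 (hM hm)).1.2
      have e1 : (p : ℝ) * q ≤ m + 1 := by exact_mod_cast hle
      have e2 : x ^ (3 * β) * x ^ (1 - 2 * β) ≤ p * q := by gcongr
      have e3 : x ^ (3 * β) * x ^ (1 - 2 * β) = x * x ^ β := by rw [← rpow_add hx0, show 3 * β + (1 - 2 * β) = 1 + β by ring, rpow_add hx0, rpow_one]
      nlinarith
    rw [hemp, sum_empty]
    have : ∑ q ∈ Q, 1 / V' / ((q : ℝ) - 1) = 1 := by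
      have e : ∀ q ∈ Q, 1 / V' / ((q : ℝ) - 1) = 1 / V' * (1 / ((q : ℝ) - 1)) := fun q _ => by rw [div_eq_mul_one_div (1 / V')]
      rw [sum_congr rfl e, ← mul_sum, ← hV']; field_simp
    rw [this]; norm_num

lemma norm_phi_sub_phi_one_le (Q : Finset ℕ) (hQ : ∀ q ∈ Q, q.Prime) (v : ℕ → ℂ) (hv : ∀ q ∈ Q, ‖v q‖ ≤ 1) (a : ℕ) (ha : 0 < a) :
    ‖phi Q v a - phi Q v 1‖ ≤ ∑ q ∈ a.primeFactors, if q ∈ Q then 2 / ((q : ℝ) - 1) else 0 := by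
  refine (norm_prod_sub_prod_le_sum Q _ _ (fun q hq => norm_phi_factor_le q a (hQ q hq) _ (hv q hq))
    (fun q hq => norm_phi_factor_le q 1 (hQ q hq) _ (hv q hq))).trans ?_
  rw [← sum_filter, ← sum_filter_add_sum_filter_not Q (fun q => q ∣ a)]
  have h0 : ∑ q ∈ Q with ¬ q ∣ a, ‖(if q ∣ a then 1 else 1 + (v q - 1) / ((q : ℂ) - 1) : ℂ) - (if q ∣ 1 then 1 else 1 + (v q - 1) / ((q : ℂ) - 1))‖ = 0 := by
    refine sum_eq_zero fun q hq => ?_; rw [mem_filter] at hq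
    have h1 : ¬ q ∣ 1 := by rw [dvd_one]; exact (hQ q hq.1).one_lt.ne'
    rw [if_neg hq.2, if_neg h1, sub_self, norm_zero]
  rw [h0, add_zero]
  refine (sum_le_sum (g := fun q : ℕ => 2 / ((q : ℝ) - 1)) fun q hq => ?_).trans (le_of_eq (sum_congr ?_ fun _ _ => rfl))
  · rw [mem_filter] at hq
    have h1 : ¬ q ∣ 1 := by rw [dvd_one]; exact (hQ q hq.1).one_lt.ne'
    have h2 : (1 : ℝ) < q := by exact_mod_cast (hQ q hq.1).one_lt
    rw [if_pos hq.2, if_neg h1, sub_add_cancel_left, norm_neg, norm_div]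
    have h3 : ‖(q : ℂ) - 1‖ = (q : ℝ) - 1 := by rw [show (q : ℂ) - 1 = (((q : ℝ) - 1 : ℝ) : ℂ) by push_cast; rfl, norm_real, norm_of_nonneg (by linarith)]
    rw [h3]; refine div_le_div_of_nonneg_right ?_ (by linarith); refine (norm_sub_le _ _).trans ?_
    rw [norm_one]; linarith [hv q hq.1]
  · ext q
    rw [mem_filter, mem_filter, mem_primeFactors]
    exact ⟨fun h => ⟨⟨hQ q h.1, h.2, ha.ne'⟩, h.1⟩, fun h => ⟨h.2, h.1.2.1⟩⟩

/-- The mean value of a multiplicative function of `m + 1` over the level set of `ω`. -/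
theorem MM_mean (R δ : ℝ) (hR : 0 < R) (hδ : 0 < δ) : ∃ W0 : ℕ, 1 ≤ W0 ∧
    ∀ᶠ x : ℝ in atTop, ∀ k : ℕ, 1 ≤ k → (k : ℝ) ≤ R * log (log x) → ∀ z : ℕ, 2 ≤ z → (z : ℝ) ≤ zz x →
      ∀ Q ⊆ primesLE z, ∀ v : ℕ → ℂ, (∀ q ∈ Q, ‖v q‖ ≤ 1) → (∀ q ∈ Q, W0 < q) →
      ‖∑ m ∈ MM k x, (Hm Q v 1 m - phi Q v 1)‖ ≤ δ * TT k x := by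
  obtain ⟨η, hη, hη1, hdec⟩ := sum_MM_decomp R (δ / 3) hR (by positivity)
  obtain ⟨C, hC, hCx⟩ := sum_inv_omega_asymp R hR
  obtain ⟨W1, hW1, hpt⟩ := prime_thm (η / 2) (δ / (6 * C)) (by positivity) (by linarith) (by positivity)
  obtain ⟨W2, hW2⟩ := exists_nat_ge (48 * C / (η * δ))
  refine ⟨max W1 W2, le_max_of_le_left hW1, ?_⟩
  filter_upwards [hdec η hη le_rfl, hCx, hpt, eventually_ge_atTop 2, (tendsto_rpow_atTop (show 0 < η / 2 by positivity)).eventually_ge_atTop 2,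
    tendsto_LL.eventually_ge_atTop 1] with x hdec hCx hpt h2 hxη hL
  have hx0 : 0 < x := by linarith
  have hl0 : 0 < log x := log_pos (by linarith)
  intro k hk hkR z hz hzx Q hQz v hv hQW
  have hQ : ∀ q ∈ Q, q.Prime := fun q hq => (mem_primesLE.1 (hQz hq)).2
  refine (hdec k hk hkR (fun m => Hm Q v 1 m - phi Q v 1) (fun m => norm_Hm_sub_phi_le_two Q hQ v hv 1 m)).trans ?_
  set D := ⌊x ^ η⌋₊ with hD
  have hDge : x ^ (η / 2) ≤ D := by
    have h1 := lt_floor_add_one (x ^ η); rw [← hD] at h1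
    have h3 : x ^ η = x ^ (η / 2) * x ^ (η / 2) := by rw [← rpow_add hx0]; ring_nf
    nlinarith
  set A := (Icc 1 ⌊x⌋₊).filter fun a => a.primeFactors.card = k - 1 with hA
  have hAm : ∀ a ∈ A, 0 < a ∧ (a : ℝ) ≤ x ∧ a.primeFactors.card = k - 1 := fun a ha => by
    rw [hA, mem_filter, mem_Icc] at ha; exact ⟨ha.1.1, (le_floor_iff hx0.le).1 ha.1.2, ha.2⟩
  have hk1 : ((k - 1 : ℕ) : ℝ) ≤ R * log (log x) := le_trans (by exact_mod_cast Nat.sub_le k 1) hkR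
  obtain ⟨hs1, hs2⟩ := hCx (k - 1) hk1 A hAm
  set g : ℕ → ℝ := fun q => if q ∈ Q then 2 / ((q : ℝ) - 1) else 0 with hg
  have hg0 : ∀ q, 0 ≤ g q := fun q => by
    rw [hg]; dsimp only
    split_ifs with h
    · have : (1 : ℝ) < q := by exact_mod_cast (hQ q h).one_lt
      exact div_nonneg (by norm_num) (by linarith)
    · exact le_rfl
  have hs2 := hs2 g hg0
  set TL := log (log x) ^ (k - 1) / ((k - 1).factorial : ℝ) with hTL
  have hgs : ∑ q ∈ primesLE ⌊x⌋₊, g q * (1 / ((q : ℝ) - 1)) ≤ η * δ / (12 * C) := by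
    have e1 : ∑ q ∈ primesLE ⌊x⌋₊, g q * (1 / ((q : ℝ) - 1)) ≤ ∑ q ∈ Q, 4 * (1 / ((q : ℝ) * ((q : ℝ) - 1))) := by
      rw [hg]; simp only [ite_mul, zero_mul]; rw [← sum_filter]
      refine (sum_le_sum (g := fun q : ℕ => 4 * (1 / ((q : ℝ) * ((q : ℝ) - 1)))) fun q hq => ?_).trans (sum_le_sum_of_subset_of_nonneg (fun q hq => (mem_filter.1 hq).2) fun q hq _ => ?_)
      · have : (2 : ℝ) ≤ q := by exact_mod_cast (hQ q (mem_filter.1 hq).2).two_le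
        rw [div_mul_div_comm, mul_one, mul_one_div, div_le_div_iff₀ (by nlinarith) (by nlinarith)]; nlinarith
      · have : (2 : ℝ) ≤ q := by exact_mod_cast (hQ q hq).two_le
        have : 0 ≤ (q : ℝ) - 1 := by linarith
        positivity
    refine e1.trans ?_; rw [← mul_sum]
    have e2 := sum_inv_mul_pred_le Q (max W1 W2) (le_max_of_le_left hW1) hQW
    have e3 : 48 * C / (η * δ) ≤ (max W1 W2 : ℕ) := hW2.trans (by exact_mod_cast le_max_right _ _)
    calc 4 * _ ≤ 4 * (1 / ((max W1 W2 : ℕ) : ℝ)) := by gcongr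
      _ ≤ 4 * (1 / (48 * C / (η * δ))) := by gcongr
      _ = _ := by field_simp; ring
  have hterm : ∀ a ∈ A, ‖∑ ℓ ∈ PZ (max (a.primeFactors.sup id) D) ⌊x / a⌋₊, (Hm Q v 1 (a * ℓ) - phi Q v 1)‖ ≤
      δ / (3 * C) * (x / log x) * (1 / a) + 4 / η * (x / log x) * (1 / a * ∑ q ∈ a.primeFactors, g q) := by
    intro a ha
    obtain ⟨ha0, hax, -⟩ := hAm a ha
    have ha1' : (1 : ℝ) ≤ a := by exact_mod_cast ha0
    set y := max (a.primeFactors.sup id) D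
    set N := ⌊x / a⌋₊
    have hNx : (N : ℝ) ≤ x / a := floor_le (by positivity)
    have hNx' : (N : ℝ) ≤ x := hNx.trans (div_le_self hx0.le ha1')
    have hgsum : 0 ≤ ∑ q ∈ a.primeFactors, g q := sum_nonneg fun q _ => hg0 q
    rcases le_or_gt N y with hNy | hNy
    · have : PZ y N = ∅ := by
        rw [Finset.eq_empty_iff_forall_notMem]; intro p hp
        have := mem_PZ.1 hp; omega
      rw [this, sum_empty, norm_zero]; positivity
    have hyD : D ≤ y := le_max_right _ _
    have hyη : x ^ (η / 2) ≤ y := hDge.trans (by exact_mod_cast hyD)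
    have hyN : (y : ℝ) ≤ N := by exact_mod_cast hNy.le
    have p1 := hpt z hz hzx Q hQz v hv (fun q hq => lt_of_le_of_lt (le_max_left _ _) (hQW q hq)) a N hNx' (hyη.trans hyN)
    have p2 := hpt z hz hzx Q hQz v hv (fun q hq => lt_of_le_of_lt (le_max_left _ _) (hQW q hq)) a y (hyN.trans hNx') hyη
    have hsplit : ∑ ℓ ∈ PZ y N, (Hm Q v 1 (a * ℓ) - phi Q v 1) =
        ∑ p ∈ primesLE N, (Hm Q v a p - phi Q v a) - ∑ p ∈ primesLE y, (Hm Q v a p - phi Q v a) + (PZ y N).card * (phi Q v a - phi Q v 1) := by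
      have e1 : primesLE N = primesLE y ∪ PZ y N := by
        ext p
        rw [Finset.mem_union, mem_primesLE, mem_primesLE, mem_PZ]; constructor
        · rintro ⟨h1, h2⟩
          by_cases h : p ≤ y
          · exact Or.inl ⟨h, h2⟩
          · exact Or.inr ⟨by omega, h1, h2⟩
        · rintro (⟨h1, h2⟩ | ⟨h1, h2, h3⟩)
          · exact ⟨by omega, h2⟩
          · exact ⟨h2, h3⟩
      have e2 : Disjoint (primesLE y) (PZ y N) := by
        rw [Finset.disjoint_left]; intro p h1 h2
        have := (mem_primesLE.1 h1).1
        have := (mem_PZ.1 h2).1; omega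
      rw [e1, sum_union e2, add_sub_cancel_left, ← nsmul_eq_mul, ← sum_const, ← sum_add_distrib]
      refine sum_congr rfl fun p _ => ?_; unfold Hm; simp only [one_mul]; ring
    have hcard : ((PZ y N).card : ℝ) * (η * log x) ≤ 4 * N := by
      have e1 := sum_log_primes_le N
      have e2 : ∑ p ∈ PZ y N, (η / 2 * log x) ≤ ∑ p ∈ primesLE N, log p := by
        refine (sum_le_sum (g := fun p : ℕ => log p) fun p hp => ?_).trans (sum_le_sum_of_subset_of_nonneg (fun p hp => ?_) fun p _ _ => by positivity)
        · rw [← log_rpow hx0]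
          exact log_le_log (by positivity) (hyη.trans (by exact_mod_cast (mem_PZ.1 hp).1.le))
        · exact mem_primesLE.2 (mem_PZ.1 hp).2
      rw [sum_const, nsmul_eq_mul] at e2; linarith
    have hcard2 : ((PZ y N).card : ℝ) ≤ 4 / η * (x / log x) * (1 / a) := by
      rw [← le_div_iff₀ (by positivity)] at hcard; refine hcard.trans ?_
      calc 4 * (N : ℝ) / (η * log x) ≤ 4 * (x / a) / (η * log x) := by gcongr
        _ = _ := by field_simp
    rw [hsplit]
    refine (norm_add_le _ _).trans (add_le_add ((norm_sub_le _ _).trans ?_) ?_)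
    · have e1 : δ / (6 * C) * (N / log x) ≤ δ / (6 * C) * (x / a / log x) := by gcongr
      have e2 : δ / (6 * C) * (y / log x) ≤ δ / (6 * C) * (x / a / log x) := by
        have := hyN.trans hNx; gcongr
      have e3 : δ / (3 * C) * (x / log x) * (1 / a) = δ / (6 * C) * (x / a / log x) + δ / (6 * C) * (x / a / log x) := by field_simp; ring
      linarith
    · rw [norm_mul, Complex.norm_natCast]
      have := norm_phi_sub_phi_one_le Q hQ v hv a ha0
      calc ((PZ y N).card : ℝ) * ‖phi Q v a - phi Q v 1‖ ≤ 4 / η * (x / log x) * (1 / a) * ∑ q ∈ a.primeFactors, g q := by gcongr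
        _ = _ := by ring
  have hfin := sum_le_sum hterm
  rw [sum_add_distrib, ← mul_sum, ← mul_sum] at hfin
  have f1 : δ / (3 * C) * (x / log x) * ∑ a ∈ A, (1 : ℝ) / a ≤ δ / 3 * TT k x := by
    calc _ ≤ δ / (3 * C) * (x / log x) * (C * TL) := by gcongr
      _ = _ := by unfold TT; rw [← hTL]; field_simp
  have f2 : 4 / η * (x / log x) * ∑ a ∈ A, (1 : ℝ) / a * ∑ q ∈ a.primeFactors, g q ≤ δ / 3 * TT k x := by
    calc _ ≤ 4 / η * (x / log x) * (C * (η * δ / (12 * C)) * TL) := by gcongr; exact hs2.trans (by gcongr)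
      _ = _ := by unfold TT; rw [← hTL]; field_simp; ring
  linarith

lemma norm_gauss_factor_le (θ : ℝ) (hθ : |θ| ≤ 1) (q : ℕ) (hq : 2 ≤ q) :
    ‖(1 + (Complex.exp (θ * I) - 1) / ((q : ℂ) - 1)) * Complex.exp (-((θ / ((q : ℝ) - 1) : ℝ) * I)) -
      Complex.exp ((-(θ ^ 2 / q) / 2 : ℝ))‖ ≤ 2 * |θ| * (θ ^ 2 / q) + 6 * θ ^ 2 * (1 / ((q : ℝ) * ((q : ℝ) - 1))) := by
  have hq' : (2 : ℝ) ≤ q := by exact_mod_cast hq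
  obtain ⟨u, hu⟩ : ∃ u : ℝ, u = 1 / ((q : ℝ) - 1) := ⟨_, rfl⟩
  have hu0 : 0 < u := by rw [hu]; apply one_div_pos.2; linarith
  have hu1 : u ≤ 1 := by rw [hu, div_le_one (by linarith)]; linarith
  have hq1 : u - 1 / q = u * (1 / q) := by
    rw [hu]; have : (q : ℝ) - 1 ≠ 0 := by linarith
    field_simp; ring
  have hqu : 1 / (q : ℝ) ≤ u := by rw [hu]; exact one_div_le_one_div_of_le (by linarith) (by linarith)
  have hq2 : u ≤ 2 * (1 / q) := by nlinarith [show 0 < 1 / (q : ℝ) by positivity]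
  have e1 : 1 / ((q : ℝ) * ((q : ℝ) - 1)) = u * (1 / q) := by rw [hu]; field_simp
  have hθ2 : θ ^ 2 ≤ 1 := by rw [← sq_abs]; nlinarith [abs_nonneg θ]
  set X := Complex.exp (θ * I) with hX
  set Y := Complex.exp (-((θ / ((q : ℝ) - 1) : ℝ) * I)) with hY
  set Z := Complex.exp ((-(θ ^ 2 / q) / 2 : ℝ)) with hZ
  have hYe : -(((θ / ((q : ℝ) - 1) : ℝ) : ℂ) * I) = ((-(θ * u) : ℝ) : ℂ) * I := by rw [hu]; push_cast; ring
  have hYn : |-(θ * u)| ≤ |θ| * u := by rw [abs_neg, abs_mul, abs_of_pos hu0]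
  have hYn1 : |θ| * u ≤ 1 := by nlinarith [abs_nonneg θ]
  have x1 : ‖X - 1‖ ≤ |θ| := by rw [hX, mul_comm]; simpa using norm_exp_I_mul_ofReal_sub_one_le (x := θ)
  have y1 : ‖Y - 1‖ ≤ |θ| * u := by rw [hY, hYe, mul_comm]; exact (norm_exp_I_mul_ofReal_sub_one_le).trans (by simpa using hYn)
  have x3 : ‖X - 1 - θ * I + θ ^ 2 / 2‖ ≤ |θ| ^ 3 := by
    have := Complex.exp_bound (x := θ * I) (by simpa using hθ) (n := 3) (by norm_num)
    simp only [sum_range_succ, range_zero, sum_empty, Nat.factorial, norm_mul, norm_I, norm_real, mul_pow, Complex.I_sq] at this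
    rw [← hX] at this; refine (le_of_eq ?_).trans (this.trans ?_)
    · congr 1; push_cast; ring
    · rw [mul_one, norm_eq_abs]; norm_num; nlinarith [pow_nonneg (abs_nonneg θ) 3]
  have y2 : ‖Y - 1 + θ * u * I‖ ≤ θ ^ 2 * u ^ 2 := by
    have := Complex.exp_bound (x := ((-(θ * u) : ℝ) : ℂ) * I) (by simpa using hYn.trans hYn1) (n := 2) (by norm_num)
    simp only [sum_range_succ, range_zero, sum_empty, Nat.factorial] at this; rw [← hYe, ← hY] at this
    refine (le_of_eq ?_).trans (this.trans ?_)
    · congr 1; rw [hYe]; push_cast; ring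
    · rw [hYe, norm_mul, norm_I, norm_real, mul_one, norm_eq_abs, sq_abs]; norm_num; nlinarith [mul_nonneg (sq_nonneg θ) (sq_nonneg u)]
  have hθq : θ ^ 2 / q = θ ^ 2 * (1 / q) := by ring
  have hq0 : 0 < 1 / (q : ℝ) := by positivity
  have z1 : ‖Z - 1 + θ ^ 2 / q / 2‖ ≤ θ ^ 2 * (u * (1 / q)) := by
    have hs : |-(θ ^ 2 / q) / 2| = θ ^ 2 * (1 / q) / 2 := by rw [hθq, neg_div, abs_neg, abs_of_nonneg (by positivity)]
    have hs1 : θ ^ 2 * (1 / q) ≤ 1 := by nlinarith [sq_nonneg θ]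
    have := Complex.exp_bound (x := ((-(θ ^ 2 / q) / 2 : ℝ) : ℂ)) (by rw [norm_real, norm_eq_abs, hs]; linarith) (n := 2) (by norm_num)
    simp only [sum_range_succ, range_zero, sum_empty, Nat.factorial] at this; rw [← hZ] at this
    refine (le_of_eq ?_).trans (this.trans ?_)
    · congr 1; push_cast; ring
    · rw [norm_real, norm_eq_abs, hs]; norm_num
      have : (θ ^ 2 * (1 / q)) * (θ ^ 2 * (1 / q)) ≤ θ ^ 2 * (u * (1 / q)) := by
        have : θ ^ 2 * (1 / (q : ℝ)) ≤ 1 * u := by gcongr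
        nlinarith [mul_nonneg (sq_nonneg θ) hq0.le]
      simp only [one_div] at this ⊢
      nlinarith [mul_nonneg (sq_nonneg θ) (mul_nonneg hu0.le (inv_nonneg.2 (by linarith : (0:ℝ) ≤ q)))]
  have hdec : (1 + (X - 1) / ((q : ℂ) - 1)) * Y - Z = (Y - 1 + θ * u * I) + u * ((X - 1) * (Y - 1)) + u * (X - 1 - θ * I + θ ^ 2 / 2)
      - ((θ ^ 2 / 2 * (u * (1 / q)) : ℝ) : ℂ) - (Z - 1 + θ ^ 2 / q / 2) := by
    have h1 : ((q : ℂ) - 1)⁻¹ = u := by rw [hu]; push_cast; ring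
    rw [← hq1, div_eq_mul_inv, h1]; push_cast; ring
  rw [hdec]
  have hXY : ‖(u : ℂ) * ((X - 1) * (Y - 1))‖ ≤ u * (|θ| * (|θ| * u)) := by rw [norm_mul, norm_mul, norm_real, norm_eq_abs, abs_of_pos hu0]; gcongr
  have hX3 : ‖(u : ℂ) * (X - 1 - θ * I + θ ^ 2 / 2)‖ ≤ u * |θ| ^ 3 := by rw [norm_mul, norm_real, norm_eq_abs, abs_of_pos hu0]; gcongr
  have hl : ‖((θ ^ 2 / 2 * (u * (1 / q)) : ℝ) : ℂ)‖ = θ ^ 2 / 2 * (u * (1 / q)) := by rw [norm_real, norm_eq_abs, abs_of_nonneg (by positivity)]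
  refine (norm_sub_le _ _).trans ?_
  refine (add_le_add ((norm_sub_le _ _).trans (add_le_add (norm_add₃_le) le_rfl)) le_rfl).trans ?_
  rw [hl, e1, hθq]
  have hsq : |θ| * |θ| = θ ^ 2 := by rw [← sq, sq_abs]
  have h3 : u * |θ| ^ 3 ≤ 2 * |θ| * (θ ^ 2 * (1 / q)) := by
    have : |θ| ^ 3 = |θ| * θ ^ 2 := by rw [← sq_abs θ]; ring
    rw [this]
    calc u * (|θ| * θ ^ 2) ≤ (2 * (1 / q)) * (|θ| * θ ^ 2) := by gcongr
      _ = _ := by ring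
  have h4 : θ ^ 2 * u ^ 2 ≤ 2 * θ ^ 2 * (u * (1 / q)) := by
    calc θ ^ 2 * u ^ 2 = θ ^ 2 * u * u := by ring
      _ ≤ θ ^ 2 * u * (2 * (1 / q)) := by gcongr
      _ = _ := by ring
  have h5 : u * (|θ| * (|θ| * u)) = θ ^ 2 * u ^ 2 := by rw [← hsq]; ring
  have h6 : 0 ≤ θ ^ 2 * (u * (1 / q)) := by positivity
  linarith

/-- Lindeberg's central limit computation for the mean value `phi`. -/
lemma norm_phi_sub_gauss_le (Q : Finset ℕ) (hQ : ∀ q ∈ Q, q.Prime) (θ : ℕ → ℝ) (h : ℝ) (h1 : h ≤ 1) (hθ : ∀ q ∈ Q, |θ q| ≤ h) :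
    ‖phi Q (fun q => Complex.exp (θ q * I)) 1 * Complex.exp (-((∑ q ∈ Q, θ q / ((q : ℝ) - 1) : ℝ) * I)) -
      Complex.exp ((-(∑ q ∈ Q, θ q ^ 2 / q) / 2 : ℝ))‖ ≤ 2 * h * ∑ q ∈ Q, θ q ^ 2 / q + 6 * h ^ 2 := by
  have e1 : Complex.exp (-((∑ q ∈ Q, θ q / ((q : ℝ) - 1) : ℝ) * I)) = ∏ q ∈ Q, Complex.exp (-((θ q / ((q : ℝ) - 1) : ℝ) * I)) := by
    rw [← Complex.exp_sum, sum_neg_distrib, ← sum_mul, ← ofReal_sum]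
  have e2 : Complex.exp ((-(∑ q ∈ Q, θ q ^ 2 / q) / 2 : ℝ)) = ∏ q ∈ Q, Complex.exp ((-(θ q ^ 2 / q) / 2 : ℝ)) := by rw [← Complex.exp_sum, ← ofReal_sum, ← sum_div, sum_neg_distrib]
  have e3 : phi Q (fun q => Complex.exp (θ q * I)) 1 = ∏ q ∈ Q, (1 + (Complex.exp (θ q * I) - 1) / ((q : ℂ) - 1)) := by
    unfold phi; exact prod_congr rfl fun q hq => by rw [if_neg (by rw [dvd_one]; exact (hQ q hq).one_lt.ne')]
  rw [e1, e2, e3, ← prod_mul_distrib]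
  refine (norm_prod_sub_prod_le_sum Q _ _ (fun q hq => ?_) fun q hq => ?_).trans ?_
  · have := norm_phi_factor_le q 1 (hQ q hq) (Complex.exp (θ q * I)) (by rw [norm_exp_ofReal_mul_I])
    rw [if_neg (by rw [dvd_one]; exact (hQ q hq).one_lt.ne')] at this
    rw [norm_mul, ← neg_mul, ← ofReal_neg, norm_exp_ofReal_mul_I, mul_one]; exact this
  · rw [Complex.norm_exp, ofReal_re, exp_le_one_iff]
    have : 0 ≤ θ q ^ 2 / q := by positivity
    linarith
  · have hs : ∑ q ∈ Q, 1 / ((q : ℝ) * ((q : ℝ) - 1)) ≤ 1 := by simpa using sum_inv_mul_pred_le Q 1 le_rfl fun q hq => (hQ q hq).one_lt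
    calc _ ≤ ∑ q ∈ Q, (2 * h * (θ q ^ 2 / q) + 6 * h ^ 2 * (1 / ((q : ℝ) * ((q : ℝ) - 1)))) := sum_le_sum fun q hq => ?_
      _ = 2 * h * ∑ q ∈ Q, θ q ^ 2 / q + 6 * h ^ 2 * ∑ q ∈ Q, 1 / ((q : ℝ) * ((q : ℝ) - 1)) := by rw [sum_add_distrib, mul_sum, mul_sum]
      _ ≤ _ := by nlinarith [sq_nonneg h]
    have hq2 := (hQ q hq).two_le
    have hq2' : (2 : ℝ) ≤ q := by exact_mod_cast hq2
    have hb := hθ q hq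
    refine (norm_gauss_factor_le (θ q) (hb.trans h1) q hq2).trans ?_
    have : θ q ^ 2 ≤ h ^ 2 := by rw [← sq_abs]; gcongr
    have : 0 ≤ 1 / ((q : ℝ) * ((q : ℝ) - 1)) := one_div_nonneg.2 (mul_nonneg (by linarith) (by linarith)); gcongr

lemma strongly_additive_eq_sum (f : ℕ → ℝ) (hstrong : ∀ (p ν : ℕ), p.Prime → 1 ≤ ν → f (p ^ ν) = f p)
    (hadd : ∀ m n : ℕ, 1 ≤ m → 1 ≤ n → Nat.Coprime m n → f (m * n) = f m + f n) (n : ℕ) (hn : 1 ≤ n) :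
    f n = ∑ q ∈ n.primeFactors, f q := by
  induction n using Nat.recOnPosPrimePosCoprime with
  | zero => omega
  | one => have := hadd 1 1 le_rfl le_rfl (by norm_num); simp at this ⊢; exact this
  | prime_pow p ν hp hν => rw [Nat.primeFactors_prime_pow hν.ne' hp, sum_singleton]; exact hstrong p ν hp hν
  | coprime a b ha hb hab iha ihb =>
    rw [hadd a b ha.le hb.le hab, Nat.Coprime.primeFactors_mul hab, sum_union hab.disjoint_primeFactors, ← iha ha.le, ← ihb hb.le]

lemma primesUpTo_eq (x : ℝ) : primesUpTo x = primesLE ⌊x⌋₊ := (Nat.primesLE_eq_filter_Icc_one _).symm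

lemma Bfn_sq (f : ℕ → ℝ) (x : ℝ) : Bfn f x ^ 2 = Bsq f x := sq_sqrt (sum_nonneg fun _ _ => by positivity)

/-- A level `z` below which all sieve estimates hold and which carries almost all of the variance. -/
lemma exists_truncation_level (f : ℕ → ℝ) (hBinf : Tendsto (fun x => Bsq f x) atTop atTop)
    (hByBx : Tendsto (fun x : ℝ => Bfn f (x ^ (1 / log (log x))) / Bfn f x) atTop (nhds 1)) :
    ∃ z : ℝ → ℕ, (∀ᶠ x in atTop, (z x : ℝ) ≤ zz x) ∧ (∀ C : ℝ, ∀ᶠ x in atTop, C * (log (log x) + 1) ≤ z x) ∧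
      Tendsto (fun x : ℝ => Bsq f (z x) / Bsq f x) atTop (nhds 1) := by
  obtain ⟨ψ, hψ⟩ : ∃ ψ : ℝ → ℝ, ψ = fun x => x ^ (1 / log (log x)) := ⟨_, rfl⟩
  have hsq : Tendsto (fun x : ℝ => Bsq f (ψ x) / Bsq f x) atTop (nhds 1) := by simpa [hψ, div_pow, Bfn_sq] using hByBx.pow 2
  have hlog : ∀ x, 0 < x → log (ψ x) = log x / log (log x) := fun x hx => by rw [hψ]; simp only; rw [log_rpow hx]; ring
  have hpos : ∀ x, 0 < x → 0 < ψ x := fun x hx => by rw [hψ]; exact rpow_pos_of_pos hx _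
  have hψt : Tendsto ψ atTop atTop := by
    refine tendsto_atTop.2 fun b => ?_
    filter_upwards [eventually_LL_le (1 / (|b| + 1)) (by positivity), tendsto_LL.eventually_ge_atTop 1, eventually_gt_atTop 0] with x h h1 h0
    have h2 : |b| + 1 ≤ log (ψ x) := by rw [hlog x h0, le_div_iff₀ (by linarith)]; rw [one_div_mul_eq_div, le_div_iff₀ (by positivity)] at h; linarith
    have := log_le_sub_one_of_pos (hpos x h0); linarith [le_abs_self b]
  have hcore : ∀ᶠ x in atTop, ∃ L, L = log (log x) ∧ 0 < ψ x ∧ 4 ≤ L ∧ 0 < x ∧ exp L = log x ∧ √L ≤ L - log L ∧ 0 ≤ log L ∧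
      log (ψ (ψ x)) = log x / (L * (L - log L)) := by
    have h1 : ∀ᶠ L : ℝ in atTop, log L ≤ L / 2 := by
      filter_upwards [isLittleO_log_id_atTop.bound (show (0 : ℝ) < 1 / 2 by norm_num), eventually_ge_atTop 1] with L h h1
      rw [norm_of_nonneg (log_nonneg h1), id, norm_of_nonneg (by linarith)] at h; linarith
    filter_upwards [tendsto_LL.eventually h1, tendsto_LL.eventually_ge_atTop 4, eventually_gt_atTop 0, tendsto_log_atTop.eventually_gt_atTop 0] with x h h4 h0 hl
    refine ⟨_, rfl, hpos x h0, h4, h0, exp_log hl, ?_, log_nonneg (by linarith), ?_⟩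
    · have : √(log (log x)) ≤ log (log x) / 2 := by rw [sqrt_le_left (by linarith)]; nlinarith
      linarith
    · rw [hlog _ (hpos x h0), hlog x h0, log_div hl.ne' (by linarith)]; field_simp
  refine ⟨fun x => ⌊ψ (ψ x)⌋₊, ?_, fun C => ?_, ?_⟩
  · filter_upwards [hcore] with x ⟨L, hL, hp, h4, h0, he, hs, hl, hψψ⟩
    refine (floor_le (hpos _ hp).le).trans ?_; rw [← exp_log (hpos _ hp), hψψ, zz, ← hL, exp_le_exp, ← he]
    have : 0 < √L := sqrt_pos.2 (by linarith); gcongr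
  · have h3 : ∀ᶠ L : ℝ in atTop, C * (L + 1) + 1 ≤ exp L / L ^ 2 := by
      filter_upwards [(tendsto_exp_div_pow_atTop 3).eventually_ge_atTop (2 * |C| + 1), eventually_ge_atTop 1] with L h h1
      have : exp L / L ^ 2 = L * (exp L / L ^ 3) := by field_simp
      rw [this]; nlinarith [le_abs_self C, abs_nonneg C]
    filter_upwards [hcore, tendsto_LL.eventually h3] with x ⟨L, hL, hp, h4, h0, he, hs, hl, hψψ⟩ h3
    rw [← hL] at h3 ⊢
    have h5 : exp L / L ^ 2 ≤ ψ (ψ x) := by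
      have : exp L / L ^ 2 ≤ log (ψ (ψ x)) := by
        rw [hψψ, ← he, sq]
        have : 0 < L - log L := (sqrt_pos.2 (by linarith)).trans_le hs
        gcongr; linarith
      linarith [log_le_sub_one_of_pos (hpos _ hp)]
    linarith [lt_floor_add_one (ψ (ψ x))]
  · have h := (hsq.comp hψt).mul hsq; rw [one_mul] at h; refine h.congr' ?_
    filter_upwards [(hBinf.comp hψt).eventually_gt_atTop 0] with x hx
    have e : Bsq f ((⌊ψ (ψ x)⌋₊ : ℕ) : ℝ) = Bsq f (ψ (ψ x)) := by unfold Bsq primesUpTo; rw [Nat.floor_natCast]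
    simp only [Function.comp_apply, e] at hx ⊢; field_simp

lemma mean_decomp (f : ℕ → ℝ) (P : Finset ℕ) (hP : ∀ q ∈ P, q.Prime) (b : ℝ) (hb : 0 < b) (W : ℕ) (hW : 1 ≤ W) (y : ℝ) :
    |∑ q ∈ P, f q / q - ∑ q ∈ P with W < q ∧ (q : ℝ) ≤ y ∧ |f q| ≤ b, f q / ((q : ℝ) - 1)| ≤
      ∑ q ∈ P with q ≤ W, |f q| + (∑ q ∈ P with b < |f q|, f q ^ 2 / q) / b + b * ∑ q ∈ P.filter (fun q : ℕ => y < (q : ℝ)), (1 : ℝ) / q + b := by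
  have h1 : b * ∑ q ∈ P with W < q, 1 / ((q : ℝ) * ((q : ℝ) - 1)) ≤ b := by
    have := sum_inv_mul_pred_le (P.filter fun q => W < q) W hW fun q hq => (mem_filter.1 hq).2
    have : 1 / (W : ℝ) ≤ 1 := by rw [div_le_one (by positivity)]; exact_mod_cast hW
    nlinarith
  refine le_trans ?_ (add_le_add_right h1 _)
  simp only [sum_filter, mul_sum, sum_div, ← sum_sub_distrib, ← sum_add_distrib]
  refine (abs_sum_le_sum_abs _ _).trans (sum_le_sum fun q hq => ?_)
  have hq2 : (2 : ℝ) ≤ q := by exact_mod_cast (hP q hq).two_le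
  have p1 : 0 ≤ if q ≤ W then |f q| else 0 := by positivity
  have p2 : 0 ≤ (if b < |f q| then f q ^ 2 / q else 0) / b := by positivity
  have p3 : 0 ≤ b * if y < (q : ℝ) then 1 / (q : ℝ) else 0 := by positivity
  have p4' : 0 ≤ 1 / ((q : ℝ) * ((q : ℝ) - 1)) := one_div_nonneg.2 (mul_nonneg (by linarith) (by linarith))
  have p4 : 0 ≤ b * if W < q then 1 / ((q : ℝ) * ((q : ℝ) - 1)) else 0 := by split_ifs <;> positivity
  have hdiv : |f q / q| = |f q| / q := by rw [abs_div, Nat.abs_cast]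
  by_cases hc1 : W < q
  · by_cases hc3 : |f q| ≤ b
    · by_cases hc2 : (q : ℝ) ≤ y
      · rw [if_pos ⟨hc1, hc2, hc3⟩]
        refine le_trans ?_ (le_add_of_nonneg_left (by positivity)); rw [if_pos hc1]
        have : f q / q - f q / ((q : ℝ) - 1) = -(f q * (1 / ((q : ℝ) * ((q : ℝ) - 1)))) := by
          have : (q : ℝ) - 1 ≠ 0 := by linarith
          field_simp; ring
        rw [this, abs_neg, abs_mul, abs_of_nonneg p4']; gcongr
      · rw [if_neg fun h => hc2 h.2.1, sub_zero, hdiv]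
        have : |f q| / q ≤ b * if y < (q : ℝ) then 1 / (q : ℝ) else 0 := by rw [if_pos (not_le.1 hc2), mul_one_div]; gcongr
        linarith
    · rw [if_neg fun h => hc3 h.2.2, sub_zero, hdiv]
      have : |f q| / q ≤ (if b < |f q| then f q ^ 2 / q else 0) / b := by rw [if_pos (not_le.1 hc3), le_div_iff₀ hb, ← sq_abs, sq, div_mul_eq_mul_div]; gcongr; exact (not_le.1 hc3).le
      linarith
  · rw [if_neg fun h => hc1 h.1, sub_zero, hdiv]
    have : |f q| / q ≤ if q ≤ W then |f q| else 0 := by rw [if_pos (not_lt.1 hc1)]; exact div_le_self (abs_nonneg _) (by linarith)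
    linarith

lemma value_decomp (f : ℕ → ℝ) (n j : ℕ) (hn : 1 ≤ n) (b : ℝ) (hb : 0 < b) (W : ℕ) (y : ℝ) (hy : 1 ≤ y) (hny : (n : ℝ) < y ^ (j + 1))
    (hbad : ∀ q ∈ n.primeFactors, W < q → |f q| ≤ b) :
    |∑ q ∈ n.primeFactors, f q - ∑ q ∈ n.primeFactors with W < q ∧ (q : ℝ) ≤ y ∧ |f q| ≤ b, f q| ≤ ∑ q ∈ primesLE W, |f q| + b * j := by
  have hcard : (n.primeFactors.filter fun q : ℕ => y < (q : ℝ)).card ≤ j := by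
    by_contra! h
    have h1 : y ^ (n.primeFactors.filter fun q : ℕ => y < (q : ℝ)).card ≤ n := by
      calc _ ≤ ∏ q ∈ n.primeFactors.filter (fun q : ℕ => y < (q : ℝ)), (q : ℝ) := by rw [← prod_const]; exact Finset.prod_le_prod (fun _ _ => by linarith) fun q hq => (mem_filter.1 hq).2.le
        _ ≤ n := by
            have := le_of_dvd hn ((prod_dvd_prod_of_subset _ _ _ (filter_subset (fun q : ℕ => y < (q : ℝ)) _)).trans (Nat.prod_primeFactors_dvd n))
            rw [← Nat.cast_prod]; exact_mod_cast this
    exact absurd (hny.trans_le (pow_le_pow_right₀ hy (Nat.succ_le_of_lt h))) (not_lt.2 h1)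
  have h1 : ∑ q ∈ n.primeFactors with q ≤ W, |f q| ≤ ∑ q ∈ primesLE W, |f q| := by
    refine sum_le_sum_of_subset_of_nonneg (fun q hq => ?_) fun _ _ _ => abs_nonneg _; rw [mem_filter] at hq
    exact mem_primesLE.2 ⟨hq.2, prime_of_mem_primeFactors hq.1⟩
  have h2 : ∑ q ∈ n.primeFactors.filter (fun q : ℕ => y < (q : ℝ)), b ≤ b * j := by rw [sum_const, nsmul_eq_mul, mul_comm]; gcongr
  refine le_trans ?_ (add_le_add h1 h2)
  simp only [sum_filter, ← sum_sub_distrib, ← sum_add_distrib]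
  refine (abs_sum_le_sum_abs _ _).trans (sum_le_sum fun q hq => ?_)
  by_cases hc1 : W < q
  · have hc3 := hbad q hq hc1
    by_cases hc2 : (q : ℝ) ≤ y
    · rw [if_pos ⟨hc1, hc2, hc3⟩, sub_self, abs_zero]; positivity
    · rw [if_neg fun h => hc2 h.2.1, if_pos (not_le.1 hc2), sub_zero]
      exact hc3.trans (le_add_of_nonneg_left (by positivity))
  · rw [if_neg fun h => hc1 h.1, sub_zero, if_pos (not_lt.1 hc1)]; exact le_add_of_nonneg_right (by positivity)

lemma norm_exp_I_sub_le (a b : ℝ) : ‖Complex.exp (a * I) - Complex.exp (b * I)‖ ≤ |a - b| := by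
  have : Complex.exp (a * I) - Complex.exp (b * I) = Complex.exp (b * I) * (Complex.exp (I * ((a - b : ℝ) : ℂ)) - 1) := by
    rw [mul_sub, ← Complex.exp_add]; push_cast; ring_nf
  rw [this, norm_mul, norm_exp_ofReal_mul_I, one_mul]
  exact norm_exp_I_mul_ofReal_sub_one_le

lemma sum_inv_large_le (n : ℕ) (hn : 1 ≤ n) (x : ℝ) (hnx : n ≤ x) (hx : 6 ≤ log x) :
    ∑ q ∈ (primesLE n).filter (fun q : ℕ => x ^ (1 / 20 : ℝ) < (q : ℝ)), (1 : ℝ) / q ≤ 40 := by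
  have hn0 : (0 : ℝ) < n := by exact_mod_cast hn
  have hx0 : 0 < x := hn0.trans_le hnx
  have h1 := sum_log_div_prime_le n hn
  have h2 : log n ≤ log x := log_le_log hn0 hnx
  have h3 : log x / 20 * ∑ q ∈ (primesLE n).filter (fun q : ℕ => x ^ (1 / 20 : ℝ) < (q : ℝ)), (1 : ℝ) / q ≤ ∑ p ∈ primesLE n, log p / (p : ℝ) := by
    rw [mul_sum]
    refine (sum_le_sum fun q hq => ?_).trans (sum_le_sum_of_subset_of_nonneg (filter_subset _ _) fun q _ _ => by positivity)
    rw [mul_one_div]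
    have := (log_lt_log (by positivity) (mem_filter.1 hq).2).le; rw [log_rpow hx0] at this
    gcongr; linarith
  nlinarith

lemma Hm_exp_eq (Q : Finset ℕ) (θ : ℕ → ℝ) (m : ℕ) :
    Hm Q (fun q => Complex.exp (θ q * I)) 1 m = Complex.exp ((∑ q ∈ Q with q ∣ m + 1, θ q : ℝ) * I) := by
  unfold Hm
  rw [sum_filter, ofReal_sum, sum_mul, Complex.exp_sum]
  refine prod_congr rfl fun q _ => ?_
  rw [one_mul]; split_ifs <;> simp

lemma norm_exp_sub_exp_le (s V ε : ℝ) (hε : 0 ≤ ε) (hV0 : 0 ≤ V) (hV1 : V ≤ 1) (hV2 : 1 - 3 * ε ≤ V) :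
    ‖Complex.exp ((-(s ^ 2 * V) / 2 : ℝ)) - Complex.exp ((-s ^ 2 / 2 : ℝ))‖ ≤ s ^ 2 * (2 * ε) := by
  rw [← Complex.ofReal_exp, ← Complex.ofReal_exp, ← Complex.ofReal_sub, norm_real, norm_eq_abs]
  have e2 : s ^ 2 * V ≤ s ^ 2 := by nlinarith [sq_nonneg s]
  have e3 : exp (-s ^ 2 / 2) ≤ exp (-(s ^ 2 * V) / 2) := by rw [exp_le_exp]; linarith
  have e4 : exp (-s ^ 2 / 2) = exp (-(s ^ 2 * V) / 2) * exp (-(s ^ 2 * (1 - V)) / 2) := by rw [← exp_add]; ring_nf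
  have e5 := add_one_le_exp (-(s ^ 2 * (1 - V)) / 2)
  have e6 : exp (-(s ^ 2 * V) / 2) ≤ 1 := by rw [exp_le_one_iff]; nlinarith [sq_nonneg s]
  have e7 := exp_pos (-(s ^ 2 * V) / 2)
  have e8 : s ^ 2 * (1 - V) ≤ s ^ 2 * (3 * ε) := by gcongr; linarith
  rw [abs_of_nonneg (by linarith), e4]
  nlinarith [mul_le_mul_of_nonneg_left e5 e7.le, mul_nonneg (sq_nonneg s) (sub_nonneg.2 hV1)]

set_option maxHeartbeats 4000000 in
theorem MM_charFun (f : ℕ → ℝ) (hstrong : ∀ (p ν : ℕ), p.Prime → 1 ≤ ν → f (p ^ ν) = f p)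
    (hadd : ∀ m n : ℕ, 1 ≤ m → 1 ≤ n → Nat.Coprime m n → f (m * n) = f m + f n)
    (hBinf : Tendsto (fun x => Bsq f x) atTop atTop)
    (hByBx : Tendsto (fun x : ℝ => Bfn f (x ^ (1 / log (log x))) / Bfn f x) atTop (nhds 1))
    (hLind : ∀ ε : ℝ, 0 < ε → (fun x : ℝ => ∑ p ∈ (primesUpTo x).filter (fun p : ℕ => ε * Bfn f x < |f p|), f p ^ 2 / p) =o[atTop] fun x => Bsq f x)
    (R s δ : ℝ) (hR : 0 < R) (hδ : 0 < δ) :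
    ∀ᶠ x : ℝ in atTop, ∀ k : ℕ, 1 ≤ k → (k : ℝ) ≤ R * log (log x) →
      ‖∑ m ∈ MM k x, (Complex.exp ((s * ((f (m + 1) - Afn f x) / Bfn f x) : ℝ) * I) - Complex.exp ((-s ^ 2 / 2 : ℝ)))‖ ≤ δ * pik k x := by
  classical
  obtain ⟨c, hc, hpik⟩ := pik_ge R hR
  obtain ⟨δ1, hδ1⟩ : ∃ δ1, δ1 = c * δ / 16 := ⟨_, rfl⟩
  have hδ1p : 0 < δ1 := by rw [hδ1]; positivity
  obtain ⟨W, hW, hmean⟩ := MM_mean R δ1 hR hδ1p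
  obtain ⟨β, hβ, hβ2, hlarge⟩ := MM_large_prime R δ1 hR hδ1p
  obtain ⟨τ1, hτ1, hthin⟩ := MM_thin R β δ1 hR hβ hβ2 hδ1p
  obtain ⟨K, hK⟩ : ∃ K, K = 1 + 65 * |s| + 2 * |s| * s ^ 2 + 6 * s ^ 2 + 2 * s ^ 2 := ⟨_, rfl⟩
  have hK0 : 0 < K := by rw [hK]; positivity
  obtain ⟨ε, hε, hε1, hεK, hεs⟩ : ∃ ε : ℝ, 0 < ε ∧ ε ≤ 1 ∧ K * ε ≤ δ / 2 ∧ |s| * ε ≤ 1 := by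
    refine ⟨min 1 (min (δ / (2 * K)) (1 / (1 + |s|))), by positivity, min_le_left _ _, ?_, ?_⟩
    · calc _ ≤ K * (δ / (2 * K)) := by gcongr; exact (min_le_right _ _).trans (min_le_left _ _)
        _ = _ := by field_simp
    · calc _ ≤ |s| * (1 / (1 + |s|)) := by gcongr; exact (min_le_right _ _).trans (min_le_right _ _)
        _ ≤ 1 := by rw [mul_one_div, div_le_one (by positivity)]; linarith
  obtain ⟨τ2, hτ2, hturan⟩ := MM_turan R ε δ1 hR hε hδ1p
  obtain ⟨z, hz1, hz2, hz3⟩ := exists_truncation_level f hBinf hByBx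
  obtain ⟨ρ, hρ, hρε, hρ1, hρ2⟩ : ∃ ρ : ℝ, 0 < ρ ∧ ρ ≤ ε ∧ ρ ≤ τ1 ∧ ρ ≤ τ2 :=
    ⟨min ε (min τ1 τ2), by positivity, min_le_left _ _, (min_le_right _ _).trans (min_le_left _ _), (min_le_right _ _).trans (min_le_right _ _)⟩
  have hBt : Tendsto (fun x => Bfn f x) atTop atTop := tendsto_sqrt_atTop.comp hBinf
  filter_upwards [hpik, hmean, hlarge, hthin, hturan, hz1, hz2 (2 * R / ε), hz2 2, hz3.eventually_const_le (show 1 - ρ < 1 by linarith),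
    eventually_zz_le (1 / 20) (by norm_num), hBt.eventually_ge_atTop (1 + (∑ q ∈ primesLE W, |f q|) / ε),
    hBinf.eventually_ge_atTop (∑ q ∈ primesLE W, f q ^ 2 / q / ε), (hLind ε hε).bound (show 0 < ρ * ε ^ 2 by positivity),
    eventually_ge_atTop (2 ^ 20 : ℝ), tendsto_log_atTop.eventually_ge_atTop 6, tendsto_LL.eventually_ge_atTop 1]
    with x hpik hmean hlarge hthin hturan hzz hz hz' hBz hzy hB1 hB2 hlin hx20 hl6 hLL
  intro k hk hkR
  specialize hmean k hk hkR (z x)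
  specialize hlarge k hk hkR
  specialize hthin k hk hkR
  specialize hturan k hk hkR (z x)
  specialize hpik k hk hkR
  obtain ⟨N, hN⟩ : ∃ N, N = z x := ⟨_, rfl⟩
  rw [← hN] at hmean hturan hzz hz hz' hBz
  obtain ⟨B, hB⟩ : ∃ B, B = Bfn f x := ⟨_, rfl⟩
  have hBsq : Bsq f x = B ^ 2 := by rw [hB, Bfn_sq]
  rw [← hB] at hB1 hlin ⊢
  rw [hBsq] at hBz hB2 hlin
  set c1 := ∑ q ∈ primesLE W, |f q|
  have hBp : 0 < B := lt_of_lt_of_le (by positivity) hB1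
  have hc1B : c1 ≤ ε * B := by
    have : c1 / ε ≤ B := by linarith
    rwa [div_le_iff₀' hε] at this
  have hx1 : (1 : ℝ) ≤ x := le_trans (by norm_num) hx20
  have hx0 : 0 < x := by linarith
  set y := x ^ (1 / 20 : ℝ) with hy
  have hy20 : y ^ 20 = x := by rw [hy, ← rpow_natCast, ← rpow_mul hx0.le]; norm_num
  have hy2 : 2 ≤ y := le_of_pow_le_pow_left₀ (n := 20) (by norm_num) (by positivity) (by rw [hy20]; exact hx20)
  have hyx : y ≤ x := by
    calc y = y ^ 1 := (pow_one _).symm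
      _ ≤ y ^ 20 := pow_le_pow_right₀ (by linarith) (by norm_num)
      _ = x := hy20
  have hN2 : 2 ≤ N := by
    have : (2 : ℝ) ≤ N := by linarith
    exact_mod_cast this
  have hNx : N ≤ ⌊x⌋₊ := le_floor (by linarith)
  set P := primesLE ⌊x⌋₊ with hP
  have hPp : ∀ q ∈ P, q.Prime := fun q hq => Nat.prime_of_mem_primesLE hq
  have hPB : ∑ q ∈ P, f q ^ 2 / q = B ^ 2 := by rw [← hBsq, Bsq, primesUpTo_eq]
  obtain ⟨b, hb⟩ : ∃ b, b = ε * B := ⟨_, rfl⟩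
  have hbp : 0 < b := by rw [hb]; positivity
  rw [← hb] at hc1B hlin
  have hlin' : ∑ q ∈ P with b < |f q|, f q ^ 2 / q ≤ ρ * b ^ 2 := by
    rw [primesUpTo_eq, norm_of_nonneg (sum_nonneg fun _ _ => by positivity), norm_of_nonneg (by positivity)] at hlin
    refine hlin.trans (le_of_eq ?_); rw [hb]; ring
  have hPz : ∑ q ∈ P with N < q, f q ^ 2 / q ≤ ρ * B ^ 2 := by
    have h1 : Bsq f N = ∑ q ∈ P with q ≤ N, f q ^ 2 / q := by
      rw [Bsq, primesUpTo_eq, Nat.floor_natCast]; refine sum_congr ?_ fun _ _ => rfl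
      ext q; rw [mem_filter, hP, mem_primesLE, mem_primesLE]
      exact ⟨fun h => ⟨⟨h.1.trans hNx, h.2⟩, h.1⟩, fun h => ⟨h.2, h.1.2⟩⟩
    have h2 := sum_filter_add_sum_filter_not P (fun q => q ≤ N) fun q : ℕ => f q ^ 2 / (q : ℝ); simp only [not_le] at h2
    rw [← h1, hPB] at h2; rw [le_div_iff₀ (by positivity)] at hBz; linarith
  set Q := P.filter fun q : ℕ => W < q ∧ (q : ℝ) ≤ y ∧ |f q| ≤ b with hQ
  set Q0 := Q.filter fun q => q ≤ N with hQ0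
  set Q1 := Q.filter fun q => N < q
  have hQm : ∀ q ∈ Q, q.Prime ∧ W < q ∧ (q : ℝ) ≤ y ∧ |f q| ≤ b := fun q hq => ⟨hPp q (mem_filter.1 hq).1, (mem_filter.1 hq).2⟩
  have hQ0m : ∀ q ∈ Q0, q ∈ Q ∧ q ≤ N := fun q hq => mem_filter.1 hq
  have hQ1m : ∀ q ∈ Q1, q ∈ Q ∧ N < q := fun q hq => mem_filter.1 hq
  have hsplit : ∀ h : ℕ → ℝ, ∑ q ∈ Q, h q = ∑ q ∈ Q0, h q + ∑ q ∈ Q1, h q := fun h => by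
    have := sum_filter_add_sum_filter_not Q (fun q => q ≤ N) h; simp only [not_le] at this; exact this.symm
  set A0 := ∑ q ∈ Q0, f q / ((q : ℝ) - 1) with hA0
  set A1 := ∑ q ∈ Q1, f q / ((q : ℝ) - 1) with hA1
  have hA : |Afn f x - (A0 + A1)| ≤ 43 * b := by
    have h1 := mean_decomp f P hPp b hbp W hW y; rw [← hQ, hsplit] at h1
    have h2 : ∑ q ∈ P with q ≤ W, |f q| ≤ c1 := by
      refine sum_le_sum_of_subset_of_nonneg (fun q hq => ?_) fun _ _ _ => abs_nonneg _; rw [mem_filter] at hq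
      exact mem_primesLE.2 ⟨hq.2, hPp q hq.1⟩
    have h3 : (∑ q ∈ P with b < |f q|, f q ^ 2 / q) / b ≤ b := by
      rw [div_le_iff₀ hbp, ← sq]
      exact hlin'.trans (mul_le_of_le_one_left (sq_nonneg b) (hρε.trans hε1))
    have h4 := sum_inv_large_le ⌊x⌋₊ (le_floor (by simpa using hx1)) x (floor_le hx0.le) hl6; rw [Afn, primesUpTo_eq]
    linarith [mul_le_mul_of_nonneg_left h4 hbp.le]
  have hT1 : ∑ q ∈ Q1, (f q / B) ^ 2 / q ≤ τ2 := by
    calc ∑ q ∈ Q1, (f q / B) ^ 2 / q = (∑ q ∈ Q1, f q ^ 2 / q) / B ^ 2 := by rw [sum_div]; exact sum_congr rfl fun q _ => by ring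
      _ ≤ (∑ q ∈ P with N < q, f q ^ 2 / q) / B ^ 2 := by
          refine div_le_div_of_nonneg_right (sum_le_sum_of_subset_of_nonneg (fun q hq => ?_) fun _ _ _ => by positivity) (sq_nonneg B)
          exact mem_filter.2 ⟨(mem_filter.1 (hQ1m q hq).1).1, (hQ1m q hq).2⟩
      _ ≤ τ2 := by rw [div_le_iff₀ (by positivity)]; exact hPz.trans (by gcongr)
  obtain ⟨V, hV⟩ : ∃ V, V = ∑ q ∈ Q0, (f q / B) ^ 2 / q := ⟨_, rfl⟩
  have hVs : V * B ^ 2 = ∑ q ∈ Q0, f q ^ 2 / q := by rw [hV, sum_mul]; exact sum_congr rfl fun q _ => by field_simp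
  have hV1 : V ≤ 1 := by
    have : V * B ^ 2 ≤ 1 * B ^ 2 := by
      rw [hVs, one_mul, ← hPB]
      exact sum_le_sum_of_subset_of_nonneg ((filter_subset _ _).trans (filter_subset _ _)) fun _ _ _ => by positivity
    exact le_of_mul_le_mul_right this (by positivity)
  have hV2 : 1 - 3 * ε ≤ V := by
    have h1 : ∑ q ∈ P with q ≤ W, f q ^ 2 / q ≤ ε * B ^ 2 := by
      rw [← sum_div, div_le_iff₀' hε] at hB2
      refine le_trans (sum_le_sum_of_subset_of_nonneg (fun q hq => ?_) fun _ _ _ => by positivity) hB2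
      rw [mem_filter] at hq; exact mem_primesLE.2 ⟨hq.2, hPp q hq.1⟩
    have h2 : B ^ 2 ≤ V * B ^ 2 + ∑ q ∈ P with N < q, f q ^ 2 / q + ∑ q ∈ P with b < |f q|, f q ^ 2 / q + ∑ q ∈ P with q ≤ W, f q ^ 2 / q := by
      rw [← hPB, hPB, hVs, ← hPB, hQ0, hQ]; simp only [sum_filter, ← sum_add_distrib]; refine sum_le_sum fun q hq => ?_
      have p1 : 0 ≤ if N < q then f q ^ 2 / (q : ℝ) else 0 := by positivity
      have p2 : 0 ≤ if b < |f q| then f q ^ 2 / (q : ℝ) else 0 := by positivity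
      have p3 : 0 ≤ if q ≤ W then f q ^ 2 / (q : ℝ) else 0 := by positivity
      have p4 : 0 ≤ if W < q ∧ (q : ℝ) ≤ y ∧ |f q| ≤ b then (if q ≤ N then f q ^ 2 / (q : ℝ) else 0) else 0 := by positivity
      by_cases g1 : N < q
      · rw [if_pos g1] at p1 ⊢; linarith
      by_cases g2 : b < |f q|
      · rw [if_pos g2] at p2 ⊢; linarith
      by_cases g3 : q ≤ W
      · rw [if_pos g3] at p3 ⊢; linarith
      have g4 : (q : ℝ) ≤ y := by
        have : (q : ℝ) ≤ N := by exact_mod_cast not_lt.1 g1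
        linarith
      rw [if_pos ⟨not_le.1 g3, g4, not_lt.1 g2⟩, if_pos (not_lt.1 g1)]; linarith
    have h3 : ρ * b ^ 2 ≤ ε * B ^ 2 := by
      have : b ^ 2 ≤ 1 * B ^ 2 := by rw [hb, mul_pow]; gcongr; exact pow_le_one₀ hε.le hε1
      rw [one_mul] at this; gcongr
    have h4 : ρ * B ^ 2 ≤ ε * B ^ 2 := by gcongr
    have : (1 - 3 * ε) * B ^ 2 ≤ V * B ^ 2 := by linarith
    exact le_of_mul_le_mul_right this (by positivity)
  -- exceptional sets
  set E1 := (MM k x).filter fun m => ∃ q ∈ P.filter (fun q : ℕ => b < |f q| ∧ (q : ℝ) ≤ x ^ (1 - 2 * β)), q ∣ m + 1 with hE1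
  set E2 := (MM k x).filter fun m => ε < |∑ q ∈ Q1 with q ∣ m + 1, f q / B - ∑ q ∈ Q1, f q / B / ((q : ℝ) - 1)| with hE2
  set E3 := (MM k x).filter fun m => ∃ q : ℕ, q.Prime ∧ x ^ (1 - 2 * β) < q ∧ q ∣ m + 1 with hE3
  have hcE1 : (E1.card : ℝ) ≤ δ1 * TT k x := by
    refine hthin _ (fun q hq => ⟨hPp q (mem_filter.1 hq).1, (mem_filter.1 hq).2.2⟩) ?_ E1 (filter_subset _ _) fun m hm => (mem_filter.1 hm).2
    have : b ^ 2 * ∑ q ∈ P.filter (fun q : ℕ => b < |f q| ∧ (q : ℝ) ≤ x ^ (1 - 2 * β)), (1 : ℝ) / q ≤ ρ * b ^ 2 := by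
      refine le_trans ?_ hlin'; rw [mul_sum]
      refine (sum_le_sum (g := fun q => f q ^ 2 / q) fun q hq => ?_).trans (sum_le_sum_of_subset_of_nonneg (fun q hq => ?_) fun _ _ _ => by positivity)
      · rw [mul_one_div, ← sq_abs (f q)]
        have := (mem_filter.1 hq).2.1.le; gcongr
      · rw [mem_filter] at hq ⊢; exact ⟨hq.1, hq.2.1⟩
    have h2 : 0 < b ^ 2 := by positivity
    rw [mul_comm ρ] at this; exact (le_of_mul_le_mul_left this h2).trans hρ1
  have hcE2 : (E2.card : ℝ) ≤ δ1 * TT k x := by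
    refine hturan hN2 hzz ?_ Q1 (fun q => f q / B) (fun q hq => ?_) hT1 E2 (filter_subset _ _) fun m hm => (mem_filter.1 hm).2
    · have : 2 * R / ε * log (log x) ≤ N := by
        refine le_trans ?_ hz
        gcongr; linarith
      rw [div_mul_eq_mul_div, div_le_iff₀' hε] at this; linarith
    · have h1 := hQm q (hQ1m q hq).1; refine ⟨h1.1, (hQ1m q hq).2, h1.2.2.1, ?_⟩
      rw [abs_div, abs_of_pos hBp, div_le_one hBp]; refine h1.2.2.2.trans ?_
      rw [hb]; exact mul_le_of_le_one_left hBp.le hε1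
  have hcE3 : (E3.card : ℝ) ≤ δ1 * TT k x := hlarge E3 (filter_subset _ _) fun m hm => (mem_filter.1 hm).2
  obtain ⟨g, hg⟩ : ∃ g : ℕ → ℝ, g = fun q => s * (f q / B) := ⟨_, rfl⟩
  obtain ⟨α, hα⟩ : ∃ α : ℝ, α = ∑ q ∈ Q0, g q / ((q : ℝ) - 1) := ⟨_, rfl⟩
  have hαA : α = s * (A0 / B) := by rw [hα, hA0, hg, sum_div, mul_sum]; exact sum_congr rfl fun q _ => by ring
  set F : ℕ → ℂ := fun m => Complex.exp ((s * ((f (m + 1) - Afn f x) / B) : ℝ) * I) with hF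
  set H : ℕ → ℂ := fun m => Hm Q0 (fun q => Complex.exp (g q * I)) 1 m with hH
  have hgood : ∀ m ∈ MM k x, m ∉ E1 ∪ E2 ∪ E3 → ‖F m - H m * Complex.exp (-(α * I))‖ ≤ 65 * |s| * ε := by
    intro m hm hmE; rw [Finset.mem_union, Finset.mem_union, not_or, not_or, hE1, hE2, hE3] at hmE
    simp only [mem_filter, hm, true_and] at hmE
    obtain ⟨⟨hn1, hn2⟩, hn3⟩ := hmE
    have hmx : ((m + 1 : ℕ) : ℝ) < y ^ (20 + 1) := by
      rw [pow_succ, hy20]; push_cast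
      have := (le_floor_iff hx0.le).1 (mem_MM.1 hm).1.2; linarith [mul_le_mul_of_nonneg_left hy2 hx0.le]
    have h1 := value_decomp f (m + 1) 20 (by omega) b hbp W y (by linarith) hmx (fun q hq hWq => by
      by_contra hc
      rw [mem_primeFactors] at hq
      have hqx : (q : ℝ) ≤ x ^ (1 - 2 * β) := by by_contra hc2; exact hn3 ⟨q, hq.1, not_le.1 hc2, hq.2.1⟩
      refine hn1 ⟨q, ⟨mem_primesLE.2 ⟨le_floor (hqx.trans ?_), hq.1⟩, not_le.1 hc, hqx⟩, hq.2.1⟩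
      calc x ^ (1 - 2 * β) ≤ x ^ (1 : ℝ) := rpow_le_rpow_of_exponent_le hx1 (by linarith)
        _ = x := rpow_one x)
    rw [← strongly_additive_eq_sum f hstrong hadd (m + 1) (by omega)] at h1
    have h2 : ∑ q ∈ (m + 1).primeFactors with W < q ∧ (q : ℝ) ≤ y ∧ |f q| ≤ b, f q = ∑ q ∈ Q0 with q ∣ m + 1, f q + ∑ q ∈ Q1 with q ∣ m + 1, f q := by
      rw [sum_filter _ f (s := Q0), sum_filter _ f (s := Q1), ← hsplit, ← sum_filter]; refine sum_congr ?_ fun _ _ => rfl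
      ext q
      rw [mem_filter, mem_filter, hQ, mem_filter, mem_primeFactors, mem_primesLE]
      exact ⟨fun h => ⟨⟨⟨le_floor (h.2.2.1.trans hyx), h.1.1⟩, h.2⟩, h.1.2.1⟩, fun h => ⟨⟨h.1.1.2, h.2, by omega⟩, h.1.2⟩⟩
    rw [h2] at h1
    have h3 : |∑ q ∈ Q1 with q ∣ m + 1, f q - A1| ≤ b := by
      have e1 : ∑ q ∈ Q1 with q ∣ m + 1, f q / B - ∑ q ∈ Q1, f q / B / ((q : ℝ) - 1) = (∑ q ∈ Q1 with q ∣ m + 1, f q - A1) / B := by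
        rw [hA1, sub_div, sum_div, sum_div]; congr 1; exact sum_congr rfl fun q _ => by ring
      rw [e1, abs_div, abs_of_pos hBp, not_lt, div_le_iff₀ hBp, ← hb] at hn2; exact hn2
    have e2 : H m * Complex.exp (-(α * I)) = Complex.exp ((s * ((∑ q ∈ Q0 with q ∣ m + 1, f q - A0) / B) : ℝ) * I) := by
      rw [hH]; simp only; rw [Hm_exp_eq, ← Complex.exp_add, hαA, hg, ← mul_sum, ← sum_div]
      congr 1; push_cast; ring
    rw [e2, hF]; refine (norm_exp_I_sub_le _ _).trans ?_; rw [← mul_sub, ← sub_div, abs_mul, abs_div, abs_of_pos hBp]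
    have h4 : |f (m + 1) - Afn f x - (∑ q ∈ Q0 with q ∣ m + 1, f q - A0)| ≤ 65 * b := by
      push_cast at h1
      have h1 := abs_le.1 h1
      have h3 := abs_le.1 h3
      have hA := abs_le.1 hA
      exact abs_le.2 ⟨by linarith [h1.1, h3.1, hA.2], by linarith [h1.2, h3.2, hA.1]⟩
    rw [hb] at h4
    calc |s| * (_ / B) ≤ |s| * (65 * (ε * B) / B) := by gcongr
      _ = 65 * |s| * ε := by field_simp
  have hHn : ∀ m, ‖H m * Complex.exp (-(α * I))‖ = 1 := fun m => by
    rw [hH]; simp only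
    rw [Hm_exp_eq, norm_mul, ← neg_mul, ← ofReal_neg, norm_exp_ofReal_mul_I, norm_exp_ofReal_mul_I, one_mul]
  have hFH : ‖∑ m ∈ MM k x, (F m - H m * Complex.exp (-(α * I)))‖ ≤ 6 * (δ1 * TT k x) + 65 * |s| * ε * pik k x := by
    have h1 : ∀ m ∈ MM k x, ‖F m - H m * Complex.exp (-(α * I))‖ ≤ (if m ∈ E1 ∪ E2 ∪ E3 then 2 else 0) + 65 * |s| * ε := fun m hm => by
      split_ifs with h
      · refine (norm_sub_le _ _).trans ?_; rw [hHn, hF, norm_exp_ofReal_mul_I]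
        have : 0 ≤ 65 * |s| * ε := by positivity
        linarith
      · rw [zero_add]; exact hgood m hm h
    refine (norm_sum_le _ _).trans ((sum_le_sum h1).trans ?_)
    rw [sum_add_distrib, ← sum_filter, sum_const, sum_const, nsmul_eq_mul, nsmul_eq_mul, pik_eq_card_MM]
    have h2 : (((MM k x).filter (· ∈ E1 ∪ E2 ∪ E3)).card : ℝ) ≤ E1.card + E2.card + E3.card := by
      have : ((MM k x).filter (· ∈ E1 ∪ E2 ∪ E3)).card ≤ E1.card + E2.card + E3.card := by
        refine (card_le_card fun m hm => (mem_filter.1 hm).2).trans ((card_union_le _ _).trans ?_)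
        gcongr; exact card_union_le _ _
      exact_mod_cast this
    linarith
  have hphi : ‖phi Q0 (fun q => Complex.exp (g q * I)) 1 * Complex.exp (-(α * I)) - Complex.exp ((-s ^ 2 / 2 : ℝ))‖ ≤
      2 * (|s| * ε) * s ^ 2 + 6 * (|s| * ε) ^ 2 + s ^ 2 * (2 * ε) := by
    have h1 := norm_phi_sub_gauss_le Q0 (fun q hq => (hQm q (hQ0m q hq).1).1) g (|s| * ε) hεs fun q hq => by
      rw [hg]; simp only; rw [abs_mul, abs_div, abs_of_pos hBp]; gcongr
      rw [div_le_iff₀ hBp, ← hb]; exact (hQm q (hQ0m q hq).1).2.2.2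
    have e1 : ∑ q ∈ Q0, g q ^ 2 / q = s ^ 2 * V := by rw [hV, hg, mul_sum]; exact sum_congr rfl fun q _ => by ring
    rw [← hα, e1] at h1
    have h2 : ‖Complex.exp ((-(s ^ 2 * V) / 2 : ℝ)) - Complex.exp ((-s ^ 2 / 2 : ℝ))‖ ≤ s ^ 2 * (2 * ε) := by exact norm_exp_sub_exp_le s V ε hε.le (by rw [hV]; positivity) hV1 hV2
    have h3 : 2 * (|s| * ε) * (s ^ 2 * V) ≤ 2 * (|s| * ε) * s ^ 2 := by gcongr; exact mul_le_of_le_one_right (sq_nonneg s) hV1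
    calc _ ≤ _ := norm_sub_le_norm_sub_add_norm_sub _ (Complex.exp ((-(s ^ 2 * V) / 2 : ℝ))) _
      _ ≤ _ := by linarith
  have hsum := hmean hN2 hzz Q0 (fun q hq => mem_primesLE.2 ⟨(hQ0m q hq).2, (hQm q (hQ0m q hq).1).1⟩) (fun q => Complex.exp (g q * I))
    (fun q _ => by rw [norm_exp_ofReal_mul_I]) (fun q hq => (hQm q (hQ0m q hq).1).2.1)
  set ph := phi Q0 (fun q => Complex.exp (g q * I)) 1
  have hdec : ∑ m ∈ MM k x, (F m - Complex.exp ((-s ^ 2 / 2 : ℝ))) = ∑ m ∈ MM k x, (F m - H m * Complex.exp (-(α * I))) +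
      (∑ m ∈ MM k x, (H m - ph)) * Complex.exp (-(α * I)) + ∑ m ∈ MM k x, (ph * Complex.exp (-(α * I)) - Complex.exp ((-s ^ 2 / 2 : ℝ))) := by
    rw [sum_mul, ← sum_add_distrib, ← sum_add_distrib]; exact sum_congr rfl fun m _ => by ring
  have hsum' : ‖(∑ m ∈ MM k x, (H m - ph)) * Complex.exp (-(α * I))‖ ≤ δ1 * TT k x := by rw [norm_mul, ← neg_mul, ← ofReal_neg, norm_exp_ofReal_mul_I, mul_one]; exact hsum
  have h3 : ‖∑ m ∈ MM k x, (ph * Complex.exp (-(α * I)) - Complex.exp ((-s ^ 2 / 2 : ℝ)))‖ ≤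
      (2 * (|s| * ε) * s ^ 2 + 6 * (|s| * ε) ^ 2 + s ^ 2 * (2 * ε)) * pik k x := by
    rw [sum_const, nsmul_eq_mul, norm_mul, Complex.norm_natCast, mul_comm, pik_eq_card_MM]
    exact mul_le_mul_of_nonneg_right hphi (Nat.cast_nonneg _)
  rw [hdec]
  refine (norm_add₃_le).trans ((add_le_add (add_le_add hFH hsum') h3).trans ?_)
  have hp0 : (0 : ℝ) ≤ pik k x := Nat.cast_nonneg _
  have h4 : δ1 * TT k x ≤ δ / 16 * pik k x := by
    calc δ1 * TT k x = δ / 16 * (c * TT k x) := by rw [hδ1]; ring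
      _ ≤ _ := by gcongr
  have h5 : 65 * |s| * ε + (2 * (|s| * ε) * s ^ 2 + 6 * (|s| * ε) ^ 2 + s ^ 2 * (2 * ε)) ≤ δ / 2 := by
    refine le_trans ?_ hεK
    have : (|s| * ε) ^ 2 ≤ s ^ 2 * ε := by rw [mul_pow, sq_abs]; gcongr; exact pow_le_of_le_one hε.le hε1 two_ne_zero
    rw [hK]; linarith
  have h6 := mul_le_mul_of_nonneg_right h5 hp0
  linarith

lemma Phi_eq_measure (t : ℝ) : Phi t = (gaussianReal 0 1).real (Set.Iic t) := by
  rw [measureReal_def, ProbabilityTheory.gaussianReal_apply_eq_integral _ one_ne_zero, ENNReal.toReal_ofReal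
    (MeasureTheory.integral_nonneg fun u => ProbabilityTheory.gaussianPDFReal_nonneg 0 1 u), Phi, ← MeasureTheory.integral_const_mul]
  simp [ProbabilityTheory.gaussianPDFReal]

lemma empirical_cdf_tendsto (S : ℕ → Finset ℕ) (hS : ∀ n, (S n).Nonempty) (Y : ℕ → ℕ → ℝ)
    (h : ∀ s : ℝ, Tendsto (fun n => (∑ m ∈ S n, Complex.exp ((s * Y n m : ℝ) * I)) / (S n).card) atTop (nhds (Complex.exp ((-s ^ 2 / 2 : ℝ))))) (t : ℝ) :
    Tendsto (fun n => (((S n).filter fun m => Y n m ≤ t).card : ℝ) / (S n).card) atTop (nhds (Phi t)) := by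
  have hc : ∀ n, ((S n).card : ENNReal) ≠ 0 := fun n => by exact_mod_cast (card_pos.2 (hS n)).ne'
  have hc' : ∀ n, ((S n).card : ENNReal) ≠ ⊤ := fun n => ENNReal.natCast_ne_top _
  obtain ⟨μ, hμ⟩ : ∃ μ : ℕ → Measure ℝ, μ = fun n => ((S n).card : ENNReal)⁻¹ • ∑ m ∈ S n, Measure.dirac (Y n m) := ⟨_, rfl⟩
  have hp : ∀ n, MeasureTheory.IsProbabilityMeasure (μ n) := fun n => ⟨by
    rw [hμ]; simp [ENNReal.inv_mul_cancel (hc n) (hc' n)]⟩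
  obtain ⟨N, hN⟩ : ∃ N : ℕ → ProbabilityMeasure ℝ, ∀ n, (N n : Measure ℝ) = μ n := ⟨fun n => ⟨μ n, hp n⟩, fun n => rfl⟩
  obtain ⟨G, hG⟩ : ∃ G : ProbabilityMeasure ℝ, (G : Measure ℝ) = gaussianReal 0 1 :=
    ⟨⟨gaussianReal 0 1, inferInstance⟩, rfl⟩
  have hlim : Tendsto N atTop (nhds G) := by
    refine ProbabilityMeasure.tendsto_of_tendsto_charFun fun s => ?_
    have h2 := h s; rw [hG, ProbabilityTheory.charFun_gaussianReal]
    have e : (s : ℂ) * (0 : ℝ) * I - ((1 : NNReal) : ℝ) * s ^ 2 / 2 = ((-s ^ 2 / 2 : ℝ) : ℂ) := by push_cast; ring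
    rw [e]; refine h2.congr fun n => ?_
    rw [hN, MeasureTheory.charFun_apply_real, hμ]; simp only
    rw [MeasureTheory.integral_smul_measure, MeasureTheory.integral_finsetSum_measure fun m _ => MeasureTheory.integrable_dirac (by simp [enorm_lt_top])]
    simp only [MeasureTheory.integral_dirac, ENNReal.toReal_inv, ENNReal.toReal_natCast, Complex.real_smul, Complex.ofReal_mul]
    push_cast; rw [div_eq_inv_mul]
  have h3 := ProbabilityMeasure.tendsto_measure_of_null_frontier_of_tendsto' hlim (E := Set.Iic t) (by
    rw [frontier_Iic, hG]
    have := ProbabilityTheory.nullSingletonClass_gaussianReal (μ := 0) (v := 1) one_ne_zero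
    exact MeasureTheory.measure_singleton t)
  have h4 := (ENNReal.tendsto_toReal (MeasureTheory.measure_ne_top _ _)).comp h3
  rw [Phi_eq_measure, measureReal_def, ← hG]
  refine h4.congr fun n => ?_
  simp only [Function.comp_apply, hN, hμ]
  rw [Measure.smul_apply, Measure.finsetSum_apply]
  simp only [Measure.dirac_apply' _ measurableSet_Iic, Set.indicator_apply, Set.mem_Iic, Pi.one_apply]
  rw [sum_boole, smul_eq_mul, ENNReal.toReal_mul, ENNReal.toReal_inv, ENNReal.toReal_natCast, ENNReal.toReal_natCast, div_eq_inv_mul]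

/-- A monotone function with values in `[0, 1]` that is close to `Phi` on a suitable finite grid is close to it everywhere. -/
lemma exists_grid (δ : ℝ) (hδ : 0 < δ) : ∃ T : Finset ℝ, ∀ F : ℝ → ℝ, Monotone F → (∀ t, 0 ≤ F t ∧ F t ≤ 1) → (∀ t ∈ T, |F t - Phi t| ≤ δ) →
    ∀ t, |F t - Phi t| ≤ 3 * δ := by
  have hcdf : Phi = cdf (gaussianReal 0 1) := by ext t; rw [Phi_eq_measure, cdf_eq_real]
  have hmono : Monotone Phi := by rw [hcdf]; exact ProbabilityTheory.monotone_cdf _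
  have hbot : Tendsto Phi atBot (nhds 0) := by rw [hcdf]; exact ProbabilityTheory.tendsto_cdf_atBot _
  have htop : Tendsto Phi atTop (nhds 1) := by rw [hcdf]; exact ProbabilityTheory.tendsto_cdf_atTop _
  have h01 : ∀ t, 0 ≤ Phi t ∧ Phi t ≤ 1 := fun t => by rw [hcdf]; exact ⟨cdf_nonneg _ _, cdf_le_one _ _⟩
  have hint : MeasureTheory.Integrable (fun u : ℝ => exp (-u ^ 2 / 2)) := by
    have := integrable_exp_neg_mul_sq (show (0 : ℝ) < 1 / 2 by norm_num)
    refine this.congr (Filter.Eventually.of_forall fun u => ?_); simp only; ring_nf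
  have hcont : Continuous Phi := by
    refine continuous_const.mul ?_
    have e : ∀ t : ℝ, ∫ u in Set.Iic t, exp (-u ^ 2 / 2) = (∫ u in Set.Iic 0, exp (-u ^ 2 / 2)) + ∫ u in (0 : ℝ)..t, exp (-u ^ 2 / 2) := fun t => by
      rw [← intervalIntegral.integral_Iic_sub_Iic hint.integrableOn hint.integrableOn]; ring
    exact (continuous_const.add (intervalIntegral.continuous_primitive (fun a b => hint.intervalIntegrable) 0)).congr fun t => (e t).symm
  have hsurj : ∀ u : ℝ, ∃ t, 0 < u → u < 1 → Phi t = u := fun u => by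
    by_cases hu : 0 < u ∧ u < 1
    · obtain ⟨a, ha⟩ := (hbot.eventually_lt_const hu.1).exists
      obtain ⟨b, hb⟩ := (htop.eventually_const_lt hu.2).exists
      obtain ⟨t, ht⟩ := mem_range_of_exists_le_of_exists_ge hcont ⟨a, ha.le⟩ ⟨b, hb.le⟩; exact ⟨t, fun _ _ => ht⟩
    · exact ⟨0, fun h1 h2 => absurd ⟨h1, h2⟩ hu⟩
  choose ψ hψ using hsurj
  obtain ⟨n, hn⟩ := exists_nat_ge (1 / δ)
  refine ⟨(range (n + 1)).image fun j : ℕ => ψ (j * δ), fun F hF hF01 hT t => ?_⟩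
  have hgrid : ∀ j : ℕ, 0 < j → (j : ℝ) * δ < 1 → Phi (ψ (j * δ)) = j * δ ∧ |F (ψ (j * δ)) - j * δ| ≤ δ := fun j hj hj1 => by
    have h1 := hψ (j * δ) (by positivity) hj1; refine ⟨h1, ?_⟩
    have := hT (ψ (j * δ)) (mem_image.2 ⟨j, mem_range.2 ?_, rfl⟩)
    · rwa [h1] at this
    · have : (j : ℝ) < n := by
        refine lt_of_lt_of_le ?_ hn
        rwa [lt_div_iff₀ hδ]
      have : j < n := by exact_mod_cast this
      omega
  obtain ⟨j, hj⟩ : ∃ j : ℕ, j = ⌊Phi t / δ⌋₊ := ⟨_, rfl⟩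
  have hj1 : (j : ℝ) * δ ≤ Phi t := by rw [← le_div_iff₀ hδ, hj]; exact floor_le (div_nonneg (h01 t).1 hδ.le)
  have hj2 : Phi t < ((j + 1 : ℕ) : ℝ) * δ := by rw [← div_lt_iff₀ hδ, hj]; push_cast; exact lt_floor_add_one _
  rw [abs_le]
  constructor
  · rcases Nat.lt_or_ge 1 j with h | h
    · obtain ⟨i, rfl⟩ : ∃ i, j = i + 1 := ⟨j - 1, by omega⟩
      push_cast at hj1 hj2
      obtain ⟨g1, g2⟩ := hgrid i (by omega) (by linarith [(h01 t).2])
      have := hF (hmono.reflect_lt (show Phi (ψ (i * δ)) < Phi t by linarith)).le; linarith [(abs_le.1 g2).1]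
    · have : ((j + 1 : ℕ) : ℝ) ≤ 2 := by exact_mod_cast (by omega : j + 1 ≤ 2)
      nlinarith [(hF01 t).1]
  · by_cases h : ((j + 1 : ℕ) : ℝ) * δ < 1
    · obtain ⟨g1, g2⟩ := hgrid (j + 1) (by omega) h
      have := hF (hmono.reflect_lt (show Phi t < Phi (ψ ((j + 1 : ℕ) * δ)) by rw [g1]; exact hj2)).le
      push_cast at *; linarith [(abs_le.1 g2).2]
    · push_cast at *; linarith [(hF01 t).2]

lemma MM_cdf (f : ℕ → ℝ)
    (hstrong : ∀ (p ν : ℕ), p.Prime → 1 ≤ ν → f (p ^ ν) = f p)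
    (hadd : ∀ m n : ℕ, 1 ≤ m → 1 ≤ n → Nat.Coprime m n → f (m * n) = f m + f n)
    (hBinf : Tendsto (fun x => Bsq f x) atTop atTop)
    (hByBx : Tendsto
      (fun x : ℝ => Bfn f (x ^ (1 / log (log x))) / Bfn f x)
      atTop (nhds 1))
    (hLind : ∀ ε : ℝ, 0 < ε →
      (fun x : ℝ => ∑ p ∈ (primesUpTo x).filter
          (fun p : ℕ => ε * Bfn f x < |f p|), f p ^ 2 / p)
        =o[atTop] fun x => Bsq f x) (R η t : ℝ) (hR : 0 < R) (hη : 0 < η) :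
    ∀ᶠ x : ℝ in atTop, ∀ k : ℕ, 1 ≤ k → (k : ℝ) ≤ R * log (log x) →
      |(((MM k x).filter fun m => (f (m + 1) - Afn f x) / Bfn f x ≤ t).card : ℝ) / pik k x - Phi t| ≤ η := by
  by_contra hcon
  have hfr : ∃ᶠ x : ℝ in atTop, ∃ k : ℕ, (1 ≤ k ∧ (k : ℝ) ≤ R * log (log x)) ∧
      η < |(((MM k x).filter fun m => (f (m + 1) - Afn f x) / Bfn f x ≤ t).card : ℝ) / pik k x - Phi t| := by
    refine fun h => hcon (h.mono fun x hx k h1 h2 => ?_)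
    by_contra h3
    exact hx ⟨k, ⟨h1, h2⟩, not_le.1 h3⟩
  have hne : ∀ᶠ x : ℝ in atTop, ∀ k : ℕ, 1 ≤ k → (k : ℝ) ≤ R * log (log x) → 0 < pik k x := by
    obtain ⟨c, hc, h⟩ := pik_ge R hR
    filter_upwards [h, rpow_le_TT R (1 / 2) 1 hR (by norm_num) one_pos, eventually_gt_atTop 0] with x h1 h2 hx k hk hk'
    have h3 : 0 < c * TT k x := mul_pos hc (by linarith [h2 k hk hk', rpow_pos_of_pos hx (1 - 1 / 2)])
    exact_mod_cast h3.trans_le (h1 k hk hk')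
  obtain ⟨x, hx, hxk⟩ := exists_seq_forall_of_frequently (hfr.and_eventually hne)
  choose k hk hbad using fun n => (hxk n).1
  have hpos : ∀ n, 0 < pik (k n) (x n) := fun n => (hxk n).2 (k n) (hk n).1 (hk n).2
  have key := empirical_cdf_tendsto (fun n => MM (k n) (x n)) (fun n => card_pos.1 (hpos n))
    (fun n m => (f (m + 1) - Afn f (x n)) / Bfn f (x n)) (fun s => ?_) t
  · obtain ⟨n, hn⟩ := (Metric.tendsto_nhds.1 key η hη).exists; rw [dist_eq] at hn; exact absurd (hbad n) (not_lt.2 hn.le)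
  · rw [Metric.tendsto_nhds]; intro ε hε
    filter_upwards [hx.eventually (MM_charFun f hstrong hadd hBinf hByBx hLind R s (ε / 2) hR (by positivity))] with n hn
    have h1 := hn (k n) (hk n).1 (hk n).2
    have hp : (0 : ℝ) < pik (k n) (x n) := by exact_mod_cast hpos n
    have hp' : ((pik (k n) (x n) : ℕ) : ℂ) ≠ 0 := by exact_mod_cast (hpos n).ne'
    rw [sum_sub_distrib, sum_const, nsmul_eq_mul, show (MM (k n) (x n)).card = pik (k n) (x n) from rfl] at h1
    rw [dist_eq_norm, show (MM (k n) (x n)).card = pik (k n) (x n) from rfl, div_sub' hp', norm_div, Complex.norm_natCast, div_lt_iff₀ hp]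
    exact h1.trans_lt (by nlinarith)

lemma abs_card_shift_sub_le (f : ℕ → ℝ) (k : ℕ) (x a b t : ℝ) (hb : 0 < b) :
    |(((Finset.Icc 2 ⌊x⌋₊).filter (fun n => (n - 1).primeFactors.card = k ∧ f n ≤ a + t * b)).card : ℝ) -
      ((MM k x).filter fun m => (f (m + 1) - a) / b ≤ t).card| ≤ 1 := by
  obtain ⟨U, hU⟩ : ∃ U, U = (Finset.Icc 2 ⌊x⌋₊).filter (fun n => (n - 1).primeFactors.card = k ∧ f n ≤ a + t * b) := ⟨_, rfl⟩
  obtain ⟨V, hV⟩ : ∃ V, V = (MM k x).filter fun m => (f (m + 1) - a) / b ≤ t := ⟨_, rfl⟩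
  have hiff : ∀ n, (f n - a) / b ≤ t ↔ f n ≤ a + t * b := fun n => by rw [div_le_iff₀ hb, sub_le_iff_le_add']
  have h1 : U.image (fun n => n - 1) ⊆ V := fun m hm => by
    obtain ⟨n, hn, rfl⟩ := mem_image.1 hm; rw [hU, mem_filter, mem_Icc] at hn
    rw [hV, mem_filter, mem_MM, show n - 1 + 1 = n by omega, hiff]; exact ⟨⟨⟨by omega, by omega⟩, hn.2.1⟩, hn.2.2⟩
  have h2 : (U.image fun n => n - 1).card = U.card := card_image_of_injOn fun m hm n hn h => by
    rw [hU, mem_coe, mem_filter, mem_Icc] at hm hn; omega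
  have h3 : V ⊆ insert ⌊x⌋₊ (U.image fun n => n - 1) := fun m hm => by
    rw [hV, mem_filter, mem_MM, hiff] at hm
    rcases eq_or_ne m ⌊x⌋₊ with h | h
    · exact mem_insert.2 (Or.inl h)
    · refine mem_insert_of_mem (mem_image.2 ⟨m + 1, ?_, by simp⟩); rw [hU, mem_filter, mem_Icc]
      exact ⟨⟨by omega, by omega⟩, hm.1.2, hm.2⟩
  rw [← hU, ← hV, abs_le]
  have h4 : (U.card : ℝ) ≤ V.card := by exact_mod_cast h2 ▸ card_le_card h1
  have h5 : (V.card : ℝ) ≤ U.card + 1 := by exact_mod_cast (card_le_card h3).trans ((card_insert_le _ _).trans_eq (by rw [h2]))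
  constructor <;> linarith

theorem stmt_13 (f : ℕ → ℝ)
    (hstrong : ∀ (p ν : ℕ), p.Prime → 1 ≤ ν → f (p ^ ν) = f p)
    (hadd : ∀ m n : ℕ, 1 ≤ m → 1 ≤ n → Nat.Coprime m n → f (m * n) = f m + f n)
    (hBinf : Tendsto (fun x => Bsq f x) atTop atTop)
    (hByBx : Tendsto
      (fun x : ℝ => Bfn f (x ^ (1 / Real.log (Real.log x))) / Bfn f x)
      atTop (nhds 1))
    (htail : (fun x : ℝ => ∑ p ∈ (primesUpTo x).filter
        (fun p : ℕ => x ^ (1 / Real.log (Real.log x)) < (p : ℝ)), f p / p)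
      =o[atTop] fun x => Bfn f x)
    (hLind : ∀ ε : ℝ, 0 < ε →
      (fun x : ℝ => ∑ p ∈ (primesUpTo x).filter
          (fun p : ℕ => ε * Bfn f x < |f p|), f p ^ 2 / p)
        =o[atTop] fun x => Bsq f x) :
    ∀ R : ℝ, 0 < R → ∀ δ : ℝ, 0 < δ → ∃ x₀ : ℝ, ∀ x : ℝ, x₀ ≤ x →
      ∀ (k : ℕ) (t : ℝ), 1 ≤ k → (k : ℝ) ≤ R * Real.log (Real.log x) →
        |(((Finset.Icc 2 ⌊x⌋₊).filter
              (fun n => (n - 1).primeFactors.card = k ∧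
                f n ≤ Afn f x + t * Bfn f x)).card : ℝ) / (pik k x : ℝ)
          - Phi t| ≤ δ := by
  intro R hR δ hδ
  obtain ⟨T, hT⟩ := exists_grid (δ / 6) (by positivity)
  obtain ⟨c, hc, hpik⟩ := pik_ge R hR
  rw [← eventually_atTop]
  have hgrid := (eventually_all_finset T).2 fun t _ => MM_cdf f hstrong hadd hBinf hByBx hLind R (δ / 6) t hR (by positivity)
  filter_upwards [hgrid, hpik, rpow_le_TT R (1 / 2) (c * δ / 2) hR (by norm_num) (by positivity), eventually_ge_atTop 1,
    (tendsto_sqrt_atTop.comp hBinf).eventually_gt_atTop 0] with x h1 h2 h3 hx hB k t hk hk'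
  have hB : 0 < Bfn f x := hB
  have hp1 : 1 ≤ δ / 2 * pik k x := by
    have e1 := h3 k hk hk'
    have e2 := one_le_rpow hx (show (0 : ℝ) ≤ 1 - 1 / 2 by norm_num)
    have e3 := mul_le_mul_of_nonneg_left (h2 k hk hk') (half_pos hδ).le; linarith
  have hp : (0 : ℝ) < pik k x := by
    by_contra h
    nlinarith
  have hmain := hT (fun t => (((MM k x).filter fun m => (f (m + 1) - Afn f x) / Bfn f x ≤ t).card : ℝ) / pik k x)
    (fun s u hsu => div_le_div_of_nonneg_right (by
      exact_mod_cast card_le_card fun m hm => by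
        rw [mem_filter] at hm ⊢; exact ⟨hm.1, hm.2.trans hsu⟩) hp.le)
    (fun s => ⟨by positivity, div_le_one_of_le₀ (by
      rw [pik_eq_card_MM]; exact_mod_cast card_filter_le _ _) hp.le⟩)
    (fun s hs => h1 s hs k hk hk') t
  have hsh := abs_card_shift_sub_le f k x (Afn f x) (Bfn f x) t hB
  refine (abs_sub_le _ _ _).trans ((add_le_add ?_ hmain).trans_eq (by ring : δ / 2 + 3 * (δ / 6) = δ))
  rw [← sub_div, abs_div, abs_of_pos hp, div_le_iff₀ hp]
  exact hsh.trans hp1
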